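/- Let θ = 0.838 and Δ₁ = log(5.995θ − 1) + ∫₂^{5.995θ − 2} (log(s−1)/s) · log((5.995θ − 1)/(s+1)) ds. For every δ > 0 there is a threshold N₀ such that for every even integer N ≥ N₀, S₁(N) ≥ (1 − δ) · 8 Δ₁ C(N) N^{0.838} / (0.838² (log N)²). -/

import Mathlib

/-- `C(N) = (∏_{p ∣ N, p > 2} (p−1)/(p−2)) · (∏_{p > 2} (1 − 1/(p−1)²))`,
both products over primes. -/
noncomputable def CN (N : ℕ) : ℝ :=
  (∏ p ∈ N.primeFactors.filter (fun p => 2 < p), ((p : ℝ) - 1) / ((p : ℝ) - 2)) *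
    ∏' p : {p : ℕ // p.Prime ∧ 2 < p}, (1 - 1 / (((p : ℕ) : ℝ) - 1) ^ 2)

/-- `S₁(N)`: the number of primes `p ≤ N^0.838` with `p ∤ N` such that every prime
`q < N^(1/11.99)` with `q ∤ N` satisfies `q ∤ N − p`. -/
noncomputable def S1 (N : ℕ) : ℕ :=
  {p : ℕ | p.Prime ∧ (p : ℝ) ≤ (N : ℝ) ^ (0.838 : ℝ) ∧ ¬ p ∣ N ∧
    ∀ q : ℕ, q.Prime → (q : ℝ) < (N : ℝ) ^ (1 / 11.99 : ℝ) → ¬ q ∣ N →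
      ¬ q ∣ (N - p)}.ncard

/-- `Δ₁` with `θ = 0.838`. -/
noncomputable def Δ₁ : ℝ :=
  Real.log (5.995 * 0.838 - 1) +
    ∫ s in (2 : ℝ)..(5.995 * 0.838 - 2),
      Real.log (s - 1) / s * Real.log ((5.995 * 0.838 - 1) / (s + 1))


section
open Complex MeasureTheory FourierTransform Filter Topology LSeries
lemma sep {φ : ℝ → ℂ} (hφ : ContDiff ℝ (⊤ : ℕ∞) φ) (hc : HasCompactSupport φ) :
    ∃ w : ℝ → ℂ, Continuous w ∧ (∀ M : ℕ, Integrable (fun ξ => (1 + |ξ|) ^ M * ‖w ξ‖)) ∧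
      ∀ v : ℝ, φ v = ∫ ξ : ℝ, w ξ * cexp (ξ * v * I) := by
  set g := hc.toSchwartzMap hφ
  have hg : (g : ℝ → ℂ) = φ := rfl
  set f := 𝓕 g
  have hf : (f : ℝ → ℂ) = 𝓕 φ := by rw [← hg]; exact SchwartzMap.fourier_coe g
  have key : ∀ M : ℕ, Integrable (fun ξ : ℝ => (1 + |ξ|) ^ M * ‖f ξ‖) := by
    intro M
    have : (fun ξ : ℝ => (1 + |ξ|) ^ M * ‖f ξ‖) =
        fun ξ => ∑ i ∈ Finset.range (M + 1), (M.choose i : ℝ) * (‖ξ‖ ^ i * ‖f ξ‖) := by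
      ext ξ
      rw [add_comm, add_pow, Finset.sum_mul]
      refine Finset.sum_congr rfl fun i _ => ?_
      simp; ring
    rw [this]
    exact integrable_finset_sum _ fun i _ => (f.integrable_pow_mul volume i).const_mul _
  have hp : (0:ℝ) < 2 * Real.pi := by positivity
  refine ⟨fun ξ => ((2 * Real.pi)⁻¹ : ℝ) * f ((2 * Real.pi)⁻¹ * ξ), by fun_prop, fun M => ?_, fun v => ?_⟩
  · have h1 := ((key M).comp_mul_left' (inv_ne_zero hp.ne')).const_mul (((2 * Real.pi)⁻¹) * (2 * Real.pi) ^ M)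
    refine h1.mono' (by fun_prop) (ae_of_all _ fun ξ => ?_)
    rw [norm_mul, norm_pow, norm_norm, norm_mul, Complex.norm_real, Real.norm_of_nonneg (by positivity),
      Real.norm_of_nonneg (by positivity)]
    have : (1 + |ξ|) ≤ 2 * Real.pi * (1 + |(2 * Real.pi)⁻¹ * ξ|) := by
      rw [abs_mul, abs_of_pos (inv_pos.2 hp), mul_add, mul_inv_cancel_left₀ hp.ne']
      nlinarith [Real.pi_gt_three]
    calc _ ≤ (2 * Real.pi * (1 + |(2 * Real.pi)⁻¹ * ξ|)) ^ M * ((2 * Real.pi)⁻¹ * ‖f ((2 * Real.pi)⁻¹ * ξ)‖) := by gcongr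
      _ = _ := by rw [mul_pow]; ring
  · have h1 := Continuous.fourierInv_fourier_eq (f := φ) hφ.continuous (hg ▸ g.integrable) (hf ▸ f.integrable)
    rw [← congrFun h1 v, Real.fourierInv_eq', ← hf]
    have := MeasureTheory.Measure.integral_comp_mul_left (fun ξ : ℝ => f ξ * cexp (2 * Real.pi * ξ * v * I)) ((2 * Real.pi)⁻¹)
    have e : ∀ ξ : ℝ, ((2 * Real.pi)⁻¹ : ℝ) * f ((2 * Real.pi)⁻¹ * ξ) * cexp (ξ * v * I) =
       ((2 * Real.pi)⁻¹ : ℝ) * ((fun ξ : ℝ => f ξ * cexp (2 * Real.pi * ξ * v * I)) ((2 * Real.pi)⁻¹ * ξ)) := by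
      intro ξ
      simp only [mul_assoc]
      congr 3
      push_cast
      have : (Real.pi : ℂ) ≠ 0 := by exact_mod_cast Real.pi_ne_zero
      field_simp
    simp only [e]
    rw [integral_const_mul, this, inv_inv, abs_of_pos hp, Complex.real_smul, ← mul_assoc, ← ofReal_mul,
      inv_mul_cancel₀ hp.ne', ofReal_one, one_mul]
    congr 1; ext ξ
    simp only [smul_eq_mul]
    rw [mul_comm]; congr 2
    simp; ring
lemma fourier_bound {φ : ℝ → ℂ} (hφ : ContDiff ℝ (⊤ : ℕ∞) φ) (hc : HasCompactSupport φ) (M : ℕ) :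
    ∃ C, 0 ≤ C ∧ ∀ (b : ℕ → ℂ) (σ K : ℝ), LSeriesSummable b σ →
      (∀ t : ℝ, ‖LSeries b (σ + t * I)‖ ≤ K * (1 + |t|) ^ M) →
      ∀ T : ℝ, ‖∑' n, term b σ n * φ (Real.log n - T)‖ ≤ C * K := by
  obtain ⟨w, hw, hwi, he⟩ := sep hφ hc
  refine ⟨∫ ξ : ℝ, (1 + |ξ|) ^ M * ‖w ξ‖, integral_nonneg fun ξ => by positivity, fun b σ K hs hK T => ?_⟩
  have hw1 : Integrable w := by
    refine (hwi 0).mono' hw.aestronglyMeasurable (ae_of_all _ fun ξ => by simp)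
  have h0 : ∀ n, term b σ n * φ (Real.log n - T) =
      ∫ ξ : ℝ, w ξ * cexp (-(ξ * T * I)) * term b (σ + (-ξ : ℝ) * I) n := by
    intro n
    rw [he, ← integral_const_mul]
    congr 1; ext ξ
    rcases eq_or_ne n 0 with rfl | hn
    · simp
    · rw [term_of_ne_zero hn, term_of_ne_zero hn, cpow_add _ _ (by exact_mod_cast hn),
        cpow_def_of_ne_zero (y := ((-ξ : ℝ) : ℂ) * I) (by exact_mod_cast hn), ← natCast_log, div_mul_eq_div_div, div_eq_mul_inv _ (cexp _),
        ← Complex.exp_neg]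
      have : cexp (ξ * (Real.log n - T : ℝ) * I) = cexp (-(ξ * T * I)) * cexp (-((Real.log n : ℝ) * (((-ξ : ℝ) : ℂ) * I))) := by
        rw [← Complex.exp_add]; congr 1; push_cast; ring
      rw [this]; ring
  have hn : ∀ (n : ℕ) (ξ : ℝ), ‖w ξ * cexp (-(ξ * T * I)) * term b (σ + (-ξ : ℝ) * I) n‖ = ‖w ξ‖ * ‖term b σ n‖ := by
    intro n ξ
    have : ‖cexp (-(ξ * T * I))‖ = 1 := by
      rw [show -((ξ:ℂ) * T * I) = ((-(ξ * T) : ℝ) : ℂ) * I by push_cast; ring, norm_exp_ofReal_mul_I]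
    rw [norm_mul, norm_mul, this, mul_one, norm_term_eq, norm_term_eq]; simp
  have hmeas : ∀ n : ℕ, Continuous fun ξ : ℝ => term b (σ + (-ξ : ℝ) * I) n := by
    intro n
    rcases eq_or_ne n 0 with rfl | hn
    · simp; fun_prop
    · simp only [term_of_ne_zero hn]
      refine Continuous.div continuous_const ?_ fun ξ => ?_
      · exact Continuous.const_cpow (by fun_prop) (Or.inl (by exact_mod_cast hn))
      · simp [cpow_eq_zero_iff, hn]
  have hint : ∀ n : ℕ, Integrable fun ξ : ℝ => w ξ * cexp (-(ξ * T * I)) * term b (σ + (-ξ : ℝ) * I) n := by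
    intro n
    refine (hw1.norm.mul_const ‖term b σ n‖).mono' ?_ (ae_of_all _ fun ξ => (hn n ξ).le)
    exact ((hw.mul (by fun_prop)).mul (hmeas n)).aestronglyMeasurable
  have h1 := hasSum_integral_of_summable_integral_norm hint (by
    simp only [hn, integral_mul_const]; exact hs.norm.mul_left _)
  simp only [h0]
  rw [h1.tsum_eq, ← integral_mul_const]
  refine norm_integral_le_of_norm_le ((hwi M).mul_const K) (ae_of_all _ fun ξ => ?_)
  rw [tsum_mul_left]
  have := hK (-ξ)
  rw [abs_neg] at this
  rw [norm_mul, norm_mul, show -((ξ:ℂ) * T * I) = ((-(ξ * T) : ℝ) : ℂ) * I by push_cast; ring, norm_exp_ofReal_mul_I]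
  calc ‖w ξ‖ * 1 * _ ≤ ‖w ξ‖ * 1 * (K * (1 + |ξ|) ^ M) := by gcongr; exact this
    _ = _ := by ring
lemma machine {φ : ℝ → ℂ} (hφ : ContDiff ℝ (⊤ : ℕ∞) φ) (hc : HasCompactSupport φ) (k M : ℕ) :
    ∃ C, 0 ≤ C ∧ ∀ (a : ℕ → ℂ) (K : ℝ), 0 ≤ K → abscissaOfAbsConv a ≤ 1 →
      (∀ j ≤ k, ∀ s : ℂ, 1 < s.re → s.re ≤ 2 → ‖iteratedDeriv j (LSeries a) s‖ ≤ K * (1 + |s.im|) ^ M) →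
      ∀ T : ℝ, ‖∑' n : ℕ, a n / n * φ (Real.log n - T)‖ * |T| ^ k ≤ C * K := by
  have h1 : ∀ i : ℕ, ContDiff ℝ (⊤ : ℕ∞) (fun u : ℝ => (-(u : ℂ)) ^ i * φ u) := fun i =>
    ((ofRealCLM.contDiff.neg).pow i).mul hφ
  have h2 : ∀ i : ℕ, HasCompactSupport (fun u : ℝ => (-(u : ℂ)) ^ i * φ u) := fun i => hc.mul_left
  choose C hC0 hC using fun i => fourier_bound (h1 i) (h2 i) M
  refine ⟨∑ i ∈ Finset.range (k + 1), C i * k.choose i, Finset.sum_nonneg fun i _ => mul_nonneg (hC0 i) (by positivity), ?_⟩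
  intro a K hK ha hb T
  obtain ⟨R, hR⟩ := hc.isCompact.isBounded.subset_closedBall 0
  set m := ⌈Real.exp (R + T)⌉₊ + 1
  have hz : ∀ n ∉ Finset.range m, φ (Real.log n - T) = 0 := by
    intro n hn
    by_contra h
    have := hR (subset_tsupport _ h)
    rw [mem_closedBall_zero_iff, Real.norm_eq_abs] at this
    have h3 : Real.log n ≤ R + T := by linarith [le_abs_self (Real.log n - T)]
    rw [Finset.mem_range, not_lt] at hn
    have : (n : ℝ) ≤ Real.exp (R + T) := by
      rw [← Real.log_le_iff_le_exp]; exact h3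
      exact_mod_cast (by omega : 0 < n)
    have := (this.trans (Nat.le_ceil _))
    have : n ≤ ⌈Real.exp (R + T)⌉₊ := by exact_mod_cast this
    omega
  have hfin : ∀ (f : ℕ → ℂ), ∑' n : ℕ, f n * φ (Real.log n - T) = ∑ n ∈ Finset.range m, f n * φ (Real.log n - T) :=
    fun f => tsum_eq_sum fun n hn => by rw [hz n hn, mul_zero]
  have main : ∀ σ : ℝ, 1 < σ → σ ≤ 2 → ‖∑ n ∈ Finset.range m, term a σ n * φ (Real.log n - T)‖ * |T| ^ k ≤
      (∑ i ∈ Finset.range (k + 1), C i * k.choose i) * K := by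
    intro σ h1σ h2σ
    have hab : abscissaOfAbsConv a < ((σ : ℝ) : EReal) := lt_of_le_of_lt ha (by exact_mod_cast h1σ)
    have hS : ∀ j, LSeriesSummable (logMul^[j] a) σ := fun j => by
      apply LSeriesSummable_of_abscissaOfAbsConv_lt_re
      rw [absicssaOfAbsConv_logPowMul]; simpa using hab
    have hlm : ∀ j n, (logMul^[j] a) n = (Real.log n : ℂ) ^ j * a n := by
      intro j; induction j with
      | zero => simp
      | succ j ih => intro n; rw [Function.iterate_succ_apply', logMul, ih, natCast_log, pow_succ']; ring
    have hB : ∀ i ∈ Finset.range (k + 1), ‖∑ n ∈ Finset.range m, term (logMul^[k - i] a) σ n *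
        ((-((Real.log n - T : ℝ) : ℂ)) ^ i * φ (Real.log n - T))‖ ≤ C i * K := by
      intro i hi
      have := hC i (logMul^[k - i] a) σ K (hS _) (fun t => ?_) T
      · rwa [tsum_eq_sum (s := Finset.range m) fun n hn => by rw [hz n hn]; simp] at this
      · have h5 := hb (k - i) (Nat.sub_le _ _) (σ + t * I) (by simpa using h1σ) (by simpa using h2σ)
        rw [LSeries_iteratedDeriv _ (by simpa using hab), norm_mul, norm_pow, norm_neg, norm_one, one_pow, one_mul] at h5
        simpa using h5
    have hT : (∑ n ∈ Finset.range m, term a σ n * φ (Real.log n - T)) * (T : ℂ) ^ k =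
        ∑ i ∈ Finset.range (k + 1), (k.choose i : ℂ) * ∑ n ∈ Finset.range m, term (logMul^[k - i] a) σ n *
        ((-((Real.log n - T : ℝ) : ℂ)) ^ i * φ (Real.log n - T)) := by
      simp_rw [Finset.mul_sum]
      rw [Finset.sum_comm, Finset.sum_mul]
      refine Finset.sum_congr rfl fun n _ => ?_
      have : (T : ℂ) ^ k = (-((Real.log n - T : ℝ) : ℂ) + (Real.log n : ℂ)) ^ k := by push_cast; ring
      rw [this, add_pow, Finset.mul_sum]
      refine Finset.sum_congr rfl fun i _ => ?_
      rcases eq_or_ne n 0 with rfl | hn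
      · simp
      · rw [term_of_ne_zero hn, term_of_ne_zero hn, hlm]; ring
    calc _ = ‖(∑ n ∈ Finset.range m, term a σ n * φ (Real.log n - T)) * (T : ℂ) ^ k‖ := by
          rw [norm_mul, norm_pow, norm_real, Real.norm_eq_abs]
      _ ≤ _ := by
        rw [hT, Finset.sum_mul]
        refine (norm_sum_le _ _).trans (Finset.sum_le_sum fun i hi => ?_)
        rw [norm_mul, norm_natCast]
        nlinarith [hB i hi, (Nat.cast_nonneg (k.choose i) : (0:ℝ) ≤ _)]
  rw [hfin]
  have hlim : Tendsto (fun σ : ℝ => ‖∑ n ∈ Finset.range m, term a σ n * φ (Real.log n - T)‖ * |T| ^ k) (𝓝[>] 1)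
      (𝓝 (‖∑ n ∈ Finset.range m, a n / n * φ (Real.log n - T)‖ * |T| ^ k)) := by
    refine Tendsto.mul_const _ (tendsto_norm.comp <| tendsto_finset_sum _ fun n _ => Tendsto.mul_const _ ?_)
    rcases eq_or_ne n 0 with rfl | hn
    · simp
    · simp only [term_of_ne_zero hn]
      refine tendsto_const_nhds.div ?_ (by exact_mod_cast hn)
      have : Continuous fun σ : ℝ => (n : ℂ) ^ (σ : ℂ) := Continuous.const_cpow (by fun_prop) (Or.inl (by exact_mod_cast hn))
      simpa using (this.tendsto 1).mono_left nhdsWithin_le_nhds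
  refine le_of_tendsto hlim ?_
  filter_upwards [Ioc_mem_nhdsGT (show (1:ℝ) < 2 by norm_num)] with σ hσ using main σ hσ.1 hσ.2
end

section
open Complex MeasureTheory Filter Topology LSeries
lemma cpd {n u : ℝ} {s : ℂ} (hn : 0 < n) (hu : n ≤ u) (hu' : u ≤ n + 1) (hs : 0 < s.re) :
    ‖(u:ℂ)^(-s) - (n:ℂ)^(-s)‖ ≤ ‖s‖ * n^(-s.re-1) := by
  have := norm_image_sub_le_of_norm_deriv_le_segment' (f := fun x:ℝ => (x:ℂ)^(-s))
    (f' := fun x:ℝ => -s * (x:ℂ)^(-s-1)) (a := n) (b := u) (C := ‖s‖ * n^(-s.re-1)) ?_ ?_ u ⟨hu, le_rfl⟩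
  · refine this.trans (mul_le_of_le_one_right (by positivity) (by linarith))
  · intro x hx
    have hs0 : -s ≠ 0 := by intro h; have := congrArg re h; simp at this; linarith
    exact (hasDerivAt_ofReal_cpow_const (by linarith [hx.1]) hs0).hasDerivWithinAt
  · intro x hx
    have hx0 : 0 < x := by linarith [hx.1]
    rw [norm_mul, norm_neg, norm_cpow_eq_rpow_re_of_pos hx0]
    gcongr
    simp only [sub_re, neg_re, one_re]
    exact Real.rpow_le_rpow_of_nonpos hn hx.1 (by linarith)
def HP (η : ℝ) : Set ℂ := {s | 1 - η < s.re}
lemma HP_open (η) : IsOpen (HP η) := isOpen_lt continuous_const continuous_re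
lemma gen {f : ℕ → ℂ → ℂ} {u : ℕ → ℝ} {K η : ℝ} (hu : Summable u) (hK : 0 ≤ K) (hu0 : ∀ n, 0 ≤ u n)
    (hd : ∀ n, DifferentiableOn ℂ (f n) (HP η))
    (hb : ∀ n, ∀ s ∈ HP η, ‖f n s‖ ≤ K * (1 + ‖s‖)^2 * u n) :
    DifferentiableOn ℂ (fun s => ∑' n, f n s) (HP η) ∧
      ∀ s ∈ HP η, Summable (fun n => f n s) ∧ ‖∑' n, f n s‖ ≤ K * (1 + ‖s‖)^2 * ∑' n, u n := by
  refine ⟨fun s hs => ?_, fun s hs => ?_⟩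
  · have ho : IsOpen (HP η ∩ Metric.ball 0 (‖s‖ + 1)) := (HP_open η).inter Metric.isOpen_ball
    refine ((differentiableOn_tsum_of_summable_norm (u := fun n => K * (1 + (‖s‖+1))^2 * u n)
      (hu.mul_left _) (fun n => (hd n).mono Set.inter_subset_left) ho ?_).differentiableAt
      (ho.mem_nhds ⟨hs, by simp⟩)).differentiableWithinAt
    intro n w hw
    refine (hb n w hw.1).trans ?_
    have : ‖w‖ < ‖s‖ + 1 := by simpa using hw.2
    have := hu0 n
    gcongr
  · have h1 : Summable fun n => ‖f n s‖ := Summable.of_nonneg_of_le (fun _ => norm_nonneg _) (fun n => hb n s hs) (hu.mul_left _)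
    refine ⟨h1.of_norm, ?_⟩
    rw [← tsum_mul_left]
    exact tsum_of_norm_bounded (hu.mul_left _).hasSum (fun n => hb n s hs)
noncomputable def PS (a : ℕ → ℂ) (n : ℕ) : ℂ := ∑ k ∈ Finset.range n, a (k+1)
noncomputable def FA (a : ℕ → ℂ) (s : ℂ) : ℂ := ∑' n : ℕ, (PS a (n+1) * ((n+1:ℕ):ℂ)^(-s) - PS a (n+1) * ((n+2:ℕ):ℂ)^(-s))
noncomputable def ZC (η : ℝ) : ℝ := ∑' n : ℕ, ((n+1:ℕ):ℝ)^(-(1+η))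
lemma ZC_sum {η : ℝ} (h0 : 0 < η) : Summable (fun n : ℕ => ((n+1:ℕ):ℝ)^(-(1+η))) :=
  (summable_nat_add_iff (f := fun n : ℕ => (n:ℝ)^(-(1+η))) 1).2 (Real.summable_nat_rpow.2 (by linarith))
lemma FA_spec {a : ℕ → ℂ} {Q η : ℝ} (ha : ∀ n, ‖a n‖ ≤ 1) (hQ : 1 ≤ Q) (hA : ∀ n, ‖PS a n‖ ≤ Q)
    (h0 : 0 < η) (h1 : η ≤ 1/2) :
    DifferentiableOn ℂ (FA a) (HP η) ∧ (∀ s ∈ HP η, ‖FA a s‖ ≤ Q^(2*η) * ZC η * (1 + ‖s‖)^2) := by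
  have hb : ∀ n : ℕ, ∀ s ∈ HP η, ‖PS a (n+1) * ((n+1:ℕ):ℂ)^(-s) - PS a (n+1) * ((n+2:ℕ):ℂ)^(-s)‖ ≤
      Q^(2*η) * (1 + ‖s‖)^2 * ((n+1:ℕ):ℝ)^(-(1+η)) := by
    intro n s hs
    simp only [HP, Set.mem_ofPred_eq] at hs
    have hn : (0:ℝ) < ((n+1:ℕ):ℝ) := by positivity
    have hn1 : (1:ℝ) ≤ ((n+1:ℕ):ℝ) := by simp
    have e1 : ‖PS a (n+1)‖ ≤ ((n+1:ℕ):ℝ)^(1-2*η) * Q^(2*η) := by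
      have e2 : ‖PS a (n+1)‖ ≤ ((n+1:ℕ):ℝ) := by
        refine (norm_sum_le _ _).trans ((Finset.sum_le_sum fun i _ => ha _).trans (by simp))
      calc ‖PS a (n+1)‖ = ‖PS a (n+1)‖^(1-2*η) * ‖PS a (n+1)‖^(2*η) := by
            rw [← Real.rpow_add_of_nonneg (norm_nonneg _) (by linarith) (by linarith)]; simp
        _ ≤ _ := by gcongr <;> first | linarith | exact hA _
    have e3 := cpd (n := ((n+1:ℕ):ℝ)) (u := ((n+2:ℕ):ℝ)) (s := s) hn (by push_cast; linarith) (by push_cast; linarith) (by linarith)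
    rw [← mul_sub, norm_mul, norm_sub_rev]
    push_cast at e3 ⊢
    push_cast at e1 hn hn1
    calc _ ≤ (((n+1):ℝ)^(1-2*η) * Q^(2*η)) * (‖s‖ * ((n:ℝ)+1)^(-s.re-1)) := by gcongr
      _ = Q^(2*η) * ‖s‖ * (((n+1):ℝ)^(1-2*η) * ((n:ℝ)+1)^(-s.re-1)) := by ring
      _ ≤ _ := by
        rw [← Real.rpow_add hn]
        gcongr
        · nlinarith [norm_nonneg s]
        · linarith
  have := gen (ZC_sum h0) (by positivity) (fun n => by positivity) ?_ hb
  · refine ⟨this.1, fun s hs => ((this.2 s hs).2).trans (le_of_eq ?_)⟩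
    simp only [ZC]; ring
  · intro n
    have : ∀ m : ℕ, m ≠ 0 → DifferentiableOn ℂ (fun s:ℂ => (m:ℂ)^(-s)) (HP η) := fun m hm =>
      (differentiable_id.neg.const_cpow (Or.inl (by simpa using hm))).differentiableOn
    exact ((this _ (by omega)).const_mul _).sub ((this _ (by omega)).const_mul _)
lemma FA_eq {a : ℕ → ℂ} {Q : ℝ} (ha : ∀ n, ‖a n‖ ≤ 1) (hA : ∀ n, ‖PS a n‖ ≤ Q) {s : ℂ} (hs : 1 < s.re) :
    FA a s = LSeries a s := by
  have hs0 : Summable (term a s) := LSeriesSummable_of_bounded_of_one_lt_re (m := 1) (fun n _ => ha n) hs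
  have h1 : Tendsto (fun N => ∑ n ∈ Finset.range N, term a s (n+1)) atTop (𝓝 (LSeries a s)) := by
    have := ((hasSum_nat_add_iff' 1).2 hs0.hasSum).tendsto_sum_nat
    simpa [LSeries] using this
  have h2 : ∀ N, ∑ n ∈ Finset.range N, (PS a (n+1) * ((n+1:ℕ):ℂ)^(-s) - PS a (n+1) * ((n+2:ℕ):ℂ)^(-s)) =
      ∑ n ∈ Finset.range N, term a s (n+1) - PS a N * ((N+1:ℕ):ℂ)^(-s) := by
    intro N
    induction N with
    | zero => simp [PS]
    | succ N ih =>
      rw [Finset.sum_range_succ, Finset.sum_range_succ, ih, term_of_ne_zero (by omega), div_eq_mul_inv, ← cpow_neg]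
      have : PS a (N+1) = PS a N + a (N+1) := Finset.sum_range_succ _ _
      rw [this]; push_cast; ring
  have h3 : Tendsto (fun N => PS a N * ((N+1:ℕ):ℂ)^(-s)) atTop (𝓝 0) := by
    refine squeeze_zero_norm (a := fun N => Q * ((N+1:ℕ):ℝ)^(-s.re)) (fun N => ?_) ?_
    · rw [norm_mul, norm_natCast_cpow_of_pos (by omega)]
      exact mul_le_mul_of_nonneg_right (hA N) (by positivity)
    · have := ((tendsto_rpow_neg_atTop (by linarith : 0 < s.re)).comp
        (tendsto_natCast_atTop_atTop.comp (tendsto_add_atTop_nat 1))).const_mul Q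
      simpa using this
  have hQ : 1 ≤ max Q 1 := le_max_right _ _
  have h4 : Summable fun n:ℕ => PS a (n+1) * ((n+1:ℕ):ℂ)^(-s) - PS a (n+1) * ((n+2:ℕ):ℂ)^(-s) := by
    have e : Summable fun n : ℕ => max Q 1 * (‖s‖ * ((n+1:ℕ):ℝ)^(-(1+s.re))) :=
      ((ZC_sum (by linarith)).mul_left _).mul_left _
    refine Summable.of_norm_bounded e fun n => ?_
    rw [← mul_sub, norm_mul, norm_sub_rev]
    have e3 := cpd (n := ((n+1:ℕ):ℝ)) (u := ((n+2:ℕ):ℝ)) (s := s) (by positivity) (by push_cast; linarith) (by push_cast; linarith) (by linarith)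
    rw [show -(1+s.re) = -s.re-1 by ring]
    push_cast at e3 ⊢
    exact mul_le_mul ((hA _).trans (le_max_left _ _)) e3 (norm_nonneg _) (by positivity)
  have h5 := h4.hasSum.tendsto_sum_nat
  simp_rw [h2] at h5
  exact tendsto_nhds_unique h5 (by simpa using h1.sub h3)
noncomputable def ZS (s : ℂ) : ℂ := 1 + ∑' n : ℕ, ((s-1) * ((n+1:ℕ):ℂ)^(-s) - ((n+1:ℕ):ℂ)^(1-s) + ((n+2:ℕ):ℂ)^(1-s))
lemma ZS_term (n : ℕ) {s : ℂ} (hs : s ∈ HP (1/2)) :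
    ‖(s-1) * ((n+1:ℕ):ℂ)^(-s) - ((n+1:ℕ):ℂ)^(1-s) + ((n+2:ℕ):ℂ)^(1-s)‖ ≤ 1 * (1 + ‖s‖)^2 * ((n+1:ℕ):ℝ)^(-(1+(1/2:ℝ))) := by
  simp only [HP, Set.mem_ofPred_eq] at hs
  have hn : (0:ℝ) < (n:ℝ)+1 := by positivity
  by_cases hs1 : s = 1
  · subst hs1; simp; positivity
  have := norm_image_sub_le_of_norm_deriv_le_segment' (f := fun x:ℝ => (x:ℂ)*((s-1) * ((n+1:ℕ):ℂ)^(-s)) + (x:ℂ)^(1-s))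
    (f' := fun x:ℝ => 1 * ((s-1) * ((n+1:ℕ):ℂ)^(-s)) + (1-s) * (x:ℂ)^(1-s-1)) (a := (n:ℝ)+1) (b := (n:ℝ)+1+1) (C := ‖s-1‖*(‖s‖ * ((n:ℝ)+1)^(-s.re-1)))
      ?_ ?_ ((n:ℝ)+1+1) ⟨by linarith, le_rfl⟩
  · have e1 : ‖s-1‖ ≤ 1 + ‖s‖ := by simpa [add_comm] using norm_sub_le s 1
    have e2 : ‖s‖ ≤ 1 + ‖s‖ := by linarith
    have e3 : ((n:ℝ)+1)^(-s.re-1) ≤ ((n:ℝ)+1)^(-(1+(1/2:ℝ))) := Real.rpow_le_rpow_of_exponent_le (by linarith [n.cast_nonneg (α := ℝ)]) (by linarith)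
    calc _ ≤ ‖s-1‖*(‖s‖ * ((n:ℝ)+1)^(-s.re-1)) * ((n:ℝ)+1+1-(n+1)) := by
          refine le_trans (le_of_eq ?_) this
          congr 1; push_cast; rw [show (n:ℂ)+1+1 = n+2 by ring]; ring
      _ = ‖s-1‖*‖s‖ * ((n:ℝ)+1)^(-s.re-1) := by ring
      _ ≤ ((1+‖s‖)*(1+‖s‖)) * ((n:ℝ)+1)^(-(1+(1/2:ℝ))) := by gcongr
      _ = _ := by push_cast; ring
  · intro x hx
    exact (((hasDerivAt_id x).ofReal_comp.mul_const _).add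
      (hasDerivAt_ofReal_cpow_const (by linarith [hx.1]) (sub_ne_zero.2 (Ne.symm hs1)))).hasDerivWithinAt
  · intro x hx
    have e3 := cpd (n := (n:ℝ)+1) (u := x) (s := s) hn hx.1 hx.2.le (by linarith)
    rw [show 1 * ((s-1) * ((n+1:ℕ):ℂ)^(-s)) + (1-s) * (x:ℂ)^(1-s-1) = -((s-1)*((x:ℂ)^(-s) - ((n+1:ℕ):ℂ)^(-s))) by
      rw [show 1-s-1 = -s by ring]; ring, norm_neg, norm_mul]
    push_cast at e3 ⊢
    gcongr
lemma ZS_spec : DifferentiableOn ℂ ZS (HP (1/2)) ∧ (∀ s ∈ HP (1/2), ‖ZS s‖ ≤ (1 + ZC (1/2)) * (1 + ‖s‖)^2) := by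
  have := gen (ZC_sum (by norm_num : (0:ℝ) < 1/2)) zero_le_one (fun n => by positivity) ?_ (fun n s hs => ZS_term n hs)
  · refine ⟨(differentiableOn_const 1).add this.1, fun s hs => (norm_add_le _ _).trans ?_⟩
    have h2 := (this.2 s hs).2
    rw [← ZC] at h2
    have : 1 ≤ (1+‖s‖)^2 := by nlinarith [norm_nonneg s]
    rw [norm_one]; linarith
  · intro n
    have h1 : ∀ m : ℕ, m ≠ 0 → DifferentiableOn ℂ (fun s:ℂ => (m:ℂ)^(-s)) (HP (1/2)) := fun m hm =>
      (differentiable_id.neg.const_cpow (Or.inl (by simpa using hm))).differentiableOn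
    have h2 : ∀ m : ℕ, m ≠ 0 → DifferentiableOn ℂ (fun s:ℂ => (m:ℂ)^(1-s)) (HP (1/2)) := fun m hm =>
      ((differentiable_id.const_sub 1).const_cpow (Or.inl (by simpa using hm))).differentiableOn
    exact (((differentiableOn_id.sub_const 1).mul (h1 _ (by omega))).sub (h2 _ (by omega))).add (h2 _ (by omega))
lemma ZS_eq {s : ℂ} (hs : 1 < s.re) : ZS s = (s-1) * riemannZeta s := by
  have h1 : HasSum (fun n : ℕ => ((n+1:ℕ):ℂ)^(-s)) (riemannZeta s) := by
    rw [zeta_eq_tsum_one_div_nat_add_one_cpow hs]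
    convert Summable.hasSum (f := fun n : ℕ => 1/((n:ℂ)+1)^s) ?_ using 2
    · push_cast; rw [cpow_neg, one_div]
    · have := (summable_nat_add_iff 1).2 (Complex.summable_one_div_nat_cpow.2 hs)
      simpa using this
  have h2 : Summable fun n : ℕ => ((s-1) * ((n+1:ℕ):ℂ)^(-s) - ((n+1:ℕ):ℂ)^(1-s) + ((n+2:ℕ):ℂ)^(1-s)) :=
    Summable.of_norm_bounded ((ZC_sum (by norm_num : (0:ℝ) < 1/2)).mul_left _) (fun n => ZS_term n (by simp [HP]; linarith))
  have h3 : ∀ N, ∑ n ∈ Finset.range N, ((s-1) * ((n+1:ℕ):ℂ)^(-s) - ((n+1:ℕ):ℂ)^(1-s) + ((n+2:ℕ):ℂ)^(1-s)) =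
     (s-1) * ∑ n ∈ Finset.range N, ((n+1:ℕ):ℂ)^(-s) - 1 + ((N+1:ℕ):ℂ)^(1-s) := by
    intro N
    induction N with
    | zero => simp
    | succ N ih => rw [Finset.sum_range_succ, Finset.sum_range_succ, ih]; push_cast; ring_nf
  have h4 : Tendsto (fun N:ℕ => ((N+1:ℕ):ℂ)^(1-s)) atTop (𝓝 0) := by
    refine squeeze_zero_norm (a := fun N:ℕ => ((N+1:ℕ):ℝ)^(-(s.re-1))) (fun N => ?_) ?_
    · rw [norm_natCast_cpow_of_pos (by omega)]; simp
    · exact (tendsto_rpow_neg_atTop (by linarith : 0 < s.re - 1)).comp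
        (tendsto_natCast_atTop_atTop.comp (tendsto_add_atTop_nat 1))
  have h5 := h2.hasSum.tendsto_sum_nat
  simp_rw [h3] at h5
  have := tendsto_nhds_unique h5 (((h1.tendsto_sum_nat.const_mul (s-1)).sub_const 1).add h4)
  rw [ZS, this]; ring
lemma PS_periodic {a : ℕ → ℂ} {q : ℕ} (hq : 0 < q) (ha : ∀ n, ‖a n‖ ≤ 1) (hp : ∀ n, a (n+q) = a n)
    (h0 : ∑ k ∈ Finset.range q, a k = 0) (n : ℕ) : ‖PS a n‖ ≤ 2 * q := by
  have hB : ∀ n, ‖∑ k ∈ Finset.range n, a k‖ ≤ q := by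
    intro n
    induction n using Nat.strong_induction_on with
    | _ n ih =>
      by_cases h : n < q
      · refine (norm_sum_le _ _).trans ((Finset.sum_le_sum fun i _ => ha _).trans (by simpa using h.le))
      · obtain ⟨m, rfl⟩ := Nat.exists_eq_add_of_le (not_lt.1 h)
        rw [Finset.sum_range_add, h0, zero_add]
        convert ih m (by omega) using 3 with i
        rw [add_comm, hp]
  have : PS a n = ∑ k ∈ Finset.range (n+1), a k - a 0 := by rw [Finset.sum_range_succ', PS]; ring
  rw [this]
  have h1 : (1:ℝ) ≤ q := by exact_mod_cast hq
  refine (norm_sub_le _ _).trans ?_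
  linarith [hB (n+1), ha 0]
end

section
open Complex MeasureTheory Filter Topology LSeries
open scoped ComplexOrder
lemma iter_inv (m : ℕ) : iteratedDeriv m (fun s : ℂ => (s-1)⁻¹) 2 = (-1)^m * m.factorial := by
  have h := iteratedDeriv_comp_sub_const (𝕜 := ℂ) m (fun s : ℂ => s⁻¹) 1
  have h2 := congrFun h 2
  rw [h2, iteratedDeriv_eq_iterate, iter_deriv_inv']
  norm_num
lemma siegelDisc : ∃ C : ℝ, 1 ≤ C ∧ ∀ (G : ℂ → ℂ) (K β : ℝ) (a : ℕ → ℂ), DifferentiableOn ℂ G (HP (1/2)) →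
    (∀ s ∈ Metric.closedBall (2:ℂ) (5/4), ‖G s‖ ≤ K) → 1 ≤ K → 0 ≤ a → a 1 = 1 → abscissaOfAbsConv a ≤ 1 →
    (∀ s : ℂ, 1 < s.re → LSeries a s = riemannZeta s * G s) → 7/8 ≤ β → β < 1 → 0 ≤ (ZS β * G β).re →
    (1-β)/6 * (C*K)^(-10*(1-β)) ≤ (G 1).re := by
  have h12 : (1:EReal) < ((2:ℝ):EReal) := by exact_mod_cast (by norm_num : (1:ℝ) < 2)
  set B := (1 + ZC (1/2)) * 36 with hB
  have hZC : 0 ≤ ZC (1/2) := tsum_nonneg fun n => by positivity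
  have hB1 : 36 ≤ B := by rw [hB]; linarith
  refine ⟨160 * B, by linarith, fun G K β a hG hK hK1 ha ha1 hab hL hβ hβ1 hpos => ?_⟩
  have hsub : Metric.closedBall (2:ℂ) (5/4) ⊆ HP (1/2) := by
    intro z hz
    have : |(z - 2).re| ≤ 5/4 := (abs_re_le_norm _).trans (by simpa [dist_eq] using hz)
    have := (abs_le.1 this).1
    simp only [HP, Set.mem_ofPred_eq, sub_re, re_ofNat] at *
    linarith
  have h1m : (1:ℂ) ∈ HP (1/2) := by simp [HP]
  set P : ℂ → ℂ := fun s => ZS s * G s with hP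
  have hPd : DifferentiableOn ℂ P (HP (1/2)) := ZS_spec.1.mul hG
  set H := dslope P 1 with hH
  have hHd : DifferentiableOn ℂ H (HP (1/2)) :=
    (differentiableOn_dslope ((HP_open _).mem_nhds h1m)).2 hPd
  set lam := G 1 with hlam
  have hP1 : P 1 = lam := by simp [hP, ZS, hlam]
  have hHs : ∀ s, s ≠ 1 → H s = (P s - lam) * (s-1)⁻¹ := by
    intro s hs; rw [hH, dslope_of_ne _ hs, slope_def_field, hP1, div_eq_mul_inv]
  have hPb : ∀ s ∈ Metric.closedBall (2:ℂ) (5/4), ‖P s‖ ≤ B * K := by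
    intro s hs
    have : ‖s‖ ≤ 5 := by
      have h1 : ‖s - 2‖ ≤ 5/4 := by simpa [dist_eq] using hs
      have := norm_add_le (s-2) 2
      simp at this; linarith
    rw [hP, norm_mul]
    gcongr
    · exact (ZS_spec.2 s (hsub hs)).trans (by rw [hB]; gcongr; nlinarith [norm_nonneg s])
    · exact hK s hs
  have hlamb : ‖lam‖ ≤ B * K := by
    rw [← hP1]; exact hPb 1 (by rw [Metric.mem_closedBall, dist_eq]; norm_num)
  have hHb : ∀ s ∈ Metric.sphere (2:ℂ) (5/4), ‖H s‖ ≤ 8*B*K := by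
    intro s hs
    have h2 : ‖s - 2‖ = 5/4 := by simpa [dist_eq] using hs
    have h1 : 1/4 ≤ ‖s-1‖ := by
      have := norm_sub_le (s-1) 1
      rw [show s-1-1 = s-2 by ring, h2] at this
      simp at this; linarith
    have hs1 : s ≠ 1 := by rintro rfl; norm_num at h1
    rw [hHs s hs1, norm_mul, norm_inv]
    have h3 : ‖P s - lam‖ ≤ 2*(B*K) := (norm_sub_le _ _).trans (by linarith [hPb s (Metric.sphere_subset_closedBall hs)])
    have h4 : ‖s-1‖⁻¹ ≤ 4 := by rw [inv_le_comm₀ (by linarith) (by norm_num)]; linarith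
    calc _ ≤ 2*(B*K)*4 := by gcongr
      _ = _ := by ring
  set c : ℕ → ℂ := fun m => ((m.factorial:ℂ))⁻¹ * (-1)^m * iteratedDeriv m H 2 with hc
  have hcb : ∀ m, ‖c m‖ ≤ 8*B*K*(4/5)^m := by
    intro m
    have := norm_iteratedDeriv_le_of_forall_mem_sphere_norm_le m (by norm_num : (0:ℝ) < 5/4)
      ((hHd.mono hsub).diffContOnCl_ball subset_rfl) hHb
    simp only [hc, norm_mul, norm_inv, norm_pow, norm_neg, norm_one, one_pow, mul_one, norm_natCast]
    have hf : (0:ℝ) < m.factorial := by positivity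
    calc _ ≤ (m.factorial:ℝ)⁻¹ * (m.factorial * (8*B*K)/(5/4)^m) := by gcongr
      _ = 8*B*K*(1/(5/4)^m) := by field_simp
      _ = _ := by rw [← one_div_pow]; norm_num
  have hser : HasSum (fun m => c m * (2-β:ℂ)^m) (H β) := by
    have hb : (β:ℂ) ∈ Metric.ball (2:ℂ) (5/4) := by
      rw [Metric.mem_ball, dist_eq]
      rw [show (β:ℂ) - 2 = ((β-2:ℝ):ℂ) by push_cast; ring, norm_real, Real.norm_eq_abs, abs_lt]
      constructor <;> linarith
    have := hasSum_taylorSeries_on_ball ((hHd.mono hsub).mono Metric.ball_subset_closedBall) hb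
    refine this.congr_fun (fun m => ?_)
    rw [hc, smul_eq_mul, smul_eq_mul]
    rw [show (β:ℂ)-2 = (-1)*(2-β) by ring, mul_pow]
    ring
  have hcre : ∀ m, c m = (m.factorial:ℂ)⁻¹ * ((-1)^m * iteratedDeriv m (LSeries a) 2) - lam := by
    intro m
    have e : H =ᶠ[𝓝 2] fun s => LSeries a s - lam * (s-1)⁻¹ := by
      have : {s : ℂ | 1 < s.re} ∈ 𝓝 (2:ℂ) := (isOpen_lt continuous_const continuous_re).mem_nhds (by simp)
      filter_upwards [this] with s hs
      have hs1 : s - 1 ≠ 0 := by intro h; rw [sub_eq_zero] at h; subst h; simp at hs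
      rw [hHs s (sub_ne_zero.1 hs1), hL s hs, hP]
      simp only [ZS_eq hs]
      field_simp
    have hLd : ContDiffAt ℂ m (LSeries a) 2 := by
      refine (((LSeries_analyticOnNhd a) 2 ?_)).contDiffAt
      simp only [Set.mem_ofPred_eq]
      exact hab.trans_lt h12
    rw [hc]
    simp only
    rw [e.iteratedDeriv_eq, iteratedDeriv_fun_sub hLd (by
      refine contDiffAt_const.mul (ContDiffAt.inv (by fun_prop) (by norm_num))), iteratedDeriv_const_mul_field, iter_inv]
    have hf : (m.factorial:ℂ) ≠ 0 := by exact_mod_cast m.factorial_ne_zero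
    have : ((-1:ℂ)^m * (-1)^m) = 1 := by rw [← mul_pow]; simp
    field_simp
    linear_combination (-lam * m.factorial) * this
  have hbm : ∀ m, -lam.re ≤ (c m).re := by
    intro m
    rw [hcre m, sub_re]
    have := iteratedDeriv_alternating ha (x := 2) (hab.trans_lt h12) m
    have h2 : 0 ≤ ((m.factorial:ℂ)⁻¹ * ((-1)^m * iteratedDeriv m (LSeries a) 2)) :=
      mul_nonneg (by rw [show ((m.factorial:ℂ)⁻¹) = ((m.factorial:ℝ)⁻¹ : ℝ) by push_cast; rfl]; exact_mod_cast (by positivity)) (by simpa using this)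
    have := (Complex.le_def.1 h2).1
    simp only [zero_re] at this; linarith
  have hb0 : 1 - lam.re ≤ (c 0).re := by
    rw [hcre 0, sub_re]
    simp only [Nat.factorial_zero, Nat.cast_one, inv_one, pow_zero, one_mul, iteratedDeriv_zero]
    have hsum : Summable (term a 2) := LSeriesSummable_of_abscissaOfAbsConv_lt_re (hab.trans_lt h12)
    have h0 : ∀ n, 0 ≤ term a 2 n := fun n => by have := term_nonneg (ha n) 2; simpa using this
    have := hsum.le_tsum 1 (fun n _ => h0 n)
    have h3 := (Complex.le_def.1 this).1
    rw [term_of_ne_zero one_ne_zero, ha1] at h3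
    simp at h3
    rw [LSeries]; linarith
  set x : ℝ := 2 - β with hx
  have hx1 : 1 < x := by linarith
  have hx2 : x ≤ 9/8 := by linarith
  have hserR : HasSum (fun m => (c m).re * x^m) (H β).re := by
    have := hasSum_re hser
    convert this using 2 with m
    rw [show (2-β:ℂ) = (x:ℂ) by rw [hx]; push_cast; ring, ← ofReal_pow, re_mul_ofReal]
  have hHβ : (H β).re ≤ lam.re / (1-β) := by
    have hne : (β:ℂ) ≠ 1 := by exact_mod_cast hβ1.ne
    rw [hHs β hne, show ((β:ℂ)-1)⁻¹ = (((β-1)⁻¹:ℝ):ℂ) by push_cast; rfl, re_mul_ofReal, sub_re]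
    rw [show (β-1)⁻¹ = -(1-β)⁻¹ by rw [← inv_neg]; ring_nf, div_eq_mul_inv]
    have : 0 < (1-β)⁻¹ := inv_pos.2 (by linarith)
    nlinarith
  have hmain : ∀ M : ℕ, 1 ≤ M → 1 - 80*B*K*(9/10)^M ≤ lam.re/(1-β) * x^M := by
    intro M hM
    have h1 := hserR.summable.sum_add_tsum_nat_add M
    rw [hserR.tsum_eq] at h1
    have ht : -(80*B*K*(9/10)^M) ≤ ∑' m, (c (m+M)).re * x^(m+M) := by
      have hg : HasSum (fun m : ℕ => 8*B*K*(9/10)^(m+M)) (80*B*K*(9/10)^M) := by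
        have := (hasSum_geometric_of_lt_one (by norm_num : (0:ℝ) ≤ 9/10) (by norm_num)).mul_left (8*B*K*(9/10)^M)
        rw [show 80*B*K*(9/10)^M = 8*B*K*(9/10)^M*(1-9/10)⁻¹ by norm_num; ring]
        refine this.congr_fun (fun m => ?_)
        rw [pow_add]; ring
      have := tsum_of_norm_bounded hg (f := fun m => (c (m+M)).re * x^(m+M)) (fun m => by
        rw [norm_mul, norm_pow, Real.norm_eq_abs, Real.norm_eq_abs, abs_of_pos (by linarith : 0 < x)]
        calc _ ≤ (8*B*K*(4/5)^(m+M)) * (9/8)^(m+M) := by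
              gcongr; exact (abs_re_le_norm _).trans (hcb _)
          _ = 8*B*K*(9/10)^(m+M) := by rw [mul_assoc, ← mul_pow]; norm_num)
      exact (abs_le.1 this).1
    have hf : 1 - lam.re * ((x^M-1)/(x-1)) ≤ ∑ m ∈ Finset.range M, (c m).re * x^m := by
      rw [← geom_sum_eq hx1.ne' M]
      obtain ⟨M, rfl⟩ : ∃ M', M = M'+1 := ⟨M-1, by omega⟩
      rw [Finset.sum_range_succ', Finset.sum_range_succ', mul_add, Finset.mul_sum]
      have : ∑ m ∈ Finset.range M, -(lam.re * x^(m+1)) ≤ ∑ m ∈ Finset.range M, (c (m+1)).re * x^(m+1) :=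
        Finset.sum_le_sum fun m _ => by have := hbm (m+1); have h5 : 0 < x^(m+1) := by positivity
                                        nlinarith
      rw [Finset.sum_neg_distrib] at this
      simp only [pow_zero, mul_one]
      linarith
    have he : lam.re * ((x^M-1)/(x-1)) = lam.re/(1-β) * x^M - lam.re/(1-β) := by
      have : 1 - β ≠ 0 := by linarith
      rw [show x - 1 = 1-β by rw [hx]; ring]; field_simp
    linarith
  set D := 160*B*K with hD
  have hD1 : 1 ≤ D := by rw [hD]; nlinarith
  have hlD : 0 ≤ Real.log D := Real.log_nonneg hD1
  set M := ⌈10 * Real.log D⌉₊ + 1 with hM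
  have hM1 : 10 * Real.log D ≤ M := by rw [hM]; push_cast; linarith [Nat.le_ceil (10 * Real.log D)]
  have hM2 : (M:ℝ) ≤ 10 * Real.log D + 2 := by rw [hM]; push_cast; linarith [Nat.ceil_lt_add_one (by positivity : 0 ≤ 10 * Real.log D)]
  have h9 : (9/10:ℝ)^M ≤ D⁻¹ := by
    have : (9/10:ℝ) ≤ Real.exp (-(1/10)) := by linarith [Real.add_one_le_exp (-(1/10):ℝ)]
    calc (9/10:ℝ)^M ≤ (Real.exp (-(1/10)))^M := by gcongr
      _ = Real.exp (-(M/10)) := by rw [← Real.exp_nat_mul]; ring_nf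
      _ ≤ Real.exp (-Real.log D) := by gcongr; linarith
      _ = _ := by rw [Real.exp_neg, Real.exp_log (by linarith)]
  have hm := hmain M (by omega)
  have h10 : 80*B*K*(9/10)^M ≤ 1/2 := by
    calc _ ≤ 80*B*K*D⁻¹ := by gcongr
      _ = 1/2 := by rw [hD]; have : B*K ≠ 0 := by positivity
                    field_simp; norm_num
  have h11 : x^M ≤ 3 * D^(10*(1-β)) := by
    have h12 : x ≤ Real.exp (1-β) := by have := Real.add_one_le_exp (1-β); rw [hx]; linarith
    calc x^M ≤ (Real.exp (1-β))^M := by gcongr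
      _ = Real.exp (M*(1-β)) := by rw [← Real.exp_nat_mul]
      _ ≤ Real.exp (1 + Real.log D * (10*(1-β))) := by gcongr; nlinarith
      _ = Real.exp 1 * D^(10*(1-β)) := by rw [Real.exp_add, Real.rpow_def_of_pos (by linarith)]
      _ ≤ _ := by gcongr; linarith [Real.exp_one_lt_d9]
  have h13 : 0 < lam.re/(1-β) := by
    by_contra h; have : 0 < x^M := by positivity
    nlinarith
  have h14 : 1/2 ≤ lam.re/(1-β) * (3 * D^(10*(1-β))) := by
    refine le_trans ?_ (mul_le_mul_of_nonneg_left h11 h13.le); linarith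
  rw [show -10*(1-β) = -(10*(1-β)) by ring, Real.rpow_neg (by linarith)]
  have h15 : 0 < D^(10*(1-β)) := by positivity
  have h16 : 0 < 1-β := by linarith
  rw [← div_eq_mul_inv, div_div, div_le_iff₀ (by positivity)]
  have : lam.re/(1-β) * (3 * D^(10*(1-β))) = lam.re * 3 * D^(10*(1-β))/(1-β) := by ring
  rw [this, le_div_iff₀ h16] at h14
  linarith
end

section
open Complex MeasureTheory Filter Topology LSeries
open scoped ComplexOrder
lemma sum_zmod {q : ℕ} [NeZero q] (f : ZMod q → ℂ) : ∑ k ∈ Finset.range q, f k = ∑ x, f x := by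
  refine Finset.sum_nbij' (fun k => (k : ZMod q)) (fun x => x.val) (by simp) ?_ ?_ ?_ (by simp)
  · intro x _; simpa using x.val_lt
  · intro k hk; exact ZMod.val_cast_of_lt (by simpa using hk)
  · intro x _; simp
lemma HP_prec (η : ℝ) : IsPreconnected (HP η) := (convex_halfSpace_re_gt _).isPreconnected
lemma chi_PS {q : ℕ} [NeZero q] {χ : DirichletCharacter ℂ q} (hχ : χ ≠ 1) (n : ℕ) : ‖PS (fun n => χ n) n‖ ≤ 2*q :=
  PS_periodic (NeZero.pos q) (fun n => χ.norm_le_one _) (by simp)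
    (by rw [sum_zmod]; exact MulChar.sum_eq_zero_of_ne_one hχ) n
lemma L_eq {q : ℕ} [NeZero q] {χ : DirichletCharacter ℂ q} (hχ : χ ≠ 1) {η : ℝ} (h0 : 0 < η) (h1 : η ≤ 1/2) :
    Set.EqOn χ.LFunction (FA (fun n => χ n)) (HP η) := by
  have hq : (1:ℝ) ≤ q := by exact_mod_cast NeZero.pos q
  have hF := FA_spec (a := fun n => χ n) (Q := 2*q) (fun n => χ.norm_le_one _) (by linarith) (chi_PS hχ) h0 h1
  refine ((χ.differentiable_LFunction hχ).differentiableOn.analyticOnNhd (HP_open η)).eqOn_of_preconnected_of_eventuallyEq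
      (hF.1.analyticOnNhd (HP_open η)) (HP_prec η) (z₀ := 2) (by simp [HP]; linarith) ?_
  have : {s : ℂ | 1 < s.re} ∈ 𝓝 (2:ℂ) := (isOpen_lt continuous_const continuous_re).mem_nhds (by simp)
  filter_upwards [this] with s hs
  rw [FA_eq (fun n => χ.norm_le_one _) (chi_PS hχ) hs, DirichletCharacter.LFunction_eq_LSeries _ hs]
lemma L_spec {q : ℕ} [NeZero q] {χ : DirichletCharacter ℂ q} (hχ : χ ≠ 1) {η : ℝ} (h0 : 0 < η) (h1 : η ≤ 1/2)
    {s : ℂ} (hs : s ∈ HP η) : ‖χ.LFunction s‖ ≤ (2*q:ℝ)^(2*η) * ZC η * (1 + ‖s‖)^2 := by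
  have hq : (1:ℝ) ≤ q := by exact_mod_cast NeZero.pos q
  rw [L_eq hχ h0 h1 hs]
  exact (FA_spec (fun n => χ.norm_le_one _) (by linarith) (chi_PS hχ) h0 h1).2 s hs
lemma L0_spec {q : ℕ} [NeZero q] {η : ℝ} (h0 : 0 < η) (h1 : η ≤ 1/2)
    {s : ℂ} (hs : 1 < s.re) : ‖LSeries (fun n => (1 : DirichletCharacter ℂ q) n) s‖ ≤
      ‖riemannZeta s‖ + (2*q:ℝ)^(2*η) * ZC η * (1 + ‖s‖)^2 := by
  set χ := (1 : DirichletCharacter ℂ q)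
  have hq : (1:ℝ) ≤ q := by exact_mod_cast NeZero.pos q
  set r : ℝ := q.totient/q with hr
  have hr0 : 0 ≤ r := by positivity
  have hr1 : r ≤ 1 := by rw [hr, div_le_one (by linarith)]; exact_mod_cast q.totient_le
  set a : ℕ → ℂ := fun n => χ n - r with ha
  have hχv : ∀ n : ℕ, χ n = if q.Coprime n then 1 else 0 := by
    intro n
    by_cases h : q.Coprime n
    · simp only [χ, if_pos h]; exact MulChar.one_apply ((ZMod.isUnit_iff_coprime n q).2 h.symm)
    · simp only [χ, if_neg h]; exact MulChar.map_nonunit _ (fun hu => h ((ZMod.isUnit_iff_coprime n q).1 hu).symm)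
  have hab : ∀ n, ‖a n‖ ≤ 1 := by
    intro n
    simp only [ha, hχv]
    split_ifs
    · rw [show (1:ℂ) - r = ((1-r:ℝ):ℂ) by push_cast; ring, norm_real, Real.norm_eq_abs, abs_le]; constructor <;> linarith
    · rw [zero_sub, norm_neg, norm_real, Real.norm_eq_abs, abs_of_nonneg hr0]; exact hr1
  have hb : ∀ n, ‖PS a n‖ ≤ 2*q := PS_periodic (NeZero.pos q) hab (by simp [ha])
    (by
      simp only [ha, hχv, Finset.sum_sub_distrib, Finset.sum_boole, Finset.sum_const, Finset.card_range, nsmul_eq_mul]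
      rw [← Nat.totient_eq_card_coprime, hr]
      have : (q:ℂ) ≠ 0 := by exact_mod_cast NeZero.ne q
      push_cast; field_simp; ring)
  have hF := FA_spec (a := a) (Q := 2*q) hab (by linarith) hb h0 h1
  have h2 := hF.2 s (by simp [HP]; linarith)
  rw [FA_eq hab hb hs] at h2
  have h3 : LSeries (fun n => χ n) s = LSeries a s + r * riemannZeta s := by
    have e1 : LSeriesSummable a s := LSeriesSummable_of_bounded_of_one_lt_re (m := 1) (fun n _ => hab n) hs
    have e2 : LSeriesSummable ((r:ℂ) • (1:ℕ → ℂ)) s := LSeriesSummable.smul _ (LSeriesSummable_one_iff.2 hs)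
    rw [← LSeries_one_eq_riemannZeta hs, ← LSeries_smul, ← LSeries_add e1 e2]
    congr 1; ext n; simp [ha]
  rw [h3]
  refine (norm_add_le _ _).trans ?_
  rw [norm_mul, norm_real, Real.norm_eq_abs, abs_of_nonneg hr0]
  have := mul_le_of_le_one_left (norm_nonneg (riemannZeta s)) hr1
  linarith
noncomputable def AF (u : ℕ →* ℂ) : ArithmeticFunction ℂ := ⟨fun n => if n = 0 then 0 else u n, by simp⟩
noncomputable def LamC (u : ℕ → ℂ) : ArithmeticFunction ℂ := ⟨fun n => (ArithmeticFunction.vonMangoldt n : ℂ) * u n, by simp⟩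
lemma AF_D (u : ℕ →* ℂ) (n : ℕ) : (AF u * LamC u) n = AF u n * (Real.log n : ℂ) := by
  rcases eq_or_ne n 0 with rfl | hn
  · simp
  rw [ArithmeticFunction.mul_apply]
  have : ∀ x ∈ n.divisorsAntidiagonal, AF u x.1 * LamC u x.2 = u n * (ArithmeticFunction.vonMangoldt x.2 : ℂ) := by
    intro x hx
    have hx1 := Nat.mem_divisorsAntidiagonal.1 hx
    have h1 : x.1 ≠ 0 := by rintro h; simp [h] at hx1; omega
    simp only [AF, LamC, ArithmeticFunction.coe_mk, if_neg h1]
    rw [← hx1.1, map_mul]; ring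
  rw [Finset.sum_congr rfl this, ← Finset.mul_sum, Nat.sum_divisorsAntidiagonal' (f := fun _ y => (ArithmeticFunction.vonMangoldt y : ℂ))]
  rw [← ofReal_sum, ArithmeticFunction.vonMangoldt_sum]
  simp [AF, hn]
lemma mul_D (f g : ArithmeticFunction ℂ) (n : ℕ) : (f * g) n * (Real.log n : ℂ) =
    ∑ x ∈ n.divisorsAntidiagonal, (f x.1 * (Real.log x.1 : ℂ) * g x.2 + f x.1 * (g x.2 * (Real.log x.2 : ℂ))) := by
  rw [ArithmeticFunction.mul_apply, Finset.sum_mul]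
  refine Finset.sum_congr rfl fun x hx => ?_
  have hx1 := Nat.mem_divisorsAntidiagonal.1 hx
  have h1 : (x.1:ℝ) ≠ 0 := by rintro h; simp at h; exact hx1.2 (by rw [← hx1.1, h]; simp)
  have h2 : (x.2:ℝ) ≠ 0 := by rintro h; simp at h; exact hx1.2 (by rw [← hx1.1, h]; simp)
  rw [show (n:ℝ) = ((x.1*x.2:ℕ):ℝ) by rw [hx1.1]]
  push_cast
  rw [Real.log_mul h1 h2]; push_cast; ring
lemma list_D (l : List (ℕ →* ℂ)) (n : ℕ) : (l.map AF).prod n * (Real.log n : ℂ) =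
    ((l.map AF).prod * LamC (fun n => (l.map (fun u => u n)).sum)) n := by
  induction l generalizing n with
  | nil =>
    have : LamC (fun n => ((([]:List (ℕ →* ℂ)).map (fun u => u n)).sum)) = 0 := by ext; simp [LamC]
    rw [this]
    by_cases h : n = 1
    · simp [h]
    · simp [ArithmeticFunction.one_apply_ne h]
  | cons u l ih =>
    simp only [List.map_cons, List.prod_cons, List.sum_cons]
    rw [mul_D]
    have e : LamC (fun n => u n + (l.map (fun u => u n)).sum) = LamC u + LamC (fun n => (l.map (fun u => u n)).sum) := by
      ext n; rw [ArithmeticFunction.add_apply]; simp only [LamC, ArithmeticFunction.coe_mk, mul_add]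
    rw [e, mul_add, show AF u * (l.map AF).prod * LamC u = (AF u * LamC u) * (l.map AF).prod by ring, mul_assoc (AF u) _ (LamC _),
      ArithmeticFunction.add_apply, ArithmeticFunction.mul_apply, ArithmeticFunction.mul_apply, ← Finset.sum_add_distrib]
    refine Finset.sum_congr rfl fun x hx => ?_
    rw [AF_D, ih]
lemma list_one (l : List (ℕ →* ℂ)) : (l.map AF).prod 1 = 1 := by
  induction l with
  | nil => simp
  | cons u l ih => rw [List.map_cons, List.prod_cons, ArithmeticFunction.mul_apply]; simp [ih]; simp [AF]
lemma list_nn (l : List (ℕ →* ℂ)) (h : ∀ n : ℕ, 0 ≤ (l.map (fun u => u n)).sum) (n : ℕ) : 0 ≤ (l.map AF).prod n := by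
  induction n using Nat.strong_induction_on with
  | _ n ih =>
    rcases eq_or_ne n 0 with rfl | hn
    · simp
    rcases eq_or_ne n 1 with rfl | hn1
    · rw [list_one]; exact zero_le_one
    have hlog : 0 < Real.log n := Real.log_pos (by exact_mod_cast (by omega : 1 < n))
    have h2 : 0 ≤ (l.map AF).prod n * (Real.log n : ℂ) := by
      rw [list_D, ArithmeticFunction.mul_apply]
      refine Finset.sum_nonneg fun x hx => ?_
      have hx1 := Nat.mem_divisorsAntidiagonal.1 hx
      by_cases hy : x.2 = 1
      · simp [hy, LamC]
      · have h0 : x.1 ≠ 0 := by rintro h; simp [h] at hx1; omega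
        have h0 : x.2 ≠ 0 := by rintro h; simp [h] at hx1; omega
        refine mul_nonneg (ih x.1 ?_) ?_
        · rw [← hx1.1]; exact lt_mul_of_one_lt_right (by omega) (by omega)
        · exact mul_nonneg (by exact_mod_cast ArithmeticFunction.vonMangoldt_nonneg) (h _)
    have h3 := mul_nonneg h2 (show (0:ℂ) ≤ ((Real.log n)⁻¹ : ℝ) by exact_mod_cast (inv_pos.2 hlog).le)
    rwa [mul_assoc, ← ofReal_mul, mul_inv_cancel₀ hlog.ne', ofReal_one, mul_one] at h3
lemma list_L (l : List (ℕ →* ℂ)) (h : ∀ u ∈ l, ∀ n, ‖u n‖ ≤ 1) {s : ℂ} (hs : 1 < s.re) :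
    LSeriesSummable (fun n => (l.map AF).prod n) s ∧
      LSeries (fun n => (l.map AF).prod n) s = (l.map (fun u => LSeries (fun n => u n) s)).prod := by
  induction l with
  | nil =>
    have e : (fun n => (([]:List (ℕ →* ℂ)).map AF).prod n) = delta := by
      ext n; simp [delta, ArithmeticFunction.one_apply]
    rw [e]; refine ⟨?_, by simp [LSeries_delta]⟩
    exact LSeriesSummable_of_bounded_of_one_lt_re (m := 1) (fun n hn => by simp only [delta]; split_ifs <;> simp) hs
  | cons u l ih =>
    have ih := ih (fun v hv => h v (by simp [hv]))
    have hu : LSeriesSummable (fun n => AF u n) s :=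
      LSeriesSummable_of_bounded_of_one_lt_re (m := 1) (fun n hn => by simpa [AF, hn] using h u (by simp) n) hs
    simp only [List.map_cons, List.prod_cons]
    refine ⟨ArithmeticFunction.LSeriesSummable_mul hu ih.1, ?_⟩
    rw [ArithmeticFunction.LSeries_mul' hu ih.1, ih.2]
    congr 1
    exact LSeries_congr (fun {n} hn => by simp [AF, hn]) s
end

section
open Complex MeasureTheory Filter Topology LSeries
open scoped ComplexOrder
noncomputable def CH {q : ℕ} (χ : DirichletCharacter ℂ q) : ℕ →* ℂ := χ.toMonoidHom.comp (Nat.castRingHom (ZMod q) : ℕ →* ZMod q)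
lemma CH_apply {q : ℕ} (χ : DirichletCharacter ℂ q) (n : ℕ) : CH χ n = χ n := rfl
lemma quad_val {q : ℕ} {χ : DirichletCharacter ℂ q} (h : χ^2 = 1) (n : ℕ) : χ n = 0 ∨ χ n = 1 ∨ χ n = -1 := by
  by_cases hu : IsUnit (n : ZMod q)
  · right
    have : (χ^2) n = 1 := by rw [h]; exact MulChar.one_apply hu
    rw [MulChar.pow_apply' _ two_ne_zero] at this
    have h3 : (χ n - 1)*(χ n + 1) = 0 := by linear_combination this
    rcases mul_eq_zero.1 h3 with h | h
    · left; linear_combination h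
    · right; linear_combination h
  · left; exact MulChar.map_nonunit _ hu
lemma mul_val {q r : ℕ} [NeZero q] [NeZero r] (χ : DirichletCharacter ℂ q) (ψ : DirichletCharacter ℂ r) (n : ℕ) :
    (DirichletCharacter.changeLevel (Dvd.intro r rfl : q ∣ q*r) χ * DirichletCharacter.changeLevel (Dvd.intro_left q rfl : r ∣ q*r) ψ) n = χ n * ψ n := by
  by_cases h : n.Coprime (q*r)
  · have h2 : IsCoprime (n:ℤ) ((q*r:ℕ):ℤ) := Nat.isCoprime_iff_coprime.2 h
    have e1 := DirichletCharacter.changeLevel_eq_cast_of_dvd' χ (Dvd.intro r rfl : q ∣ q*r) h2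
    have e2 := DirichletCharacter.changeLevel_eq_cast_of_dvd' ψ (Dvd.intro_left q rfl : r ∣ q*r) h2
    rw [MulChar.mul_apply]
    simp only [Int.cast_natCast] at e1 e2
    rw [e1, e2]
  · have h1 : ¬ IsUnit ((n:ℕ):ZMod (q*r)) := fun hu => h ((ZMod.isUnit_iff_coprime n _).1 hu)
    rw [MulChar.map_nonunit _ h1]
    rw [Nat.coprime_mul_iff_right, not_and_or] at h
    rcases h with h | h
    · rw [MulChar.map_nonunit χ (fun hu => h ((ZMod.isUnit_iff_coprime n _).1 hu)), zero_mul]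
    · rw [MulChar.map_nonunit ψ (fun hu => h ((ZMod.isUnit_iff_coprime n _).1 hu)), mul_zero]
lemma chi_mul_ne {q r : ℕ} [NeZero q] [NeZero r] {χ : DirichletCharacter ℂ q} {ψ : DirichletCharacter ℂ r}
    (h1 : χ.IsPrimitive) (h2 : ψ.IsPrimitive) (hqr : q ≠ r) :
    DirichletCharacter.changeLevel (Dvd.intro r rfl : q ∣ q*r) χ * DirichletCharacter.changeLevel (Dvd.intro_left q rfl : r ∣ q*r) ψ ≠ 1 := by
  intro h
  have h3 := eq_inv_of_mul_eq_one_left h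
  have : NeZero (q*r) := ⟨mul_ne_zero (NeZero.ne q) (NeZero.ne r)⟩
  have h4 := congrArg DirichletCharacter.conductor h3
  rw [DirichletCharacter.conductor_changeLevel, DirichletCharacter.conductor_inv, DirichletCharacter.conductor_changeLevel] at h4
  rw [DirichletCharacter.IsPrimitive] at h1 h2
  omega
lemma LK {q : ℕ} [NeZero q] {χ : DirichletCharacter ℂ q} (hχ : χ ≠ 1) {s : ℂ} (hs : s ∈ Metric.closedBall (2:ℂ) (5/4)) :
    ‖χ.LFunction s‖ ≤ 72 * (1 + ZC (1/2)) * q := by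
  have hz : ‖s - 2‖ ≤ 5/4 := by simpa [dist_eq] using hs
  have h1 : s ∈ HP (1/2) := by
    have := (abs_le.1 ((abs_re_le_norm _).trans hz)).1
    simp only [HP, Set.mem_ofPred_eq, sub_re, re_ofNat] at *
    linarith
  have h2 : ‖s‖ ≤ 5 := by
    have := norm_add_le (s-2) 2
    simp at this; linarith
  have hZC : 0 ≤ ZC (1/2) := tsum_nonneg fun n => by positivity
  refine (L_spec hχ (by norm_num) le_rfl h1).trans ?_
  rw [show (2:ℝ)*(1/2) = 1 by norm_num, Real.rpow_one]
  calc _ ≤ 2*q*(1+ZC (1/2))*(1+5)^2 := by gcongr; linarith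
    _ = _ := by ring
lemma abs_le_one_of {l : List (ℕ →* ℂ)} (h : ∀ u ∈ l, ∀ n, ‖u n‖ ≤ 1) : abscissaOfAbsConv (fun n => (l.map AF).prod n) ≤ 1 := by
  refine abscissaOfAbsConv_le_of_forall_lt_LSeriesSummable fun y hy => (list_L l h ?_).1
  simpa using hy
lemma L_real_pos {q : ℕ} [NeZero q] {χ : DirichletCharacter ℂ q} (hχ : χ ≠ 1) (h2 : χ^2 = 1) {β : ℝ} (hβ : 1/2 < β) (hβ1 : β < 1)
    (hnz : ∀ b : ℝ, β ≤ b → b < 1 → χ.LFunction b ≠ 0) : (χ.LFunction β).im = 0 ∧ 0 ≤ (χ.LFunction β).re := by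
  have him : ∀ b : ℝ, β ≤ b → (χ.LFunction b).im = 0 := by
    intro b hb
    rw [L_eq hχ (η := 1/2) (by norm_num) le_rfl (by simp [HP]; linarith), ← conj_eq_iff_im, FA, Complex.conj_tsum]
    congr 1; ext n
    have h1 : (starRingEnd ℂ) (PS (fun n => χ n) (n+1)) = PS (fun n => χ n) (n+1) := by
      rw [PS, map_sum]
      refine Finset.sum_congr rfl fun k _ => ?_
      rcases quad_val h2 (k+1) with h | h | h <;> rw [h] <;> simp
    have h3 : ∀ m : ℕ, (starRingEnd ℂ) ((m:ℂ)^(-(b:ℂ))) = (m:ℂ)^(-(b:ℂ)) := fun m => by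
      rw [← ofReal_neg, ← ofReal_natCast, ← ofReal_cpow (by positivity), conj_ofReal]
    rw [map_sub, map_mul, map_mul, h1, h3, h3]
  have hnn : ∀ n : ℕ, 0 ≤ ((([1, CH χ]:List (ℕ →* ℂ)).map (fun u => u n)).sum) := by
    intro n
    simp only [List.map_cons, List.map_nil, List.sum_cons, List.sum_nil, add_zero, MonoidHom.one_apply, CH_apply]
    rcases quad_val h2 n with h | h | h <;> rw [h] <;> norm_num
  have hno : ∀ u ∈ ([1, CH χ]:List (ℕ →* ℂ)), ∀ n, ‖u n‖ ≤ 1 := by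
    intro u hu n
    simp only [List.mem_cons, List.not_mem_nil, or_false] at hu
    rcases hu with rfl | rfl
    · simp
    · exact χ.norm_le_one _
  refine ⟨him β le_rfl, ?_⟩
  by_contra hneg
  push Not at hneg
  have h2pos : 0 < (χ.LFunction (2:ℝ)).re := by
    have := LSeries.positive (a := fun n => (([1, CH χ]:List (ℕ →* ℂ)).map AF).prod n) (x := 2) (fun n => list_nn _ hnn n)
      (by rw [list_one]; exact zero_lt_one) ((abs_le_one_of hno).trans_lt (by exact_mod_cast (by norm_num : (1:ℝ) < 2)))
    · rw [(list_L _ hno (by simp)).2] at this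
      · simp only [List.map_cons, List.map_nil, List.prod_cons, List.prod_nil, mul_one] at this
        have e : LSeries (fun n => (1:ℕ →* ℂ) n) ((2:ℝ):ℂ) = (Real.pi^2/6:ℝ) := by
          have := LSeries_one_eq_riemannZeta (s := 2) (by simp)
          rw [riemannZeta_two] at this
          push_cast
          rw [← this]; rfl
        rw [e] at this
        have h3 := (Complex.lt_def.1 this).1
        rw [re_ofReal_mul] at h3
        rw [DirichletCharacter.LFunction_eq_LSeries _ (by simp)]
        exact (mul_pos_iff_of_pos_left (by positivity)).1 h3
  have hc : ContinuousOn (fun b : ℝ => (χ.LFunction b).re) (Set.Icc β 2) :=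
    (continuous_re.comp ((χ.differentiable_LFunction hχ).continuous.comp continuous_ofReal)).continuousOn
  obtain ⟨b, hb, hb0⟩ := intermediate_value_Icc (by linarith : β ≤ 2) hc ⟨hneg.le, h2pos.le⟩
  have hz : χ.LFunction b = 0 := Complex.ext (by simpa using hb0) (by simpa using him b hb.1)
  by_cases h : b < 1
  · exact hnz b hb.1 h hz
  · exact χ.LFunction_ne_zero_of_one_le_re (Or.inl hχ) (by simpa using h) hz
end

section
open Complex MeasureTheory Filter Topology LSeries
open scoped ComplexOrder
lemma ZC_nn (η : ℝ) : 0 ≤ ZC η := tsum_nonneg fun n => by positivity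
lemma CH_no {q : ℕ} (χ : DirichletCharacter ℂ q) (n : ℕ) : ‖CH χ n‖ ≤ 1 := χ.norm_le_one _
lemma L_one_CH (s : ℂ) (hs : 1 < s.re) : LSeries (fun n => (1:ℕ →* ℂ) n) s = riemannZeta s := LSeries_one_eq_riemannZeta hs
lemma LCH {q : ℕ} [NeZero q] (χ : DirichletCharacter ℂ q) {s : ℂ} (hs : 1 < s.re) : LSeries (fun n => CH χ n) s = χ.LFunction s :=
  (DirichletCharacter.LFunction_eq_LSeries _ hs).symm
theorem siegel {ε : ℝ} (hε : 0 < ε) : ∃ c : ℝ, 0 < c ∧ ∀ (q : ℕ) [NeZero q] (χ : DirichletCharacter ℂ q), χ.IsPrimitive → χ ≠ 1 →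
    χ^2 = 1 → c * (q:ℝ)^(-ε) ≤ ‖χ.LFunction 1‖ := by
  obtain ⟨C, hC, hS⟩ := siegelDisc
  have hcont : ∃ d > 0, ∀ b : ℝ, 1 - d < b → b < 1 → 0 ≤ (ZS b).re := by
    have h1 : ContinuousAt (fun b : ℝ => (ZS b).re) 1 := by
      refine continuous_re.continuousAt.comp (ContinuousAt.comp (f := fun b : ℝ => (b:ℂ)) (g := ZS) ?_ continuous_ofReal.continuousAt)
      exact (ZS_spec.1.differentiableAt ((HP_open _).mem_nhds (by simp [HP]))).continuousAt
    have h2 : (0:ℝ) < (ZS ((1:ℝ):ℂ)).re := by simp [ZS]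
    obtain ⟨d, hd, h3⟩ := Metric.eventually_nhds_iff.1 (h1.eventually (lt_mem_nhds h2))
    refine ⟨d, hd, fun b hb hb1 => (h3 ?_).le⟩
    rw [Real.dist_eq, abs_lt]; constructor <;> linarith
  obtain ⟨d, hd, hZ⟩ := hcont
  obtain ⟨δ, hδ, hδ1, hδ2, hδ3⟩ : ∃ δ : ℝ, 0 < δ ∧ δ ≤ ε/100 ∧ δ ≤ 1/8 ∧ δ ≤ d :=
    ⟨min (ε/100) (min (1/8) d), by positivity, min_le_left _ _, (min_le_right _ _).trans (min_le_left _ _), (min_le_right _ _).trans (min_le_right _ _)⟩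
  set A := 72 * (1 + ZC (1/2)) with hA
  have hA1 : 1 ≤ A := by have := ZC_nn (1/2); linarith
  by_cases hz : ∃ (q₁ : ℕ) (_ : NeZero q₁) (χ₁ : DirichletCharacter ℂ q₁) (β : ℝ), χ₁.IsPrimitive ∧ χ₁ ≠ 1 ∧ χ₁^2 = 1 ∧ 1 - δ < β ∧ β < 1 ∧ χ₁.LFunction β = 0
  · obtain ⟨q₁, hq₁, χ₁, β, hp1, hn1, hs1, hb, hb1, hz⟩ := hz
    obtain ⟨c0, hc0, hmin⟩ : ∃ c > 0, ∀ χ : DirichletCharacter ℂ q₁, χ ≠ 1 → c ≤ ‖χ.LFunction 1‖ := by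
      have : Nonempty {χ : DirichletCharacter ℂ q₁ // χ ≠ 1} := ⟨⟨χ₁, hn1⟩⟩
      obtain ⟨x, hx⟩ := Finite.exists_min (fun χ : {χ : DirichletCharacter ℂ q₁ // χ ≠ 1} => ‖χ.1.LFunction 1‖)
      exact ⟨_, norm_pos_iff.2 (x.1.LFunction_ne_zero_of_one_le_re (Or.inl x.2) (by simp)), fun χ h => hx ⟨χ, h⟩⟩
    have hq1 : (1:ℝ) ≤ q₁ := by exact_mod_cast Nat.one_le_iff_ne_zero.2 hq₁.ne
    set B := ‖χ₁.LFunction 1‖ * ((2*q₁:ℝ)^(2*δ) * ZC δ * 4) + 1 with hB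
    have hB0 : 0 < B := by have := ZC_nn δ; positivity
    set c1 := (1-β)/6*(C*(A^3*q₁^2))^(-10*δ)/B with hc1
    have hc1p : 0 < c1 := by have : 0 < 1-β := by linarith
                             positivity
    refine ⟨min c0 c1, lt_min hc0 hc1p, fun q _ χ hp hn hs => ?_⟩
    have hq : (1:ℝ) ≤ q := by exact_mod_cast Nat.one_le_iff_ne_zero.2 (NeZero.ne q)
    by_cases hqq : q₁ = q
    · subst hqq
      calc _ ≤ c0 * 1 := mul_le_mul (min_le_left _ _) (Real.rpow_le_one_of_one_le_of_nonpos hq1 (by linarith)) (by positivity) hc0.le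
        _ ≤ _ := by rw [mul_one]; exact hmin _ hn
    have : NeZero (q₁*q) := ⟨mul_ne_zero (NeZero.ne _) (NeZero.ne _)⟩
    set ψ := DirichletCharacter.changeLevel (Dvd.intro q rfl : q₁ ∣ q₁*q) χ₁ * DirichletCharacter.changeLevel (Dvd.intro_left q₁ rfl : q ∣ q₁*q) χ with hψ
    have hψ1 : ψ ≠ 1 := chi_mul_ne hp1 hp hqq
    have hψv : ∀ n : ℕ, ψ n = χ₁ n * χ n := mul_val χ₁ χ
    set l : List (ℕ →* ℂ) := [1, CH χ₁, CH χ, CH ψ] with hl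
    have hno : ∀ u ∈ l, ∀ n, ‖u n‖ ≤ 1 := by
      intro u hu n
      simp only [hl, List.mem_cons, List.not_mem_nil, or_false] at hu
      rcases hu with rfl | rfl | rfl | rfl
      · simp
      all_goals exact CH_no _ _
    have hnn : ∀ n : ℕ, 0 ≤ (l.map (fun u => u n)).sum := by
      intro n
      simp only [hl, List.map_cons, List.map_nil, List.sum_cons, List.sum_nil, add_zero, MonoidHom.one_apply, CH_apply, hψv]
      rcases quad_val hs1 n with h | h | h <;> rcases quad_val hs n with h' | h' | h' <;> rw [h, h'] <;> norm_num
    have key := hS (fun s => χ₁.LFunction s * (χ.LFunction s * ψ.LFunction s)) (A*q₁*(A*q*(A*(q₁*q)))) β (fun n => (l.map AF).prod n)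
      ((χ₁.differentiable_LFunction hn1).mul ((χ.differentiable_LFunction hn).mul (ψ.differentiable_LFunction hψ1))).differentiableOn
      (fun s hs => by
        rw [norm_mul, norm_mul]
        have h1 := LK hn1 hs
        have h2 := LK hn hs
        have h3 := LK hψ1 hs
        push_cast at h3
        gcongr)
      (by have e : (1:ℝ) ≤ A*q₁ := one_le_mul_of_one_le_of_one_le hA1 hq1
          have e2 : (1:ℝ) ≤ A*q := one_le_mul_of_one_le_of_one_le hA1 hq
          have e3 : (1:ℝ) ≤ A*(q₁*q) := one_le_mul_of_one_le_of_one_le hA1 (one_le_mul_of_one_le_of_one_le hq1 hq)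
          exact one_le_mul_of_one_le_of_one_le e (one_le_mul_of_one_le_of_one_le e2 e3))
      (fun n => list_nn l hnn n) (list_one l) (abs_le_one_of hno)
      (fun s hs => by
        rw [(list_L l hno hs).2]
        simp only [hl, List.map_cons, List.map_nil, List.prod_cons, List.prod_nil, mul_one]
        rw [L_one_CH s hs, LCH _ hs, LCH _ hs, LCH _ hs])
      (by linarith) hb1 (by rw [hz]; simp)
    have hup := key.trans ((le_abs_self _).trans (abs_re_le_norm _))
    rw [norm_mul, norm_mul] at hup
    have h4 := L_spec hψ1 hδ (by linarith) (show (1:ℂ) ∈ HP δ by simp [HP, hδ])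
    rw [norm_one] at h4
    push_cast at h4
    have e0 : (2*(q₁*q):ℝ)^(2*δ) = (2*q₁:ℝ)^(2*δ) * (q:ℝ)^(2*δ) := by
      rw [← mul_assoc, Real.mul_rpow (by positivity) (by positivity)]
    rw [e0] at h4
    have e1 : (C*(A^3*q₁^2))^(-10*δ) * (q:ℝ)^(-(20*δ)) ≤ (C * (A*q₁*(A*q*(A*(q₁*q)))))^(-10*(1-β)) := by
      have : C * (A*q₁*(A*q*(A*(q₁*q)))) = C*(A^3*q₁^2) * (q:ℝ)^(2:ℝ) := by rw [Real.rpow_two]; ring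
      rw [this]
      have h5 : (C*(A^3*q₁^2))^(-10*δ) * (q:ℝ)^(-(20*δ)) = (C*(A^3*q₁^2) * (q:ℝ)^(2:ℝ))^(-10*δ) := by
        rw [Real.mul_rpow (x := C*(A^3*q₁^2)) (by positivity) (by positivity), ← Real.rpow_mul (by positivity)]; ring_nf
      rw [h5]
      apply Real.rpow_le_rpow_of_exponent_le
      · refine one_le_mul_of_one_le_of_one_le (one_le_mul_of_one_le_of_one_le hC (one_le_mul_of_one_le_of_one_le (one_le_pow₀ hA1) (one_le_pow₀ hq1))) ?_
        exact Real.one_le_rpow hq (by norm_num)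
      · linarith
    set X := ‖χ.LFunction 1‖ with hX
    have h6 : (1-β)/6 * ((C*(A^3*q₁^2))^(-10*δ) * (q:ℝ)^(-(20*δ))) ≤ X * (B * (q:ℝ)^(2*δ)) := by
      calc _ ≤ (1-β)/6 * _ := mul_le_mul_of_nonneg_left e1 (by linarith)
        _ ≤ _ := hup
        _ ≤ ‖χ₁.LFunction 1‖ * (X * ((2*q₁:ℝ)^(2*δ) * (q:ℝ)^(2*δ) * ZC δ * (1+1)^2)) := by gcongr
        _ = X * ((B-1) * (q:ℝ)^(2*δ)) := by rw [hB]; ring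
        _ ≤ _ := by gcongr; linarith
    calc min c0 c1 * (q:ℝ)^(-ε) ≤ c1 * (q:ℝ)^(-(22*δ)) := mul_le_mul (min_le_right _ _) (Real.rpow_le_rpow_of_exponent_le hq (by linarith)) (by positivity) hc1p.le
      _ = ((1-β)/6 * ((C*(A^3*q₁^2))^(-10*δ) * (q:ℝ)^(-(20*δ)))) * (B⁻¹ * (q:ℝ)^(-(2*δ))) := by
          rw [hc1, show -(22*δ) = -(20*δ) + -(2*δ) by ring, Real.rpow_add (by positivity)]; ring
      _ ≤ (X * (B * (q:ℝ)^(2*δ))) * (B⁻¹ * (q:ℝ)^(-(2*δ))) := by gcongr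
      _ = X * (B*B⁻¹) * ((q:ℝ)^(2*δ) * (q:ℝ)^(-(2*δ))) := by ring
      _ = X := by rw [mul_inv_cancel₀ hB0.ne', ← Real.rpow_add (by positivity)]; simp
  · push Not at hz
    refine ⟨δ/2/6 * (C*A)^(-(5*δ)), by positivity, fun q _ χ hp hn hs => ?_⟩
    have hq : (1:ℝ) ≤ q := by exact_mod_cast Nat.one_le_iff_ne_zero.2 (NeZero.ne q)
    set l : List (ℕ →* ℂ) := [1, CH χ] with hl
    have hno : ∀ u ∈ l, ∀ n, ‖u n‖ ≤ 1 := by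
      intro u hu n
      simp only [hl, List.mem_cons, List.not_mem_nil, or_false] at hu
      rcases hu with rfl | rfl
      · simp
      all_goals exact CH_no _ _
    have hnn : ∀ n : ℕ, 0 ≤ (l.map (fun u => u n)).sum := by
      intro n
      simp only [hl, List.map_cons, List.map_nil, List.sum_cons, List.sum_nil, add_zero, MonoidHom.one_apply, CH_apply]
      rcases quad_val hs n with h | h | h <;> rw [h] <;> norm_num
    have hpos := L_real_pos hn hs (β := 1 - δ/2) (by linarith) (by linarith) (fun b h1 h2 => hz q inferInstance χ b hp hn hs (by linarith) h2)
    have key := hS (fun s => χ.LFunction s) (A*q) (1-δ/2) (fun n => (l.map AF).prod n)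
      (χ.differentiable_LFunction hn).differentiableOn (fun s hs => LK hn hs) (one_le_mul_of_one_le_of_one_le hA1 hq)
      (fun n => list_nn l hnn n) (list_one l) (abs_le_one_of hno)
      (fun s hs => by
        rw [(list_L l hno hs).2]
        simp only [hl, List.map_cons, List.map_nil, List.prod_cons, List.prod_nil, mul_one]
        rw [L_one_CH s hs, LCH _ hs])
      (by linarith) (by linarith) (by
        rw [mul_re, hpos.1, mul_zero, sub_zero]
        exact mul_nonneg (hZ _ (by linarith) (by linarith)) hpos.2)
    refine le_trans ?_ (key.trans ((le_abs_self _).trans (abs_re_le_norm _)))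
    rw [show 1-(1-δ/2) = δ/2 by ring, ← mul_assoc C A, Real.mul_rpow (x := C*A) (by positivity) (by positivity), show -10*(δ/2) = -(5*δ) by ring, mul_assoc (δ/2/6)]
    exact mul_le_mul_of_nonneg_left (mul_le_mul_of_nonneg_left (Real.rpow_le_rpow_of_exponent_le hq (by linarith)) (by positivity)) (by positivity)
end

section
open Complex MeasureTheory Filter Topology LSeries
lemma one_le_ZC {η : ℝ} (h : 0 < η) : 1 ≤ ZC η := by
  have := (ZC_sum h).le_tsum 0 (fun n _ => by positivity)
  simpa [ZC] using this
lemma nrm_s {s : ℂ} (h1 : 0 ≤ s.re) (h2 : s.re ≤ 2) : ‖s‖ ≤ 2 + |s.im| :=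
  (norm_le_abs_re_add_abs_im s).trans (by rw [abs_of_nonneg h1]; linarith)
lemma lip {F : ℂ → ℂ} {η K : ℝ} (h0 : 0 < η) (h1 : η ≤ 1) (hK : 0 ≤ K) (hd : DifferentiableOn ℂ F (HP η))
    (hb : ∀ s ∈ HP η, ‖F s‖ ≤ K * (1 + ‖s‖)^2) {s w : ℂ} (hs : 1 ≤ s.re) (hs2 : s.re ≤ 2) (hw : ‖w - s‖ < η) :
    ‖F w‖ ≤ 16*K*(1+|s.im|)^2 ∧ ‖F w - F s‖ ≤ 32*K*(1+|s.im|)^2/η*‖w - s‖ := by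
  have hns := nrm_s (by linarith) hs2
  have hball : ∀ w, ‖w - s‖ < η → w ∈ HP η ∧ ‖F w‖ ≤ 16*K*(1+|s.im|)^2 := by
    intro w hw
    have h3 : w ∈ HP η := by
      have := (abs_le.1 ((abs_re_le_norm _).trans hw.le)).1
      have h4 := (abs_lt.1 ((abs_re_le_norm _).trans_lt hw)).1
      simp only [sub_re, HP, Set.mem_ofPred_eq] at *; linarith
    refine ⟨h3, (hb w h3).trans ?_⟩
    have : ‖w‖ ≤ 3 + |s.im| := by have := norm_add_le (w - s) s; simp at this; linarith
    calc _ ≤ K*(4*(1+|s.im|))^2 := by gcongr; have := abs_nonneg s.im; linarith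
      _ = _ := by ring
  refine ⟨(hball w hw).2, ?_⟩
  have := Complex.dist_le_div_mul_dist_of_mapsTo_ball (f := F) (c := s) (R₁ := η) (R₂ := 32*K*(1+|s.im|)^2) (z := w)
    (hd.mono fun w hw => (hball w (by simpa [dist_eq] using hw)).1)
    (fun w hw => by
      have h5 := (hball w (by simpa [dist_eq] using hw)).2
      have h6 := (hball s (by simpa using h0)).2
      rw [Metric.mem_closedBall, dist_eq]
      exact (norm_sub_le _ _).trans (by linarith)) (by simpa [dist_eq] using hw)
  simpa only [dist_eq] using this
lemma low {F : ℂ → ℂ} {y W τ : ℝ} (hW : 1 ≤ W) (hτ : 0 < τ → 1 ≤ W*τ)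
    (hL : ∀ x x' : ℝ, 0 < x → x ≤ 1 → 0 < x' → x' ≤ 1 → |x' - x| < 1/W → ‖F (1+x'+I*y) - F (1+x+I*y)‖ ≤ W*|x'-x|)
    (h3 : ∀ x : ℝ, 0 < x → x ≤ 1 → (τ ≤ |y| ∨ τ ≤ x) → x^3 ≤ W^4*‖F (1+x+I*y)‖^4)
    (hn : ∀ x : ℝ, 0 < x → x ≤ 1 → x < τ → |y| < τ → 1/W ≤ ‖F (1+x+I*y)‖) {x : ℝ} (h0 : 0 < x) (h1 : x ≤ 1) :
    1 ≤ 16*W^7*‖F (1+x+I*y)‖ := by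
  have hW0 : 0 < W := by linarith
  set l := ‖F (1+x+I*y)‖ with hl
  have hl0 : 0 ≤ l := norm_nonneg _
  by_contra hc
  push Not at hc
  have hW7 : W ≤ W^7 := le_self_pow₀ hW (by norm_num)
  have hc' : W*(16*W^6*l) < 1 := by nlinarith
  by_cases hnear : x < τ ∧ |y| < τ
  · have := hn x h0 h1 hnear.1 hnear.2
    rw [div_le_iff₀ hW0] at this
    have h6 : 1 ≤ W^6 := one_le_pow₀ hW
    nlinarith [mul_le_mul_of_nonneg_left h6 (mul_nonneg hl0 hW0.le)]
  have hor : τ ≤ |y| ∨ τ ≤ x := by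
    rw [not_and_or] at hnear; push Not at hnear; exact hnear.symm
  set x0 := 1/(16*W^8) with hx0
  have hx00 : 0 < x0 := by positivity
  have hx0W : x0 * W ≤ 1/16 := by
    rw [hx0, div_mul_eq_mul_div, div_le_div_iff₀ (by positivity) (by norm_num)]
    have : W ≤ W^8 := le_self_pow₀ hW (by norm_num)
    linarith
  have hx01 : x0 ≤ 1 := by nlinarith
  have fin : ∀ v : ℝ, 0 ≤ v → 8*W^7*v < 1 → x0^3 ≤ W^4*v^4 → False := by
    intro v hv hv1 hv3
    have e1 : (8*W^7*v)^4 < 1 := pow_lt_one₀ (by positivity) hv1 (by norm_num)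
    have e2 : x0^3*(16*W^8)^3 = 1 := by rw [hx0]; field_simp
    have e3 : x0^3*(16*W^8)^3 ≤ W^4*v^4*(16*W^8)^3 := by gcongr
    have e4 : W^4*v^4*(16*W^8)^3 = (8*W^7*v)^4 := by ring
    linarith
  by_cases hx : x0 ≤ x
  · exact fin l hl0 (by nlinarith [mul_nonneg hl0 (pow_nonneg hW0.le 7)]) ((pow_le_pow_left₀ hx00.le hx 3).trans (h3 x h0 h1 hor))
  · push Not at hx
    have hy : τ ≤ |y| := by
      rcases hor with h | h
      · exact h
      · by_contra h'
        by_cases ht : 0 < τ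
        · have := hτ ht; nlinarith
        · exact h' ((not_lt.1 ht).trans (abs_nonneg _))
    have hd : |x0 - x| ≤ x0 := by rw [abs_le]; constructor <;> linarith
    have hd2 : |x0 - x| < 1/W := by rw [lt_div_iff₀ hW0]; nlinarith
    have e := hL x x0 h0 h1 hx00 hx01 hd2
    have e2 := norm_sub_norm_le (F (1+x0+I*y)) (F (1+x+I*y))
    refine fin ‖F (1+x0+I*y)‖ (norm_nonneg _) ?_ (h3 x0 hx00 hx01 (Or.inl hy))
    have e3 : W^7*(W*x0) = 1/16 := by rw [hx0]; field_simp
    have e4 : ‖F (1+x0+I*y)‖ ≤ l + W*x0 := by nlinarith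
    nlinarith [mul_le_mul_of_nonneg_left e4 (pow_nonneg hW0.le 7)]
lemma zeta_le {s : ℂ} {κ : ℝ} (hs : 1 < s.re) (hκ : 0 < κ) (hk : κ ≤ ‖s - 1‖) : ‖riemannZeta s‖ ≤ (1 + ZC (1/2)) * (1 + ‖s‖)^2 / κ := by
  have h1 := ZS_spec.2 s (by simp [HP]; linarith)
  rw [ZS_eq hs, norm_mul] at h1
  rw [le_div_iff₀ hκ]
  nlinarith [norm_nonneg (riemannZeta s)]
lemma pt_re (x y : ℝ) : ((1:ℂ)+x+I*y).re = 1 + x ∧ ((1:ℂ)+x+I*y).im = y := by simp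
lemma pt_nr {x y : ℝ} (h0 : 0 < x) (h1 : x ≤ 1) : 1 + ‖(1:ℂ)+x+I*y‖ ≤ 3*(1+|y|) := by
  have := nrm_s (s := (1:ℂ)+x+I*y) (by simp; linarith) (by simp; linarith)
  rw [(pt_re x y).2] at this; have := abs_nonneg y; linarith
lemma pt_ge {x y : ℝ} : |y| ≤ ‖(1:ℂ)+x+I*y-1‖ ∧ x ≤ ‖(1:ℂ)+x+I*y-1‖ := by
  constructor
  · have := abs_im_le_norm ((1:ℂ)+x+I*y-1); simpa using this
  · have := (le_abs_self _).trans (abs_re_le_norm ((1:ℂ)+x+I*y-1)); simpa using this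
lemma pt_le {x y : ℝ} (h0 : 0 < x) : ‖(1:ℂ)+x+I*y-1‖ ≤ x + |y| := by
  have := norm_le_abs_re_add_abs_im ((1:ℂ)+x+I*y-1)
  simpa [abs_of_pos h0] using this
lemma pt_two (x y : ℝ) : (1:ℂ)+x+2*I*y = 1+x+I*(2*y:ℝ) := by push_cast; ring
lemma pt_zero (x : ℝ) : (1:ℂ)+x = 1+x+I*(0:ℝ) := by simp
lemma pt_sub (x x' y : ℝ) : ‖(1:ℂ)+x'+I*y - (1+x+I*y)‖ = |x'-x| := by
  rw [show (1:ℂ)+x'+I*y - (1+x+I*y) = ((x'-x:ℝ):ℂ) by push_cast; ring, norm_real, Real.norm_eq_abs]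
lemma prod_low {a b c A B X l : ℝ} (h : 1 ≤ a^3*b^4*c) (ha : 0 ≤ a) (hc : 0 ≤ c) (hX : 0 < X) (hA : a ≤ A/X) (hc' : c ≤ B)
    (hb : 0 ≤ b) (hl : b ≤ l) : X^3 ≤ A^3*l^4*B := by
  have h2 : a^3*b^4*c ≤ (A/X)^3*l^4*B := by
    have h0 := ha.trans hA
    have h1 := hb.trans hl
    generalize A/X = D at hA h0
    gcongr
  have : (A/X)^3*l^4*B*X^3 = A^3*l^4*B := by field_simp
  nlinarith [pow_pos hX 3]
lemma zeta_low : ∃ C : ℝ, 1 ≤ C ∧ ∀ s : ℂ, 1 < s.re → s.re ≤ 2 → 1 ≤ C*(1+|s.im|)^14*‖ZS s‖ := by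
  obtain ⟨Z, hZ⟩ : ∃ Z, Z = 1 + ZC (1/2) := ⟨_, rfl⟩
  have hZ1 : 1 ≤ Z := by have := ZC_nn (1/2); linarith
  have hlip := fun s w => lip (s := s) (w := w) (by norm_num) (by norm_num) (by linarith : 0 ≤ Z) ZS_spec.1 (hZ ▸ ZS_spec.2)
  obtain ⟨b, hbb⟩ : ∃ b, b = 256*Z := ⟨_, rfl⟩
  obtain ⟨A, hA⟩ : ∃ A, A = 9*Z*b^5 := ⟨_, rfl⟩
  have hb4 : 1 ≤ b^4 := one_le_pow₀ (by linarith)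
  have hb1 : 1 ≤ b := by linarith
  have hAb : b ≤ A := by
    rw [hA, pow_succ]; nlinarith [mul_le_mul_of_nonneg_left hb4 (by positivity : 0 ≤ 9*Z*b)]
  have hA64 : 64*Z ≤ A := by linarith
  have hA1 : 64 ≤ A := by linarith
  refine ⟨16*A^7, by have : 1 ≤ A^7 := one_le_pow₀ (by linarith)
                     linarith, fun s h1 h2 => ?_⟩
  set y := s.im
  obtain ⟨x, hx⟩ : ∃ x, x = s.re - 1 := ⟨_, rfl⟩
  have hs : s = 1+x+I*y := by apply Complex.ext <;> simp [hx, y]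
  have hE : 1 ≤ 1+|y| := by have := abs_nonneg y; linarith
  have hE2 : 1 ≤ (1+|y|)^2 := one_le_pow₀ hE
  have hAW : A ≤ A*(1+|y|)^2 := le_mul_of_one_le_right (by linarith) hE2
  have hτ0 : (0:ℝ) < 1/b := by positivity
  have := low (F := ZS) (y := y) (W := A*(1+|y|)^2) (τ := 1/b) (by linarith) (fun _ => ?_) ?_ ?_ ?_ (x := x) (by linarith) (by linarith)
  · rw [← hs] at this
    calc _ ≤ _ := this
      _ = _ := by ring
  · rw [mul_one_div, le_div_iff₀ (by positivity)]
    linarith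
  · intro x x' h0 h1 h0' h1' hxx
    have hp := pt_re x y
    have h6 := (hlip (1+x+I*y) (1+x'+I*y) (by linarith) (by linarith) (by
      rw [pt_sub]
      refine hxx.trans_le ?_
      rw [div_le_div_iff₀ (by linarith) (by norm_num)]; linarith)).2
    rw [pt_sub, hp.2] at h6
    refine h6.trans (mul_le_mul_of_nonneg_right ?_ (abs_nonneg _))
    rw [div_le_iff₀ (by norm_num)]; nlinarith
  · intro x h0 h1 hor
    have h7 := DirichletCharacter.norm_LSeries_product_ge_one (1:DirichletCharacter ℂ 1) h0 y
    have e1 : (fun n : ℕ => (1:DirichletCharacter ℂ 1) n) = 1 := by ext n; simp [MulChar.one_apply (isUnit_of_subsingleton _)]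
    rw [one_pow, e1, LSeries_one_eq_riemannZeta (by simp [h0]), LSeries_one_eq_riemannZeta (by simp [h0]), LSeries_one_eq_riemannZeta (by simp [h0]), norm_mul, norm_mul, norm_pow, norm_pow, pt_two] at h7
    have hκ : 1/b ≤ ‖(1:ℂ)+x+I*y-1‖ := by
      rcases hor with h | h
      exacts [h.trans pt_ge.1, h.trans pt_ge.2]
    have hκ2 : 1/b ≤ ‖(1:ℂ)+x+I*(2*y:ℝ)-1‖ := by
      rcases hor with h | h
      · refine h.trans (le_trans ?_ pt_ge.1); rw [abs_mul]; have := abs_nonneg y; norm_num; linarith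
      · exact h.trans pt_ge.2
    have hκ0 : x ≤ ‖(1:ℂ)+x-1‖ := by rw [pt_zero]; exact pt_ge.2
    have b1 := zeta_le (s := 1+x) (by simp [h0]) h0 hκ0
    have b2 := zeta_le (s := 1+x+I*(2*y:ℝ)) (by simp [h0]) hτ0 hκ2
    have n1 : 1+‖(1:ℂ)+x‖ ≤ 3 := by rw [pt_zero]; simpa using pt_nr (y := 0) h0 h1
    have n2 : 1+‖(1:ℂ)+x+I*(2*y:ℝ)‖ ≤ 6*(1+|y|) := by
      refine (pt_nr h0 h1).trans ?_
      rw [abs_mul]; norm_num; have := abs_nonneg y; linarith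
    have b3 : ‖riemannZeta (1+x+I*y)‖ ≤ b*‖ZS (1+x+I*y)‖ := by
      rw [ZS_eq (by simp [h0]), norm_mul]
      rw [div_le_iff₀ (by positivity)] at hκ
      nlinarith [norm_nonneg (riemannZeta (1+x+I*y))]
    have := prod_low (A := 9*Z) (B := 36*b*Z*(1+|y|)^2) h7 (norm_nonneg _) (norm_nonneg _) h0
      (b1.trans (by rw [← hZ]; refine div_le_div_of_nonneg_right ?_ h0.le; nlinarith [mul_le_mul_of_nonneg_left (pow_le_pow_left₀ (by positivity) n1 2) (by linarith : 0 ≤ Z)]))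
      (b2.trans (by
        rw [← hZ, div_div_eq_mul_div, div_one]
        calc _ ≤ Z*(6*(1+|y|))^2*b := by gcongr
          _ = _ := by ring)) (norm_nonneg _) b3
    refine this.trans ?_
    rw [mul_pow b, show (9*Z)^3*(b^4*‖ZS (1+x+I*y)‖^4)*(36*b*Z*(1+|y|)^2) = (4*(9*Z)^4*b^5*(1+|y|)^2)*‖ZS (1+x+I*y)‖^4 by ring]
    refine mul_le_mul_of_nonneg_right ?_ (by positivity)
    rw [hA]
    have g1 : 4*b^5 ≤ (b^5)^4 := by
      have : 1 ≤ b := by linarith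
      calc 4*b^5 ≤ b*b^5 := by gcongr; linarith
        _ = b^6 := by ring
        _ ≤ b^20 := pow_le_pow_right₀ this (by norm_num)
        _ = _ := by ring
    have g2 : (1+|y|)^2 ≤ ((1+|y|)^2)^4 := le_self_pow₀ hE2 (by norm_num)
    calc _ = (9*Z)^4*(4*b^5)*(1+|y|)^2 := by ring
      _ ≤ (9*Z)^4*(b^5)^4*((1+|y|)^2)^4 := by gcongr
      _ = _ := by ring
  · intro x h0 h1 hx hy
    have h6 := (hlip 1 (1+x+I*y) (by simp) (by simp) (lt_of_le_of_lt (pt_le h0) (by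
      have : 1/b ≤ 1/256 := by apply one_div_le_one_div_of_le <;> linarith
      linarith))).2
    have e : ZS 1 = 1 := by simp [ZS]
    rw [e] at h6
    have h8 : ‖(1:ℂ)+x+I*y-1‖ ≤ 2*(1/b) := (pt_le h0).trans (by linarith)
    have h9 := norm_sub_norm_le 1 (1 - ZS (1+x+I*y))
    rw [sub_sub_cancel, norm_sub_rev 1, norm_one] at h9
    have h10 : 32*Z*(1+|(1:ℂ).im|)^2/(1/2)*‖(1:ℂ)+x+I*y-1‖ ≤ 1/2 := by
      calc _ ≤ 32*Z*(1+|(1:ℂ).im|)^2/(1/2)*(2*(1/b)) := by gcongr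
        _ = _ := by rw [hbb]; simp; field_simp; norm_num
    refine le_trans ?_ (by linarith : 1/2 ≤ ‖ZS (1+x+I*y)‖)
    apply one_div_le_one_div_of_le <;> linarith
lemma L_341 {q : ℕ} [NeZero q] (χ : DirichletCharacter ℂ q) {η Z K κ W x y : ℝ} (hη : 0 < η) (hη1 : η ≤ 1/2) (hZ : Z = 1 + ZC (1/2))
    (hK : K = (2*q:ℝ)^(2*η)*ZC η) (hκ : 0 < κ) (hκ1 : κ ≤ 1) (hW : 36*(Z+K)*(1+|y|)^2/κ ≤ W) (h0 : 0 < x) (h1 : x ≤ 1)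
    (hor : χ^2 ≠ 1 ∨ κ ≤ |y| ∨ κ ≤ x) : x^3 ≤ W^4*‖χ.LFunction (1+x+I*y)‖^4 := by
  have hK0 : 0 ≤ K := by rw [hK]; have := ZC_nn η; positivity
  have hZ0 : 0 ≤ Z := by rw [hZ]; have := ZC_nn (1/2); positivity
  have h7 := DirichletCharacter.norm_LSeries_product_ge_one χ h0 y
  rw [norm_mul, norm_mul, norm_pow, norm_pow, pt_two, ← DirichletCharacter.LFunction_eq_LSeries χ (by simp [h0])] at h7
  have hE : 1 ≤ (1+|y|)^2 := one_le_pow₀ (by have := abs_nonneg y; linarith)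
  have n1 : 1+‖(1:ℂ)+x‖ ≤ 3 := by rw [pt_zero]; simpa using pt_nr (y := 0) h0 h1
  have n2 : 1+‖(1:ℂ)+x+I*(2*y:ℝ)‖ ≤ 6*(1+|y|) := by
    refine (pt_nr h0 h1).trans ?_
    rw [abs_mul]; norm_num; have := abs_nonneg y; linarith
  have q1 : (1+‖(1:ℂ)+x‖)^2 ≤ 9 := by nlinarith [norm_nonneg ((1:ℂ)+x)]
  have q2 : (1+‖(1:ℂ)+x+I*(2*y:ℝ)‖)^2 ≤ 36*(1+|y|)^2 := by nlinarith [norm_nonneg ((1:ℂ)+x+I*(2*y:ℝ)), abs_nonneg y]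
  have hκ0 : x ≤ ‖(1:ℂ)+x-1‖ := by rw [pt_zero]; exact pt_ge.2
  have b1 := zeta_le (s := 1+x) (by simp [h0]) h0 hκ0
  have l1 := L0_spec (q := q) hη hη1 (s := 1+x) (by simp [h0])
  rw [← hZ] at b1
  rw [← hK] at l1
  have c1 : ‖LSeries (fun n => (1:DirichletCharacter ℂ q) n) (1+x)‖ ≤ 9*(Z+K)/x := by
    have d1 : Z*(1+‖(1:ℂ)+x‖)^2/x ≤ Z*9/x := by gcongr
    have d2 : K*(1+‖(1:ℂ)+x‖)^2 ≤ K*9/x := by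
      rw [le_div_iff₀ h0]
      calc _ ≤ K*9*1 := by gcongr
        _ = _ := by ring
    calc _ ≤ _ := l1
      _ ≤ Z*9/x + K*9/x := by linarith
      _ = _ := by ring
  have d3 : K*(1+‖(1:ℂ)+x+I*(2*y:ℝ)‖)^2 ≤ K*(36*(1+|y|)^2)/κ := by
    rw [le_div_iff₀ hκ]
    calc _ ≤ K*(36*(1+|y|)^2)*1 := by gcongr
        _ = _ := by ring
  have hsp : 0 ≤ Z*(36*(1+|y|)^2)/κ := by positivity
  have c2 : ‖LSeries (fun n => (χ^2:DirichletCharacter ℂ q) n) (1+x+I*(2*y:ℝ))‖ ≤ 36*(Z+K)*(1+|y|)^2/κ := by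
    have e : 36*(Z+K)*(1+|y|)^2/κ = Z*(36*(1+|y|)^2)/κ + K*(36*(1+|y|)^2)/κ := by ring
    rw [e]
    by_cases h2 : χ^2 = 1
    · rw [h2]
      have hκ2 : κ ≤ ‖(1:ℂ)+x+I*(2*y:ℝ)-1‖ := by
        rcases hor with h | h | h
        · exact absurd h2 h
        · refine h.trans (le_trans ?_ pt_ge.1); rw [abs_mul]; have := abs_nonneg y; norm_num; linarith
        · exact h.trans pt_ge.2
      have b2 := zeta_le (s := 1+x+I*(2*y:ℝ)) (by simp [h0]) hκ hκ2
      have l2 := L0_spec (q := q) hη hη1 (s := 1+x+I*(2*y:ℝ)) (by simp [h0])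
      rw [← hK] at l2
      rw [← hZ] at b2
      have d1 : Z*(1+‖(1:ℂ)+x+I*(2*y:ℝ)‖)^2/κ ≤ Z*(36*(1+|y|)^2)/κ := by gcongr
      linarith
    · have l2 := L_spec h2 hη hη1 (s := 1+x+I*(2*y:ℝ)) (by simp [HP]; linarith)
      rw [DirichletCharacter.LFunction_eq_LSeries _ (by simp [h0]), ← hK] at l2
      linarith
  have hW9 : 9*(Z+K) ≤ W := by
    refine le_trans ?_ hW
    rw [le_div_iff₀ hκ]
    calc 9*(Z+K)*κ ≤ 36*(Z+K)*1 := by gcongr; norm_num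
      _ ≤ _ := by gcongr
  refine (prod_low (A := W) (B := W) h7 (norm_nonneg _) (norm_nonneg _) h0 (c1.trans (by gcongr)) (c2.trans hW) (norm_nonneg _) le_rfl).trans (le_of_eq (by ring))
set_option maxHeartbeats 1000000 in
theorem L_low {ε : ℝ} (hε : 0 < ε) : ∃ C : ℝ, 1 ≤ C ∧ ∀ (q : ℕ) [NeZero q] (χ : DirichletCharacter ℂ q), χ.IsPrimitive → χ ≠ 1 →
    ∀ s : ℂ, 1 < s.re → s.re ≤ 2 → 1 ≤ C*(q:ℝ)^ε*(1+|s.im|)^14*‖χ.LFunction s‖ := by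
  obtain ⟨η, hη, hη1, hη2⟩ : ∃ η : ℝ, 0 < η ∧ η ≤ 1/2 ∧ 35*η ≤ ε := ⟨min (1/2) (ε/35), by positivity, min_le_left _ _, by linarith [min_le_right (1/2) (ε/35)]⟩
  obtain ⟨c', hc', hS⟩ := siegel hη
  obtain ⟨c, hc, hcc, hc1⟩ : ∃ c : ℝ, 0 < c ∧ c ≤ c' ∧ c ≤ 1 := ⟨min c' 1, by positivity, min_le_left _ _, min_le_right _ _⟩
  obtain ⟨Z, hZ⟩ : ∃ Z, Z = 1 + ZC (1/2) := ⟨_, rfl⟩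
  have hZ1 : 1 ≤ Z := by have := ZC_nn (1/2); linarith
  obtain ⟨D, hD⟩ : ∃ D, D = 36*2*128*Z*(2:ℝ)^(4*η)*(ZC η)^2/(c*η) := ⟨_, rfl⟩
  have hZη := one_le_ZC hη
  have hD1 : 1 ≤ D := by
    have g1 : 1 ≤ (2:ℝ)^(4*η) := Real.one_le_rpow (by norm_num) (by linarith)
    have g2 : 1 ≤ (ZC η)^2 := one_le_pow₀ hZη
    rw [hD, le_div_iff₀ (by positivity)]
    have g3 : 1 ≤ 36*2*128*Z*(2:ℝ)^(4*η)*(ZC η)^2 := one_le_mul_of_one_le_of_one_le (one_le_mul_of_one_le_of_one_le (by linarith) g1) g2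
    nlinarith
  refine ⟨16*D^7, by have : 1 ≤ D^7 := one_le_pow₀ hD1
                     linarith, fun q _ χ hp hn s h1 h2 => ?_⟩
  have hq : (1:ℝ) ≤ q := by exact_mod_cast Nat.one_le_iff_ne_zero.2 (NeZero.ne q)
  obtain ⟨K, hK⟩ : ∃ K, K = (2*q:ℝ)^(2*η)*ZC η := ⟨_, rfl⟩
  have hK1 : 1 ≤ K := by rw [hK]; exact one_le_mul_of_one_le_of_one_le (Real.one_le_rpow (by linarith) (by linarith)) hZη
  have hsp : ∀ s ∈ HP η, ‖χ.LFunction s‖ ≤ K*(1+‖s‖)^2 := fun s hs => hK ▸ L_spec hn hη hη1 hs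
  have hlip := fun s w => lip (s := s) (w := w) hη (by linarith) (by linarith) (χ.differentiable_LFunction hn).differentiableOn hsp
  set y := s.im
  obtain ⟨x, hx⟩ : ∃ x, x = s.re - 1 := ⟨_, rfl⟩
  have hs : s = 1+x+I*y := by apply Complex.ext <;> simp [hx, y]
  have hE : 1 ≤ 1+|y| := by have := abs_nonneg y; linarith
  have hE2 : 1 ≤ (1+|y|)^2 := one_le_pow₀ hE
  obtain ⟨τ, hτ⟩ : ∃ τ, τ = c*η/(128*K*(q:ℝ)^η) := ⟨_, rfl⟩
  have hqη : 1 ≤ (q:ℝ)^η := Real.one_le_rpow hq hη.le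
  have hτ0 : 0 < τ := by rw [hτ]; positivity
  have hτη : 128*τ ≤ η := by
    rw [hτ, mul_div_assoc', div_le_iff₀ (by positivity)]
    have : 1 ≤ K*(q:ℝ)^η := one_le_mul_of_one_le_of_one_le hK1 hqη
    nlinarith [mul_le_mul hc1 this zero_le_one zero_le_one]
  obtain ⟨W, hW⟩ : ∃ W, W = D*(q:ℝ)^(5*η)*(1+|y|)^2 := ⟨_, rfl⟩
  have hWK : W = 36*2*Z*K*(1+|y|)^2/τ := by
    have g1 : K^2 = (2:ℝ)^(4*η)*(q:ℝ)^(4*η)*(ZC η)^2 := by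
      rw [hK, mul_pow, ← Real.rpow_natCast, ← Real.rpow_mul (by positivity), Real.mul_rpow (by positivity) (by positivity)]; push_cast; ring_nf
    rw [hτ, hW, hD, show 5*η = 4*η+η by ring, Real.rpow_add (by positivity), div_div_eq_mul_div,
      show 36*2*Z*K*(1+|y|)^2*(128*K*(q:ℝ)^η) = 36*2*Z*(1+|y|)^2*128*(q:ℝ)^η*K^2 by ring, g1]
    ring
  have hWτ : 72*K*(1+|y|)^2 ≤ W*τ := by
    rw [hWK, div_mul_cancel₀ _ hτ0.ne']
    have : 0 ≤ K*(1+|y|)^2 := by positivity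
    nlinarith
  have hWη : 128*(72*K*(1+|y|)^2) ≤ W*η := by
    have : 0 ≤ W := by rw [hW]; positivity
    nlinarith
  have hKE : 1 ≤ K*(1+|y|)^2 := one_le_mul_of_one_le_of_one_le hK1 hE2
  have hW1 : 1 ≤ W := by rw [hW]; exact one_le_mul_of_one_le_of_one_le (one_le_mul_of_one_le_of_one_le hD1 (Real.one_le_rpow hq (by linarith))) hE2
  have h341 : 36*(Z+K)*(1+|y|)^2/τ ≤ W := by
    rw [hWK]; refine div_le_div_of_nonneg_right (mul_le_mul_of_nonneg_right ?_ (by positivity)) hτ0.le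
    nlinarith [mul_nonneg (by linarith : 0 ≤ Z-1) (by linarith : 0 ≤ K-1), mul_le_mul_of_nonneg_left hK1 (by linarith : 0 ≤ Z)]
  have := low (F := χ.LFunction) (y := y) (W := W) (τ := if χ^2 = 1 then τ else 0) hW1 (fun h => ?_) ?_ ?_ ?_ (x := x) (by linarith) (by linarith)
  · rw [← hs] at this
    refine this.trans ?_
    rw [hW, mul_pow, mul_pow, ← Real.rpow_natCast ((q:ℝ)^(5*η)), ← Real.rpow_mul (by positivity), ← mul_assoc, ← mul_assoc, ← pow_mul]
    gcongr 16*D^7*?_*_*_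
    refine Real.rpow_le_rpow_of_exponent_le hq ?_
    push_cast; linarith
  · have : χ^2 = 1 := by by_contra hh; simp [hh] at h
    rw [if_pos this]; linarith
  · intro x x' h0 h1 h0' h1' hxx
    have hp := pt_re x y
    have h6 := (hlip (1+x+I*y) (1+x'+I*y) (by linarith) (by linarith) (by
      rw [pt_sub]
      refine hxx.trans_le ?_
      rw [div_le_iff₀ (by linarith)]; linarith)).2
    rw [pt_sub, hp.2] at h6
    refine h6.trans (mul_le_mul_of_nonneg_right ?_ (abs_nonneg _))
    rw [div_le_iff₀ hη]; linarith
  · intro x h0 h1 hor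
    refine L_341 χ hη hη1 hZ hK hτ0 (by linarith) h341 h0 h1 ?_
    by_cases h2 : χ^2 = 1
    · rw [if_pos h2] at hor; exact Or.inr hor
    · exact Or.inl h2
  · intro x h0 h1 hx hy
    by_cases h2 : χ^2 = 1
    swap
    · rw [if_neg h2] at hx; linarith
    rw [if_pos h2] at hx hy
    have h6 := (hlip 1 (1+x+I*y) (by simp) (by simp) (lt_of_le_of_lt (pt_le h0) (by linarith))).2
    have h8 : ‖(1:ℂ)+x+I*y-1‖ ≤ 2*τ := (pt_le h0).trans (by linarith)
    have h9 := norm_sub_norm_le (χ.LFunction 1) (χ.LFunction 1 - χ.LFunction (1+x+I*y))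
    rw [sub_sub_cancel, norm_sub_rev] at h9
    have hcq : c*(q:ℝ)^(-η) ≤ ‖χ.LFunction 1‖ := (mul_le_mul_of_nonneg_right hcc (by positivity)).trans (hS q χ hp hn h2)
    have h10 : 32*K*(1+|(1:ℂ).im|)^2/η*‖(1:ℂ)+x+I*y-1‖ ≤ c*(q:ℝ)^(-η)/2 := by
      calc _ ≤ 32*K*(1+|(1:ℂ).im|)^2/η*(2*τ) := by gcongr
        _ = _ := by rw [hτ, Real.rpow_neg (by positivity)]; simp; field_simp; norm_num
    refine le_trans ?_ (by linarith : c*(q:ℝ)^(-η)/2 ≤ ‖χ.LFunction (1+x+I*y)‖)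
    rw [div_le_iff₀ (by linarith)]
    have h11 : c*(q:ℝ)^(-η)/2*η = 64*K*τ := by rw [hτ, Real.rpow_neg (by positivity)]; field_simp; norm_num
    have h12 : c*(q:ℝ)^(-η)/2 ≥ 64*K*τ := by rw [← h11]; exact mul_le_of_le_one_right (by positivity) (by linarith)
    nlinarith
end

section
open Complex MeasureTheory Filter Topology LSeries
open scoped ArithmeticFunction.vonMangoldt
lemma ball_HP {η r : ℝ} {s z : ℂ} (hs : 1 ≤ s.re) (hz : ‖z - s‖ < r) (hr : r ≤ η) : z ∈ HP η := by
  have h4 := (abs_lt.1 ((abs_re_le_norm _).trans_lt hz)).1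
  simp only [sub_re, HP, Set.mem_ofPred_eq] at *; linarith
lemma dbound {F : ℂ → ℂ} {η K : ℝ} (h0 : 0 < η) (h1 : η ≤ 1) (hK : 1 ≤ K) (hd : DifferentiableOn ℂ F (HP η))
    (hb : ∀ s ∈ HP η, ‖F s‖ ≤ K * (1 + ‖s‖)^2) {s z : ℂ} (hs : 1 ≤ s.re) (hs2 : s.re ≤ 2) (hz : ‖z - s‖ < η/2) :
    ‖deriv F z‖ ≤ 64*K*(1+|s.im|)^2/η := by
  have hsub : ∀ w ∈ Metric.closedBall z (η/4), ‖w - s‖ < η := fun w hw => by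
    rw [Metric.mem_closedBall, dist_eq] at hw
    calc ‖w - s‖ = ‖(w - z) + (z - s)‖ := by ring_nf
      _ ≤ _ := norm_add_le _ _
      _ < η := by linarith
  have := norm_deriv_le_of_forall_mem_sphere_norm_le (f := F) (c := z) (R := η/4) (C := 16*K*(1+|s.im|)^2) (by linarith)
    (hd.diffContOnCl_ball fun w hw => ball_HP hs (hsub w hw) le_rfl)
    (fun w hw => (lip h0 h1 (by linarith) hd hb hs hs2 (hsub w (Metric.sphere_subset_closedBall hw))).1)
  refine this.trans (le_of_eq (by field_simp; norm_num))
lemma ratio {F G : ℂ → ℂ} {η K w B : ℝ} (h0 : 0 < η) (h1 : η ≤ 1) (hK : 1 ≤ K) (hd : DifferentiableOn ℂ F (HP η))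
    (hb : ∀ s ∈ HP η, ‖F s‖ ≤ K * (1 + ‖s‖)^2) {s : ℂ} (hs : 1 ≤ s.re) (hs2 : s.re ≤ 2) (hw : 1 ≤ w) (hlow : 1 ≤ w*‖F s‖)
    (hG : DifferentiableOn ℂ G (HP η)) (hB : ∀ z, ‖z - s‖ < η/2 → ‖G z‖ ≤ B) (j : ℕ) :
    ‖iteratedDeriv j (fun z => G z / F z) s‖ ≤ j.factorial*(2*w*B)*(64*K*(1+|s.im|)^2*w/η)^j := by
  have hE : 1 ≤ (1+|s.im|)^2 := one_le_pow₀ (by have := abs_nonneg s.im; linarith)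
  obtain ⟨P, hP⟩ : ∃ P, P = K*(1+|s.im|)^2*w := ⟨_, rfl⟩
  have hP1 : 1 ≤ P := by rw [hP]; exact one_le_mul_of_one_le_of_one_le (one_le_mul_of_one_le_of_one_le hK hE) hw
  have hr0 : 0 < η/(64*P) := by positivity
  have hr : η/(64*P) < η/2 := by
    rw [div_lt_div_iff₀ (by positivity) (by norm_num)]; nlinarith
  have hB0 : 0 ≤ B := (norm_nonneg _).trans (hB s (by simpa using h0))
  have hF : ∀ z ∈ Metric.closedBall s (η/(64*P)), 1 ≤ 2*w*‖F z‖ := fun z hz => by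
    rw [Metric.mem_closedBall, dist_eq] at hz
    have e := (lip h0 h1 (by linarith) hd hb hs hs2 (w := z) (by linarith)).2
    have e2 := norm_sub_norm_le (F s) (F s - F z)
    rw [sub_sub_cancel, norm_sub_rev (F s)] at e2
    have e3 : w*(32*K*(1+|s.im|)^2/η*‖z - s‖) ≤ 1/2 := by
      calc _ ≤ w*(32*K*(1+|s.im|)^2/η*(η/(64*P))) := by gcongr
        _ = 1/2 := by rw [hP]; field_simp; norm_num
    nlinarith [mul_le_mul_of_nonneg_left e (by linarith : 0 ≤ w), mul_le_mul_of_nonneg_left e2 (by linarith : 0 ≤ w)]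
  have hF0 : ∀ z ∈ Metric.closedBall s (η/(64*P)), F z ≠ 0 := fun z hz h => by
    have := hF z hz; rw [h] at this; simp at this; linarith
  have hsub : Metric.closedBall s (η/(64*P)) ⊆ HP η := fun z hz => by
    rw [Metric.mem_closedBall, dist_eq] at hz
    exact ball_HP hs (hz.trans_lt hr) (by linarith)
  have := norm_iteratedDeriv_le_of_forall_mem_sphere_norm_le (f := fun z => G z / F z) (c := s) (R := η/(64*P)) (C := 2*w*B) j hr0
    (((hG.mono hsub).div (hd.mono hsub) hF0).diffContOnCl_ball subset_rfl) (fun z hz => by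
      have hz' := Metric.sphere_subset_closedBall hz
      have e := hF z hz'
      rw [Metric.mem_closedBall, dist_eq] at hz'
      have hFp : 0 < ‖F z‖ := by by_contra h; nlinarith [norm_nonneg (F z)]
      rw [norm_div, div_le_iff₀ hFp]
      have := hB z (by linarith)
      nlinarith)
  refine this.trans (le_of_eq ?_)
  rw [hP, div_eq_mul_inv _ ((η/(64*(K*(1+|s.im|)^2*w)))^j), ← inv_pow, inv_div]; ring
lemma mratio {φ : ℝ → ℂ} (hφ : ContDiff ℝ (⊤ : ℕ∞) φ) (hc : HasCompactSupport φ) (k M₁ : ℕ) : ∃ C : ℝ, 0 ≤ C ∧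
    ∀ (F G : ℂ → ℂ) (a : ℕ → ℂ) (η K w B : ℝ), 0 < η → η ≤ 1 → 1 ≤ K → 1 ≤ w → 0 ≤ B → DifferentiableOn ℂ F (HP η) →
    (∀ s ∈ HP η, ‖F s‖ ≤ K * (1 + ‖s‖)^2) → DifferentiableOn ℂ G (HP η) →
    (∀ s z : ℂ, 1 < s.re → s.re ≤ 2 → ‖z - s‖ < η/2 → ‖G z‖ ≤ B*(1+|s.im|)^M₁) →
    (∀ s : ℂ, 1 < s.re → s.re ≤ 2 → 1 ≤ w*(1+|s.im|)^14*‖F s‖) → (∀ s : ℂ, 1 < s.re → LSeriesSummable a s) →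
    (∀ s : ℂ, 1 < s.re → LSeries a s = G s / F s) →
    ∀ T : ℝ, ‖∑' n : ℕ, a n / n * φ (Real.log n - T)‖ * |T|^k ≤ C*(w*B)*(K*w/η)^k := by
  obtain ⟨C, hC, H⟩ := machine hφ hc k (14+M₁+16*k)
  refine ⟨C*(k.factorial*2*64^k), by positivity, fun F G a η K w B h0 h1 hK hw hB hd hb hG hGB hlow hsum hL T => ?_⟩
  have h2 : 1 ≤ K*w/η := by rw [le_div_iff₀ h0]; nlinarith
  refine (H a (k.factorial*2*64^k*(w*B)*(K*w/η)^k) (by positivity) ?_ ?_ T).trans (le_of_eq (by ring))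
  · refine abscissaOfAbsConv_le_of_forall_lt_LSeriesSummable fun y hy => hsum _ (by simpa using hy)
  · intro j hj s hs hs2
    have hE : 1 ≤ 1+|s.im| := by have := abs_nonneg s.im; linarith
    have e : LSeries a =ᶠ[𝓝 s] fun z => G z / F z := by
      filter_upwards [(isOpen_lt continuous_const continuous_re).mem_nhds hs] with z hz using hL z hz
    rw [e.iteratedDeriv_eq]
    refine (ratio h0 h1 hK hd hb hs.le hs2 (one_le_mul_of_one_le_of_one_le hw (one_le_pow₀ hE)) (hlow s hs hs2) hG (fun z hz => hGB s z hs hs2 hz) j).trans ?_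
    have e1 : 64*K*(1+|s.im|)^2*(w*(1+|s.im|)^14)/η = 64*(K*w/η)*(1+|s.im|)^16 := by ring
    have e2 : (64*(K*w/η)*(1+|s.im|)^16)^j ≤ (64*(K*w/η)*(1+|s.im|)^16)^k :=
      pow_le_pow_right₀ (one_le_mul_of_one_le_of_one_le (by linarith) (one_le_pow₀ hE)) hj
    rw [e1]
    calc _ ≤ k.factorial*(2*(w*(1+|s.im|)^14)*(B*(1+|s.im|)^M₁))*(64*(K*w/η)*(1+|s.im|)^16)^k := by
          gcongr
      _ = _ := by rw [mul_pow, mul_pow, ← pow_mul, pow_add, pow_add]; ring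
theorem prime_chi {φ : ℝ → ℂ} (hφ : ContDiff ℝ (⊤ : ℕ∞) φ) (hc : HasCompactSupport φ) (k : ℕ) {ε : ℝ} (hε : 0 < ε) : ∃ C : ℝ, 0 ≤ C ∧
    ∀ (q : ℕ) [NeZero q] (χ : DirichletCharacter ℂ q), χ.IsPrimitive → χ ≠ 1 →
    ∀ T : ℝ, ‖∑' n : ℕ, χ n * Λ n / n * φ (Real.log n - T)‖ * |T|^k ≤ C*(q:ℝ)^ε := by
  obtain ⟨C, hC, H⟩ := mratio hφ hc k 2
  obtain ⟨η, hη, hη1, hη2⟩ : ∃ η : ℝ, 0 < η ∧ η ≤ 1/2 ∧ 5*(k+1)*η ≤ ε := ⟨min (1/2) (ε/(5*(k+1))), by positivity, min_le_left _ _, by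
    have := min_le_right (1/2) (ε/(5*(k+1))); rwa [le_div_iff₀' (by positivity)] at this⟩
  obtain ⟨D, hD, HD⟩ := L_low hη
  obtain ⟨A, hA⟩ : ∃ A, A = (2:ℝ)^(2*η)*ZC η := ⟨_, rfl⟩
  have hA1 : 1 ≤ A := by rw [hA]; exact one_le_mul_of_one_le_of_one_le (Real.one_le_rpow (by norm_num) (by linarith)) (one_le_ZC hη)
  refine ⟨C*(D*(64*A/η))*(A*D/η)^k, by positivity, fun q _ χ hp hn T => ?_⟩
  have hq : (1:ℝ) ≤ q := by exact_mod_cast Nat.one_le_iff_ne_zero.2 (NeZero.ne q)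
  have hK : (2*q:ℝ)^(2*η)*ZC η = A*(q:ℝ)^(2*η) := by rw [hA, Real.mul_rpow (by positivity) (by positivity)]; ring
  have hd := χ.differentiable_LFunction hn
  have hK1 : 1 ≤ A*(q:ℝ)^(2*η) := one_le_mul_of_one_le_of_one_le hA1 (Real.one_le_rpow hq (by linarith))
  have hb : ∀ s ∈ HP η, ‖χ.LFunction s‖ ≤ A*(q:ℝ)^(2*η)*(1+‖s‖)^2 := fun s hs => hK ▸ L_spec hn hη hη1 hs
  have := H χ.LFunction (fun s => -deriv χ.LFunction s) (fun n => χ n * Λ n) η (A*(q:ℝ)^(2*η)) (D*(q:ℝ)^η) (64*(A*(q:ℝ)^(2*η))/η) hη (by linarith)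
    hK1 (one_le_mul_of_one_le_of_one_le hD (Real.one_le_rpow hq hη.le)) (by positivity) hd.differentiableOn hb
    (hd.differentiableOn.deriv (HP_open η)).neg
    (fun s z hs hs2 hz => by
      rw [norm_neg]
      exact (dbound hη (by linarith) hK1 hd.differentiableOn hb hs.le hs2 hz).trans (le_of_eq (by ring)))
    (fun s hs hs2 => HD q χ hp hn s hs hs2)
    (fun s hs => DirichletCharacter.LSeriesSummable_twist_vonMangoldt χ hs)
    (fun s hs => by
      have := DirichletCharacter.LSeries_twist_vonMangoldt_eq χ hs
      rw [← DirichletCharacter.deriv_LFunction_eq_deriv_LSeries χ hs, ← DirichletCharacter.LFunction_eq_LSeries χ hs] at this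
      exact this) T
  refine this.trans ?_
  have e : C*(D*(q:ℝ)^η*(64*(A*(q:ℝ)^(2*η))/η))*(A*(q:ℝ)^(2*η)*(D*(q:ℝ)^η)/η)^k = C*(D*(64*A/η))*(A*D/η)^k*((q:ℝ)^(2*η)*(q:ℝ)^η)^(k+1) := by
    rw [show A*(q:ℝ)^(2*η)*(D*(q:ℝ)^η)/η = A*D/η*((q:ℝ)^(2*η)*(q:ℝ)^η) by ring, mul_pow]; ring
  rw [e]
  refine mul_le_mul_of_nonneg_left ?_ (by positivity)
  rw [← Real.rpow_add (by positivity), ← Real.rpow_natCast, ← Real.rpow_mul (by positivity)]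
  refine Real.rpow_le_rpow_of_exponent_le hq ?_
  push_cast; nlinarith
lemma lam_L {s : ℂ} (hs : 1 < s.re) : LSeriesSummable (fun n => (ArithmeticFunction.liouville n : ℂ)) s ∧
    LSeries (fun n => (ArithmeticFunction.liouville n : ℂ)) s = (s-1)*riemannZeta (2*s) / ZS s := by
  have hno : ∀ n : ℕ, ‖(ArithmeticFunction.liouville n : ℂ)‖ ≤ 1 := fun n => by
    by_cases h : n = 0
    · simp [h]
    · rw [ArithmeticFunction.liouville_apply h]; simp
  have hsm := LSeriesSummable_of_bounded_of_one_lt_re (f := fun n => (ArithmeticFunction.liouville n : ℂ)) (m := 1) (fun n _ => hno n) hs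
  refine ⟨hsm, ?_⟩
  have hs0 : s ≠ 0 := fun h => by simp [h] at hs; linarith
  set f : ℕ →*₀ ℂ := { toFun := fun n => ArithmeticFunction.liouville n * (n:ℂ)^(-s), map_zero' := by simp, map_one' := by simp [ArithmeticFunction.liouville_apply_one], map_mul' := fun m n => by
                        rw [ArithmeticFunction.liouville_apply_mul, Nat.cast_mul, natCast_mul_natCast_cpow]; push_cast; ring } with hf
  have hfe : ∀ n, f n = LSeries.term (fun n => (ArithmeticFunction.liouville n : ℂ)) s n := fun n => by
    rw [LSeries.term_def]
    by_cases h : n = 0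
    · simp [h]
    · rw [if_neg h, div_eq_mul_inv, ← cpow_neg]; rfl
  have h1 := EulerProduct.eulerProduct_completely_multiplicative_hasProd (f := f) (by
    have : Summable (fun n => ‖LSeries.term (fun n => (ArithmeticFunction.liouville n : ℂ)) s n‖) := hsm.norm
    exact this.congr fun n => by rw [hfe])
  have e1 : ∑' n, f n = LSeries (fun n => (ArithmeticFunction.liouville n : ℂ)) s := tsum_congr hfe
  rw [e1] at h1
  have h2 := h1.mul (riemannZeta_eulerProduct_hasProd hs)
  have h3 := riemannZeta_eulerProduct_hasProd (s := 2*s) (by simp; linarith)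
  have h4 : (fun p : Nat.Primes => (1 - f p)⁻¹ * (1 - (p:ℂ)^(-s))⁻¹) = fun p : Nat.Primes => (1 - (p:ℂ)^(-(2*s)))⁻¹ := by
    ext p
    have : f p = -(p:ℂ)^(-s) := by
      show (ArithmeticFunction.liouville (p:ℕ) : ℂ) * _ = _
      rw [ArithmeticFunction.liouville_apply p.2.ne_zero, ArithmeticFunction.cardFactors_apply_prime p.2]; simp
    rw [this, ← mul_inv, show -(2*s) = -s + -s by ring, cpow_add _ _ (by exact_mod_cast p.2.ne_zero)]
    ring_nf
  rw [h4] at h2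
  have h5 := h2.unique h3
  have hz := riemannZeta_ne_zero_of_one_le_re hs.le
  have hs1 : s - 1 ≠ 0 := fun h => by rw [sub_eq_zero.1 h] at hs; simp at hs
  rw [← h5, ZS_eq hs]; field_simp
theorem liou {φ : ℝ → ℂ} (hφ : ContDiff ℝ (⊤ : ℕ∞) φ) (hc : HasCompactSupport φ) (k : ℕ) : ∃ C : ℝ, 0 ≤ C ∧
    ∀ T : ℝ, ‖∑' n : ℕ, (ArithmeticFunction.liouville n : ℂ) / n * φ (Real.log n - T)‖ * |T|^k ≤ C := by
  obtain ⟨C, hC, H⟩ := mratio hφ hc k 3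
  obtain ⟨D, hD, HD⟩ := zeta_low
  obtain ⟨Z, hZ⟩ : ∃ Z, Z = 1 + ZC (1/2) := ⟨_, rfl⟩
  have hZ1 : 1 ≤ Z := by have := ZC_nn (1/2); linarith
  have hsub : HP (1/4) ⊆ HP (1/2) := fun s hs => by simp only [HP, Set.mem_ofPred_eq] at *; linarith
  refine ⟨_, ?_, fun T => H ZS (fun s => (s-1)*riemannZeta (2*s)) _ (1/4) Z D (2*Z*64*4) (by norm_num) (by norm_num) hZ1 hD (by positivity)
    (ZS_spec.1.mono hsub) (fun s hs => hZ ▸ ZS_spec.2 s (hsub hs)) ?_ ?_ HD (fun s hs => (lam_L hs).1) (fun s hs => (lam_L hs).2) T⟩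
  · positivity
  · intro s hs
    have : 2*s ≠ 1 := fun h => by
      have := congrArg re h
      simp [HP] at this hs; linarith
    exact ((differentiableAt_id.sub_const 1).mul ((differentiableAt_riemannZeta this).comp s (differentiableAt_id.const_mul 2))).differentiableWithinAt
  · intro s z hs hs2 hz
    have h1 := (abs_lt.1 ((abs_re_le_norm _).trans_lt hz)).1
    have hE := abs_nonneg s.im
    have h2 : ‖z‖ ≤ 3 + |s.im| := by
      have := norm_add_le (z - s) s; have h3 := nrm_s (by linarith) hs2; simp at this; linarith
    have h3 : 1/2 ≤ ‖2*z-1‖ := by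
      refine le_trans ?_ ((le_abs_self _).trans (abs_re_le_norm _)); simp at *; linarith
    have h4 := zeta_le (s := 2*z) (by simp at *; linarith) (by norm_num) h3
    rw [← hZ, norm_mul] at h4
    have h5 : ‖z - 1‖ ≤ 4*(1+|s.im|) := (norm_sub_le _ _).trans (by simp; linarith)
    have h6 : ‖riemannZeta (2*z)‖ ≤ 2*Z*64*(1+|s.im|)^2 := by
      refine h4.trans ?_
      rw [div_div_eq_mul_div, div_one]
      calc _ ≤ Z*(8*(1+|s.im|))^2*2 := by gcongr; simp; linarith
        _ = _ := by ring
    rw [norm_mul]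
    calc _ ≤ (4*(1+|s.im|))*(2*Z*64*(1+|s.im|)^2) := by gcongr
      _ = _ := by ring
theorem lam_one {φ : ℝ → ℂ} (hφ : ContDiff ℝ (⊤ : ℕ∞) φ) (hc : HasCompactSupport φ) (k : ℕ) : ∃ C : ℝ, 0 ≤ C ∧
    ∀ T : ℝ, ‖∑' n : ℕ, ((Λ n : ℂ) - 1) / n * φ (Real.log n - T)‖ * |T|^k ≤ C := by
  obtain ⟨C, hC, H⟩ := mratio hφ hc k 4
  obtain ⟨D, hD, HD⟩ := zeta_low
  obtain ⟨Z, hZ⟩ : ∃ Z, Z = 1 + ZC (1/2) := ⟨_, rfl⟩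
  have hZ1 : 1 ≤ Z := by have := ZC_nn (1/2); linarith
  have hb : ∀ s ∈ HP (1/2), ‖ZS s‖ ≤ Z*(1+‖s‖)^2 := hZ ▸ ZS_spec.2
  have h11 : (1:ℂ) ∈ HP (1/2) := by simp [HP]
  have hds : DifferentiableOn ℂ (dslope ZS 1) (HP (1/2)) := (differentiableOn_dslope ((HP_open _).mem_nhds h11)).2 ZS_spec.1
  have e1 : ZS 1 = 1 := by simp [ZS]
  refine ⟨_, ?_, fun T => H ZS (fun s => -deriv ZS s - dslope ZS 1 s * ZS s) _ (1/2) Z D (3000*Z^2) (by norm_num) (by norm_num) hZ1 hD (by positivity)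
    ZS_spec.1 hb ((ZS_spec.1.deriv (HP_open _)).neg.sub (hds.mul ZS_spec.1)) ?_ HD ?_ ?_ T⟩
  · positivity
  · intro s z hs hs2 hz
    have hE : 1 ≤ 1+|s.im| := by have := abs_nonneg s.im; linarith
    have d1 := dbound (by norm_num) (by norm_num) hZ1 ZS_spec.1 hb hs.le hs2 hz
    have d2 := (lip (w := z) (by norm_num) (by norm_num) (by linarith) ZS_spec.1 hb hs.le hs2 (by linarith)).1
    have d3 : ‖dslope ZS 1 z‖ ≤ 128*Z*(1+|s.im|)^2 := by
      have hE2 : 1 ≤ (1+|s.im|)^2 := one_le_pow₀ hE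
      by_cases h : ‖z - 1‖ < 1/2
      · by_cases hz1 : z = 1
        · rw [hz1, dslope_same]
          rw [hz1] at d1; exact d1.trans (le_of_eq (by ring))
        · rw [dslope_of_ne _ hz1, slope_def_field, norm_div, div_le_iff₀ (norm_pos_iff.2 (sub_ne_zero.2 hz1))]
          have := (lip (s := 1) (w := z) (by norm_num) (by norm_num) (by linarith) ZS_spec.1 hb (by simp) (by simp) h).2
          refine this.trans (mul_le_mul_of_nonneg_right ?_ (norm_nonneg _))
          simp; nlinarith
      · push Not at h
        have hz1 : z ≠ 1 := fun hh => by rw [hh] at h; norm_num at h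
        rw [dslope_of_ne _ hz1, slope_def_field, norm_div, div_le_iff₀ (norm_pos_iff.2 (sub_ne_zero.2 hz1)), e1]
        have := (norm_sub_le (ZS z) 1)
        rw [norm_one] at this
        have : 0 ≤ Z*(1+|s.im|)^2 := by positivity
        nlinarith
    have d6 : 64*Z*(1+|s.im|)^2/(1/2) = 128*Z*(1+|s.im|)^2 := by ring
    have d7 : Z*(1+|s.im|)^2 ≤ Z^2*(1+|s.im|)^4 := by gcongr <;> norm_num <;> nlinarith
    calc _ ≤ ‖-deriv ZS z‖ + ‖dslope ZS 1 z‖*‖ZS z‖ := (norm_sub_le _ _).trans (by rw [norm_mul])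
      _ ≤ 128*Z*(1+|s.im|)^2 + 128*Z*(1+|s.im|)^2*(16*Z*(1+|s.im|)^2) := by rw [norm_neg]; gcongr; linarith
      _ ≤ _ := by nlinarith
  · intro s hs
    exact (ArithmeticFunction.LSeriesSummable_vonMangoldt hs).sub (LSeriesSummable_one_iff.2 hs)
  · intro s hs
    have hs1 : s - 1 ≠ 0 := fun h => by rw [sub_eq_zero.1 h] at hs; simp at hs
    have hz := riemannZeta_ne_zero_of_one_le_re hs.le
    have := LSeries_sub (ArithmeticFunction.LSeriesSummable_vonMangoldt hs) (LSeriesSummable_one_iff.2 hs)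
    rw [ArithmeticFunction.LSeries_vonMangoldt_eq_deriv_riemannZeta_div hs, LSeries_one_eq_riemannZeta hs] at this
    have e2 : deriv ZS s = riemannZeta s + (s-1)*deriv riemannZeta s := by
      have e : ZS =ᶠ[𝓝 s] fun z => (z-1)*riemannZeta z := by
        filter_upwards [(isOpen_lt continuous_const continuous_re).mem_nhds hs] with z hz using ZS_eq hz
      rw [e.deriv_eq, deriv_fun_mul (by fun_prop) (differentiableAt_riemannZeta (sub_ne_zero.1 hs1))]
      simp
    refine this.trans ?_
    rw [dslope_of_ne _ (sub_ne_zero.1 hs1), slope_def_field, e1, e2, ZS_eq hs]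
    field_simp; ring
end

section
open Complex MeasureTheory Filter Topology
lemma gall {f f' g : ℝ → ℝ} (hf : ∀ x, HasDerivAt f (f' x) x) (hf' : Continuous f') (hg : Continuous g)
    (hb : ∀ x, |f' x| ≤ g x) (x₀ δ : ℝ) (hδ : 0 < δ) :
    f x₀ * δ ≤ ∫ x in Set.Ioc (x₀-δ/2) (x₀+δ/2), (f x + δ * g x) := by
  have hfc : Continuous f := continuous_iff_continuousAt.2 fun x => (hf x).continuousAt
  have hle : x₀-δ/2 ≤ x₀+δ/2 := by linarith
  rw [← intervalIntegral.integral_of_le hle, intervalIntegral.integral_add (hfc.intervalIntegrable _ _)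
    ((hg.const_mul δ).intervalIntegrable _ _), intervalIntegral.integral_const_mul]
  have h1 : ∫ x in (x₀-δ/2)..(x₀+δ/2), (f x₀ - ∫ x in (x₀-δ/2)..(x₀+δ/2), g x) ≤ ∫ x in (x₀-δ/2)..(x₀+δ/2), f x := by
    refine intervalIntegral.integral_mono_on hle (by simp) (hfc.intervalIntegrable _ _) fun x hx => ?_
    have h2 : ∫ t in x..x₀, f' t = f x₀ - f x :=
      intervalIntegral.integral_eq_sub_of_hasDerivAt (fun t _ => hf t) (hf'.intervalIntegrable _ _)
    have h3 : ‖∫ t in x..x₀, f' t‖ ≤ |∫ t in x..x₀, g t| :=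
      intervalIntegral.norm_integral_le_abs_of_norm_le (by filter_upwards with t; exact hb t) (hg.intervalIntegrable _ _)
    have h4 : |∫ t in x..x₀, g t| ≤ |∫ t in (x₀-δ/2)..(x₀+δ/2), g t| := by
      refine intervalIntegral.abs_integral_mono_interval ?_ ?_ (hg.intervalIntegrable _ _)
      · rw [Set.uIoc_of_le hle]
        intro t ht
        rw [Set.mem_uIoc] at ht
        constructor <;> rcases ht with h | h <;> linarith [hx.1, hx.2, h.1, h.2]
      · filter_upwards with t; exact (abs_nonneg _).trans (hb t)
    rw [abs_of_nonneg (intervalIntegral.integral_nonneg hle fun t _ => (abs_nonneg _).trans (hb t))] at h4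
    rw [h2, Real.norm_eq_abs] at h3
    linarith [le_abs_self (f x₀ - f x)]
  rw [intervalIntegral.integral_const, smul_eq_mul] at h1
  linarith
noncomputable def ES (a : ℕ → ℂ) (N : ℕ) (x : ℝ) : ℂ := ∑ n ∈ Finset.range N, a n * cexp (n * x * (2*Real.pi*I))
lemma ES_cont (a : ℕ → ℂ) (N : ℕ) : Continuous (ES a N) := by unfold ES; fun_prop
lemma ES_deriv (a : ℕ → ℂ) (N : ℕ) (x : ℝ) : HasDerivAt (ES a N) (ES (fun n => a n * (n * (2*Real.pi*I))) N x) x := by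
  unfold ES
  refine HasDerivAt.fun_sum fun n _ => ?_
  have h1 : HasDerivAt (fun y : ℂ => a n * cexp (n * y * (2*Real.pi*I))) (a n * (cexp (n * x * (2*Real.pi*I)) * (n * 1 * (2*Real.pi*I)))) x :=
    ((((hasDerivAt_id (x:ℂ)).const_mul _).mul_const _).cexp).const_mul _
  refine h1.comp_ofReal.congr_deriv ?_
  ring
lemma ES_pars (a : ℕ → ℂ) (N : ℕ) : ∫ x in (-1:ℝ)..2, ‖ES a N x‖^2 = 3 * ∑ n ∈ Finset.range N, ‖a n‖^2 := by
  have h0 : ∀ x : ℝ, ((‖ES a N x‖^2 : ℝ):ℂ) = ∑ n ∈ Finset.range N, ∑ m ∈ Finset.range N,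
      a n * (starRingEnd ℂ) (a m) * cexp ((((n:ℂ)-m) * (2*Real.pi*I)) * x) := by
    intro x
    rw [ofReal_pow, ← Complex.mul_conj', ES, map_sum, Finset.sum_mul_sum]
    refine Finset.sum_congr rfl fun n _ => Finset.sum_congr rfl fun m _ => ?_
    rw [map_mul, ← Complex.exp_conj, mul_mul_mul_comm, ← Complex.exp_add]
    congr 2
    simp only [map_mul, conj_ofReal, conj_I, map_natCast, map_ofNat]; ring
  apply ofReal_injective
  rw [← intervalIntegral.integral_ofReal, intervalIntegral.integral_congr (fun x _ => h0 x),
    intervalIntegral.integral_finsetSum (fun n _ => Continuous.intervalIntegrable (by fun_prop) _ _)]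
  push_cast
  rw [Finset.mul_sum]
  refine Finset.sum_congr rfl fun n hn => ?_
  rw [intervalIntegral.integral_finsetSum (fun n _ => Continuous.intervalIntegrable (by fun_prop) _ _),
    Finset.sum_eq_single_of_mem n hn]
  · rw [intervalIntegral.integral_const_mul, Complex.mul_conj']; simp; ring
  · intro m _ hm
    have hk : ((n:ℂ)-m) * (2*Real.pi*I) ≠ 0 :=
      mul_ne_zero (sub_ne_zero.2 (by exact_mod_cast hm.symm)) (by simp [Real.pi_ne_zero])
    have h3 : cexp ((((n:ℂ)-m) * (2*Real.pi*I)) * (2:ℝ)) = cexp ((((n:ℂ)-m) * (2*Real.pi*I)) * (-1:ℝ)) := by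
      rw [Complex.exp_eq_exp_iff_exists_int]
      exact ⟨3*(n-m), by push_cast; ring⟩
    rw [intervalIntegral.integral_const_mul, integral_exp_mul_complex hk, h3]; simp
lemma LS_pts {ι : Type*} (s : Finset ι) (x : ι → ℝ) (a : ℕ → ℂ) (N : ℕ) (K : ℝ) (hK : 1 ≤ K) (hN : N ≤ K)
    (h0 : ∀ i ∈ s, 0 ≤ x i ∧ x i ≤ 1) (hx : ∀ i ∈ s, ∀ j ∈ s, i ≠ j → 1 ≤ K * |x i - x j|) :
    ∑ i ∈ s, ‖ES a N (x i)‖^2 ≤ 200 * K * ∑ n ∈ Finset.range N, ‖a n‖^2 := by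
  have hK0 : 0 < K := by linarith
  obtain ⟨b, hb⟩ : ∃ b : ℕ → ℂ, b = fun n => a n * (n * (2*Real.pi*I)) := ⟨_, rfl⟩
  obtain ⟨g, hg⟩ : ∃ g : ℝ → ℝ, g = fun x => K * ‖ES a N x‖^2 + K⁻¹ * ‖ES b N x‖^2 := ⟨_, rfl⟩
  have ca := ES_cont a N
  have cb := ES_cont b N
  have hgc : Continuous g := by rw [hg]; fun_prop
  obtain ⟨F, hF⟩ : ∃ F : ℝ → ℝ, F = fun x => ‖ES a N x‖^2 + K⁻¹ * g x := ⟨_, rfl⟩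
  have hFc : Continuous F := by rw [hF]; fun_prop
  have hF0 : ∀ x, 0 ≤ F x := fun x => by simp only [hF, hg]; positivity
  have h1 : ∀ i ∈ s, ‖ES a N (x i)‖^2 * K⁻¹ ≤ ∫ t in Set.Ioc (x i - K⁻¹/2) (x i + K⁻¹/2), F t := by
    intro i _
    rw [hF]
    refine gall (f := fun x => ‖ES a N x‖^2) (f' := fun x => 2 * inner ℝ (ES a N x) (ES b N x)) (fun x => ?_) (by fun_prop) hgc (fun x => ?_) (x i) K⁻¹ (by positivity)
    · rw [hb]; exact (ES_deriv a N x).norm_sq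
    · have := abs_real_inner_le_norm (ES a N x) (ES b N x)
      rw [abs_mul, abs_two, hg]
      have h2 : 0 ≤ K⁻¹ * (K * ‖ES a N x‖ - ‖ES b N x‖)^2 := by positivity
      have h3 : K⁻¹ * (K * ‖ES a N x‖ - ‖ES b N x‖)^2 = K * ‖ES a N x‖^2 + K⁻¹ * ‖ES b N x‖^2 - 2 * (‖ES a N x‖ * ‖ES b N x‖) := by
        field_simp; ring
      simp only; linarith
  have hK1 : K⁻¹ ≤ 1 := inv_le_one_of_one_le₀ hK
  have h2 : ∑ i ∈ s, ∫ t in Set.Ioc (x i - K⁻¹/2) (x i + K⁻¹/2), F t ≤ ∫ t in (-1:ℝ)..2, F t := by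
    rw [← integral_biUnion_finset s (fun _ _ => measurableSet_Ioc) ?_ (fun i _ => (hFc.integrableOn_Ioc)),
      intervalIntegral.integral_of_le (by norm_num)]
    · refine setIntegral_mono_set hFc.integrableOn_Ioc (by filter_upwards with t; exact hF0 t) (HasSubset.Subset.eventuallyLE ?_)
      refine Set.iUnion₂_subset fun i hi => Set.Ioc_subset_Ioc ?_ ?_ <;> linarith [(h0 i hi).1, (h0 i hi).2]
    · intro i hi j hj hij
      refine Set.disjoint_left.2 fun t ht ht' => ?_
      have := hx i hi j hj hij
      have h5 : |x i - x j| < K⁻¹ := by rw [abs_lt]; constructor <;> linarith [ht.1, ht.2, ht'.1, ht'.2]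
      have := (mul_lt_mul_iff_right₀ hK0).2 h5
      rw [mul_inv_cancel₀ hK0.ne'] at this; linarith
  have h3 : ∫ t in (-1:ℝ)..2, F t = 2 * (3 * ∑ n ∈ Finset.range N, ‖a n‖^2) + K⁻¹ * K⁻¹ * (3 * ∑ n ∈ Finset.range N, ‖b n‖^2) := by
    rw [← ES_pars, ← ES_pars, ← intervalIntegral.integral_const_mul, ← intervalIntegral.integral_const_mul,
      ← intervalIntegral.integral_add (Continuous.intervalIntegrable (by fun_prop) _ _) (Continuous.intervalIntegrable (by fun_prop) _ _)]
    refine intervalIntegral.integral_congr fun t _ => ?_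
    simp only [hF, hg]; field_simp; ring
  have h4 : ∑ n ∈ Finset.range N, ‖b n‖^2 ≤ 40 * K^2 * ∑ n ∈ Finset.range N, ‖a n‖^2 := by
    rw [Finset.mul_sum]
    refine Finset.sum_le_sum fun n hn => ?_
    have hnK : (n:ℝ) ≤ K := le_trans (by exact_mod_cast (Finset.mem_range.1 hn).le) hN
    have h6 : (n:ℝ)^2 ≤ K^2 := by gcongr
    have h7 : Real.pi^2 ≤ 10 := by nlinarith [Real.pi_lt_d2, Real.pi_pos]
    have : ‖b n‖^2 = 4 * (n^2 * Real.pi^2) * ‖a n‖^2 := by simp [hb, abs_of_pos Real.pi_pos]; ring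
    rw [this]
    refine mul_le_mul_of_nonneg_right ?_ (by positivity)
    have := mul_le_mul h6 h7 (by positivity) (by positivity); linarith
  have h5 := (Finset.sum_le_sum h1).trans (h2.trans_eq h3)
  rw [← Finset.sum_mul] at h5
  have h6 : K⁻¹ * K⁻¹ * (3 * ∑ n ∈ Finset.range N, ‖b n‖^2) ≤ K⁻¹ * K⁻¹ * (3 * (40 * K^2 * ∑ n ∈ Finset.range N, ‖a n‖^2)) := by gcongr
  have h7 : K⁻¹ * K⁻¹ * (3 * (40 * K^2 * ∑ n ∈ Finset.range N, ‖a n‖^2)) = 120 * ∑ n ∈ Finset.range N, ‖a n‖^2 := by field_simp; ring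
  have hs : 0 ≤ ∑ n ∈ Finset.range N, ‖a n‖^2 := Finset.sum_nonneg fun _ _ => by positivity
  have h8 : (∑ i ∈ s, ‖ES a N (x i)‖^2) * K⁻¹ ≤ 200 * ∑ n ∈ Finset.range N, ‖a n‖^2 := by linarith
  rw [mul_inv_le_iff₀ hK0] at h8; linarith
lemma tau_sq {r : ℕ} [NeZero r] (χ : DirichletCharacter ℂ r) (hχ : χ.IsPrimitive) :
    ‖gaussSum χ (ZMod.stdAddChar (N := r))‖^2 = r := by
  apply ofReal_injective
  rw [ofReal_pow, ← Complex.mul_conj', starRingEnd_apply]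
  have h1 : gaussSum χ (ZMod.stdAddChar (N := r)) * star (gaussSum χ (ZMod.stdAddChar (N := r))) =
      ∑ y : ZMod r, ∑ x : ZMod r, χ x * (ZMod.stdAddChar (y * (x - 1)) : ℂ) := by
    rw [star_gaussSum_eq, gaussSum, gaussSum, Finset.mul_sum]
    refine Finset.sum_congr rfl fun y _ => ?_
    have := gaussSum_mulShift_of_isPrimitive (ZMod.stdAddChar (N := r)) hχ y
    rw [← mul_assoc, mul_comm _ (χ⁻¹ y)]
    change χ⁻¹ y * gaussSum χ _ * _ = _
    rw [← this, gaussSum, Finset.sum_mul]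
    refine Finset.sum_congr rfl fun x _ => ?_
    rw [AddChar.mulShift_apply, mul_assoc, AddChar.inv_apply, ← AddChar.map_add_eq_mul]
    congr 2; ring
  rw [h1, Finset.sum_comm]
  simp_rw [← Finset.mul_sum, AddChar.sum_mulShift _ (ZMod.isPrimitive_stdAddChar r)]
  simp [sub_eq_zero]
lemma chi_pars {r : ℕ} [NeZero r] (f : ZMod r → ℂ) :
    ∑ χ : DirichletCharacter ℂ r, ‖∑ x, χ x * f x‖^2 = r.totient * ∑ x with IsUnit x, ‖f x‖^2 := by
  apply ofReal_injective
  push_cast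
  have h0 : ∀ χ : DirichletCharacter ℂ r, ((‖∑ x, χ x * f x‖:ℂ))^2 = ∑ y, ∑ x, (χ⁻¹ y * χ x) * (f x * star (f y)) := by
    intro χ
    rw [← Complex.mul_conj', map_sum, Finset.mul_sum]
    refine Finset.sum_congr rfl fun y _ => ?_
    rw [Finset.sum_mul]
    refine Finset.sum_congr rfl fun x _ => ?_
    rw [map_mul, ← MulChar.star_apply']; simp only [starRingEnd_apply]; ring
  simp_rw [h0]
  rw [Finset.sum_comm, Finset.mul_sum, Finset.sum_filter]
  refine Finset.sum_congr rfl fun y _ => ?_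
  rw [Finset.sum_comm]
  simp_rw [← Finset.sum_mul]
  split_ifs with hy
  · have h2 : ∀ x, ∑ χ : DirichletCharacter ℂ r, χ⁻¹ y * χ x = if y = x then (r.totient:ℂ) else 0 := by
      intro x
      rw [← DirichletCharacter.sum_char_inv_mul_char_eq ℂ hy x]
      refine Finset.sum_congr rfl fun χ _ => ?_
      rw [MulChar.inv_apply_eq_inv', ← eq_inv_of_mul_eq_one_left (a := χ y⁻¹)]
      rw [← map_mul, ZMod.inv_mul_of_unit _ hy, map_one]
    simp_rw [h2, ite_mul, zero_mul]
    rw [Finset.sum_ite_eq]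
    simp [Complex.mul_conj']
  · refine Finset.sum_eq_zero fun x _ => ?_
    rw [Finset.sum_eq_zero, zero_mul]
    intro χ _
    rw [MulChar.map_nonunit _ hy, zero_mul]
lemma tau_ES {r : ℕ} [NeZero r] (χ : DirichletCharacter ℂ r) (hχ : χ.IsPrimitive) (a : ℕ → ℂ) (N : ℕ) :
    r * ‖∑ n ∈ Finset.range N, a n * χ n‖^2 = ‖∑ x : ZMod r, χ x * ES (fun n => star (a n)) N (x.val / r)‖^2 := by
  have h1 : ∑ x : ZMod r, χ x * ES (fun n => star (a n)) N (x.val / r) =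
      star (∑ n ∈ Finset.range N, a n * χ n) * gaussSum χ (ZMod.stdAddChar (N := r)) := by
    simp_rw [ES, Finset.mul_sum]
    rw [Finset.sum_comm, star_sum, Finset.sum_mul]
    refine Finset.sum_congr rfl fun n _ => ?_
    rw [star_mul', MulChar.star_apply', mul_assoc (star (a n)), ← gaussSum_mulShift_of_isPrimitive _ hχ, gaussSum, Finset.mul_sum]
    refine Finset.sum_congr rfl fun x _ => ?_
    have h2 := ZMod.stdAddChar_coe (N := r) ((n * x.val : ℕ):ℤ)
    push_cast at h2
    rw [ZMod.natCast_zmod_val] at h2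
    rw [AddChar.mulShift_apply, h2]
    have : (n:ℂ) * ((x.val:ℝ) / r : ℝ) * (2*Real.pi*I) = 2*Real.pi*I*(n*x.val)/r := by push_cast; ring
    rw [this]; ring
  rw [h1, norm_mul, mul_pow, tau_sq χ hχ, norm_star]; ring
open scoped Classical in
theorem large_sieve (a : ℕ → ℂ) (N Q : ℕ) :
    ∑ k ∈ Finset.range Q, ((k+1:ℕ):ℝ) / (k+1).totient * ∑ χ : DirichletCharacter ℂ (k+1) with χ.IsPrimitive,
      ‖∑ n ∈ Finset.range N, a n * χ n‖^2 ≤ 200 * (N + Q^2) * ∑ n ∈ Finset.range N, ‖a n‖^2 := by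
  rcases Nat.eq_zero_or_pos Q with rfl | hQ
  · simp; positivity
  have h1 : ∀ k ∈ Finset.range Q, ((k+1:ℕ):ℝ) / (k+1).totient * ∑ χ : DirichletCharacter ℂ (k+1) with χ.IsPrimitive,
      ‖∑ n ∈ Finset.range N, a n * χ n‖^2 ≤ ∑ x : ZMod (k+1) with IsUnit x, ‖ES (fun n => star (a n)) N (x.val / (k+1:ℕ))‖^2 := by
    intro k _
    have ht : (0:ℝ) < (k+1).totient := by exact_mod_cast Nat.totient_pos.2 (Nat.succ_pos k)
    have h2 := chi_pars (r := k+1) (fun x => ES (fun n => star (a n)) N (x.val / (k+1:ℕ)))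
    rw [div_mul_eq_mul_div, div_le_iff₀ ht, mul_comm _ ((k+1).totient:ℝ), ← h2, Finset.mul_sum]
    refine (Finset.sum_le_sum fun χ hχ => (tau_ES χ (Finset.mem_filter.1 hχ).2 a N).le).trans ?_
    exact Finset.sum_le_sum_of_subset_of_nonneg (Finset.filter_subset _ _) fun _ _ _ => by positivity
  refine (Finset.sum_le_sum h1).trans ?_
  rw [← Finset.sum_sigma (Finset.range Q) (fun k => Finset.univ.filter fun x : ZMod (k+1) => IsUnit x)
    (fun z => ‖ES (fun n => star (a n)) N (z.2.val / (z.1+1:ℕ))‖^2)]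
  have hQ1 : (1:ℝ) ≤ Q := by exact_mod_cast hQ
  have hN0 : (0:ℝ) ≤ N := by positivity
  have key := LS_pts ((Finset.range Q).sigma (fun k => Finset.univ.filter fun x : ZMod (k+1) => IsUnit x))
    (fun z => ((z.2.val:ℝ) / (z.1+1:ℕ))) (fun n => star (a n)) N (N+Q^2) (by nlinarith) (by nlinarith) ?_ ?_
  · simpa only [norm_star] using key
  · rintro ⟨k, x⟩ _
    refine ⟨by positivity, ?_⟩
    rw [div_le_one (by positivity)]
    exact_mod_cast (ZMod.val_lt x).le
  · rintro ⟨k, x⟩ hi ⟨l, y⟩ hj hne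
    simp only [Finset.mem_sigma, Finset.mem_range, Finset.mem_filter, Finset.mem_univ, true_and] at hi hj ⊢
    have cx : x.val.Coprime (k+1) := by simpa using ZMod.val_coe_unit_coprime hi.2.unit
    have cy : y.val.Coprime (l+1) := by simpa using ZMod.val_coe_unit_coprime hj.2.unit
    have hd : x.val * (l+1) ≠ y.val * (k+1) := by
      intro h
      have e1 : k+1 ∣ l+1 := cx.symm.dvd_of_dvd_mul_left ⟨y.val, by rw [h]; ring⟩
      have e2 : l+1 ∣ k+1 := cy.symm.dvd_of_dvd_mul_left ⟨x.val, by rw [← h]; ring⟩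
      have e3 : k = l := by have := Nat.dvd_antisymm e1 e2; omega
      subst e3
      exact hne (by rw [ZMod.val_injective _ (Nat.eq_of_mul_eq_mul_right (Nat.succ_pos k) h)])
    have hd' : (1:ℝ) ≤ |(x.val:ℝ) * (l+1:ℕ) - y.val * (k+1:ℕ)| := by
      have : (1:ℤ) ≤ |(x.val:ℤ) * (l+1:ℕ) - y.val * (k+1:ℕ)| := Int.one_le_abs (sub_ne_zero.2 (by exact_mod_cast hd))
      exact_mod_cast this
    have hp : (0:ℝ) < ((k+1:ℕ):ℝ) * (l+1:ℕ) := by positivity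
    have e : (x.val:ℝ)/(k+1:ℕ) - (y.val:ℝ)/(l+1:ℕ) = ((x.val:ℝ) * (l+1:ℕ) - y.val * (k+1:ℕ)) / (((k+1:ℕ):ℝ) * (l+1:ℕ)) := by
      field_simp
    rw [e, abs_div, abs_of_pos hp, mul_div_assoc', le_div_iff₀ hp, one_mul]
    have hk : ((k+1:ℕ):ℝ) ≤ Q := by exact_mod_cast hi.1
    have hl : ((l+1:ℕ):ℝ) ≤ Q := by exact_mod_cast hj.1
    have := mul_le_mul hk hl (by positivity) (by positivity)
    nlinarith
end

section
open Complex MeasureTheory Filter Topology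
open scoped ArithmeticFunction.vonMangoldt ArithmeticFunction.Moebius ArithmeticFunction.zeta
noncomputable def WS (φ : ℝ → ℂ) (T : ℝ) (X : ℕ) (χ F : ℕ → ℂ) : ℂ :=
  ∑ n ∈ Finset.Ioc 0 X, F n * χ n / n * φ (Real.log n - T)
def cof (f : ArithmeticFunction ℝ) (n : ℕ) : ℂ := (f n : ℝ)
lemma sum_Ioc0 {M : Type*} [AddCommMonoid M] (f : ℕ → M) (X : ℕ) : ∑ n ∈ Finset.Ioc 0 X, f n = ∑ k ∈ Finset.range X, f (k+1) := by
  induction X with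
  | zero => simp
  | succ n ih => rw [Finset.sum_Ioc_succ_top (Nat.zero_le n), ih, Finset.sum_range_succ]
lemma supp_bd {φ : ℝ → ℂ} (hc : HasCompactSupport φ) : ∃ A : ℝ, 0 < A ∧ ∀ v, A ≤ |v| → φ v = 0 := by
  obtain ⟨A, hA⟩ := hc.isCompact.isBounded.subset_closedBall 0
  refine ⟨|A|+1, by positivity, fun v hv => ?_⟩
  by_contra h
  have := hA (subset_tsupport φ h)
  rw [mem_closedBall_zero_iff, Real.norm_eq_abs] at this
  linarith [le_abs_self A]
lemma phi_zero {φ : ℝ → ℂ} {A T : ℝ} (hA : ∀ v, A ≤ |v| → φ v = 0) {X : ℕ} (hX : Real.exp (T+A) ≤ X) {n : ℕ} (hn : X ≤ n) :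
    φ (Real.log n - T) = 0 := by
  have h1 : Real.exp (T+A) ≤ n := hX.trans (by exact_mod_cast hn)
  have h2 := (Real.le_log_iff_exp_le ((Real.exp_pos _).trans_le h1)).2 h1
  exact hA _ (le_trans (by linarith) (le_abs_self _))
lemma WS_conv {φ : ℝ → ℂ} {A T : ℝ} (hA : ∀ v, A ≤ |v| → φ v = 0) {X : ℕ} (hX : Real.exp (T+A) ≤ X) {r : ℕ}
    (χ : DirichletCharacter ℂ r) (F G : ArithmeticFunction ℝ) :
    WS φ T X (fun n => χ n) (cof (F*G)) = ∑ a ∈ Finset.Ioc 0 X, ∑ b ∈ Finset.Ioc 0 X,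
      (cof F a * χ a / a) * (cof G b * χ b / b) * φ (Real.log a + Real.log b - T) := by
  rw [WS, ← Finset.sum_product']
  trans ∑ n ∈ Finset.Ioc 0 X, ∑ x ∈ Finset.Ioc 0 X ×ˢ Finset.Ioc 0 X with x.1 * x.2 = n,
    (cof F x.1 * χ x.1 / x.1) * (cof G x.2 * χ x.2 / x.2) * φ (Real.log x.1 + Real.log x.2 - T)
  · refine Finset.sum_congr rfl fun n hn => ?_
    rw [Finset.mem_Ioc] at hn
    rw [cof, ArithmeticFunction.mul_apply, Nat.divisorsAntidiagonal_eq_prod_filter_of_le hn.1.ne' hn.2, ofReal_sum, Finset.sum_mul,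
      Finset.sum_div, Finset.sum_mul]
    refine Finset.sum_congr rfl fun x hx => ?_
    simp only [Finset.mem_filter, Finset.mem_product, Finset.mem_Ioc] at hx
    have h1 : (x.1:ℝ) ≠ 0 := by exact_mod_cast hx.1.1.1.ne'
    have h2 : (x.2:ℝ) ≠ 0 := by exact_mod_cast hx.1.2.1.ne'
    rw [← hx.2, Nat.cast_mul (α := ℝ), Real.log_mul h1 h2]
    push_cast; rw [map_mul]; simp only [cof]; ring
  · simp_rw [Finset.sum_filter]
    rw [Finset.sum_comm]
    refine Finset.sum_congr rfl fun x hx => ?_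
    simp only [Finset.mem_product, Finset.mem_Ioc] at hx
    rw [Finset.sum_ite_eq]
    split_ifs with h
    · rfl
    · have h3 : X ≤ x.1 * x.2 := by
        by_contra h4; exact h (Finset.mem_Ioc.2 ⟨Nat.mul_pos hx.1.1 hx.2.1, by omega⟩)
      have := phi_zero hA hX h3
      rw [Nat.cast_mul, Real.log_mul (by exact_mod_cast hx.1.1.ne') (by exact_mod_cast hx.2.1.ne')] at this
      rw [this, mul_zero]
lemma tI {φ : ℝ → ℂ} (hφ : ContDiff ℝ (⊤ : ℕ∞) φ) (hc : HasCompactSupport φ) {A : ℝ} (hA0 : 0 < A) (hA : ∀ v, A ≤ |v| → φ v = 0) :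
    ∃ C : ℝ, 0 ≤ C ∧ ∀ (r : ℕ) [NeZero r] (χ : DirichletCharacter ℂ r), χ ≠ 1 → ∀ (τ : ℝ) (X : ℕ), Real.exp (τ+A) ≤ X →
      ‖∑ b ∈ Finset.Ioc 0 X, χ b / b * φ (Real.log b - τ)‖ ≤ C * r * Real.exp (-τ) := by
  obtain ⟨ψ, hψ⟩ : ∃ ψ : ℝ → ℂ, ψ = fun v : ℝ => cexp (-(v:ℂ)) * φ v := ⟨_, rfl⟩
  have hψc : ContDiff ℝ 1 ψ := by
    rw [hψ]
    exact (ContDiff.mul (ofRealCLM.contDiff.neg.cexp) (hφ.of_le (by exact_mod_cast le_top)))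
  obtain ⟨L, hL⟩ := hψc.lipschitzWith_of_hasCompactSupport (by rw [hψ]; exact hc.mul_left) one_ne_zero
  have hcl : ∀ v, ψ (max (-A) (min A v)) = ψ v := by
    intro v
    have z : ∀ u, A ≤ |u| → ψ u = 0 := fun u hu => by simp [hψ, hA u hu]
    rcases le_total A v with h | h
    · rw [min_eq_left h, max_eq_right (by linarith), z A (le_abs_self A), z v (h.trans (le_abs_self v))]
    · rw [min_eq_right h]
      rcases le_total v (-A) with h' | h'
      · rw [max_eq_left h', z (-A) (by rw [abs_neg]; exact le_abs_self A), z v (le_trans (by linarith) (neg_le_abs v))]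
      · rw [max_eq_right h']
  refine ⟨2*(L*(2*A)), by positivity, fun r _ χ hχ τ X hX => ?_⟩
  have hX1 : 1 ≤ X := by
    have : (0:ℝ) < X := (Real.exp_pos _).trans_le hX
    exact_mod_cast this
  obtain ⟨c, hcd⟩ : ∃ c : ℕ → ℝ, c = fun n => max (-A) (min A (Real.log (n+1:ℕ) - τ)) := ⟨_, rfl⟩
  obtain ⟨g, hg⟩ : ∃ g : ℕ → ℂ, g = fun n => ψ (c n) := ⟨_, rfl⟩
  have hgv : ∀ n : ℕ, g n = ψ (Real.log (n+1:ℕ) - τ) := fun n => by rw [hg, hcd]; exact hcl _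
  have hmono : Monotone c := by
    rw [hcd]
    intro m n h
    dsimp only
    refine max_le_max le_rfl (min_le_min le_rfl (sub_le_sub_right (Real.log_le_log (by positivity) (by exact_mod_cast Nat.succ_le_succ h)) _))
  have e1 : ∑ b ∈ Finset.Ioc 0 X, χ b / b * φ (Real.log b - τ) = cexp (-τ) * ∑ k ∈ Finset.range X, g k * χ (k+1:ℕ) := by
    rw [Finset.mul_sum, sum_Ioc0]
    refine Finset.sum_congr rfl fun k _ => ?_
    rw [hgv, hψ]
    dsimp only
    have h1 : cexp (-((Real.log (k+1:ℕ) - τ : ℝ):ℂ)) = cexp τ / (k+1:ℕ) := by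
      rw [ofReal_sub, neg_sub, Complex.exp_sub, ← ofReal_exp (Real.log _), Real.exp_log (by positivity), ofReal_natCast]
    rw [h1, show ∀ a b c : ℂ, cexp (-τ) * (cexp τ / a * b * c) = (cexp (-τ) * cexp τ) * (c / a * b) by intros; ring,
      ← Complex.exp_add]
    simp
  have hgX : g (X-1) = 0 := by
    rw [hgv, Nat.sub_add_cancel hX1, hψ]; simp only [phi_zero hA hX le_rfl, mul_zero]
  have e2 : ‖∑ k ∈ Finset.range X, g k * χ (k+1:ℕ)‖ ≤ 2*r*(L*(2*A)) := by
    have := Finset.sum_range_by_parts g (fun k => χ (k+1:ℕ)) X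
    simp only [smul_eq_mul] at this
    rw [this, hgX, zero_mul, zero_sub, norm_neg]
    have h2 : ∀ i ∈ Finset.range (X-1), ‖(g (i+1) - g i) * ∑ k ∈ Finset.range (i+1), χ (k+1:ℕ)‖ ≤ (L*(c (i+1) - c i)) * (2*r) := by
      intro i _
      rw [norm_mul]
      refine mul_le_mul ?_ (chi_PS hχ (i+1)) (norm_nonneg _) ?_
      · have := hL.dist_le_mul (c (i+1)) (c i)
        rwa [dist_eq_norm, Real.dist_eq, abs_of_nonneg (sub_nonneg.2 (hmono (Nat.le_succ i))), ← congrFun hg (i+1), ← congrFun hg i] at this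
      · exact mul_nonneg L.2 (sub_nonneg.2 (hmono (Nat.le_succ i)))
    refine (norm_sum_le_of_le _ h2).trans ?_
    rw [← Finset.sum_mul, ← Finset.mul_sum, Finset.sum_range_sub, mul_comm]
    have h3 : c (X-1) ≤ A := by rw [hcd]; exact max_le (by linarith) (min_le_left _ _)
    have h4 : -A ≤ c 0 := by rw [hcd]; exact le_max_left _ _
    refine mul_le_mul_of_nonneg_left (mul_le_mul_of_nonneg_left (by linarith) L.2) (by positivity)
  rw [e1, norm_mul, ← ofReal_neg, norm_exp_ofReal]
  have := mul_le_mul_of_nonneg_left e2 (Real.exp_pos (-τ)).le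
  linarith
def trl (f : ArithmeticFunction ℝ) (U : ℕ) : ArithmeticFunction ℝ := ⟨fun n => if n ≤ U then f n else 0, by simp⟩
def trg (f : ArithmeticFunction ℝ) (U : ℕ) : ArithmeticFunction ℝ := ⟨fun n => if n ≤ U then 0 else f n, by simp⟩
lemma tr_add (f : ArithmeticFunction ℝ) (U : ℕ) : trl f U + trg f U = f := by
  ext n; change (if n ≤ U then f n else 0) + (if n ≤ U then 0 else f n) = f n; split_ifs <;> simp
lemma vaughan (U : ℕ) : Λ = trl Λ U + trl (μ : ArithmeticFunction ℝ) U * ArithmeticFunction.log - (trl (μ : ArithmeticFunction ℝ) U * trl Λ U) * ζ +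
    (trg (μ : ArithmeticFunction ℝ) U * ζ) * trg Λ U := by
  have h1 := tr_add Λ U
  have h2 := tr_add (μ : ArithmeticFunction ℝ) U
  have h3 := ArithmeticFunction.coe_moebius_mul_coe_zeta (R := ℝ)
  have h4 := ArithmeticFunction.vonMangoldt_mul_zeta
  rw [← h4]
  linear_combination (trl (μ : ArithmeticFunction ℝ) U * ζ - 1) * h1 - trg Λ U * h3 - trg Λ U * ζ * h2
lemma WS_I {φ : ℝ → ℂ} (hφ : ContDiff ℝ (⊤ : ℕ∞) φ) (hc : HasCompactSupport φ) {A : ℝ} (hA0 : 0 < A) (hA : ∀ v, A ≤ |v| → φ v = 0) :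
    ∃ C : ℝ, 0 ≤ C ∧ ∀ (r : ℕ) [NeZero r] (χ : DirichletCharacter ℂ r), χ ≠ 1 → ∀ (T : ℝ) (X : ℕ), Real.exp (T+A) ≤ X →
      ∀ (F : ArithmeticFunction ℝ),
      ‖WS φ T X (fun n => χ n) (cof (F*ζ))‖ ≤ C * r * Real.exp (-T) * ∑ a ∈ Finset.Ioc 0 X, |F a| ∧
      ‖WS φ T X (fun n => χ n) (cof (F*ArithmeticFunction.log))‖ ≤ C * r * Real.exp (-T) * (1 + |T| + Real.log X) * ∑ a ∈ Finset.Ioc 0 X, |F a| := by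
  obtain ⟨C₁, h1, H1⟩ := tI hφ hc hA0 hA
  obtain ⟨C₂, h2, H2⟩ := tI (φ := fun v => v * φ v) ((ofRealCLM.contDiff).mul hφ) hc.mul_left hA0 (fun v hv => by simp [hA v hv])
  refine ⟨C₁+C₂, by positivity, fun r _ χ hχ T X hX F => ?_⟩
  have hX' : ∀ a ∈ Finset.Ioc 0 X, Real.exp ((T - Real.log a) + A) ≤ X := fun a ha =>
    le_trans (Real.exp_le_exp.2 (by linarith [Real.log_natCast_nonneg a])) hX
  have hexp : ∀ a ∈ Finset.Ioc 0 X, Real.exp (-(T - Real.log a)) = a * Real.exp (-T) := fun a ha => by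
    rw [neg_sub, sub_eq_add_neg, Real.exp_add, Real.exp_log (by exact_mod_cast (Finset.mem_Ioc.1 ha).1)]
  have key : ∀ (G : ArithmeticFunction ℝ) (B : ℝ),
      (∀ a ∈ Finset.Ioc 0 X, ‖∑ b ∈ Finset.Ioc 0 X, (cof G b * χ b / b) * φ (Real.log b - (T - Real.log a))‖ ≤ B * (a * Real.exp (-T))) →
      ‖WS φ T X (fun n => χ n) (cof (F*G))‖ ≤ B * Real.exp (-T) * ∑ a ∈ Finset.Ioc 0 X, |F a| := by
    intro G B h
    rw [WS_conv hA hX, Finset.mul_sum]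
    refine norm_sum_le_of_le _ fun a ha => ?_
    have ha0 : (0:ℝ) < a := by exact_mod_cast (Finset.mem_Ioc.1 ha).1
    have e : ∑ b ∈ Finset.Ioc 0 X, (cof F a * χ a / a) * (cof G b * χ b / b) * φ (Real.log a + Real.log b - T) =
      (cof F a * χ a / a) * ∑ b ∈ Finset.Ioc 0 X, (cof G b * χ b / b) * φ (Real.log b - (T - Real.log a)) := by
      rw [Finset.mul_sum]
      refine Finset.sum_congr rfl fun b _ => ?_
      rw [show Real.log b - (T - Real.log a) = Real.log a + Real.log b - T by ring]; ring
    have hn : ‖cof F a * χ a / a‖ ≤ |F a| / a := by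
      rw [norm_div, norm_mul, cof, norm_real, Real.norm_eq_abs, norm_natCast]
      exact div_le_div_of_nonneg_right (mul_le_of_le_one_right (abs_nonneg _) (χ.norm_le_one _)) ha0.le
    rw [e, norm_mul]
    refine (mul_le_mul hn (h a ha) (norm_nonneg _) (by positivity)).trans_eq ?_
    field_simp
  have hr : (0:ℝ) ≤ r := by positivity
  constructor
  · refine key _ _ fun a ha => ?_
    have := H1 r χ hχ _ X (hX' a ha)
    rw [hexp a ha] at this
    have e : ∑ b ∈ Finset.Ioc 0 X, (cof ζ b * χ b / b) * φ (Real.log b - (T - Real.log a)) = ∑ b ∈ Finset.Ioc 0 X, χ b / b * φ (Real.log b - (T - Real.log a)) := by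
      refine Finset.sum_congr rfl fun b hb => ?_
      rw [cof, ArithmeticFunction.natCoe_apply, ArithmeticFunction.zeta_apply_ne (Finset.mem_Ioc.1 hb).1.ne']; simp
    rw [e]
    refine this.trans (mul_le_mul_of_nonneg_right (mul_le_mul_of_nonneg_right (by linarith) hr) (by positivity))
  · refine (key _ ((C₁ + C₂) * r * (1 + |T| + Real.log X)) fun a ha => ?_).trans_eq (by ring)
    have t1 := H1 r χ hχ _ X (hX' a ha)
    have t2 := H2 r χ hχ _ X (hX' a ha)
    rw [hexp a ha] at t1 t2
    have e : ∑ b ∈ Finset.Ioc 0 X, (cof ArithmeticFunction.log b * χ b / b) * φ (Real.log b - (T - Real.log a)) =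
       (T - Real.log a : ℝ) * ∑ b ∈ Finset.Ioc 0 X, χ b / b * φ (Real.log b - (T - Real.log a)) +
       ∑ b ∈ Finset.Ioc 0 X, χ b / b * ((Real.log b - (T - Real.log a) : ℝ) * φ (Real.log b - (T - Real.log a))) := by
      rw [Finset.mul_sum, ← Finset.sum_add_distrib]
      refine Finset.sum_congr rfl fun b hb => ?_
      rw [cof, ArithmeticFunction.log_apply]; push_cast; ring
    rw [e]
    have ha' := Finset.mem_Ioc.1 ha
    have hlX : Real.log a ≤ Real.log X := Real.log_le_log (by exact_mod_cast ha'.1) (by exact_mod_cast ha'.2)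
    have hl0 := Real.log_natCast_nonneg a
    have hT : ‖((T - Real.log a : ℝ):ℂ)‖ ≤ |T| + Real.log X := by
      rw [norm_real, Real.norm_eq_abs]; refine (abs_sub _ _).trans ?_; rw [abs_of_nonneg hl0]; linarith
    refine (norm_add_le _ _).trans ?_
    rw [norm_mul]
    have p1 := mul_le_mul hT t1 (norm_nonneg _) (by positivity)
    have pz : 0 ≤ r * (a * Real.exp (-T)) := by positivity
    have : (|T| + Real.log X) * (C₁ * r * (a * Real.exp (-T))) + C₂ * r * (a * Real.exp (-T)) ≤
      (C₁ + C₂) * r * (1 + |T| + Real.log X) * (a * Real.exp (-T)) := by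
      have : 0 ≤ (C₁ + C₂ * (|T| + Real.log X)) * (r * (a * Real.exp (-T))) := mul_nonneg (by have := abs_nonneg T; positivity) pz
      linarith
    linarith
end

section
open Complex MeasureTheory Filter Topology
open scoped ArithmeticFunction.vonMangoldt ArithmeticFunction.Moebius ArithmeticFunction.zeta
lemma sep_bd {φ : ℝ → ℂ} (hφ : ContDiff ℝ (⊤ : ℕ∞) φ) (hc : HasCompactSupport φ) : ∃ C : ℝ, 0 ≤ C ∧
    ∀ (ι : Type) (s : Finset ι) (c : ι → ℂ) (v : ι → ℝ) (K : ℝ), (∀ ξ : ℝ, ‖∑ i ∈ s, c i * cexp (ξ * v i * I)‖ ≤ K) →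
      ‖∑ i ∈ s, c i * φ (v i)‖ ≤ C * K := by
  obtain ⟨w, hw, hi, h⟩ := sep hφ hc
  have hi0 : Integrable w := by
    have := hi 0
    simp only [pow_zero, one_mul] at this
    exact (integrable_norm_iff hw.aestronglyMeasurable).1 this
  refine ⟨∫ ξ, ‖w ξ‖, integral_nonneg fun _ => norm_nonneg _, fun ι s c v K hK => ?_⟩
  have e1 : ∑ i ∈ s, c i * φ (v i) = ∫ ξ : ℝ, w ξ * ∑ i ∈ s, c i * cexp (ξ * v i * I) := by
    simp_rw [Finset.mul_sum]
    rw [integral_finsetSum]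
    · refine Finset.sum_congr rfl fun i _ => ?_
      rw [h (v i), ← integral_const_mul]
      exact integral_congr_ae (by filter_upwards with ξ; ring)
    · intro i _
      refine hi0.mul_bdd (c := ‖c i‖) (Continuous.aestronglyMeasurable (by fun_prop)) (by
        filter_upwards with ξ
        rw [norm_mul, show (ξ:ℂ) * v i * I = ((ξ * v i : ℝ):ℂ) * I by push_cast; ring, norm_exp_ofReal_mul_I, mul_one])
  rw [e1, ← integral_mul_const]
  refine norm_integral_le_of_norm_le (hi0.norm.mul_const K) (by
    filter_upwards with ξ
    rw [norm_mul]
    exact mul_le_mul_of_nonneg_left (hK ξ) (norm_nonneg _))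
abbrev CZ := Σ k : ℕ, DirichletCharacter ℂ (k+1)
open scoped Classical in
noncomputable def ZQ (Q : ℕ) : Finset CZ := (Finset.range Q).sigma fun k => Finset.univ.filter fun χ => χ.IsPrimitive
noncomputable def cz (z : CZ) : ℝ := ((z.1+1:ℕ):ℝ) / (z.1+1).totient
lemma cz_nn (z : CZ) : 0 ≤ cz z := by unfold cz; positivity
lemma LS_box (a : ℕ → ℂ) (M Q : ℕ) :
    ∑ z ∈ ZQ Q, cz z * ‖∑ n ∈ Finset.Ioc M (2*M), a n * z.2 n‖^2 ≤ 200 * (2*M+1+Q^2) * ∑ n ∈ Finset.Ioc M (2*M), ‖a n‖^2 := by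
  have h := large_sieve (fun n => if n ∈ Finset.Ioc M (2*M) then a n else 0) (2*M+1) Q
  have hs : Finset.range (2*M+1) ∩ Finset.Ioc M (2*M) = Finset.Ioc M (2*M) := by ext; simp
  have e2 : ∀ f : ℕ → ℝ, ∑ n ∈ Finset.range (2*M+1), (if n ∈ Finset.Ioc M (2*M) then f n else 0) = ∑ n ∈ Finset.Ioc M (2*M), f n := by
    intro f; rw [Finset.sum_ite_mem, hs]
  have e3 : ∀ f : ℕ → ℂ, ∑ n ∈ Finset.range (2*M+1), (if n ∈ Finset.Ioc M (2*M) then f n else 0) = ∑ n ∈ Finset.Ioc M (2*M), f n := by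
    intro f; rw [Finset.sum_ite_mem, hs]
  simp only [ite_mul, zero_mul, apply_ite norm, norm_zero, ite_pow, ne_eq, OfNat.ofNat_ne_zero, not_false_eq_true, zero_pow] at h
  rw [e2] at h
  simp only [e3] at h
  rw [ZQ, Finset.sum_sigma]
  simp only [cz]
  simp_rw [Finset.mul_sum] at h ⊢
  push_cast at h ⊢
  exact h
lemma box {φ : ℝ → ℂ} (hφ : ContDiff ℝ (⊤ : ℕ∞) φ) (hc : HasCompactSupport φ) : ∃ C : ℝ, 0 ≤ C ∧
    ∀ (α β : ℕ → ℂ) (M N Q : ℕ) (T : ℝ),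
    ∑ z ∈ ZQ Q, cz z * ‖∑ a ∈ Finset.Ioc M (2*M), ∑ b ∈ Finset.Ioc N (2*N), (α a * z.2 a) * (β b * z.2 b) * φ (Real.log a + Real.log b - T)‖ ≤
     C * Real.sqrt (((2*M+1+Q^2) * ∑ n ∈ Finset.Ioc M (2*M), ‖α n‖^2) * ((2*N+1+Q^2) * ∑ n ∈ Finset.Ioc N (2*N), ‖β n‖^2)) := by
  obtain ⟨C, hC, H⟩ := sep_bd hφ hc
  refine ⟨C*200, by positivity, fun α β M N Q T => ?_⟩
  choose u hu1 hu2 using fun z : CZ => Complex.exists_norm_eq_mul_self (∑ a ∈ Finset.Ioc M (2*M), ∑ b ∈ Finset.Ioc N (2*N), (α a * z.2 a) * (β b * z.2 b) * φ (Real.log a + Real.log b - T))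
  obtain ⟨f, hf⟩ : ∃ f : (CZ × ℕ × ℕ) → ℂ, f = fun i => cz i.1 * u i.1 * ((α i.2.1 * i.1.2 i.2.1) * (β i.2.2 * i.1.2 i.2.2)) := ⟨_, rfl⟩
  have key := H (CZ × ℕ × ℕ) (ZQ Q ×ˢ (Finset.Ioc M (2*M) ×ˢ Finset.Ioc N (2*N))) f (fun i => Real.log i.2.1 + Real.log i.2.2 - T)
    (200 * Real.sqrt (((2*M+1+Q^2) * ∑ n ∈ Finset.Ioc M (2*M), ‖α n‖^2) * ((2*N+1+Q^2) * ∑ n ∈ Finset.Ioc N (2*N), ‖β n‖^2))) ?_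
  · rw [← mul_assoc] at key
    refine le_trans (le_of_eq ?_) key
    rw [← Real.norm_of_nonneg (Finset.sum_nonneg fun z _ => mul_nonneg (cz_nn z) (norm_nonneg _)), ← norm_real]
    congr 1
    rw [Finset.sum_product]
    push_cast
    refine Finset.sum_congr rfl fun z _ => ?_
    rw [hu2 z, Finset.sum_product, Finset.mul_sum, Finset.mul_sum]
    refine Finset.sum_congr rfl fun a _ => ?_
    rw [Finset.mul_sum, Finset.mul_sum]
    refine Finset.sum_congr rfl fun b _ => ?_
    rw [hf]; ring
  · intro ξ
    obtain ⟨α', hα'⟩ : ∃ α' : ℕ → ℂ, α' = fun a => α a * cexp (ξ * Real.log a * I) := ⟨_, rfl⟩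
    obtain ⟨β', hβ'⟩ : ∃ β' : ℕ → ℂ, β' = fun b => β b * cexp (ξ * Real.log b * I) := ⟨_, rfl⟩
    have nrm : ∀ (x y : ℝ), ‖cexp (x*y*I)‖ = 1 := fun x y => by rw [← ofReal_mul, norm_exp_ofReal_mul_I]
    have na : ∀ n, ‖α' n‖ = ‖α n‖ := fun n => by rw [hα', norm_mul, nrm, mul_one]
    have nb : ∀ n, ‖β' n‖ = ‖β n‖ := fun n => by rw [hβ', norm_mul, nrm, mul_one]
    have e : ∑ i ∈ ZQ Q ×ˢ (Finset.Ioc M (2*M) ×ˢ Finset.Ioc N (2*N)), f i * cexp (ξ * (Real.log i.2.1 + Real.log i.2.2 - T : ℝ) * I) =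
      ∑ z ∈ ZQ Q, (cz z * u z * cexp (ξ * (-T : ℝ) * I)) * ((∑ a ∈ Finset.Ioc M (2*M), α' a * z.2 a) * ∑ b ∈ Finset.Ioc N (2*N), β' b * z.2 b) := by
      rw [Finset.sum_product]
      refine Finset.sum_congr rfl fun z _ => ?_
      rw [Finset.sum_product, Finset.sum_mul_sum, Finset.mul_sum]
      refine Finset.sum_congr rfl fun a _ => ?_
      rw [Finset.mul_sum]
      refine Finset.sum_congr rfl fun b _ => ?_
      rw [hf, hα', hβ']
      have : cexp (ξ * (Real.log a + Real.log b - T : ℝ) * I) = cexp (ξ * (-T : ℝ) * I) * cexp (ξ * Real.log a * I) * cexp (ξ * Real.log b * I) := by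
        rw [← Complex.exp_add, ← Complex.exp_add]; congr 1; push_cast; ring
      simp only [this]; ring
    rw [e]
    have h1 := LS_box α' M Q
    have h2 := LS_box β' N Q
    simp only [na] at h1
    simp only [nb] at h2
    have h3 : ‖∑ z ∈ ZQ Q, (cz z * u z * cexp (ξ * (-T : ℝ) * I)) * ((∑ a ∈ Finset.Ioc M (2*M), α' a * z.2 a) * ∑ b ∈ Finset.Ioc N (2*N), β' b * z.2 b)‖ ≤
      ∑ z ∈ ZQ Q, (Real.sqrt (cz z) * ‖∑ a ∈ Finset.Ioc M (2*M), α' a * z.2 a‖) * (Real.sqrt (cz z) * ‖∑ b ∈ Finset.Ioc N (2*N), β' b * z.2 b‖) := by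
      refine norm_sum_le_of_le _ fun z _ => le_of_eq ?_
      rw [norm_mul, norm_mul, norm_mul, norm_mul, hu1, nrm, norm_real, Real.norm_of_nonneg (cz_nn z), mul_mul_mul_comm (Real.sqrt _), Real.mul_self_sqrt (cz_nn z)]
      ring
    refine h3.trans (abs_le_of_sq_le_sq' ?_ (by positivity)).2
    refine (Finset.sum_mul_sq_le_sq_mul_sq _ _ _).trans ?_
    rw [mul_pow, Real.sq_sqrt (by positivity)]
    simp only [mul_pow, Real.sq_sqrt (cz_nn _)]
    refine (mul_le_mul h1 h2 (Finset.sum_nonneg fun z _ => mul_nonneg (cz_nn z) (by positivity)) (by positivity)).trans_eq (by ring)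
lemma dyad {M : Type*} [AddCommMonoid M] (f : ℕ → M) (J : ℕ) (h1 : f 1 = 0) :
    ∑ n ∈ Finset.Ioc 0 (2^J), f n = ∑ i ∈ Finset.range J, ∑ n ∈ Finset.Ioc (2^i) (2*2^i), f n := by
  induction J with
  | zero => rw [pow_zero, sum_Ioc0]; simp [h1]
  | succ n ih =>
    rw [Finset.sum_range_succ, ← ih, pow_succ, mul_comm (2^n) 2, Finset.sum_Ioc_consecutive f (Nat.zero_le _) (by omega)]
lemma box_sq {F : ArithmeticFunction ℝ} {J i : ℕ} (hi : i < J) (Q : ℕ) :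
    ((2*((2^i:ℕ):ℝ)+1+Q^2) * ∑ n ∈ Finset.Ioc (2^i) (2*2^i), ‖cof F n / n‖^2) ≤ 3 * (1+Q^2*(1/2^i)) * ∑ n ∈ Finset.Ioc 0 (2^J), F n^2/n := by
  have hM : (0:ℝ) < 2^i := by positivity
  have hM1 : (1:ℝ) ≤ 2^i := one_le_pow₀ (by norm_num)
  have h1 : ∑ n ∈ Finset.Ioc (2^i) (2*2^i), ‖cof F n / n‖^2 ≤ (1/2^i) * ∑ n ∈ Finset.Ioc 0 (2^J), F n^2/n := by
    rw [Finset.mul_sum]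
    refine (Finset.sum_le_sum (g := fun n : ℕ => 1/2^i * (F n^2/n)) fun n hn => ?_).trans
      (Finset.sum_le_sum_of_subset_of_nonneg (Finset.Ioc_subset_Ioc (Nat.zero_le _) ?_) fun _ _ _ => by positivity)
    · have hn' : (2:ℝ)^i ≤ n := by exact_mod_cast (Finset.mem_Ioc.1 hn).1.le
      rw [norm_div, cof, norm_real, norm_natCast, div_pow, Real.norm_eq_abs, sq_abs, sq (n:ℝ), ← div_div, mul_comm, ← div_eq_mul_one_div]
      exact div_le_div_of_nonneg_left (by positivity) hM hn'
    · rw [← pow_succ']; exact Nat.pow_le_pow_right (by norm_num) hi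
  have hS : 0 ≤ ∑ n ∈ Finset.Ioc 0 (2^J), F n^2/n := Finset.sum_nonneg fun _ _ => by positivity
  push_cast
  refine (mul_le_mul_of_nonneg_left h1 (by positivity)).trans ?_
  rw [← mul_assoc]
  refine mul_le_mul_of_nonneg_right ?_ hS
  rw [mul_one_div, div_le_iff₀ hM]
  have : (1 + (Q:ℝ)^2 * (1/2^i)) * 2^i = 2^i + Q^2 := by field_simp
  nlinarith [sq_nonneg (Q:ℝ)]
theorem tII {φ : ℝ → ℂ} (hφ : ContDiff ℝ (⊤ : ℕ∞) φ) (hc : HasCompactSupport φ) {A : ℝ} (hA : ∀ v, A ≤ |v| → φ v = 0) :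
    ∃ C : ℝ, 0 ≤ C ∧ ∀ (J Q U : ℕ) (T u v : ℝ) (F G : ArithmeticFunction ℝ), 0 ≤ u → 0 ≤ v → Real.exp (T+A) ≤ (2^J:ℕ) → 1 ≤ U →
      4 ≤ u^2*U → 4*Real.exp (A-T) ≤ v^2 → (∀ n ≤ U, F n = 0) → (∀ n ≤ U, G n = 0) →
      ∑ z ∈ ZQ Q, cz z * ‖WS φ T (2^J) (fun n => z.2 n) (cof (F*G))‖ ≤
        C * J^2 * Real.sqrt ((∑ n ∈ Finset.Ioc 0 (2^J), F n^2/n) * (∑ n ∈ Finset.Ioc 0 (2^J), G n^2/n)) * (1 + Q*u + Q^2*v) := by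
  obtain ⟨C, hC, H⟩ := box hφ hc
  refine ⟨C*3, by positivity, fun J Q U T u v F G hu hv hI hU huU hvT hF hG => ?_⟩
  obtain ⟨SF, hSF⟩ : ∃ SF, SF = ∑ n ∈ Finset.Ioc 0 (2^J), F n^2/n := ⟨_, rfl⟩
  obtain ⟨SG, hSG⟩ : ∃ SG, SG = ∑ n ∈ Finset.Ioc 0 (2^J), G n^2/n := ⟨_, rfl⟩
  have hSF0 : 0 ≤ SF := hSF ▸ Finset.sum_nonneg fun _ _ => by positivity
  have hSG0 : 0 ≤ SG := hSG ▸ Finset.sum_nonneg fun _ _ => by positivity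
  rw [← hSF, ← hSG]
  obtain ⟨B, hB⟩ : ∃ B : CZ → ℕ → ℕ → ℂ, B = fun z i j => ∑ a ∈ Finset.Ioc (2^i) (2*2^i), ∑ b ∈ Finset.Ioc (2^j) (2*2^j),
      (cof F a / a * z.2 a) * (cof G b / b * z.2 b) * φ (Real.log a + Real.log b - T) := ⟨_, rfl⟩
  have e1 : ∀ z : CZ, WS φ T (2^J) (fun n => z.2 n) (cof (F*G)) = ∑ i ∈ Finset.range J, ∑ j ∈ Finset.range J, B z i j := by
    intro z
    rw [WS_conv hA hI, dyad _ J (by simp [cof, hF 1 hU])]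
    refine Finset.sum_congr rfl fun i _ => ?_
    rw [hB]
    dsimp only
    refine Eq.trans (Finset.sum_congr rfl fun a _ => ?_) Finset.sum_comm
    rw [dyad _ J (by simp [cof, hG 1 hU])]
    refine Finset.sum_congr rfl fun i _ => Finset.sum_congr rfl fun b _ => ?_
    ring
  have hbox : ∀ i ∈ Finset.range J, ∀ j ∈ Finset.range J, ∑ z ∈ ZQ Q, cz z * ‖B z i j‖ ≤ C * (3 * (1 + Q*u + Q^2*v) * Real.sqrt (SF*SG)) := by
    intro i hi j hj
    by_cases hz : (2*2^i ≤ U ∨ 2*2^j ≤ U) ∨ (4:ℝ)*(2^i*2^j) ≤ Real.exp (T-A)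
    · have : ∀ z, B z i j = 0 := by
        intro z
        rw [hB]
        refine Finset.sum_eq_zero fun a ha => Finset.sum_eq_zero fun b hb => ?_
        rw [Finset.mem_Ioc] at ha hb
        rcases hz with (h | h) | h
        · simp [cof, hF a (ha.2.trans h)]
        · simp [cof, hG b (hb.2.trans h)]
        · have ha0 : (0:ℝ) < a := by exact_mod_cast (Nat.zero_le _).trans_lt ha.1
          have hb0 : (0:ℝ) < b := by exact_mod_cast (Nat.zero_le _).trans_lt hb.1
          have hab : (a:ℝ)*b ≤ Real.exp (T-A) := by
            refine le_trans ?_ h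
            have h1 : (a:ℝ) ≤ 2*2^i := by exact_mod_cast ha.2
            have h2 : (b:ℝ) ≤ 2*2^j := by exact_mod_cast hb.2
            exact (mul_le_mul h1 h2 hb0.le (by positivity)).trans_eq (by ring)
          have := Real.log_le_log (by positivity) hab
          rw [Real.log_mul ha0.ne' hb0.ne', Real.log_exp] at this
          rw [hA _ (le_trans (by linarith) (neg_le_abs _)), mul_zero]
      simp only [this, norm_zero, mul_zero, Finset.sum_const_zero]; positivity
    · push Not at hz
      have h := H (fun n => cof F n / n) (fun n => cof G n / n) (2^i) (2^j) Q T
      rw [hB]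
      refine h.trans (mul_le_mul_of_nonneg_left ?_ hC)
      have b1 := box_sq (F := F) (Finset.mem_range.1 hi) Q
      have b2 := box_sq (F := G) (Finset.mem_range.1 hj) Q
      rw [← hSF] at b1
      rw [← hSG] at b2
      have U0 : (0:ℝ) < U := by exact_mod_cast hU
      have m1 : (1:ℝ)/2^i ≤ u^2/2 := by
        have : (U:ℝ) < 2*2^i := by exact_mod_cast hz.1.1
        rw [div_le_iff₀ (by positivity)]; have := mul_le_mul_of_nonneg_left this.le (sq_nonneg u); linarith
      have m2 : (1:ℝ)/2^j ≤ u^2/2 := by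
        have : (U:ℝ) < 2*2^j := by exact_mod_cast hz.1.2
        rw [div_le_iff₀ (by positivity)]; have := mul_le_mul_of_nonneg_left this.le (sq_nonneg u); linarith
      have m3 : (1:ℝ)/2^i*(1/2^j) ≤ v^2 := by
        refine le_trans ?_ hvT
        rw [show A-T = -(T-A) by ring, Real.exp_neg, div_mul_div_comm, one_mul, div_le_iff₀ (by positivity), mul_assoc, ← div_eq_inv_mul, mul_div_assoc', le_div_iff₀ (Real.exp_pos _)]
        linarith [hz.2]
      have q0 : (0:ℝ) ≤ Q^2 := by positivity
      have P : (1+(Q:ℝ)^2*(1/2^i))*(1+(Q:ℝ)^2*(1/2^j)) ≤ (1 + Q*u + Q^2*v)^2 := by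
        have w1 := mul_le_mul_of_nonneg_left m1 q0
        have w2 := mul_le_mul_of_nonneg_left m2 q0
        have w3 := mul_le_mul_of_nonneg_left m3 (mul_nonneg q0 q0)
        have x1 : 0 ≤ (Q:ℝ)*u := by positivity
        have x2 : 0 ≤ (Q:ℝ)^2*v := by positivity
        have x3 : 0 ≤ (Q:ℝ)*u*((Q:ℝ)^2*v) := by positivity
        linarith
      refine Real.sqrt_le_iff.2 ⟨by positivity, ?_⟩
      rw [mul_pow, Real.sq_sqrt (by positivity)]
      refine (mul_le_mul b1 b2 (by positivity) (by positivity)).trans ?_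
      have := mul_le_mul_of_nonneg_right P (mul_nonneg hSF0 hSG0)
      linarith
  calc _ ≤ ∑ z ∈ ZQ Q, ∑ i ∈ Finset.range J, ∑ j ∈ Finset.range J, cz z * ‖B z i j‖ := by
        refine Finset.sum_le_sum fun z _ => ?_
        rw [e1]; simp_rw [← Finset.mul_sum]
        exact mul_le_mul_of_nonneg_left ((norm_sum_le _ _).trans (Finset.sum_le_sum fun i _ => norm_sum_le _ _)) (cz_nn z)
    _ = ∑ i ∈ Finset.range J, ∑ j ∈ Finset.range J, ∑ z ∈ ZQ Q, cz z * ‖B z i j‖ := by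
        rw [Finset.sum_comm]; exact Finset.sum_congr rfl fun i _ => Finset.sum_comm
    _ ≤ ∑ i ∈ Finset.range J, ∑ j ∈ Finset.range J, C * (3 * (1 + Q*u + Q^2*v) * Real.sqrt (SF*SG)) :=
        Finset.sum_le_sum fun i hi => Finset.sum_le_sum fun j hj => hbox i hi j hj
    _ = _ := by simp only [Finset.sum_const, Finset.card_range, nsmul_eq_mul]; ring
end

section
open Complex MeasureTheory Filter Topology
open scoped ArithmeticFunction.vonMangoldt ArithmeticFunction.Moebius ArithmeticFunction.zeta
lemma div_sum (f : ℕ → ℝ) (h0 : ∀ n, 0 ≤ f n) (hm : ∀ a b, f (a*b) ≤ f a * f b) (X : ℕ) :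
    ∑ n ∈ Finset.Ioc 0 X, n.divisors.card * f n / n ≤ (∑ n ∈ Finset.Ioc 0 X, f n / n)^2 := by
  obtain ⟨g, hg⟩ : ∃ g : ArithmeticFunction ℝ, ∀ n, g n = f n / n := ⟨⟨fun n => f n / n, by simp⟩, fun _ => rfl⟩
  have hg0 : ∀ n, 0 ≤ g n := fun n => by rw [hg]; exact div_nonneg (h0 n) (Nat.cast_nonneg n)
  have h1 : ∑ n ∈ Finset.Ioc 0 X, n.divisors.card * f n / n ≤ ∑ n ∈ Finset.Ioc 0 X, (g*g) n := by
    refine Finset.sum_le_sum fun n _ => ?_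
    rw [ArithmeticFunction.mul_apply, Nat.sum_divisorsAntidiagonal (fun a b => g a * g b), mul_div_assoc, ← nsmul_eq_mul]
    refine Finset.card_nsmul_le_sum _ _ _ fun d hd => ?_
    have hdn := Nat.mul_div_cancel' (Nat.dvd_of_mem_divisors hd)
    simp only [hg, div_mul_div_comm]
    rw [← Nat.cast_mul, hdn]
    refine div_le_div_of_nonneg_right ?_ (Nat.cast_nonneg n)
    conv_lhs => rw [← hdn]
    exact hm _ _
  refine h1.trans ?_
  rw [ArithmeticFunction.sum_Ioc_mul_eq_sum_prod_filter, sq, Finset.sum_mul_sum, ← Finset.sum_product']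
  simp only [← hg]
  exact Finset.sum_le_sum_of_subset_of_nonneg (Finset.filter_subset _ _) fun _ _ _ => mul_nonneg (hg0 _) (hg0 _)
lemma harm (J : ℕ) : ∑ n ∈ (Finset.Ioc 0 (2^J) : Finset ℕ), (1:ℝ) / n ≤ 1 + J := by
  induction J with
  | zero => rw [pow_zero, sum_Ioc0]; simp
  | succ n ih =>
    rw [pow_succ, mul_comm (2^n) 2, ← Finset.sum_Ioc_consecutive _ (Nat.zero_le _) (show 2^n ≤ 2*2^n by omega)]
    have : ∑ m ∈ (Finset.Ioc (2^n) (2*2^n) : Finset ℕ), (1:ℝ) / m ≤ ∑ m ∈ (Finset.Ioc (2^n) (2*2^n) : Finset ℕ), (1:ℝ) / 2^n := by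
      refine Finset.sum_le_sum fun m hm => one_div_le_one_div_of_le (by positivity) ?_
      exact_mod_cast (Finset.mem_Ioc.1 hm).1.le
    rw [two_mul] at this ⊢
    rw [Finset.sum_const, Nat.card_Ioc, Nat.add_sub_cancel, nsmul_eq_mul] at this
    push_cast at this ⊢
    rw [mul_one_div, div_self (by positivity)] at this
    linarith
lemma div2_sum (J : ℕ) : ∑ n ∈ (Finset.Ioc 0 (2^J) : Finset ℕ), (n.divisors.card:ℝ)^2 / n ≤ (1+J)^4 := by
  have h1 := div_sum (fun n => n.divisors.card) (fun _ => by positivity)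
    (fun a b => by rw [Nat.divisors_mul]; exact_mod_cast Finset.card_mul_le) (2^J)
  have h2 := div_sum (fun _ => 1) (fun _ => by positivity) (fun a b => by simp) (2^J)
  have h3 := harm J
  simp only [mul_one] at h2
  have h5 : 0 ≤ ∑ n ∈ (Finset.Ioc 0 (2^J) : Finset ℕ), (1:ℝ) / n := Finset.sum_nonneg fun _ _ => by positivity
  have h6 : 0 ≤ ∑ n ∈ (Finset.Ioc 0 (2^J) : Finset ℕ), (n.divisors.card:ℝ) / n := Finset.sum_nonneg fun _ _ => by positivity
  calc _ = ∑ n ∈ (Finset.Ioc 0 (2^J) : Finset ℕ), (n.divisors.card:ℝ) * n.divisors.card / n := by simp only [sq]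
    _ ≤ _ := h1
    _ ≤ ((1+J)^2)^2 := pow_le_pow_left₀ h6 (h2.trans (pow_le_pow_left₀ h5 h3 2)) 2
    _ = _ := by ring
lemma mu_zeta_bd (U n : ℕ) : |(trg (μ : ArithmeticFunction ℝ) U * (ζ : ArithmeticFunction ℝ)) n| ≤ n.divisors.card := by
  rw [ArithmeticFunction.mul_apply, ← Nat.map_div_right_divisors, Finset.sum_map]
  refine (Finset.abs_sum_le_sum_abs _ _).trans ((Finset.sum_le_card_nsmul _ _ 1 fun d _ => ?_).trans_eq (by simp))
  rw [abs_mul]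
  refine mul_le_one₀ ?_ (abs_nonneg _) ?_
  · change |if _ then _ else _| ≤ (1:ℝ)
    split_ifs
    · simp
    · rw [ArithmeticFunction.intCoe_apply]; exact_mod_cast ArithmeticFunction.abs_moebius_le_one
  · simp only [ArithmeticFunction.natCoe_apply, ArithmeticFunction.zeta_apply]; split_ifs <;> simp
lemma mu_zeta_z (U n : ℕ) (h : n ≤ U) : (trg (μ : ArithmeticFunction ℝ) U * (ζ : ArithmeticFunction ℝ)) n = 0 := by
  rw [ArithmeticFunction.mul_apply]
  refine Finset.sum_eq_zero fun x hx => ?_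
  have h1 := Nat.fst_mem_divisors_of_mem_antidiagonal hx
  have : trg (μ : ArithmeticFunction ℝ) U x.1 = 0 := if_pos ((Nat.divisor_le h1).trans h)
  rw [this, zero_mul]
lemma mu_lam_sum (U X : ℕ) : ∑ a ∈ Finset.Ioc 0 X, |(trl (μ : ArithmeticFunction ℝ) U * trl Λ U) a| ≤ U * (U * Real.log X) := by
  rcases Nat.eq_zero_or_pos X with rfl | hX
  · simp
  have hU : ∀ x, |trl (μ : ArithmeticFunction ℝ) U x| ≤ if x ≤ U then 1 else 0 := by
    intro x
    change |if _ then _ else _| ≤ _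
    split_ifs
    · rw [ArithmeticFunction.intCoe_apply]; exact_mod_cast ArithmeticFunction.abs_moebius_le_one
    · simp
  have hL : ∀ a ∈ Finset.Ioc 0 X, |(trl (μ : ArithmeticFunction ℝ) U * trl Λ U) a| ≤ if a ≤ U*U then Real.log X else 0 := by
    intro a ha
    rw [Finset.mem_Ioc] at ha
    rw [ArithmeticFunction.mul_apply]
    split_ifs with h
    · refine (Finset.abs_sum_le_sum_abs _ _).trans ?_
      have h1 : ∑ x ∈ a.divisorsAntidiagonal, |trl (μ : ArithmeticFunction ℝ) U x.1 * trl Λ U x.2| ≤ ∑ x ∈ a.divisorsAntidiagonal, Λ x.2 := by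
        refine Finset.sum_le_sum fun x _ => ?_
        rw [abs_mul]
        have h3 : |trl Λ U x.2| ≤ Λ x.2 := by
          change |if _ then _ else _| ≤ _
          split_ifs
          · rw [abs_of_nonneg ArithmeticFunction.vonMangoldt_nonneg]
          · simp [ArithmeticFunction.vonMangoldt_nonneg]
        exact (mul_le_mul ((hU x.1).trans (by split_ifs <;> norm_num)) h3 (abs_nonneg _) zero_le_one).trans_eq (one_mul _)
      refine h1.trans ?_
      rw [Nat.sum_divisorsAntidiagonal' (fun _ b => Λ b), ArithmeticFunction.vonMangoldt_sum]
      exact Real.log_le_log (by exact_mod_cast ha.1) (by exact_mod_cast ha.2)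
    · rw [Finset.sum_eq_zero, abs_zero]
      intro x hx
      have h2 := (Nat.mem_divisorsAntidiagonal.1 hx).1
      by_cases h1 : x.1 ≤ U
      · have : ¬ x.2 ≤ U := fun h3 => h (h2 ▸ Nat.mul_le_mul h1 h3)
        have : trl Λ U x.2 = 0 := if_neg this
        rw [this, mul_zero]
      · have : trl (μ : ArithmeticFunction ℝ) U x.1 = 0 := if_neg h1
        rw [this, zero_mul]
  refine (Finset.sum_le_sum hL).trans ?_
  rw [← Finset.sum_filter, Finset.sum_const, nsmul_eq_mul, ← mul_assoc]
  refine mul_le_mul_of_nonneg_right ?_ (Real.log_natCast_nonneg X)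
  have : (Finset.filter (fun a => a ≤ U*U) (Finset.Ioc 0 X)).card ≤ (Finset.Ioc 0 (U*U)).card :=
    Finset.card_le_card fun a ha => by simp only [Finset.mem_filter, Finset.mem_Ioc] at ha ⊢; exact ⟨ha.1.1, ha.2⟩
  rw [Nat.card_Ioc, Nat.sub_zero] at this
  exact_mod_cast this
lemma mu_sum (U X : ℕ) : ∑ a ∈ Finset.Ioc 0 X, |trl (μ : ArithmeticFunction ℝ) U a| ≤ U := by
  have hU : ∀ x ∈ Finset.Ioc 0 X, |trl (μ : ArithmeticFunction ℝ) U x| ≤ if x ≤ U then 1 else 0 := by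
    intro x _
    change |if _ then _ else _| ≤ _
    split_ifs
    · rw [ArithmeticFunction.intCoe_apply]; exact_mod_cast ArithmeticFunction.abs_moebius_le_one
    · simp
  refine (Finset.sum_le_sum hU).trans ?_
  rw [← Finset.sum_filter, Finset.sum_const, nsmul_eq_mul, mul_one]
  have : (Finset.filter (fun a => a ≤ U) (Finset.Ioc 0 X)).card ≤ (Finset.Ioc 0 U).card :=
    Finset.card_le_card fun a ha => by simp only [Finset.mem_filter, Finset.mem_Ioc] at ha ⊢; exact ⟨ha.1.1, ha.2⟩
  rw [Nat.card_Ioc, Nat.sub_zero] at this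
  exact_mod_cast this
lemma abel_g (g G : ℕ → ℝ) (hG : ∀ n, G (n+1) = G n + g n) (R D : ℕ) (h : R ≤ D) :
    ∑ k ∈ Finset.Ico R D, g k / (k+1) = ∑ j ∈ Finset.Ico R D, G (j+1) / ((j+1)*(j+2)) + G D / (D+1) - G R / (R+1) := by
  induction D, h using Nat.le_induction with
  | base => simp
  | succ n hn ih =>
    rw [Finset.sum_Ico_succ_top hn, Finset.sum_Ico_succ_top hn, ih, hG n]
    push_cast
    field_simp
    ring
lemma abel_bd (g G : ℕ → ℝ) (hg : ∀ n, 0 ≤ g n) (hG0 : G 0 = 0) (hG : ∀ n, G (n+1) = G n + g n) (R D J : ℕ) (h : R ≤ D) (hR : 1 ≤ R) (hJ : D ≤ 2^J) (K u v : ℝ)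
    (hK : 0 ≤ K) (hu : 0 ≤ u) (hv : 0 ≤ v) (hb : ∀ Q ≤ D, G Q ≤ K*(1+Q*u+Q^2*v)) :
    ∑ k ∈ Finset.Ico R D, g k / (k+1) ≤ K*(2/R + u*(2+J) + 2*D*v) := by
  have hGn : ∀ n, 0 ≤ G n := fun n => by
    induction n with
    | zero => exact hG0.ge
    | succ n ih => rw [hG]; exact add_nonneg ih (hg n)
  rw [abel_g g G hG R D h]
  have hR0 : (0:ℝ) < R := by exact_mod_cast hR
  have hRD : (R:ℝ) ≤ D := by exact_mod_cast h
  have h1 : ∑ j ∈ Finset.Ico R D, G (j+1) / ((j+1)*(j+2)) ≤ ∑ j ∈ Finset.Ico R D, K*((1/((j:ℝ)+1) - 1/((j+1:ℕ)+1:ℝ)) + u * (1/(j+1:ℕ)) + v) := by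
    refine Finset.sum_le_sum fun j hj => ?_
    rw [div_le_iff₀ (by positivity)]
    refine (hb (j+1) (Finset.mem_Ico.1 hj).2).trans ?_
    rw [mul_assoc]
    refine mul_le_mul_of_nonneg_left ?_ hK
    push_cast
    have : (1/((j:ℝ)+1) - 1/((j:ℝ)+1+1) + u*(1/((j:ℝ)+1)) + v) * (((j:ℝ)+1)*(j+2)) = 1 + u*(j+2) + v*((j+1)*(j+2)) := by field_simp; ring
    rw [this]
    nlinarith [mul_nonneg hv (by positivity : (0:ℝ) ≤ j+1)]
  have h2 : G D / (D+1) ≤ K*(1/R + u + D*v) := by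
    rw [div_le_iff₀ (by positivity)]
    refine (hb D le_rfl).trans ?_
    rw [mul_assoc]
    refine mul_le_mul_of_nonneg_left ?_ hK
    have : 1 ≤ 1/(R:ℝ)*(D+1) := by rw [one_div_mul_eq_div, le_div_iff₀ hR0]; linarith
    have hD0 : (0:ℝ) ≤ D := by positivity
    nlinarith [mul_nonneg hD0 hv]
  have h3 : ∑ j ∈ Finset.Ico R D, (1/((j:ℝ)+1) - 1/((j+1:ℕ)+1:ℝ)) ≤ 1/R := by
    have : ∀ D, R ≤ D → ∑ j ∈ Finset.Ico R D, (1/((j:ℝ)+1) - 1/((j+1:ℕ)+1:ℝ)) = 1/((R:ℝ)+1) - 1/((D:ℝ)+1) := by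
      intro D h
      induction D, h using Nat.le_induction with
      | base => simp
      | succ n hn ih => rw [Finset.sum_Ico_succ_top hn, ih]; push_cast; ring
    rw [this D h]
    have a1 : 1/((R:ℝ)+1) ≤ 1/R := one_div_le_one_div_of_le hR0 (by linarith)
    have a2 : 0 ≤ 1/((D:ℝ)+1) := by positivity
    linarith
  have h4 : ∑ j ∈ Finset.Ico R D, (1:ℝ)/(j+1:ℕ) ≤ 1+J := by
    refine le_trans ?_ (harm J)
    rw [sum_Ioc0 (fun n : ℕ => (1:ℝ)/n)]
    refine Finset.sum_le_sum_of_subset_of_nonneg (fun j hj => Finset.mem_range.2 ((Finset.mem_Ico.1 hj).2.trans_le hJ)) fun _ _ _ => by positivity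
  rw [← Finset.mul_sum, Finset.sum_add_distrib, Finset.sum_add_distrib, ← Finset.mul_sum, Finset.sum_const, Nat.card_Ico, nsmul_eq_mul] at h1
  have h5 : ((D-R:ℕ):ℝ) * v ≤ D*v := mul_le_mul_of_nonneg_right (by exact_mod_cast Nat.sub_le D R) hv
  have h6 := mul_le_mul_of_nonneg_left h4 hu
  have h7 : ∑ j ∈ Finset.Ico R D, (1/((j:ℝ)+1) - 1/((j+1:ℕ)+1:ℝ)) + u * ∑ j ∈ Finset.Ico R D, (1:ℝ)/(j+1:ℕ) + ((D-R:ℕ):ℝ)*v ≤ 1/R + u*(1+J) + D*v := by linarith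
  have h8 := mul_le_mul_of_nonneg_left h7 hK
  have h9 : 0 ≤ G R / (R+1) := div_nonneg (hGn R) (by positivity)
  have h10 : K*(2/R + u*(2+J) + 2*D*v) = K*(1/R + u*(1+J) + D*v) + K*(1/R + u + D*v) := by ring
  linarith
end

section
open Complex MeasureTheory Filter Topology
open scoped ArithmeticFunction.vonMangoldt ArithmeticFunction.Moebius ArithmeticFunction.zeta
open scoped Classical in
noncomputable def prims (k : ℕ) : Finset (DirichletCharacter ℂ (k+1)) := Finset.univ.filter fun χ => χ.IsPrimitive
noncomputable def PC (φ : ℝ → ℂ) (T : ℝ) {q : ℕ} (χ : DirichletCharacter ℂ q) : ℂ := ∑' n : ℕ, χ n * Λ n / n * φ (Real.log n - T)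
noncomputable def ch (φ : ℝ → ℂ) (T : ℝ) (X : ℕ) (F : ArithmeticFunction ℝ) (k : ℕ) : ℝ :=
  ∑ χ ∈ prims k, cz ⟨k, χ⟩ * ‖WS φ T X (fun n => χ n) (cof F)‖
lemma ch_nn (φ : ℝ → ℂ) (T : ℝ) (X : ℕ) (F : ArithmeticFunction ℝ) (k : ℕ) : 0 ≤ ch φ T X F k :=
  Finset.sum_nonneg fun _ _ => mul_nonneg (cz_nn _) (norm_nonneg _)
lemma PC_WS {φ : ℝ → ℂ} {A T : ℝ} (hA : ∀ v, A ≤ |v| → φ v = 0) {X : ℕ} (hX : Real.exp (T+A) ≤ X) {q : ℕ} (χ : DirichletCharacter ℂ q) :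
    PC φ T χ = WS φ T X (fun n => χ n) (cof Λ) := by
  rw [PC, WS, tsum_eq_sum (s := Finset.Ioc 0 X)]
  · exact Finset.sum_congr rfl fun n _ => by simp only [cof]; ring
  · intro n hn
    rcases Nat.eq_zero_or_pos n with rfl | h
    · simp
    · rw [phi_zero hA hX (by rw [Finset.mem_Ioc] at hn; omega), mul_zero]
lemma prims_card (k : ℕ) : ((prims k).card : ℝ) ≤ (k+1).totient := by
  have h : (prims k).card ≤ (k+1).totient := by
    refine (Finset.card_le_univ _).trans_eq ?_
    rw [← Nat.card_eq_fintype_card]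
    exact DirichletCharacter.card_eq_totient_of_hasEnoughRootsOfUnity ℂ (k+1)
  exact_mod_cast h
lemma prims_p {k : ℕ} {χ : DirichletCharacter ℂ (k+1)} (h : χ ∈ prims k) : χ.IsPrimitive := by
  classical
  simpa [prims] using h
lemma prims_ne {k : ℕ} (hk : 1 ≤ k) {χ : DirichletCharacter ℂ (k+1)} (h : χ ∈ prims k) : χ ≠ 1 := by
  rintro rfl
  have := prims_p h
  rw [DirichletCharacter.isPrimitive_def, DirichletCharacter.conductor_one] at this
  omega
lemma ch_bd (φ : ℝ → ℂ) (T : ℝ) (X : ℕ) (F : ArithmeticFunction ℝ) (k : ℕ) (B : ℝ)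
    (h : ∀ χ ∈ prims k, ‖WS φ T X (fun n => χ n) (cof F)‖ ≤ B) (hB : 0 ≤ B) : ch φ T X F k ≤ (k+1) * B := by
  have ht : (0:ℝ) < (k+1).totient := by exact_mod_cast Nat.totient_pos.2 (Nat.succ_pos k)
  refine (Finset.sum_le_card_nsmul _ _ (cz ⟨k, 1⟩ * B) fun χ hχ => mul_le_mul_of_nonneg_left (h χ hχ) (cz_nn _)).trans ?_
  rw [nsmul_eq_mul]
  refine (mul_le_mul_of_nonneg_right (prims_card k) (mul_nonneg (cz_nn _) hB)).trans_eq ?_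
  rw [cz]
  push_cast
  field_simp
lemma WS_add (φ : ℝ → ℂ) (T : ℝ) (X : ℕ) (χ : ℕ → ℂ) (F G : ArithmeticFunction ℝ) : WS φ T X χ (cof (F+G)) = WS φ T X χ (cof F) + WS φ T X χ (cof G) := by
  simp only [WS, ← Finset.sum_add_distrib]
  exact Finset.sum_congr rfl fun n _ => by simp only [cof, ArithmeticFunction.add_apply]; push_cast; ring
lemma WS_sub (φ : ℝ → ℂ) (T : ℝ) (X : ℕ) (χ : ℕ → ℂ) (F G : ArithmeticFunction ℝ) : WS φ T X χ (cof (F-G)) = WS φ T X χ (cof F) - WS φ T X χ (cof G) := by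
  simp only [WS, ← Finset.sum_sub_distrib]
  refine Finset.sum_congr rfl fun n _ => ?_
  have : (F-G) n = F n - G n := by rw [sub_eq_add_neg, ArithmeticFunction.add_apply, ArithmeticFunction.neg_apply, sub_eq_add_neg]
  simp only [cof, this]; push_cast; ring
lemma ch_I {φ : ℝ → ℂ} (hφ : ContDiff ℝ (⊤ : ℕ∞) φ) (hc : HasCompactSupport φ) {A : ℝ} (hA0 : 0 < A) (hA : ∀ v, A ≤ |v| → φ v = 0) :
    ∃ C : ℝ, 0 ≤ C ∧ ∀ (T : ℝ) (X U k : ℕ), Real.exp (T+A) ≤ X → Real.log U + A ≤ T → 1 ≤ k →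
      ch φ T X Λ k ≤ ch φ T X ((trg (μ : ArithmeticFunction ℝ) U * ζ) * trg Λ U) k + C * (k+1)^2 * Real.exp (-T) * (U^2 * (1+|T|+Real.log X)) := by
  obtain ⟨C, hC, H⟩ := WS_I hφ hc hA0 hA
  refine ⟨2*C, by positivity, fun T X U k hX hU hk => ?_⟩
  obtain ⟨M, hM⟩ : ∃ M, M = 2*C*(k+1)*Real.exp (-T)*(U^2*(1+|T|+Real.log X)) := ⟨_, rfl⟩
  have hlX := Real.log_natCast_nonneg X
  have hM0 : 0 ≤ M := by rw [hM]; positivity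
  obtain ⟨V, hV⟩ : ∃ V, V = (trg (μ : ArithmeticFunction ℝ) U * ζ) * trg Λ U := ⟨_, rfl⟩
  have key : ∀ χ ∈ prims k, ‖WS φ T X (fun n => χ n) (cof Λ)‖ ≤ ‖WS φ T X (fun n => χ n) (cof V)‖ + M := by
    intro χ hχ
    have h0 : WS φ T X (fun n => χ n) (cof (trl Λ U)) = 0 := by
      refine Finset.sum_eq_zero fun n hn => ?_
      by_cases h : n ≤ U
      · have hn0 : (0:ℝ) < n := by exact_mod_cast (Finset.mem_Ioc.1 hn).1
        have h1 : Real.log n ≤ Real.log U := Real.log_le_log hn0 (by exact_mod_cast h)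
        rw [hA _ (le_trans (by linarith) (neg_le_abs _)), mul_zero]
      · have : cof (trl Λ U) n = 0 := by simp only [cof, ofReal_eq_zero]; exact if_neg h
        simp [this]
    have e := congrArg (fun F => WS φ T X (fun n => χ n) (cof F)) (vaughan U)
    simp only [WS_add, WS_sub, h0, zero_add] at e
    rw [← hV] at e
    obtain ⟨b1, -⟩ := H (k+1) χ (prims_ne hk hχ) T X hX (trl (μ : ArithmeticFunction ℝ) U * trl Λ U)
    obtain ⟨-, b2⟩ := H (k+1) χ (prims_ne hk hχ) T X hX (trl (μ : ArithmeticFunction ℝ) U)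
    have c0 : 0 ≤ C * ((k+1:ℕ):ℝ) * Real.exp (-T) := by positivity
    have c1 := mul_le_mul_of_nonneg_left (mu_lam_sum U X) c0
    have c2 := mul_le_mul_of_nonneg_left (mu_sum U X) (mul_nonneg c0 (by positivity : 0 ≤ 1+|T|+Real.log X))
    have hUU : (U:ℝ) ≤ U^2 := by
      rcases Nat.eq_zero_or_pos U with h | h
      · simp [h]
      · exact le_self_pow₀ (by exact_mod_cast h) (by norm_num)
    have c3 : C * ((k+1:ℕ):ℝ) * Real.exp (-T) * (U*(U*Real.log X)) ≤ C * ((k+1:ℕ):ℝ) * Real.exp (-T) * (U^2 * (1+|T|+Real.log X)) := by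
      refine mul_le_mul_of_nonneg_left ?_ c0
      rw [← mul_assoc, ← sq]
      exact mul_le_mul_of_nonneg_left (by linarith [abs_nonneg T]) (by positivity)
    have c4 : C * ((k+1:ℕ):ℝ) * Real.exp (-T) * (1+|T|+Real.log X) * U ≤ C * ((k+1:ℕ):ℝ) * Real.exp (-T) * (U^2 * (1+|T|+Real.log X)) := by
      rw [mul_assoc _ _ (U:ℝ), mul_comm _ (U:ℝ)]
      exact mul_le_mul_of_nonneg_left (mul_le_mul_of_nonneg_right hUU (by positivity)) c0
    rw [e]
    refine (norm_add_le _ _).trans ?_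
    have := norm_sub_le (WS φ T X (fun n => χ n) (cof (trl (μ : ArithmeticFunction ℝ) U * ArithmeticFunction.log))) (WS φ T X (fun n => χ n) (cof (trl (μ : ArithmeticFunction ℝ) U * trl Λ U * ζ)))
    have hM' : M = C * ((k+1:ℕ):ℝ) * Real.exp (-T) * (U^2 * (1+|T|+Real.log X)) + C * ((k+1:ℕ):ℝ) * Real.exp (-T) * (U^2 * (1+|T|+Real.log X)) := by
      rw [hM]; push_cast; ring
    linarith
  have ht : (0:ℝ) < (k+1).totient := by exact_mod_cast Nat.totient_pos.2 (Nat.succ_pos k)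
  rw [← hV, ch, ch]
  refine (Finset.sum_le_sum fun χ hχ => mul_le_mul_of_nonneg_left (key χ hχ) (cz_nn _)).trans ?_
  simp only [mul_add, Finset.sum_add_distrib]
  refine add_le_add le_rfl ?_
  refine (Finset.sum_le_card_nsmul _ _ (cz ⟨k, 1⟩ * M) fun χ hχ => le_rfl).trans ?_
  rw [nsmul_eq_mul]
  refine (mul_le_mul_of_nonneg_right (prims_card k) (mul_nonneg (cz_nn _) hM0)).trans_eq ?_
  rw [cz, hM]
  push_cast
  field_simp
lemma ch_small {φ : ℝ → ℂ} (hφ : ContDiff ℝ (⊤ : ℕ∞) φ) (hc : HasCompactSupport φ) {A : ℝ} (hA : ∀ v, A ≤ |v| → φ v = 0) (m : ℕ) :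
    ∃ C : ℝ, 0 ≤ C ∧ ∀ (T : ℝ) (X R : ℕ), 0 < T → Real.exp (T+A) ≤ X → ∑ k ∈ Finset.Ico 1 R, ch φ T X Λ k / (k+1) ≤ C * R^2 / T^m := by
  obtain ⟨C, hC, H⟩ := prime_chi hφ hc m one_pos
  refine ⟨C, hC, fun T X R hT hX => ?_⟩
  have : ∀ k ∈ Finset.Ico 1 R, ch φ T X Λ k / (k+1) ≤ C * R / T^m := by
    intro k hk
    rw [Finset.mem_Ico] at hk
    rw [div_le_iff₀' (by positivity)]
    refine ch_bd _ _ _ _ _ _ (fun χ hχ => ?_) (by positivity)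
    rw [← PC_WS hA hX, le_div_iff₀ (by positivity)]
    have := H (k+1) χ (prims_p hχ) (prims_ne hk.1 hχ) T
    rw [abs_of_pos hT, Real.rpow_one] at this
    exact this.trans (mul_le_mul_of_nonneg_left (by exact_mod_cast hk.2) hC)
  refine (Finset.sum_le_card_nsmul _ _ _ this).trans ?_
  rw [nsmul_eq_mul, Nat.card_Ico, sq, mul_div_assoc', ← mul_assoc C, mul_comm (C*R) (R:ℝ)]
  refine div_le_div_of_nonneg_right (mul_le_mul_of_nonneg_right ?_ (by positivity)) (by positivity)
  exact_mod_cast Nat.sub_le R 1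
lemma ch_II {φ : ℝ → ℂ} (hφ : ContDiff ℝ (⊤ : ℕ∞) φ) (hc : HasCompactSupport φ) {A : ℝ} (hA : ∀ v, A ≤ |v| → φ v = 0) :
    ∃ C : ℝ, 0 ≤ C ∧ ∀ (T u v : ℝ) (J U R D : ℕ), 0 ≤ u → 0 ≤ v → Real.exp (T+A) ≤ (2^J:ℕ) → 1 ≤ U → 4 ≤ u^2*U → 4*Real.exp (A-T) ≤ v^2 →
      1 ≤ R → R ≤ D → D ≤ 2^J →
      ∑ k ∈ Finset.Ico R D, ch φ T (2^J) ((trg (μ : ArithmeticFunction ℝ) U * ζ) * trg Λ U) k / (k+1) ≤ C * (1+J)^6 * (2/R + u*(2+J) + 2*D*v) := by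
  obtain ⟨C, hC, H⟩ := tII hφ hc hA
  refine ⟨C, hC, fun T u v J U R D hu hv hX hU hu2 hv2 hR hRD hDJ => ?_⟩
  refine abel_bd _ (fun Q => ∑ k ∈ Finset.range Q, ch φ T (2^J) ((trg (μ : ArithmeticFunction ℝ) U * ζ) * trg Λ U) k) (fun _ => ch_nn _ _ _ _ _) (by simp)
    (fun n => Finset.sum_range_succ _ _) R D J hRD hR hDJ _ u v (by positivity) hu hv (fun Q _ => ?_)
  have h := H J Q U T u v (trg (μ : ArithmeticFunction ℝ) U * ζ) (trg Λ U) hu hv hX hU hu2 hv2 (fun n hn => mu_zeta_z U n hn) (fun n hn => if_pos hn)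
  rw [ZQ, Finset.sum_sigma] at h
  refine h.trans ?_
  refine mul_le_mul_of_nonneg_right ?_ (by positivity)
  have s1 : ∑ n ∈ Finset.Ioc 0 (2^J), ((trg (μ : ArithmeticFunction ℝ) U * (ζ : ArithmeticFunction ℝ)) n)^2 / n ≤ (1+J)^4 := by
    refine le_trans (Finset.sum_le_sum fun n _ => ?_) (div2_sum J)
    refine div_le_div_of_nonneg_right ?_ (Nat.cast_nonneg n)
    rw [← sq_abs]
    exact pow_le_pow_left₀ (abs_nonneg _) (mu_zeta_bd U n) 2
  have s2 : ∑ n ∈ Finset.Ioc 0 (2^J), (trg Λ U n)^2 / n ≤ (1+J)^4 := by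
    have : ∀ n ∈ Finset.Ioc 0 (2^J), (trg Λ U n)^2 / n ≤ (J:ℝ)^2 * (1/n) := by
      intro n hn
      rw [Finset.mem_Ioc] at hn
      rw [mul_one_div]
      refine div_le_div_of_nonneg_right ?_ (Nat.cast_nonneg n)
      have h1 : Λ n ≤ J := by
        refine ArithmeticFunction.vonMangoldt_le_log.trans ((Real.log_le_log (by exact_mod_cast hn.1) (by exact_mod_cast hn.2 : (n:ℝ) ≤ 2^J)).trans ?_)
        rw [Real.log_pow]
        exact mul_le_of_le_one_right (Nat.cast_nonneg J) (by linarith [Real.log_two_lt_d9])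
      have h2 : trg Λ U n = if n ≤ U then 0 else Λ n := rfl
      rw [h2]
      split_ifs
      · rw [zero_pow two_ne_zero]; positivity
      · exact pow_le_pow_left₀ ArithmeticFunction.vonMangoldt_nonneg h1 2
    refine (Finset.sum_le_sum this).trans ?_
    rw [← Finset.mul_sum]
    refine (mul_le_mul_of_nonneg_left (harm J) (by positivity)).trans ?_
    have hJ : (0:ℝ) ≤ J := Nat.cast_nonneg J
    nlinarith [pow_nonneg hJ 2, pow_nonneg hJ 3, pow_nonneg hJ 4]
  have s3 : Real.sqrt ((∑ n ∈ Finset.Ioc 0 (2^J), ((trg (μ : ArithmeticFunction ℝ) U * (ζ : ArithmeticFunction ℝ)) n)^2 / n) * ∑ n ∈ Finset.Ioc 0 (2^J), (trg Λ U n)^2 / n) ≤ (1+J)^4 := by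
    refine Real.sqrt_le_iff.2 ⟨by positivity, ?_⟩
    rw [sq]
    exact mul_le_mul s1 s2 (Finset.sum_nonneg fun _ _ => by positivity) (by positivity)
  have s4 : (J:ℝ)^2 ≤ (1+J)^2 := pow_le_pow_left₀ (Nat.cast_nonneg J) (by linarith) 2
  calc _ ≤ C * (1+J)^2 * (1+J)^4 := mul_le_mul (mul_le_mul_of_nonneg_left s4 hC) s3 (Real.sqrt_nonneg _) (by positivity)
    _ = _ := by ring
end

section
open Complex MeasureTheory Filter Topology
open scoped ArithmeticFunction.vonMangoldt ArithmeticFunction.Moebius ArithmeticFunction.zeta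
lemma exp_pow_bd (c : ℝ) (hc : 0 < c) (m : ℕ) : ∃ C : ℝ, 0 ≤ C ∧ ∀ T : ℝ, 0 < T → Real.exp (-(c*T)) ≤ C / T^m := by
  refine ⟨m.factorial / c^m, by positivity, fun T hT => ?_⟩
  have h := Real.pow_div_factorial_le_exp (c*T) (by positivity) m
  rw [Real.exp_neg, div_div, inv_eq_one_div, div_le_div_iff₀ (Real.exp_pos _) (by positivity), one_mul, ← mul_pow]
  rwa [div_le_iff₀' (by positivity)] at h
set_option maxHeartbeats 1000000 in
lemma BVc {φ : ℝ → ℂ} (hφ : ContDiff ℝ (⊤ : ℕ∞) φ) (hc : HasCompactSupport φ) {ε : ℝ} (hε : 0 < ε) (hε1 : ε ≤ 1/2) (m : ℕ) :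
    ∃ C T₀ : ℝ, 0 ≤ C ∧ 1 ≤ T₀ ∧ ∀ T, T₀ ≤ T → ∀ D : ℕ, (D:ℝ) ≤ Real.exp ((1/2-ε)*T) →
      ∑ k ∈ Finset.Ico 1 D, (∑ χ ∈ prims k, ‖PC φ T χ‖) / (k+1).totient ≤ C / T^m := by
  obtain ⟨A, hA0, hA⟩ := supp_bd hc
  obtain ⟨C₁, hC₁, H1⟩ := ch_I hφ hc hA0 hA
  obtain ⟨C₂, hC₂, H2⟩ := ch_small hφ hc hA (2*(m+7)+m)
  obtain ⟨C₃, hC₃, H3⟩ := ch_II hφ hc hA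
  obtain ⟨C₄, hC₄, H4⟩ := exp_pow_bd (ε/8) (by positivity) (m+7)
  refine ⟨4*C₂ + C₁*4*20*C₄ + C₃*9^6*(2+30*C₄+4*Real.exp (A/2)*C₄), max 4 (2*A+4), by positivity, le_trans (by norm_num) (le_max_left _ _), fun T hT D hD => ?_⟩
  have hT1 : 4 ≤ T := (le_max_left _ _).trans hT
  have hTA : 2*A+4 ≤ T := (le_max_right _ _).trans hT
  have hT0 : 0 < T := by linarith
  have hεT : 0 < ε*T := mul_pos hε hT0
  have hεT1 : ε*T ≤ 1/2*T := mul_le_mul_of_nonneg_right hε1 hT0.le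
  obtain ⟨J, hJ⟩ : ∃ J, J = ⌈2*(T+A)⌉₊ := ⟨_, rfl⟩
  have hJ1 : 2*(T+A) ≤ J := by rw [hJ]; exact Nat.le_ceil _
  have hJ2 : (J:ℝ) ≤ 3*T := by rw [hJ]; have := Nat.ceil_lt_add_one (a := 2*(T+A)) (by positivity); linarith
  have hX : Real.exp (T+A) ≤ (2^J:ℕ) := by
    push_cast
    rw [← Real.rpow_natCast, Real.rpow_def_of_pos two_pos]
    have := Real.log_two_gt_d9
    have h3 := mul_nonneg (by linarith : 0 ≤ Real.log 2 - 1/2) (Nat.cast_nonneg (α := ℝ) J)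
    exact Real.exp_le_exp.2 (by linarith)
  have hlX : Real.log (2^J:ℕ) ≤ 3*T := by
    push_cast; rw [Real.log_pow]
    exact (mul_le_of_le_one_right (Nat.cast_nonneg J) (by linarith [Real.log_two_lt_d9])).trans hJ2
  obtain ⟨R, hR⟩ : ∃ R, R = ⌈T^(m+7)⌉₊ := ⟨_, rfl⟩
  have hTp : 1 ≤ T^(m+7) := one_le_pow₀ (by linarith)
  have hR1 : T^(m+7) ≤ R := by rw [hR]; exact Nat.le_ceil _
  have hR2 : (R:ℝ) ≤ 2*T^(m+7) := by rw [hR]; have := Nat.ceil_lt_add_one (a := T^(m+7)) (by positivity); linarith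
  have hR3 : 1 ≤ R := by exact_mod_cast hTp.trans hR1
  have key : ∑ k ∈ Finset.Ico 1 D, (∑ χ ∈ prims k, ‖PC φ T χ‖) / (k+1).totient = ∑ k ∈ Finset.Ico 1 D, ch φ T (2^J) Λ k / (k+1) := by
    refine Finset.sum_congr rfl fun k _ => ?_
    have ht : (0:ℝ) < (k+1).totient := by exact_mod_cast Nat.totient_pos.2 (Nat.succ_pos k)
    rw [ch]
    simp only [cz, ← PC_WS hA hX]
    rw [← Finset.mul_sum]
    push_cast
    field_simp
  rw [key]
  have small := H2 T (2^J) R hT0 hX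
  have small' : ∑ k ∈ Finset.Ico 1 R, ch φ T (2^J) Λ k / (k+1) ≤ 4*C₂ / T^m := by
    refine small.trans ?_
    rw [div_le_div_iff₀ (by positivity) (by positivity), pow_add, mul_comm 2 (m+7), pow_mul, ← mul_assoc]
    refine mul_le_mul_of_nonneg_right ?_ (by positivity)
    have := pow_le_pow_left₀ (Nat.cast_nonneg R) hR2 2
    have := mul_le_mul_of_nonneg_left this hC₂
    linarith
  have hnn : ∀ k : ℕ, 0 ≤ ch φ T (2^J) Λ k / (k+1) := fun k => div_nonneg (ch_nn _ _ _ _ _) (by positivity)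
  have hxx : 0 ≤ C₁*4*20*C₄ := by positivity
  have hyy : 0 ≤ C₃*9^6*(2+30*C₄+4*Real.exp (A/2)*C₄) := by positivity
  rcases le_total D R with hDR | hRD
  · refine (Finset.sum_le_sum_of_subset_of_nonneg (Finset.Ico_subset_Ico_right hDR) fun k _ _ => hnn k).trans (small'.trans ?_)
    exact div_le_div_of_nonneg_right (by linarith) (by positivity)
  obtain ⟨U, hU⟩ : ∃ U, U = ⌈Real.exp (ε/4*T)⌉₊ := ⟨_, rfl⟩
  have hE1 : 1 ≤ Real.exp (ε/4*T) := Real.one_le_exp (by positivity)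
  have hU1 : Real.exp (ε/4*T) ≤ U := by rw [hU]; exact Nat.le_ceil _
  have hU2 : (U:ℝ) ≤ 2*Real.exp (ε/4*T) := by rw [hU]; have := Nat.ceil_lt_add_one (a := Real.exp (ε/4*T)) (by positivity); linarith
  have hU3 : 1 ≤ U := by exact_mod_cast hE1.trans hU1
  have hlU : Real.log U + A ≤ T := by
    have h1 : Real.log U ≤ Real.log (2*Real.exp (ε/4*T)) := Real.log_le_log (by exact_mod_cast hU3) hU2
    rw [Real.log_mul (by norm_num) (by positivity), Real.log_exp] at h1
    have := Real.log_two_lt_d9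
    linarith
  have hDJ : D ≤ 2^J := by
    have : (D:ℝ) ≤ (2^J:ℕ) := hD.trans (le_trans (Real.exp_le_exp.2 (by linarith)) hX)
    exact_mod_cast this
  have big := H3 T (2*Real.exp (-(ε/8*T))) (2*Real.exp ((A-T)/2)) J U R D (by positivity) (by positivity) hX hU3
    (by
      rw [mul_pow, ← Real.exp_nat_mul]
      have : Real.exp ((2:ℕ)*(-(ε/8*T))) * Real.exp (ε/4*T) = 1 := by rw [← Real.exp_add, Real.exp_eq_one_iff]; push_cast; ring
      have h2 := mul_le_mul_of_nonneg_left hU1 (Real.exp_pos ((2:ℕ)*(-(ε/8*T)))).le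
      rw [this] at h2
      linarith)
    (by rw [mul_pow, ← Real.exp_nat_mul]; push_cast; rw [mul_div_cancel₀ _ (by norm_num)]; norm_num) hR3 hRD hDJ
  have e1 := H4 T hT0
  obtain ⟨P, hP⟩ : ∃ P, P = T^(m+7) := ⟨_, rfl⟩
  rw [← hP] at e1 hR1 hTp
  have hP0 : 0 < P := by linarith
  have f7 : T^7 / P = 1/T^m := by rw [hP, pow_add, div_eq_div_iff (by positivity) (by positivity)]; ring
  have hDv : (D:ℝ) * Real.exp ((A-T)/2) ≤ Real.exp (A/2) * (C₄/P) := by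
    refine (mul_le_mul_of_nonneg_right hD (Real.exp_pos _).le).trans ?_
    refine le_trans ?_ (mul_le_mul_of_nonneg_left e1 (Real.exp_pos _).le)
    rw [← Real.exp_add, ← Real.exp_add]
    exact Real.exp_le_exp.2 (by linarith)
  have bigb : ∑ k ∈ Finset.Ico R D, ch φ T (2^J) ((trg (μ : ArithmeticFunction ℝ) U * ζ) * trg Λ U) k / (k+1) ≤ C₃*9^6*(2+30*C₄+4*Real.exp (A/2)*C₄) / T^m := by
    refine big.trans ?_
    have b1 : (1+J:ℝ)^6 ≤ 9^6 * T^6 := by rw [← mul_pow]; exact pow_le_pow_left₀ (by positivity) (by linarith) 6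
    have b2 : 2/(R:ℝ) + 2*Real.exp (-(ε/8*T))*(2+J) + 2*D*(2*Real.exp ((A-T)/2)) ≤ (2+30*C₄+4*Real.exp (A/2)*C₄) * (T/P) := by
      have c1 : 2/(R:ℝ) ≤ 2*(T/P) := by
        rw [← mul_div_assoc, div_le_div_iff₀ (by linarith) hP0]
        have := mul_le_mul (by linarith : 1 ≤ T) hR1 hP0.le hT0.le
        linarith
      have c2 : 2*Real.exp (-(ε/8*T))*(2+J) ≤ 2*(C₄/P)*(4*T) := mul_le_mul (mul_le_mul_of_nonneg_left e1 (by norm_num)) (by linarith) (by positivity) (by positivity)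
      have c3 : C₄/P ≤ C₄*(T/P) := by rw [← mul_div_assoc]; exact div_le_div_of_nonneg_right (le_mul_of_one_le_right hC₄ (by linarith)) hP0.le
      have c4 := mul_le_mul_of_nonneg_left c3 (Real.exp_pos (A/2)).le
      have c5 : C₄/P*T = C₄*(T/P) := by ring
      have c6 : 0 ≤ C₄*(T/P) := by positivity
      have c7 : 2*(C₄/P)*(4*T) = 8*(C₄*(T/P)) := by ring
      have c8 : (2+30*C₄+4*Real.exp (A/2)*C₄) * (T/P) = 2*(T/P) + 30*(C₄*(T/P)) + 4*(Real.exp (A/2)*(C₄*(T/P))) := by ring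
      have c9 : 2*D*(2*Real.exp ((A-T)/2)) = 4*(D*Real.exp ((A-T)/2)) := by ring
      rw [c8, c9]
      linarith
    calc C₃ * (1+J:ℝ)^6 * _ ≤ C₃ * (9^6*T^6) * ((2+30*C₄+4*Real.exp (A/2)*C₄) * (T/P)) :=
          mul_le_mul (mul_le_mul_of_nonneg_left b1 hC₃) b2 (by positivity) (by positivity)
      _ = C₃*9^6*(2+30*C₄+4*Real.exp (A/2)*C₄) * (T^7/P) := by ring
      _ = _ := by rw [f7, mul_one_div]
  have tI : ∀ k ∈ Finset.Ico R D, ch φ T (2^J) Λ k / (k+1) ≤ ch φ T (2^J) ((trg (μ : ArithmeticFunction ℝ) U * ζ) * trg Λ U) k / (k+1) + C₁ * D * Real.exp (-T) * (U^2*(5*T)) := by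
    intro k hk
    rw [Finset.mem_Ico] at hk
    have h := H1 T (2^J) U k hX hlU (hR3.trans hk.1)
    rw [div_le_iff₀ (by positivity), add_mul, div_mul_cancel₀ _ (by positivity)]
    refine h.trans (add_le_add le_rfl ?_)
    rw [abs_of_pos hT0]
    have k1 : (k:ℝ)+1 ≤ D := by exact_mod_cast hk.2
    have k2 : (1 + T + Real.log (2^J:ℕ)) ≤ 5*T := by linarith
    calc C₁ * (k+1:ℝ)^2 * Real.exp (-T) * (U^2*(1+T+Real.log (2^J:ℕ))) ≤ C₁ * (k+1:ℝ)^2 * Real.exp (-T) * (U^2*(5*T)) :=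
          mul_le_mul_of_nonneg_left (mul_le_mul_of_nonneg_left k2 (by positivity)) (by positivity)
      _ = (C₁ * Real.exp (-T) * (U^2*(5*T)) * (k+1)) * (k+1) := by ring
      _ ≤ (C₁ * Real.exp (-T) * (U^2*(5*T)) * (k+1)) * D := mul_le_mul_of_nonneg_left k1 (by positivity)
      _ = _ := by ring
  have tIs : (D:ℝ) * (C₁ * D * Real.exp (-T) * (U^2*(5*T))) ≤ C₁*4*20*C₄/T^m := by
    have u1 : (U:ℝ)^2 ≤ 4*(Real.exp (ε/4*T)*Real.exp (ε/4*T)) := by linarith [pow_le_pow_left₀ (Nat.cast_nonneg U) hU2 2]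
    have u2 : (D:ℝ)*D ≤ Real.exp ((1/2-ε)*T)*Real.exp ((1/2-ε)*T) := mul_le_mul hD hD (Nat.cast_nonneg D) (Real.exp_pos _).le
    have u3 : Real.exp ((1/2-ε)*T)*Real.exp ((1/2-ε)*T)*Real.exp (-T)*(Real.exp (ε/4*T)*Real.exp (ε/4*T)) ≤ C₄/P := by
      refine le_trans ?_ e1
      simp only [← Real.exp_add]
      exact Real.exp_le_exp.2 (by linarith)
    have u4 : T ≤ T^7 := le_self_pow₀ (by linarith) (by norm_num)
    calc (D:ℝ) * (C₁ * D * Real.exp (-T) * (U^2*(5*T))) = C₁*(5*T)*((D*D*Real.exp (-T))*U^2) := by ring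
      _ ≤ C₁*(5*T)*((Real.exp ((1/2-ε)*T)*Real.exp ((1/2-ε)*T)*Real.exp (-T))*(4*(Real.exp (ε/4*T)*Real.exp (ε/4*T)))) :=
          mul_le_mul_of_nonneg_left (mul_le_mul (mul_le_mul_of_nonneg_right u2 (Real.exp_pos _).le) u1 (by positivity) (by positivity)) (by positivity)
      _ = C₁*20*T*(Real.exp ((1/2-ε)*T)*Real.exp ((1/2-ε)*T)*Real.exp (-T)*(Real.exp (ε/4*T)*Real.exp (ε/4*T))) := by ring
      _ ≤ C₁*20*T*(C₄/P) := mul_le_mul_of_nonneg_left u3 (by positivity)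
      _ ≤ C₁*20*T^7*(C₄/P) := mul_le_mul_of_nonneg_right (mul_le_mul_of_nonneg_left u4 (by positivity)) (by positivity)
      _ = C₁*20*C₄*(T^7/P) := by ring
      _ = C₁*20*C₄/T^m := by rw [f7, mul_one_div]
      _ ≤ _ := div_le_div_of_nonneg_right (by linarith [mul_nonneg hC₁ hC₄]) (by positivity)
  rw [← Finset.sum_Ico_consecutive _ hR3 hRD]
  have sI := Finset.sum_le_sum tI
  rw [Finset.sum_add_distrib, Finset.sum_const, Nat.card_Ico, nsmul_eq_mul] at sI
  have sI2 : ((D-R:ℕ):ℝ) * (C₁ * D * Real.exp (-T) * (U^2*(5*T))) ≤ (D:ℝ) * (C₁ * D * Real.exp (-T) * (U^2*(5*T))) :=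
    mul_le_mul_of_nonneg_right (by exact_mod_cast Nat.sub_le D R) (by positivity)
  rw [add_div, add_div]
  linarith
end

section
open Complex MeasureTheory Filter Topology
open scoped ArithmeticFunction.vonMangoldt ArithmeticFunction.Moebius ArithmeticFunction.zeta
lemma tot_div (n : ℕ) : n ≤ n.totient * n.divisors.card := by
  induction n using Nat.recOnPosPrimePosCoprime with
  | prime_pow p n hp hn =>
    rw [Nat.totient_prime_pow hp hn, Nat.divisors_prime_pow hp, Finset.card_map, Finset.card_range]
    obtain ⟨m, rfl⟩ := Nat.exists_eq_add_of_le' hn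
    have h2 : p ≤ (p-1)*(m+1+1) := by
      obtain ⟨r, rfl⟩ := Nat.exists_eq_add_of_le hp.two_le
      have : 2 + r - 1 = r+1 := by omega
      rw [this]; nlinarith
    rw [Nat.add_sub_cancel, pow_succ, mul_assoc]
    exact Nat.mul_le_mul_left _ h2
  | zero => simp
  | one => simp
  | coprime a b _ _ hab ha hb =>
    rw [Nat.totient_mul hab, hab.card_divisors_mul]
    calc a*b ≤ _ := Nat.mul_le_mul ha hb
      _ = _ := by ring
lemma tot_sum (J D : ℕ) (h : D ≤ 2^J) : ∑ n ∈ Finset.Ioc 0 D, (1:ℝ)/n.totient ≤ (1+J)^2 := by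
  have h2 := div_sum (fun _ => 1) (fun _ => by positivity) (fun a b => by simp) (2^J)
  have h5 : 0 ≤ ∑ n ∈ (Finset.Ioc 0 (2^J) : Finset ℕ), (1:ℝ) / n := Finset.sum_nonneg fun _ _ => by positivity
  refine le_trans ?_ (h2.trans (pow_le_pow_left₀ h5 (harm J) 2))
  refine le_trans ?_ (Finset.sum_le_sum_of_subset_of_nonneg (Finset.Ioc_subset_Ioc_right h) fun _ _ _ => by positivity)
  refine Finset.sum_le_sum fun n hn => ?_
  have hn0 := (Finset.mem_Ioc.1 hn).1
  have ht : (0:ℝ) < n.totient := by exact_mod_cast Nat.totient_pos.2 hn0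
  rw [mul_one, div_le_div_iff₀ ht (by exact_mod_cast hn0), one_mul, mul_comm]
  exact_mod_cast tot_div n
lemma lcount (d J : ℕ) (hd : 0 < d) : (((Finset.Ioc 0 (2^J)).filter fun n => ¬ n.Coprime d ∧ Λ n ≠ 0).card : ℝ) ≤ d * (J+1) := by
  have : (Finset.Ioc 0 (2^J)).filter (fun n => ¬ n.Coprime d ∧ Λ n ≠ 0) ⊆ (d.divisors ×ˢ Finset.range (J+1)).image fun x => x.1^x.2 := by
    intro n hn
    simp only [Finset.mem_filter, Finset.mem_Ioc, ArithmeticFunction.vonMangoldt_ne_zero_iff] at hn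
    obtain ⟨⟨hn0, hnJ⟩, hnd, hp⟩ := hn
    rw [isPrimePow_nat_iff] at hp
    obtain ⟨p, k, hp, hk, rfl⟩ := hp
    refine Finset.mem_image.2 ⟨(p,k), ?_, rfl⟩
    rw [Finset.mem_product, Nat.mem_divisors, Finset.mem_range]
    refine ⟨⟨?_, hd.ne'⟩, ?_⟩
    · by_contra h
      exact hnd (Nat.Coprime.pow_left k ((Nat.Prime.coprime_iff_not_dvd hp).2 h))
    · exact Nat.lt_succ_of_le ((Nat.pow_le_pow_iff_right one_lt_two).1 ((Nat.pow_le_pow_left hp.two_le k).trans hnJ))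
  have h2 := (Finset.card_le_card this).trans Finset.card_image_le
  rw [Finset.card_product, Finset.card_range] at h2
  exact_mod_cast h2.trans (Nat.mul_le_mul_right _ (Nat.card_divisors_le_self d))
noncomputable def wt (φ : ℝ → ℂ) (T : ℝ) (n : ℕ) : ℂ := (Λ n : ℂ) / n * φ (Real.log n - T)
noncomputable def RD (φ : ℝ → ℂ) (T : ℝ) (N d : ℕ) : ℂ :=
  (∑' n : ℕ, if (n : ZMod d) = N then wt φ T n else 0) - (∑' n : ℕ, wt φ T n) / d.totient
lemma wt_zero {φ : ℝ → ℂ} {A T : ℝ} (hA : ∀ v, A ≤ |v| → φ v = 0) {X : ℕ} (hX : Real.exp (T+A) ≤ X) {n : ℕ} (hn : n ∉ Finset.Ioc 0 X) : wt φ T n = 0 := by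
  rcases Nat.eq_zero_or_pos n with rfl | h
  · simp [wt]
  · rw [wt, phi_zero hA hX (by rw [Finset.mem_Ioc] at hn; omega), mul_zero]
lemma wt_bd {φ : ℝ → ℂ} {A T M : ℝ} (hA : ∀ v, A ≤ |v| → φ v = 0) (hM : ∀ v, ‖φ v‖ ≤ M) {J n : ℕ} (hn : n ∈ Finset.Ioc 0 (2^J)) :
    ‖wt φ T n‖ ≤ J * M * Real.exp (A-T) := by
  rw [Finset.mem_Ioc] at hn
  have hM0 : 0 ≤ M := (norm_nonneg _).trans (hM 0)
  have hn0 : (0:ℝ) < n := by exact_mod_cast hn.1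
  by_cases h : A ≤ |Real.log n - T|
  · rw [wt, hA _ h, mul_zero, norm_zero]; positivity
  · have h1 : T - A ≤ Real.log n := by have := (abs_lt.1 (not_le.1 h)).1; linarith
    rw [Real.le_log_iff_exp_le hn0] at h1
    have h2 : Λ n ≤ J := by
      refine ArithmeticFunction.vonMangoldt_le_log.trans ((Real.log_le_log (by exact_mod_cast hn.1) (by exact_mod_cast hn.2 : (n:ℝ) ≤ 2^J)).trans ?_)
      rw [Real.log_pow]
      exact mul_le_of_le_one_right (Nat.cast_nonneg J) (by linarith [Real.log_two_lt_d9])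
    rw [wt, norm_mul, norm_div, norm_real, Real.norm_of_nonneg ArithmeticFunction.vonMangoldt_nonneg, norm_natCast]
    have h3 : Λ n / n ≤ J * Real.exp (A-T) := by
      rw [show A-T = -(T-A) by ring, Real.exp_neg, ← div_eq_mul_inv]
      exact div_le_div₀ (Nat.cast_nonneg J) h2 (Real.exp_pos _) h1
    calc _ ≤ J * Real.exp (A-T) * M := mul_le_mul h3 (hM _) (norm_nonneg _) (by positivity)
      _ = _ := by ring
lemma ex_prim {d : ℕ} [NeZero d] (χ : DirichletCharacter ℂ d) (hχ : χ ≠ 1) : ∃ k, 1 ≤ k ∧ k < d ∧ ∃ ψ ∈ prims k, ∃ h : k+1 ∣ d, DirichletCharacter.changeLevel h ψ = χ := by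
  have h1 := χ.changeLevel_primitiveCharacter
  have h2 := χ.primitiveCharacter_isPrimitive
  have h3 := χ.conductor_ne_zero
  have h4 : χ.conductor ≠ 1 := fun h => hχ (DirichletCharacter.eq_one_iff_conductor_eq_one.2 h)
  revert h1 h2
  generalize χ.primitiveCharacter = ψ
  generalize_proofs hd
  revert ψ hd
  generalize χ.conductor = c at *
  intro ψ hd h1 h2
  obtain ⟨k, rfl⟩ := Nat.exists_eq_succ_of_ne_zero h3
  have := Nat.le_of_dvd (NeZero.pos d) hd
  exact ⟨k, by omega, by omega, ψ, by classical simpa [prims] using h2, hd, h1⟩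
lemma RD_bd {φ : ℝ → ℂ} {A T M : ℝ} (hA : ∀ v, A ≤ |v| → φ v = 0) (hM : ∀ v, ‖φ v‖ ≤ M) {J : ℕ} (hX : Real.exp (T+A) ≤ (2^J:ℕ))
    {N d : ℕ} (hd : 0 < d) (hN : d.Coprime N) :
    ‖RD φ T N d‖ ≤ (∑ k ∈ (Finset.Ico 1 d).filter (fun k => k+1 ∣ d), ∑ ψ ∈ prims k, ‖PC φ T ψ‖) / d.totient + d * (J+1)^2 * M * Real.exp (A-T) := by
  classical
  haveI : NeZero d := ⟨hd.ne'⟩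
  have hM0 : 0 ≤ M := (norm_nonneg _).trans (hM 0)
  have ht : (0:ℝ) < d.totient := by exact_mod_cast Nat.totient_pos.2 hd
  have htc : (d.totient:ℂ) ≠ 0 := by exact_mod_cast ht.ne'
  obtain ⟨E, hE⟩ : ∃ E, E = d * (J+1)^2 * M * Real.exp (A-T) := ⟨_, rfl⟩
  obtain ⟨W, hW⟩ : ∃ W, W = Finset.Ioc 0 (2^J) := ⟨_, rfl⟩
  have cmp : ∀ a b : ℕ → ℂ, (∀ n, n.Coprime d → a n = b n) → (∀ n, ‖a n - b n‖ ≤ 1) → ‖∑ n ∈ W, a n * wt φ T n - ∑ n ∈ W, b n * wt φ T n‖ ≤ E := by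
    intro a b h1 h2
    rw [← Finset.sum_sub_distrib]
    have : ∀ n ∈ W, ‖a n * wt φ T n - b n * wt φ T n‖ ≤ if (¬ n.Coprime d ∧ Λ n ≠ 0) then J * M * Real.exp (A-T) else 0 := by
      intro n hn
      rw [← sub_mul, norm_mul]
      split_ifs with h
      · rw [← one_mul (J * M * Real.exp (A-T))]
        exact mul_le_mul (h2 n) (wt_bd hA hM (hW ▸ hn)) (norm_nonneg _) zero_le_one
      · by_cases hc : n.Coprime d
        · simp [h1 n hc]
        · have : Λ n = 0 := by by_contra h'; exact h ⟨hc, h'⟩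
          simp [wt, this]
    refine (norm_sum_le _ _).trans ((Finset.sum_le_sum this).trans ?_)
    rw [← Finset.sum_filter, Finset.sum_const, nsmul_eq_mul, hW]
    refine (mul_le_mul_of_nonneg_right (lcount d J hd) (by positivity)).trans ?_
    rw [hE]
    have : d * (J+1) * (J*M*Real.exp (A-T)) = (d*M*Real.exp (A-T)*(J+1))*J := by ring
    rw [this]
    refine (mul_le_mul_of_nonneg_left (by linarith : (J:ℝ) ≤ J+1) (by positivity)).trans_eq (by ring)
  have fin : ∀ (a : ℕ → ℂ), ∑' n : ℕ, a n * wt φ T n = ∑ n ∈ W, a n * wt φ T n := fun a =>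
    tsum_eq_sum fun n hn => by rw [wt_zero hA hX (hW ▸ hn), mul_zero]
  have hPC : ∀ {q : ℕ} (χ : DirichletCharacter ℂ q), PC φ T χ = ∑ n ∈ W, χ n * wt φ T n := by
    intro q χ
    rw [← fin, PC]
    exact tsum_congr fun n => by rw [wt]; ring
  have e1 : ∑' n : ℕ, (if (n : ZMod d) = N then wt φ T n else 0) = (∑ χ : DirichletCharacter ℂ d, χ (N:ZMod d)⁻¹ * PC φ T χ) / d.totient := by
    have : ∀ n : ℕ, (if (n : ZMod d) = N then wt φ T n else 0) = (if (N : ZMod d) = n then 1 else 0) * wt φ T n := fun n => by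
      simp only [eq_comm (a := (n : ZMod d))]; split_ifs <;> simp
    rw [tsum_congr this, fin, eq_div_iff htc]
    simp only [hPC, Finset.mul_sum]
    rw [Finset.sum_comm, Finset.sum_mul]
    refine Finset.sum_congr rfl fun n _ => ?_
    simp only [← mul_assoc]
    rw [← Finset.sum_mul, DirichletCharacter.sum_char_inv_mul_char_eq ℂ ((ZMod.isUnit_iff_coprime N d).2 hN.symm)]
    split_ifs <;> simp [mul_comm]
  have hnrm : ∀ χ : DirichletCharacter ℂ d, ‖χ (N:ZMod d)⁻¹‖ ≤ 1 := fun χ => χ.norm_le_one _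
  have e2 : RD φ T N d = (∑ χ ∈ Finset.univ.erase (1 : DirichletCharacter ℂ d), χ (N:ZMod d)⁻¹ * PC φ T χ) / d.totient
      + ((1 : DirichletCharacter ℂ d) (N:ZMod d)⁻¹ * PC φ T (1 : DirichletCharacter ℂ d) - ∑' n : ℕ, wt φ T n) / d.totient := by
    rw [RD, e1, ← Finset.sum_erase_add _ _ (Finset.mem_univ (1 : DirichletCharacter ℂ d))]
    ring
  have hu : IsUnit ((N:ZMod d)⁻¹) := by
    have := (ZMod.isUnit_iff_coprime N d).2 hN.symm
    exact IsUnit.of_mul_eq_one _ (ZMod.inv_mul_of_unit _ this)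
  have e3 : ‖(1 : DirichletCharacter ℂ d) (N:ZMod d)⁻¹ * PC φ T (1 : DirichletCharacter ℂ d) - ∑' n : ℕ, wt φ T n‖ ≤ E := by
    rw [MulChar.one_apply hu, one_mul, hPC]
    have := cmp (fun n => (1 : DirichletCharacter ℂ d) n) (fun _ => 1) (fun n hn => MulChar.one_apply ((ZMod.isUnit_iff_coprime n d).2 hn))
      (fun n => by
        by_cases h : IsUnit (n : ZMod d)
        · rw [MulChar.one_apply h]; simp
        · rw [MulChar.map_nonunit _ h]; simp)
    rw [← fin (fun _ => 1)] at this
    simpa using this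
  obtain ⟨S, hS⟩ : ∃ S, S = (Finset.Ico 1 d).filter (fun k => k+1 ∣ d) := ⟨_, rfl⟩
  have e4 : ∑ χ ∈ Finset.univ.erase (1 : DirichletCharacter ℂ d), ‖PC φ T χ‖ ≤ ∑ χ ∈ Finset.univ.erase (1 : DirichletCharacter ℂ d), E + ∑ k ∈ S, ∑ ψ ∈ prims k, ‖PC φ T ψ‖ := by
    have hex : ∀ χ : DirichletCharacter ℂ d, χ ≠ 1 → ∃ z : CZ, z.1 ∈ S ∧ z.2 ∈ prims z.1 ∧ ∃ h : z.1+1 ∣ d, DirichletCharacter.changeLevel h z.2 = χ := by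
      intro χ hχ
      obtain ⟨k, h1, h2, ψ, h3, h4, h5⟩ := ex_prim χ hχ
      exact ⟨⟨k, ψ⟩, by rw [hS, Finset.mem_filter, Finset.mem_Ico]; exact ⟨⟨h1, h2⟩, h4⟩, h3, h4, h5⟩
    choose! f hf1 hf2 hf3 hf4 using hex
    have b1 : ∀ χ ∈ Finset.univ.erase (1 : DirichletCharacter ℂ d), ‖PC φ T χ‖ ≤ E + ‖PC φ T (f χ).2‖ := by
      intro χ hχ
      have hχ1 := (Finset.mem_erase.1 hχ).1
      have hcop : ∀ n : ℕ, n.Coprime d → χ n = (f χ).2 n := by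
        intro n hn
        have := DirichletCharacter.changeLevel_eq_cast_of_dvd' (f χ).2 (hf3 χ hχ1) (a := n) (Nat.isCoprime_iff_coprime.2 hn)
        rw [hf4 χ hχ1] at this
        exact_mod_cast this
      have := cmp (fun n => χ n) (fun n => (f χ).2 n) hcop (fun n => by
        by_cases h : IsUnit (n : ZMod d)
        · rw [hcop n ((ZMod.isUnit_iff_coprime n d).1 h)]; simp
        · rw [MulChar.map_nonunit _ h, zero_sub, norm_neg]; exact DirichletCharacter.norm_le_one _ _)
      rw [← hPC, ← hPC] at this
      have h2 := norm_sub_norm_le (PC φ T χ) (PC φ T (f χ).2)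
      linarith
    refine (Finset.sum_le_sum b1).trans ?_
    rw [Finset.sum_add_distrib]
    refine add_le_add le_rfl ?_
    rw [Finset.sum_sigma']
    have hinj : Set.InjOn f (Finset.univ.erase (1 : DirichletCharacter ℂ d) : Set (DirichletCharacter ℂ d)) := by
      intro χ hχ χ' hχ' he
      have h1 := (Finset.mem_erase.1 (Finset.mem_coe.1 hχ)).1
      have h2 := (Finset.mem_erase.1 (Finset.mem_coe.1 hχ')).1
      have aux : ∀ z z' : CZ, z = z' → ∀ (h : z.1+1 ∣ d) (h' : z'.1+1 ∣ d), DirichletCharacter.changeLevel h z.2 = DirichletCharacter.changeLevel h' z'.2 := by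
        rintro z _ rfl h h'; rfl
      rw [← hf4 χ h1, ← hf4 χ' h2]
      exact aux _ _ he _ _
    rw [← Finset.sum_image (f := fun z : CZ => ‖PC φ T z.2‖) (g := f) hinj]
    refine Finset.sum_le_sum_of_subset_of_nonneg ?_ fun _ _ _ => norm_nonneg _
    intro z hz
    obtain ⟨χ, hχ, rfl⟩ := Finset.mem_image.1 hz
    have h1 := (Finset.mem_erase.1 hχ).1
    exact Finset.mem_sigma.2 ⟨hf1 χ h1, hf2 χ h1⟩
  have hcard : ((Finset.univ.erase (1 : DirichletCharacter ℂ d)).card : ℝ) + 1 = d.totient := by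
    rw [Finset.card_erase_of_mem (Finset.mem_univ _), Finset.card_univ, ← Nat.card_eq_fintype_card,
      DirichletCharacter.card_eq_totient_of_hasEnoughRootsOfUnity ℂ d, Nat.cast_sub (Nat.totient_pos.2 hd)]
    simp
  rw [e2, ← add_div, norm_div, _root_.norm_natCast, ← hS, ← hE, div_le_iff₀ ht, add_mul, div_mul_cancel₀ _ ht.ne']
  refine (norm_add_le _ _).trans ?_
  have e5 : ‖∑ χ ∈ Finset.univ.erase (1 : DirichletCharacter ℂ d), χ (N:ZMod d)⁻¹ * PC φ T χ‖ ≤ ∑ χ ∈ Finset.univ.erase (1 : DirichletCharacter ℂ d), ‖PC φ T χ‖ := by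
    refine (norm_sum_le _ _).trans (Finset.sum_le_sum fun χ _ => ?_)
    rw [norm_mul]
    exact mul_le_of_le_one_left (norm_nonneg _) (hnrm χ)
  rw [Finset.sum_const, nsmul_eq_mul] at e4
  rw [← hcard]
  linarith
theorem BV {φ : ℝ → ℂ} (hφ : ContDiff ℝ (⊤ : ℕ∞) φ) (hc : HasCompactSupport φ) {ε : ℝ} (hε : 0 < ε) (hε1 : ε ≤ 1/2) (m : ℕ) :
    ∃ C T₀ : ℝ, 0 ≤ C ∧ 1 ≤ T₀ ∧ ∀ T, T₀ ≤ T → ∀ D N : ℕ, (D:ℝ) ≤ Real.exp ((1/2-ε)*T) →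
      ∑ d ∈ (Finset.Ioc 0 D).filter (fun d => d.Coprime N), ‖RD φ T N d‖ ≤ C / T^m := by
  obtain ⟨A, hA0, hA⟩ := supp_bd hc
  obtain ⟨M, hM⟩ := hc.exists_bound_of_continuous hφ.continuous
  obtain ⟨C, T₀, hC, hT₀, H⟩ := BVc hφ hc hε hε1 (m+2)
  obtain ⟨C₄, hC₄, H4⟩ := exp_pow_bd ε hε (m+2)
  have hM0 : 0 ≤ M := (norm_nonneg _).trans (hM 0)
  refine ⟨16*C+16*M*Real.exp A*C₄, max T₀ (max 4 (2*A+4)), by positivity, hT₀.trans (le_max_left _ _), fun T hT D N hD => ?_⟩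
  have hTT : T₀ ≤ T := (le_max_left _ _).trans hT
  have hT1 : 4 ≤ T := ((le_max_left _ _).trans (le_max_right _ _)).trans hT
  have hTA : 2*A+4 ≤ T := ((le_max_right _ _).trans (le_max_right _ _)).trans hT
  have hT0 : 0 < T := by linarith
  have hεT : 0 < ε*T := mul_pos hε hT0
  obtain ⟨J, hJ⟩ : ∃ J, J = ⌈2*(T+A)⌉₊ := ⟨_, rfl⟩
  have hJ1 : 2*(T+A) ≤ J := by rw [hJ]; exact Nat.le_ceil _
  have hJ2 : (J:ℝ) ≤ 3*T := by rw [hJ]; have := Nat.ceil_lt_add_one (a := 2*(T+A)) (by positivity); linarith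
  have hX : Real.exp (T+A) ≤ (2^J:ℕ) := by
    push_cast
    rw [← Real.rpow_natCast, Real.rpow_def_of_pos two_pos]
    have := Real.log_two_gt_d9
    have h3 := mul_nonneg (by linarith : 0 ≤ Real.log 2 - 1/2) (Nat.cast_nonneg (α := ℝ) J)
    exact Real.exp_le_exp.2 (by linarith)
  have hDJ : D ≤ 2^J := by
    have : (D:ℝ) ≤ (2^J:ℕ) := hD.trans (le_trans (Real.exp_le_exp.2 (by linarith)) hX)
    exact_mod_cast this
  obtain ⟨P, hP⟩ : ∃ P : ℕ → ℝ, P = fun k => ∑ ψ ∈ prims k, ‖PC φ T ψ‖ := ⟨_, rfl⟩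
  have hP0 : ∀ k, 0 ≤ P k := fun k => by rw [hP]; exact Finset.sum_nonneg fun _ _ => norm_nonneg _
  have hbv := H T hTT D hD
  have hP' : ∑ k ∈ Finset.Ico 1 D, P k / (k+1).totient ≤ C / T^(m+2) := by rw [hP]; exact hbv
  have s1 : ∑ d ∈ (Finset.Ioc 0 D).filter (fun d => d.Coprime N), ‖RD φ T N d‖ ≤
      ∑ d ∈ Finset.Ioc 0 D, ((∑ k ∈ (Finset.Ico 1 d).filter (fun k => k+1 ∣ d), P k) / d.totient + D * (J+1)^2 * M * Real.exp (A-T)) := by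
    refine (Finset.sum_le_sum (g := fun d => (∑ k ∈ (Finset.Ico 1 d).filter (fun k => k+1 ∣ d), P k) / d.totient + D * (J+1)^2 * M * Real.exp (A-T)) fun d hd => ?_).trans
      (Finset.sum_le_sum_of_subset_of_nonneg (Finset.filter_subset _ _) fun d _ _ => add_nonneg (div_nonneg (Finset.sum_nonneg fun k _ => hP0 k) (Nat.cast_nonneg _)) (by positivity))
    rw [Finset.mem_filter, Finset.mem_Ioc] at hd
    rw [hP]
    refine (RD_bd hA hM hX hd.1.1 hd.2).trans (add_le_add le_rfl ?_)
    have : (d:ℝ) ≤ D := by exact_mod_cast hd.1.2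
    exact mul_le_mul_of_nonneg_right (mul_le_mul_of_nonneg_right (mul_le_mul_of_nonneg_right this (by positivity)) hM0) (Real.exp_pos _).le
  rw [Finset.sum_add_distrib, Finset.sum_const, Nat.card_Ioc, nsmul_eq_mul, Nat.sub_zero] at s1
  have s2 : ∑ d ∈ Finset.Ioc 0 D, (∑ k ∈ (Finset.Ico 1 d).filter (fun k => k+1 ∣ d), P k) / d.totient ≤
      (∑ k ∈ Finset.Ico 1 D, P k / (k+1).totient) * ∑ n ∈ Finset.Ioc 0 D, (1:ℝ)/n.totient := by
    simp only [Finset.sum_div]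
    rw [Finset.sum_mul_sum, Finset.sum_sigma', ← Finset.sum_product']
    refine (Finset.sum_le_sum (g := fun x : (_ : ℕ) × ℕ => P x.2 / (x.2+1).totient * (1/(x.1/(x.2+1)).totient)) fun x hx => ?_).trans ?_
    · simp only [Finset.mem_sigma, Finset.mem_filter, Finset.mem_Ioc, Finset.mem_Ico] at hx
      obtain ⟨c, hc⟩ := hx.2.2
      have hc0 : 0 < c := Nat.pos_of_ne_zero (by rintro rfl; omega)
      rw [hc, Nat.mul_div_cancel_left _ (Nat.succ_pos _), div_mul_div_comm, mul_one]
      have h1 : (0:ℝ) < (x.2+1).totient := by exact_mod_cast Nat.totient_pos.2 (Nat.succ_pos _)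
      have h2 : (0:ℝ) < c.totient := by exact_mod_cast Nat.totient_pos.2 hc0
      exact div_le_div_of_nonneg_left (hP0 _) (mul_pos h1 h2) (by exact_mod_cast Nat.totient_super_multiplicative _ _)
    · have hinj : Set.InjOn (fun x : (_ : ℕ) × ℕ => (x.2, x.1/(x.2+1))) ((Finset.Ioc 0 D).sigma fun d => (Finset.Ico 1 d).filter (fun k => k+1 ∣ d) : Finset ((_ : ℕ) × ℕ)) := by
        rintro ⟨d, k⟩ hx ⟨d', k'⟩ hx' he
        simp only [Finset.mem_coe, Finset.mem_sigma, Finset.mem_filter] at hx hx'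
        simp only [Prod.mk.injEq] at he
        obtain ⟨rfl, he⟩ := he
        have h1 := Nat.mul_div_cancel' hx.2.2
        have h2 := Nat.mul_div_cancel' hx'.2.2
        rw [he] at h1
        rw [h1] at h2
        subst h2; rfl
      have := Finset.sum_image (f := fun y : ℕ × ℕ => P y.1 / (y.1+1).totient * (1/(y.2).totient)) hinj
      rw [← this]
      refine Finset.sum_le_sum_of_subset_of_nonneg ?_ fun _ _ _ => mul_nonneg (div_nonneg (hP0 _) (Nat.cast_nonneg _)) (by positivity)
      intro y hy
      obtain ⟨x, hx, rfl⟩ := Finset.mem_image.1 hy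
      simp only [Finset.mem_sigma, Finset.mem_filter, Finset.mem_Ioc, Finset.mem_Ico] at hx
      simp only [Finset.mem_product, Finset.mem_Ioc, Finset.mem_Ico]
      exact ⟨⟨hx.2.1.1, by omega⟩, Nat.div_pos (Nat.le_of_dvd (by omega) hx.2.2) (Nat.succ_pos _), (Nat.div_le_self _ _).trans hx.1.2⟩
  have hJJ : (1+J:ℝ)^2 ≤ 16*T^2 := by rw [show 16*T^2 = (4*T)^2 by ring]; exact pow_le_pow_left₀ (by positivity) (by linarith) 2
  have s3 := s2.trans (mul_le_mul hP' ((tot_sum J D hDJ).trans hJJ) (Finset.sum_nonneg fun _ _ => by positivity) (by positivity))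
  have s4 : C / T^(m+2) * (16*T^2) = 16*C/T^m := by rw [pow_add]; field_simp
  have s5 : (D:ℝ) * (D * (J+1)^2 * M * Real.exp (A-T)) ≤ 16*M*Real.exp A*C₄/T^m := by
    have u2 : (D:ℝ)*D ≤ Real.exp ((1/2-ε)*T)*Real.exp ((1/2-ε)*T) := mul_le_mul hD hD (Nat.cast_nonneg D) (Real.exp_pos _).le
    have u3 : (D:ℝ)*D*Real.exp (A-T) ≤ Real.exp A * (C₄/T^(m+2)) := by
      refine (mul_le_mul_of_nonneg_right u2 (Real.exp_pos _).le).trans (le_trans ?_ (mul_le_mul_of_nonneg_left (H4 T hT0) (Real.exp_pos A).le))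
      simp only [← Real.exp_add]
      exact Real.exp_le_exp.2 (by linarith)
    calc (D:ℝ) * (D * (J+1)^2 * M * Real.exp (A-T)) = M*(1+J:ℝ)^2*(D*D*Real.exp (A-T)) := by ring
      _ ≤ M*(16*T^2)*(Real.exp A * (C₄/T^(m+2))) := mul_le_mul (mul_le_mul_of_nonneg_left hJJ hM0) u3 (by positivity) (by positivity)
      _ = _ := by rw [pow_add]; field_simp
  rw [add_div]
  linarith
end

section
open Complex MeasureTheory Filter Topology
open scoped ArithmeticFunction.vonMangoldt
lemma riem {φ : ℝ → ℂ} (hφ : ContDiff ℝ (⊤ : ℕ∞) φ) (hc : HasCompactSupport φ) (m : ℕ) : ∃ C : ℝ, 0 ≤ C ∧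
    (∀ T, ‖∑' n : ℕ, (1:ℂ)/n * φ (Real.log n - T)‖ ≤ C) ∧ ∀ T, 0 < T → ‖(∑' n : ℕ, (1:ℂ)/n * φ (Real.log n - T)) - ∫ v, φ v‖ ≤ C/T^m := by
  obtain ⟨A, hA0, hA⟩ := supp_bd hc
  obtain ⟨L, hL⟩ := (hφ.of_le (show (1:WithTop ℕ∞) ≤ (⊤:ℕ∞) by exact_mod_cast le_top)).lipschitzWith_of_hasCompactSupport hc one_ne_zero
  obtain ⟨M, hM⟩ := hφ.continuous.bounded_above_of_compact_support hc
  have hM0 : 0 ≤ M := (norm_nonneg _).trans (hM 0)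
  have hint := hφ.continuous.integrable_of_hasCompactSupport (μ := volume) hc
  obtain ⟨S, hS⟩ : ∃ S, S = ∑' n : ℕ, 1/((n:ℝ)+1)^((3:ℝ)/2) := ⟨_, rfl⟩
  have hsum : Summable fun n : ℕ => 1/((n:ℝ)+1)^((3:ℝ)/2) := by
    have := (summable_nat_add_iff 1).2 (Real.summable_one_div_nat_rpow.2 (by norm_num : (1:ℝ) < 3/2))
    simpa using this
  have hS0 : 0 ≤ S := by rw [hS]; exact tsum_nonneg fun _ => by positivity
  obtain ⟨J, hJ⟩ : ∃ J, J = ∫ v, ‖φ v‖ := ⟨_, rfl⟩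
  have hJ0 : 0 ≤ J := by rw [hJ]; exact integral_nonneg fun _ => norm_nonneg _
  have key : ∀ T, ∃ I1 : ℂ, ‖I1‖ ≤ J ∧ (A ≤ T → I1 = ∫ v, φ v) ∧
      ‖(∑' n : ℕ, (1:ℂ)/n * φ (Real.log n - T)) - I1‖ ≤ (M+L)*S * min 1 (Real.exp ((A+1-T)/2)) := by
    intro T
    obtain ⟨X, hX⟩ := exists_nat_ge (Real.exp (T+A))
    obtain ⟨c, hcd⟩ : ∃ c : ℕ → ℝ, c = fun n => Real.log (n+1:ℕ) - T := ⟨_, rfl⟩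
    have hstep : ∀ n, c n ≤ c (n+1) ∧ c (n+1) - c n ≤ 1/((n:ℝ)+1) ∧ 1/((n:ℝ)+1) - 1/((n:ℝ)+1)^2 ≤ c (n+1) - c n := by
      intro n
      have e : c (n+1) - c n = Real.log (1+1/((n:ℝ)+1)) := by
        rw [hcd]; dsimp only
        rw [sub_sub_sub_cancel_right, ← Real.log_div (by positivity) (by positivity)]
        congr 1; push_cast; field_simp
      have hy : 0 < 1/((n:ℝ)+1) := by positivity
      have h1 := Real.log_nonneg (show 1 ≤ 1+1/((n:ℝ)+1) by linarith)
      have h2 := Real.log_le_sub_one_of_pos (show 0 < 1+1/((n:ℝ)+1) by linarith)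
      have h3 := Real.one_sub_inv_le_log_of_pos (show 0 < 1+1/((n:ℝ)+1) by linarith)
      refine ⟨by linarith, by linarith, ?_⟩
      rw [e]; refine le_trans ?_ h3
      have : (1:ℝ) - (1+1/((n:ℝ)+1))⁻¹ - (1/((n:ℝ)+1) - 1/((n:ℝ)+1)^2) = 1/(((n:ℝ)+1)^2*(n+2)) := by field_simp; ring
      have : 0 ≤ 1/(((n:ℝ)+1)^2*(n+2)) := by positivity
      linarith
    have hi : ∀ a b, IntervalIntegrable φ volume a b := fun a b => hφ.continuous.intervalIntegrable a b
    have hc0 : c 0 ≤ c X := by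
      rw [hcd]; simp only [sub_le_sub_iff_right]; exact Real.log_le_log (by simp) (by simp)
    have hcX : A ≤ c X := by
      rw [hcd]; simp only
      have := (Real.le_log_iff_exp_le (by positivity)).2 (hX.trans (by push_cast; linarith : (X:ℝ) ≤ (X+1:ℕ)))
      linarith
    refine ⟨∫ v in (c 0)..(c X), φ v, ?_, fun hT => ?_, ?_⟩
    · refine (intervalIntegral.norm_integral_le_integral_norm hc0).trans ?_
      rw [intervalIntegral.integral_of_le hc0, hJ]
      exact setIntegral_le_integral hint.norm (Eventually.of_forall fun _ => norm_nonneg _)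
    · rw [intervalIntegral.integral_eq_integral_of_support_subset]
      intro v hv
      have h0 : c 0 = -T := by simp [hcd]
      by_contra h
      apply hv
      apply hA
      rw [Set.mem_Ioc] at h
      rcases le_or_gt v (c 0) with h1 | h1
      · rw [abs_of_nonpos (by linarith)]; linarith
      · have : c X < v := not_le.1 fun h2 => h ⟨h1, h2⟩
        exact le_trans (by linarith) (le_abs_self v)
    · have e1 : ∑' n : ℕ, (1:ℂ)/n * φ (Real.log n - T) = ∑ k ∈ Finset.range X, (1:ℂ)/(k+1:ℕ) * φ (c k) := by
        rw [tsum_eq_sum (s := Finset.Ioc 0 X), sum_Ioc0]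
        · simp [hcd]
        · intro n hn
          rcases Nat.eq_zero_or_pos n with rfl | h
          · simp
          · rw [phi_zero hA hX (by by_contra h2; exact hn (Finset.mem_Ioc.2 ⟨h, by omega⟩)), mul_zero]
      rw [e1, ← intervalIntegral.sum_integral_adjacent_intervals (fun k _ => hi _ _), ← Finset.sum_sub_distrib]
      have hk : ∀ k ∈ Finset.range X, ‖(1:ℂ)/(k+1:ℕ) * φ (c k) - ∫ v in (c k)..(c (k+1)), φ v‖ ≤
          (M+L)*min 1 (Real.exp ((A+1-T)/2)) * (1/((k:ℝ)+1)^((3:ℝ)/2)) := by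
        intro k _
        obtain ⟨s1, s2, s3⟩ := hstep k
        have hk0 : (0:ℝ) < (k:ℝ)+1 := by positivity
        have hk1 : 1/((k:ℝ)+1) ≤ 1 := by rw [div_le_one hk0]; linarith
        by_cases hz : c k < -A-1
        · have hz2 : ∀ v, v ≤ c (k+1) → φ v = 0 := fun v hv => hA v (by rw [abs_of_nonpos (by linarith)]; linarith)
          rw [hz2 _ s1, intervalIntegral.integral_congr (g := fun _ => 0) (fun v hv => hz2 v (by rw [Set.uIcc_of_le s1] at hv; exact hv.2))]
          simp; positivity
        · have e2 : (1:ℂ)/(k+1:ℕ) * φ (c k) - ∫ v in (c k)..(c (k+1)), φ v =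
              ((1/((k:ℝ)+1) - (c (k+1) - c k) : ℝ):ℂ) * φ (c k) - ∫ v in (c k)..(c (k+1)), (φ v - φ (c k)) := by
            rw [intervalIntegral.integral_sub (hi _ _) intervalIntegrable_const, intervalIntegral.integral_const, real_smul]
            push_cast; ring
          have h4 : ‖∫ v in (c k)..(c (k+1)), (φ v - φ (c k))‖ ≤ (L*(1/((k:ℝ)+1)))*|c (k+1) - c k| := by
            refine intervalIntegral.norm_integral_le_of_norm_le_const fun v hv => ?_
            rw [Set.uIoc_of_le s1] at hv
            have := hL.dist_le_mul v (c k)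
            rw [dist_eq_norm, Real.dist_eq, abs_of_pos (by linarith [hv.1])] at this
            exact this.trans (mul_le_mul_of_nonneg_left (by linarith [hv.2]) L.2)
          have h5 : ‖((1/((k:ℝ)+1) - (c (k+1) - c k) : ℝ):ℂ) * φ (c k)‖ ≤ 1/((k:ℝ)+1)^2 * M := by
            rw [norm_mul, norm_real, Real.norm_eq_abs, abs_of_nonneg (by linarith)]
            exact mul_le_mul (by linarith) (hM _) (norm_nonneg _) (by positivity)
          have h6 : ‖(1:ℂ)/(k+1:ℕ) * φ (c k) - ∫ v in (c k)..(c (k+1)), φ v‖ ≤ (M+L)*(1/((k:ℝ)+1)^2) := by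
            rw [e2]
            refine (norm_sub_le _ _).trans ((add_le_add h5 (h4.trans (mul_le_mul_of_nonneg_left
              (show |c (k+1) - c k| ≤ 1/((k:ℝ)+1) by rw [abs_of_nonneg (by linarith)]; exact s2) (by positivity)))).trans (le_of_eq ?_))
            field_simp
          refine h6.trans ?_
          rw [mul_assoc]
          refine mul_le_mul_of_nonneg_left ?_ (by positivity)
          have e3 : 1/((k:ℝ)+1)^2 = ((k:ℝ)+1)^(-(1:ℝ)/2) * (1/((k:ℝ)+1)^((3:ℝ)/2)) := by
            rw [one_div, one_div, ← Real.rpow_neg hk0.le, ← Real.rpow_add hk0, ← Real.rpow_natCast, ← Real.rpow_neg hk0.le]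
            norm_num
          rw [e3]
          refine mul_le_mul_of_nonneg_right (le_min ?_ ?_) (by positivity)
          · exact Real.rpow_le_one_of_one_le_of_nonpos (by linarith [Nat.cast_nonneg (α := ℝ) k]) (by norm_num)
          · rw [Real.rpow_def_of_pos hk0]
            refine Real.exp_le_exp.2 ?_
            have : c k = Real.log ((k:ℝ)+1) - T := by rw [hcd]; simp
            linarith
      refine (norm_sum_le_of_le _ hk).trans ?_
      rw [← Finset.mul_sum]
      have := hsum.sum_le_tsum (Finset.range X) (fun _ _ => by positivity)
      rw [← hS] at this
      calc _ ≤ (M+L)*min 1 (Real.exp ((A+1-T)/2)) * S := mul_le_mul_of_nonneg_left this (by positivity)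
        _ = _ := by ring
  obtain ⟨C, hC0, hC⟩ := exp_pow_bd (1/2) (by norm_num) m
  have hb : ∀ T, ‖∑' n : ℕ, (1:ℂ)/n * φ (Real.log n - T)‖ ≤ J + (M+L)*S := by
    intro T
    obtain ⟨I1, h1, _, h2⟩ := key T
    have h3 : (M+L)*S * min 1 (Real.exp ((A+1-T)/2)) ≤ (M+L)*S * 1 := mul_le_mul_of_nonneg_left (min_le_left _ _) (by positivity)
    have h4 := norm_sub_norm_le (∑' n : ℕ, (1:ℂ)/n * φ (Real.log n - T)) I1
    linarith
  refine ⟨J+(M+L)*S + ((J+(M+L)*S)+J)*A^m + (M+L)*S*Real.exp ((A+1)/2)*C, by positivity, fun T => (hb T).trans ?_, fun T hT => ?_⟩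
  · have h1 : 0 ≤ ((J+(M+L)*S)+J)*A^m := by positivity
    have h2 : 0 ≤ (M+L)*S*Real.exp ((A+1)/2)*C := by positivity
    linarith
  rw [le_div_iff₀ (by positivity)]
  rcases le_total A T with h | h
  · obtain ⟨I1, h1, h2, h3⟩ := key T
    rw [h2 h] at h3
    have h4 : (M+L)*S * min 1 (Real.exp ((A+1-T)/2)) ≤ (M+L)*S*Real.exp ((A+1)/2)*(C/T^m) := by
      rw [mul_assoc ((M+L)*S)]
      refine mul_le_mul_of_nonneg_left ((min_le_right _ _).trans ?_) (by positivity)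
      rw [show (A+1-T)/2 = (A+1)/2 + -(1/2*T) by ring, Real.exp_add]
      exact mul_le_mul_of_nonneg_left (hC T hT) (Real.exp_pos _).le
    have h5 := mul_le_mul_of_nonneg_right (h3.trans h4) (show 0 ≤ T^m by positivity)
    rw [show (M+L)*S*Real.exp ((A+1)/2)*(C/T^m)*T^m = (M+L)*S*Real.exp ((A+1)/2)*C by field_simp] at h5
    have h6 : 0 ≤ ((J+(M+L)*S)+J)*A^m := by positivity
    have h7 : 0 ≤ (M+L)*S := by positivity
    linarith
  · have h1 : ‖∫ v, φ v‖ ≤ J := by rw [hJ]; exact norm_integral_le_integral_norm _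
    have h2 := (norm_sub_le (∑' n : ℕ, (1:ℂ)/n * φ (Real.log n - T)) (∫ v, φ v)).trans (add_le_add (hb T) h1)
    have h3 := mul_le_mul h2 (pow_le_pow_left₀ hT.le h m) (by positivity) (by positivity)
    have h4 : 0 ≤ (M+L)*S*Real.exp ((A+1)/2)*C := by positivity
    have h5 : 0 ≤ (M+L)*S := by positivity
    linarith
end

section
open Complex MeasureTheory Filter Topology
open scoped ArithmeticFunction.vonMangoldt
noncomputable def sm (h : ℝ → ℝ) (f : ℕ → ℝ) (T : ℝ) : ℝ := ∑' n : ℕ, f n * h (Real.log n - T)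
lemma cs_cast {h : ℝ → ℝ} (hc : HasCompactSupport h) : HasCompactSupport (fun v => (h v : ℂ)) := hc.comp_left (g := Complex.ofReal) ofReal_zero
lemma h_zero {h : ℝ → ℝ} (hs : ∀ v, 0 ≤ v → h v = 0) {T : ℝ} {X n : ℕ} (hX : Real.exp T ≤ X) (hn : X ≤ n) : h (Real.log n - T) = 0 := by
  have h1 : Real.exp T ≤ n := hX.trans (by exact_mod_cast hn)
  exact hs _ (sub_nonneg.2 ((Real.le_log_iff_exp_le ((Real.exp_pos _).trans_le h1)).2 h1))
lemma sm_term {h : ℝ → ℝ} {f : ℕ → ℝ} {T : ℝ} {X : ℕ} (hs : ∀ v, 0 ≤ v → h v = 0) (f0 : f 0 = 0) (hX : Real.exp T ≤ X) :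
    ∀ n ∉ Finset.Ioc 0 X, f n * h (Real.log n - T) = 0 := by
  intro n hn
  rcases Nat.eq_zero_or_pos n with rfl | h0
  · rw [f0, zero_mul]
  · rw [h_zero hs hX (by rw [Finset.mem_Ioc] at hn; omega), mul_zero]
lemma sm_fin {h : ℝ → ℝ} {f : ℕ → ℝ} {T : ℝ} {X : ℕ} (hs : ∀ v, 0 ≤ v → h v = 0) (f0 : f 0 = 0) (hX : Real.exp T ≤ X) :
    sm h f T = ∑ n ∈ Finset.Ioc 0 X, f n * h (Real.log n - T) := tsum_eq_sum (sm_term hs f0 hX)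
lemma lam_lim {h : ℝ → ℝ} (hd : ContDiff ℝ (⊤ : ℕ∞) h) (hc : HasCompactSupport h) {η : ℝ} (hη : 0 < η) :
    ∃ t1 : ℝ, 1 ≤ t1 ∧ ∀ T, t1 ≤ T → |sm h (fun n => Λ n / n) T - ∫ v, h v| ≤ η := by
  have hd' : ContDiff ℝ (⊤ : ℕ∞) (fun v => (h v : ℂ)) := ofRealCLM.contDiff.comp hd
  have hc' : HasCompactSupport (fun v => (h v : ℂ)) := cs_cast hc
  obtain ⟨C1, h10, h1⟩ := lam_one hd' hc' 1
  obtain ⟨C2, h20, -, h2⟩ := riem hd' hc' 1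
  obtain ⟨A, hA0, hA⟩ := supp_bd hc'
  refine ⟨max 1 ((C1+C2)/η), le_max_left _ _, fun T hT => ?_⟩
  have hT0 : 0 < T := one_pos.trans_le ((le_max_left _ _).trans hT)
  have e : ((sm h (fun n => Λ n / n) T - ∫ v, h v : ℝ):ℂ) = (∑' n : ℕ, ((Λ n:ℂ)-1)/n * (h (Real.log n - T):ℂ)) +
      ((∑' n : ℕ, (1:ℂ)/n * (h (Real.log n - T):ℂ)) - ∫ v, (h v:ℂ)) := by
    obtain ⟨X, hX⟩ := exists_nat_ge (Real.exp (T+A))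
    have hz : ∀ n ∉ Finset.Ioc 0 X, n = 0 ∨ (h (Real.log n - T):ℂ) = 0 := by
      intro n hn
      rw [Finset.mem_Ioc] at hn
      rcases Nat.eq_zero_or_pos n with h0 | h0
      · exact .inl h0
      · exact .inr (phi_zero (φ := fun v => (h v:ℂ)) hA hX (by omega))
    rw [← add_sub_assoc, tsum_eq_sum (s := Finset.Ioc 0 X) (fun n hn => by rcases hz n hn with h | h <;> simp [h]),
      tsum_eq_sum (s := Finset.Ioc 0 X) (fun n hn => by rcases hz n hn with h | h <;> simp [h]), ← Finset.sum_add_distrib, sm,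
      tsum_eq_sum (s := Finset.Ioc 0 X) (fun n hn => by rcases hz n hn with h | h; · simp [h]
                                                        · rw [ofReal_eq_zero.1 h, mul_zero]), ofReal_sub, ← integral_complex_ofReal]
    push_cast
    congr 1
    exact Finset.sum_congr rfl fun n _ => by ring
  have h3 := h1 T
  rw [pow_one, abs_of_pos hT0, ← le_div_iff₀ hT0] at h3
  have h4 := h2 T hT0
  rw [pow_one] at h4
  rw [← Real.norm_eq_abs, ← norm_real, e]
  refine (norm_add_le _ _).trans ((add_le_add h3 h4).trans ?_)
  rw [← add_div, div_le_iff₀ hT0]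
  have := (le_max_right _ _).trans hT
  rw [div_le_iff₀ hη] at this; linarith
lemma log_pf {N : ℕ} (hN : N ≠ 0) : ∑ p ∈ N.primeFactors, Real.log p ≤ Real.log N := by
  rw [← Real.log_prod (fun p hp => by exact_mod_cast (Nat.prime_of_mem_primeFactors hp).ne_zero), ← Nat.cast_prod]
  exact Real.log_le_log (by exact_mod_cast Finset.prod_pos fun p hp => (Nat.prime_of_mem_primeFactors hp).pos)
    (by exact_mod_cast Nat.le_of_dvd (Nat.pos_of_ne_zero hN) (Nat.prod_primeFactors_dvd N))
open Classical in
lemma lamdiff {h : ℝ → ℝ} {A B : ℝ} (h0 : ∀ v, 0 ≤ h v) (hB : ∀ v, h v ≤ B) (hs : ∀ v, 0 ≤ v → h v = 0) (hA : ∀ v, v ≤ -A → h v = 0) {N : ℕ} (hN : N ≠ 0)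
    {T : ℝ} (hT : 0 ≤ T) : sm h (fun n => Λ n / n) T ≤ sm h (fun n => if n.Prime ∧ ¬ n ∣ N then Real.log n / n else 0) T +
      B * Real.exp (A-T) * (2 * Real.exp (T/2) * T + Real.log N) := by
  have hB0 : 0 ≤ B := (h0 0).trans (hB 0)
  obtain ⟨X, hX⟩ := exists_nat_ge (Real.exp T)
  have hb : ∀ n : ℕ, 0 < n → 1 / (n:ℝ) * h (Real.log n - T) ≤ B * Real.exp (A-T) := by
    intro n hn
    have hn' : (0:ℝ) < n := by exact_mod_cast hn
    by_cases h2 : Real.log n - T ≤ -A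
    · rw [hA _ h2]; simp; positivity
    · rw [not_le] at h2
      have h3 : Real.exp (T-A) ≤ n := by rw [← Real.le_log_iff_exp_le hn']; linarith
      have h4 : 1/(n:ℝ) ≤ Real.exp (A-T) := by
        rw [show A-T = -(T-A) by ring, Real.exp_neg, ← one_div]; exact one_div_le_one_div_of_le (Real.exp_pos _) h3
      calc _ ≤ Real.exp (A-T) * B := mul_le_mul h4 (hB _) (h0 _) (Real.exp_pos _).le
        _ = _ := mul_comm _ _
  have hL : ∀ n : ℕ, 0 ≤ Λ n := fun n => ArithmeticFunction.vonMangoldt_nonneg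
  have key : ∀ n ∈ Finset.Ioc 0 X, Λ n / n * h (Real.log n - T) ≤ (if n.Prime ∧ ¬ n ∣ N then Real.log n / n else 0) * h (Real.log n - T) +
      ((if ¬ n.Prime ∧ n ≤ ⌊Real.exp T⌋₊ then Λ n else 0) * (B * Real.exp (A-T)) + (if n ∈ N.primeFactors then Real.log n else 0) * (B * Real.exp (A-T))) := by
    intro n hn
    have hn0 := (Finset.mem_Ioc.1 hn).1
    have hbn := hb n hn0
    have hl : 0 ≤ Real.log n := Real.log_natCast_nonneg n
    by_cases hp : n.Prime
    · rw [if_neg (show ¬(¬ n.Prime ∧ n ≤ ⌊Real.exp T⌋₊) by tauto), ArithmeticFunction.vonMangoldt_apply_prime hp]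
      by_cases hd : n ∣ N
      · rw [if_neg (by simp [hd]), if_pos (Nat.mem_primeFactors.2 ⟨hp, hd, hN⟩)]
        calc _ = Real.log n * (1/(n:ℝ) * h (Real.log n - T)) := by ring
          _ ≤ Real.log n * (B * Real.exp (A-T)) := mul_le_mul_of_nonneg_left hbn hl
          _ = _ := by ring
      · rw [if_pos ⟨hp, hd⟩]
        have : 0 ≤ (if n ∈ N.primeFactors then Real.log n else 0) * (B * Real.exp (A-T)) := by split_ifs <;> positivity
        linarith
    · have h6 : n ∉ N.primeFactors := fun h => hp (Nat.prime_of_mem_primeFactors h)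
      rw [if_neg (by tauto), if_neg h6]
      by_cases h5 : n ≤ ⌊Real.exp T⌋₊
      · rw [if_pos ⟨hp, h5⟩]
        calc _ = Λ n * (1/(n:ℝ) * h (Real.log n - T)) := by ring
          _ ≤ Λ n * (B * Real.exp (A-T)) := mul_le_mul_of_nonneg_left hbn (hL n)
          _ = _ := by ring
      · rw [if_neg (by tauto), hs]
        · simp
        · rw [not_le, Nat.floor_lt (Real.exp_pos _).le] at h5
          exact sub_nonneg.2 ((Real.le_log_iff_exp_le (by exact_mod_cast hn0)).2 h5.le)
  rw [sm_fin hs (by simp) hX, sm_fin hs (by simp) hX]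
  refine (Finset.sum_le_sum key).trans ?_
  rw [Finset.sum_add_distrib, Finset.sum_add_distrib, ← Finset.sum_mul, ← Finset.sum_mul, mul_comm _ (B*Real.exp (A-T)), mul_comm _ (B*Real.exp (A-T)), ← mul_add]
  refine add_le_add le_rfl (mul_le_mul_of_nonneg_left (add_le_add ?_ ?_) (by positivity))
  · have h7 := Chebyshev.psi_sub_theta_le (Real.one_le_exp hT)
    rw [Chebyshev.psi_sub_theta_eq_sum_not_prime, Real.log_exp, Real.sqrt_eq_rpow, ← Real.exp_mul, mul_one_div] at h7
    refine le_trans ?_ h7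
    rw [← Finset.sum_filter]
    refine Finset.sum_le_sum_of_subset_of_nonneg (fun n hn => ?_) fun _ _ _ => hL _
    simp only [Finset.mem_filter, Finset.mem_Ioc] at hn ⊢; tauto
  · rw [← Finset.sum_filter]
    refine le_trans (Finset.sum_le_sum_of_subset_of_nonneg (fun n hn => (Finset.mem_filter.1 hn).2) fun n _ _ => Real.log_natCast_nonneg n) (log_pf hN)
noncomputable def hbp : ContDiffBump (-1/2:ℝ) := ⟨1/4, 1/2, by norm_num, by norm_num⟩
noncomputable def hh : ℝ → ℝ := hbp.normed volume
lemma hh_nn (v : ℝ) : 0 ≤ hh v := hbp.nonneg_normed v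
lemma hh_cd : ContDiff ℝ (⊤ : ℕ∞) hh := hbp.contDiff_normed
lemma hh_cs : HasCompactSupport hh := hbp.hasCompactSupport_normed
lemma hh_int : ∫ v, hh v = 1 := hbp.integral_normed
lemma hh_sup {v : ℝ} (h : hh v ≠ 0) : -1 < v ∧ v < 0 := by
  have : v ∈ Function.support hh := h
  rw [hh, hbp.support_normed_eq, Metric.mem_ball, Real.dist_eq, abs_lt] at this
  simp only [hbp] at this
  constructor <;> linarith [this.1, this.2]
lemma hh_z1 (v : ℝ) (h : 0 ≤ v) : hh v = 0 := by by_contra h2; linarith [(hh_sup h2).2]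
lemma hh_z2 (v : ℝ) (h : v ≤ -1) : hh v = 0 := by by_contra h2; linarith [(hh_sup h2).1]
lemma hh_bd : ∃ B, 0 < B ∧ ∀ v, hh v ≤ B := by
  obtain ⟨B, hB⟩ := hh_cd.continuous.bounded_above_of_compact_support hh_cs
  exact ⟨|B|+1, by positivity, fun v => (le_abs_self _).trans ((hB v).trans (by linarith [le_abs_self B]))⟩
noncomputable def gp (N p : ℕ) : ℝ := if p ∣ N then 0 else 1/((p:ℝ)-1)
noncomputable def MN (N : ℕ) (t : ℝ) : ℝ := sm hh (fun p => if p.Prime then Real.log p * gp N p else 0) t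
lemma gp_nn (N p : ℕ) (hp : p.Prime) : 0 ≤ gp N p := by
  rw [gp]; split_ifs
  · rfl
  · have : (2:ℝ) ≤ p := by exact_mod_cast hp.two_le
    exact div_nonneg zero_le_one (by linarith)
lemma MU {η : ℝ} (hη : 0 < η) : ∃ t1 : ℝ, 1 ≤ t1 ∧ ∀ (N : ℕ) (t : ℝ), t1 ≤ t → MN N t ≤ 1 + η := by
  obtain ⟨t1, h1, h2⟩ := lam_lim hh_cd hh_cs (η := min 1 (η/2)) (by positivity)
  refine ⟨max t1 (2 + Real.log (8/η)), h1.trans (le_max_left _ _), fun N t ht => ?_⟩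
  have ht1 := (le_max_left _ _).trans ht
  have ht2 := (le_max_right _ _).trans ht
  have h3 := (abs_le.1 (h2 t ht1)).2
  rw [hh_int] at h3
  obtain ⟨X, hX⟩ := exists_nat_ge (Real.exp t)
  have hk : MN N t ≤ (1+η/4) * sm hh (fun n => Λ n / n) t := by
    rw [MN, sm_fin hh_z1 (by simp) hX, sm_fin hh_z1 (by simp) hX, Finset.mul_sum]
    refine Finset.sum_le_sum fun n hn => ?_
    rw [← mul_assoc]
    by_cases h5 : hh (Real.log n - t) = 0
    · rw [h5]; simp
    refine mul_le_mul_of_nonneg_right ?_ (hh_nn _)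
    have h0 : 0 ≤ Λ n / n := div_nonneg ArithmeticFunction.vonMangoldt_nonneg (Nat.cast_nonneg _)
    split_ifs with hp
    · rw [ArithmeticFunction.vonMangoldt_apply_prime hp] at h0 ⊢
      rw [gp]; split_ifs
      · rw [mul_zero]; positivity
      · have hn0 : (0:ℝ) < n := by exact_mod_cast hp.pos
        have hn2 : (2:ℝ) ≤ n := by exact_mod_cast hp.two_le
        have h6 : 1 + Real.log (8/η) ≤ Real.log n := by linarith [(hh_sup h5).1]
        have h7 : 8/η ≤ n := by
          rw [← Real.log_le_log_iff (by positivity) hn0]; linarith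
        rw [div_le_iff₀ hη] at h7
        have h8 : 1/((n:ℝ)-1) ≤ (1+η/4)/n := by
          rw [div_le_div_iff₀ (by linarith) hn0]; nlinarith
        calc _ ≤ Real.log n * ((1+η/4)/n) := mul_le_mul_of_nonneg_left h8 (Real.log_natCast_nonneg n)
          _ = _ := by ring
    · positivity
  have h4 : min 1 (η/2) ≤ 1 := min_le_left _ _
  have h5 : min 1 (η/2) ≤ η/2 := min_le_right _ _
  have h6 : (1+η/4) * sm hh (fun n => Λ n / n) t ≤ (1+η/4)*(1+min 1 (η/2)) := mul_le_mul_of_nonneg_left (by linarith) (by positivity)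
  nlinarith
lemma ML {η : ℝ} (hη : 0 < η) : ∃ t1 : ℝ, 1 ≤ t1 ∧ ∀ (N : ℕ) (t : ℝ), 1 ≤ N → t1 ≤ t → 2*Real.log (Real.log N) ≤ t → 1 - η ≤ MN N t := by
  obtain ⟨t1, h1, h2⟩ := lam_lim hh_cd hh_cs (η := η/2) (by positivity)
  obtain ⟨B, hB0, hB⟩ := hh_bd
  obtain ⟨C, hC0, hC⟩ := exp_pow_bd (1/2) (by norm_num) 2
  refine ⟨max t1 (B * Real.exp 1 * (3*C)/(η/2)), h1.trans (le_max_left _ _), fun N t hN ht ht3 => ?_⟩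
  have ht1 := (le_max_left _ _).trans ht
  have ht2 := (le_max_right _ _).trans ht
  have ht0 : 1 ≤ t := h1.trans ht1
  have h3 := (abs_le.1 (h2 t ht1)).1
  rw [hh_int] at h3
  have h4 := lamdiff hh_nn hB hh_z1 hh_z2 (show N ≠ 0 by omega) (T := t) (by linarith)
  have h5 : sm hh (fun n => if n.Prime ∧ ¬ n ∣ N then Real.log n / n else 0) t ≤ MN N t := by
    obtain ⟨X, hX⟩ := exists_nat_ge (Real.exp t)
    rw [MN, sm_fin hh_z1 (by simp) hX, sm_fin hh_z1 (by simp) hX]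
    refine Finset.sum_le_sum fun n hn => mul_le_mul_of_nonneg_right ?_ (hh_nn _)
    by_cases hp : n.Prime
    · by_cases hd : n ∣ N
      · simp [hp, hd, gp]
      · simp only [hp, hd, gp, not_false_eq_true, and_self, if_true, if_false]
        have hn2 : (2:ℝ) ≤ n := by exact_mod_cast hp.two_le
        rw [div_eq_mul_one_div]
        exact mul_le_mul_of_nonneg_left (one_div_le_one_div_of_le (by linarith) (by linarith)) (Real.log_natCast_nonneg n)
    · simp [hp]
  have h6 : Real.log N ≤ Real.exp (t/2) := by
    rcases le_or_gt (Real.log N) 0 with h | h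
    · exact h.trans (Real.exp_pos _).le
    · rw [← Real.log_le_iff_le_exp h]; linarith
  have h7 : B * Real.exp (1-t) * (2 * Real.exp (t/2) * t + Real.log N) ≤ η/2 := by
    have h8 : 2 * Real.exp (t/2) * t + Real.log N ≤ 3*t*Real.exp (t/2) := by nlinarith [Real.exp_pos (t/2)]
    have h9 := hC t (by linarith)
    calc _ ≤ B * Real.exp (1-t) * (3*t*Real.exp (t/2)) := mul_le_mul_of_nonneg_left h8 (by positivity)
      _ = B * Real.exp 1 * 3*t * Real.exp (-(1/2*t)) := by
        rw [show (1-t) = 1 + -(1/2*t) + -(t/2) by ring, Real.exp_add, Real.exp_add, Real.exp_neg (t/2)]; field_simp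
      _ ≤ B * Real.exp 1 * 3*t * (C/t^2) := mul_le_mul_of_nonneg_left h9 (by positivity)
      _ = B * Real.exp 1 * (3*C)/t := by field_simp
      _ ≤ η/2 := by
        rw [div_le_iff₀ (by positivity)] at ht2 ⊢; linarith
  linarith
end

section
open MeasureTheory Filter Topology
lemma hh_le (x a b : ℝ) (hab : a ≤ b) : ∫ t in a..b, hh (x-t) ≤ 1 := by
  have hi : Integrable (fun t => hh (x-t)) := (hh_cd.continuous.integrable_of_hasCompactSupport hh_cs).comp_sub_left x
  rw [intervalIntegral.integral_of_le hab]
  refine (setIntegral_le_integral hi (Eventually.of_forall fun _ => hh_nn _)).trans (le_of_eq ?_)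
  rw [integral_sub_left_eq_self, hh_int]
lemma hh_eq (x a b : ℝ) (ha : a ≤ x) (hb : x+1 ≤ b) : ∫ t in a..b, hh (x-t) = 1 := by
  rw [intervalIntegral.integral_eq_integral_of_support_subset, integral_sub_left_eq_self, hh_int]
  intro t ht
  have := hh_sup ht
  constructor <;> linarith [this.1, this.2]
lemma MN_fin (N : ℕ) (t : ℝ) (s : Finset ℕ) (hs : ∀ p : ℕ, p.Prime → hh (Real.log p - t) ≠ 0 → p ∈ s) :
    ∑ p ∈ s with p.Prime, Real.log p * gp N p * hh (Real.log p - t) = MN N t := by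
  rw [MN, sm, tsum_eq_sum (s := s), Finset.sum_filter]
  · exact Finset.sum_congr rfl fun p _ => by split_ifs <;> simp
  · intro p hp
    split_ifs with h
    · rw [not_not.1 fun h2 => hp (hs p h h2), mul_zero]
    · simp
lemma MN_le (N : ℕ) (t : ℝ) (s : Finset ℕ) : ∑ p ∈ s with p.Prime, Real.log p * gp N p * hh (Real.log p - t) ≤ MN N t := by
  obtain ⟨X, hX⟩ := exists_nat_ge (Real.exp t)
  rw [← MN_fin N t (s ∪ Finset.range X) fun p hp h => ?_]
  · refine Finset.sum_le_sum_of_subset_of_nonneg (Finset.filter_subset_filter _ Finset.subset_union_left) fun p hp _ => ?_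
    exact mul_nonneg (mul_nonneg (Real.log_natCast_nonneg p) (gp_nn N p (Finset.mem_filter.1 hp).2)) (hh_nn _)
  · rw [Finset.mem_union, Finset.mem_range]
    exact .inr (not_le.1 fun h2 => h (h_zero hh_z1 hX h2))
lemma hhc (x : ℝ) : Continuous fun t => hh (x-t) := hh_cd.continuous.comp (by fun_prop)
lemma LU {N z0 z : ℕ} {c : ℝ} (hz0 : 1 ≤ z0) (hM : ∀ t, Real.log z0 ≤ t → MN N t ≤ c) (F : ℕ → ℝ) (χ : ℝ → ℝ)
    (hχc : ContinuousOn χ (Set.Icc (Real.log z0) (Real.log z + 1))) (hχ : ∀ t ∈ Set.Icc (Real.log z0) (Real.log z + 1), 0 ≤ χ t)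
    (hF : ∀ p ∈ Finset.Ico z0 z, p.Prime → ∀ t, Real.log p ≤ t → t ≤ Real.log p + 1 → F p ≤ Real.log p * χ t) (hzz : z0 ≤ z) :
    ∑ p ∈ Finset.Ico z0 z with p.Prime, gp N p * F p ≤ c * ∫ t in (Real.log z0)..(Real.log z + 1), χ t := by
  have hz : Real.log z0 ≤ Real.log z := Real.log_le_log (by exact_mod_cast hz0) (by exact_mod_cast hzz)
  have hab : Real.log z0 ≤ Real.log z + 1 := by linarith
  have hi : ∀ p : ℕ, IntervalIntegrable (fun t => χ t * (Real.log p * gp N p * hh (Real.log p - t))) volume (Real.log z0) (Real.log z + 1) := by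
    intro p
    refine ContinuousOn.intervalIntegrable ?_
    rw [Set.uIcc_of_le hab]
    exact hχc.mul ((continuous_const.mul (hhc _)).continuousOn)
  calc _ ≤ ∑ p ∈ Finset.Ico z0 z with p.Prime, ∫ t in (Real.log z0)..(Real.log z + 1), χ t * (Real.log p * gp N p * hh (Real.log p - t)) := by
        refine Finset.sum_le_sum fun p hp => ?_
        rw [Finset.mem_filter] at hp
        have hp1 := Finset.mem_Ico.1 hp.1
        have l1 : Real.log z0 ≤ Real.log p := Real.log_le_log (by exact_mod_cast hz0) (by exact_mod_cast hp1.1)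
        have l2 : Real.log p ≤ Real.log z := Real.log_le_log (by exact_mod_cast hp.2.pos) (by exact_mod_cast hp1.2.le)
        have he := congrArg (gp N p * F p * ·) (hh_eq (Real.log p) (Real.log z0) (Real.log z + 1) l1 (by linarith))
        simp only [mul_one, ← intervalIntegral.integral_const_mul] at he
        rw [← he]
        refine intervalIntegral.integral_mono_on hab (((hhc _).intervalIntegrable _ _).const_mul _) (hi p) fun t ht => ?_
        by_cases h0 : hh (Real.log p - t) = 0
        · rw [h0]; simp
        · have h1 := hh_sup h0
          have h2 := mul_le_mul_of_nonneg_left (hF p hp.1 hp.2 t (by linarith) (by linarith)) (gp_nn N p hp.2)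
          have h3 := mul_le_mul_of_nonneg_right h2 (hh_nn (Real.log p - t))
          linarith
    _ = ∫ t in (Real.log z0)..(Real.log z + 1), ∑ p ∈ Finset.Ico z0 z with p.Prime, χ t * (Real.log p * gp N p * hh (Real.log p - t)) :=
        (intervalIntegral.integral_finsetSum fun p _ => hi p).symm
    _ ≤ ∫ t in (Real.log z0)..(Real.log z + 1), c * χ t := by
        refine intervalIntegral.integral_mono_on hab ?_ ?_ fun t ht => ?_
        · refine ContinuousOn.intervalIntegrable ?_
          rw [Set.uIcc_of_le hab]
          exact continuousOn_finset_sum _ fun p _ => hχc.mul ((continuous_const.mul (hhc _)).continuousOn)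
        · refine (ContinuousOn.intervalIntegrable ?_).const_mul c
          rwa [Set.uIcc_of_le hab]
        · rw [← Finset.mul_sum, mul_comm]
          exact mul_le_mul_of_nonneg_right ((MN_le N t _).trans (hM t ht.1)) (hχ t ht)
    _ = _ := intervalIntegral.integral_const_mul _ _
lemma LLow {N z Z : ℕ} {a b c : ℝ} (hz : 1 ≤ z) (hab : a ≤ b) (ha : Real.log z + 1 ≤ a) (hb : b ≤ Real.log Z) (hM : ∀ t, a ≤ t → t ≤ b → c ≤ MN N t) (F : ℕ → ℝ) (χ : ℝ → ℝ)
    (hχi : IntervalIntegrable χ volume a b) (hχ : ∀ t ∈ Set.Icc a b, 0 ≤ χ t)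
    (hF0 : ∀ p ∈ Finset.Ico z Z, p.Prime → 0 ≤ F p)
    (hF : ∀ p ∈ Finset.Ico z Z, p.Prime → ∀ t ∈ Set.Icc a b, Real.log p ≤ t → t ≤ Real.log p + 1 → Real.log p * χ t ≤ F p) :
    c * ∫ t in a..b, χ t ≤ ∑ p ∈ Finset.Ico z Z with p.Prime, gp N p * F p := by
  have hi : ∀ p : ℕ, IntervalIntegrable (fun t => χ t * (Real.log p * gp N p * hh (Real.log p - t))) volume a b :=
    fun p => hχi.mul_continuousOn (continuous_const.mul (hhc _)).continuousOn
  calc _ = ∫ t in a..b, c * χ t := (intervalIntegral.integral_const_mul _ _).symm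
    _ ≤ ∫ t in a..b, ∑ p ∈ Finset.Ico z Z with p.Prime, χ t * (Real.log p * gp N p * hh (Real.log p - t)) := by
        refine intervalIntegral.integral_mono_on hab (hχi.const_mul c) ?_ fun t ht => ?_
        · have := IntervalIntegrable.sum (Finset.filter Nat.Prime (Finset.Ico z Z)) (fun p _ => hi p)
          rwa [Finset.sum_fn] at this
        · rw [← Finset.mul_sum, mul_comm, MN_fin]
          · exact mul_le_mul_of_nonneg_left (hM t ht.1 ht.2) (hχ t ht)
          · intro p hp h0
            have h1 := hh_sup h0
            have hp0 : (0:ℝ) < p := by exact_mod_cast hp.pos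
            have hZ0 : (0:ℝ) < Z := by
              rcases Nat.eq_zero_or_pos Z with h | h
              · have hz' := Real.log_natCast_nonneg z
                rw [h, Nat.cast_zero, Real.log_zero] at hb; linarith
              · exact_mod_cast h
            rw [Finset.mem_Ico]
            constructor
            · have : (z:ℝ) ≤ p := (Real.log_le_log_iff (by exact_mod_cast hz) hp0).1 (by linarith [ht.1])
              exact_mod_cast this
            · have : (p:ℝ) < Z := (Real.log_lt_log_iff hp0 hZ0).1 (by linarith [ht.2])
              exact_mod_cast this
    _ = ∑ p ∈ Finset.Ico z Z with p.Prime, ∫ t in a..b, χ t * (Real.log p * gp N p * hh (Real.log p - t)) :=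
        intervalIntegral.integral_finsetSum fun p _ => hi p
    _ ≤ _ := by
        refine Finset.sum_le_sum fun p hp => ?_
        rw [Finset.mem_filter] at hp
        have hg := gp_nn N p hp.2
        have h4 : gp N p * F p * ∫ t in a..b, hh (Real.log p - t) ≤ gp N p * F p * 1 :=
          mul_le_mul_of_nonneg_left (hh_le _ _ _ hab) (mul_nonneg hg (hF0 p hp.1 hp.2))
        rw [mul_one] at h4
        refine le_trans ?_ h4
        rw [← intervalIntegral.integral_const_mul]
        refine intervalIntegral.integral_mono_on hab (hi p) (((hhc _).intervalIntegrable _ _).const_mul _) fun t ht => ?_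
        by_cases h0 : hh (Real.log p - t) = 0
        · rw [h0]; simp
        · have h1 := hh_sup h0
          have h2 := mul_le_mul_of_nonneg_left (hF p hp.1 hp.2 t ht (by linarith) (by linarith)) hg
          have h3 := mul_le_mul_of_nonneg_right h2 (hh_nn (Real.log p - t))
          linarith
lemma prime_recip {κ : ℝ} (hκ : 0 < κ) : ∃ C : ℝ, 0 ≤ C ∧ ∀ z : ℕ, 1 ≤ z → ∑ p ∈ Finset.range z with p.Prime, (1:ℝ)/p ≤ C + κ * Real.log z := by
  obtain ⟨t1, h1, h2⟩ := MU (η := 1) one_pos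
  obtain ⟨z0, hz0⟩ := exists_nat_ge (Real.exp (max t1 (2/κ)))
  have hz00 : (0:ℝ) < z0 := (Real.exp_pos _).trans_le hz0
  have hl0 := (Real.le_log_iff_exp_le hz00).2 hz0
  refine ⟨z0 + κ, by positivity, fun z hz => ?_⟩
  have hlz := Real.log_natCast_nonneg z
  have h4 : ∑ p ∈ Finset.range z0 with p.Prime, (1:ℝ)/p ≤ z0 := by
    refine (Finset.sum_le_card_nsmul _ _ 1 fun p hp => ?_).trans ?_
    · have : (1:ℝ) ≤ p := by exact_mod_cast (Finset.mem_filter.1 hp).2.one_le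
      rw [div_le_one (by linarith)]; exact this
    · rw [nsmul_eq_mul, mul_one]; exact_mod_cast (Finset.card_filter_le _ _).trans (by simp)
  rcases le_total z z0 with h | h
  · refine (Finset.sum_le_sum_of_subset_of_nonneg (Finset.filter_subset_filter _ (Finset.range_mono h)) fun _ _ _ => by positivity).trans (h4.trans ?_)
    nlinarith
  · have h5 := LU (N := 1) (z0 := z0) (z := z) (c := 2) (by exact_mod_cast hz00) (fun t ht => (h2 1 t (by linarith [(le_max_left t1 (2/κ)).trans hl0])).trans (by norm_num))
      (fun _ => 1) (fun _ => κ/2) continuousOn_const (fun _ _ => by positivity) (fun p hp _ t _ _ => ?_) h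
    · rw [Finset.sum_filter, ← Finset.sum_range_add_sum_Ico _ h, ← Finset.sum_filter, ← Finset.sum_filter]
      rw [intervalIntegral.integral_const, smul_eq_mul] at h5
      have h6 : ∑ p ∈ Finset.Ico z0 z with p.Prime, (1:ℝ)/p ≤ ∑ p ∈ Finset.Ico z0 z with p.Prime, gp 1 p * 1 := by
        refine Finset.sum_le_sum fun p hp => ?_
        have hp' := (Finset.mem_filter.1 hp).2
        have : (2:ℝ) ≤ p := by exact_mod_cast hp'.two_le
        rw [gp, if_neg (by rw [Nat.dvd_one]; exact hp'.one_lt.ne'), mul_one]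
        exact one_div_le_one_div_of_le (by linarith) (by linarith)
      have h7 : 0 ≤ Real.log z0 := Real.log_natCast_nonneg z0
      nlinarith
    · have h8 : Real.log z0 ≤ Real.log p := Real.log_le_log hz00 (by exact_mod_cast (Finset.mem_Ico.1 hp).1)
      have h9 := ((le_max_right t1 (2/κ)).trans hl0).trans h8
      rw [div_le_iff₀ hκ] at h9
      linarith
end

section
open MeasureTheory Filter Topology
open scoped ArithmeticFunction.vonMangoldt ArithmeticFunction.Moebius ArithmeticFunction.zeta
noncomputable def gN (N n : ℕ) : ℝ := if n = 0 then 0 else (n.primeFactorsList.map (gp N)).prod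
lemma gN_mul (N : ℕ) {a b : ℕ} (ha : a ≠ 0) (hb : b ≠ 0) : gN N (a*b) = gN N a * gN N b := by
  rw [gN, gN, gN, if_neg ha, if_neg hb, if_neg (mul_ne_zero ha hb), ((Nat.perm_primeFactorsList_mul ha hb).map _).prod_eq, List.map_append, List.prod_append]
lemma gN_zero (N : ℕ) : gN N 0 = 0 := if_pos rfl
lemma gN_one (N : ℕ) : gN N 1 = 1 := by simp [gN]
lemma gN_prime (N : ℕ) {p : ℕ} (hp : p.Prime) : gN N p = gp N p := by rw [gN, if_neg hp.ne_zero, Nat.primeFactorsList_prime hp]; simp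
lemma gN_pow (N : ℕ) {p : ℕ} (hp : p.Prime) (j : ℕ) : gN N (p^j) = gp N p ^ j := by
  induction j with
  | zero => simp [gN_one]
  | succ j ih => rw [pow_succ, gN_mul N (pow_ne_zero _ hp.ne_zero) hp.ne_zero, ih, gN_prime N hp, pow_succ]
lemma gN_nn (N n : ℕ) : 0 ≤ gN N n := by
  rw [gN]; split_ifs
  · rfl
  · refine List.prod_nonneg fun a ha => ?_
    obtain ⟨p, hp, rfl⟩ := List.mem_map.1 ha
    exact gp_nn N p (Nat.prime_of_mem_primeFactorsList hp)
noncomputable def cA (N : ℕ) : ArithmeticFunction ℝ := ⟨fun n => n * gN N n, by simp⟩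
noncomputable def kA (N : ℕ) : ArithmeticFunction ℝ := cA N * (μ : ArithmeticFunction ℝ)
lemma cA_eq (N : ℕ) : kA N * (ζ : ArithmeticFunction ℝ) = cA N := by rw [kA, mul_assoc, ArithmeticFunction.coe_moebius_mul_coe_zeta, mul_one]
lemma kA_mult (N : ℕ) : (kA N).IsMultiplicative := by
  refine ArithmeticFunction.IsMultiplicative.mul ?_ ArithmeticFunction.isMultiplicative_moebius.intCast
  rw [ArithmeticFunction.IsMultiplicative.iff_ne_zero]
  refine ⟨by simp [cA, gN_one], fun {a b} ha hb _ => ?_⟩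
  change ((a*b:ℕ):ℝ) * gN N (a*b) = (a * gN N a) * (b * gN N b)
  rw [gN_mul N ha hb]; push_cast; ring
lemma kA_pow (N : ℕ) {p : ℕ} (hp : p.Prime) (j : ℕ) : kA N (p^(j+1)) = (p * gp N p)^j * (p * gp N p - 1) := by
  have h : ∀ j, ∑ i ∈ Finset.range (j+1), kA N (p^i) = (p * gp N p)^j := by
    intro j
    have := congrArg (fun f : ArithmeticFunction ℝ => f (p^j)) (cA_eq N)
    simp only [ArithmeticFunction.coe_mul_zeta_apply, Nat.divisors_prime_pow hp, Finset.sum_map, Function.Embedding.coeFn_mk] at this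
    rw [this]
    change ((p^j:ℕ):ℝ) * gN N (p^j) = _
    rw [gN_pow N hp, mul_pow]; push_cast; rfl
  have h2 := h (j+1)
  rw [Finset.sum_range_succ, h j, pow_succ (_*_) j] at h2
  linear_combination h2
noncomputable def fa (N : ℕ) (α : ℝ) (n : ℕ) : ℝ := |kA N n| * (n:ℝ)^(α-1)
lemma fa_hr {N : ℕ} (hN : Even N) {α : ℝ} (h0 : 0 ≤ α) (h1 : α ≤ 1/4) {p : ℕ} (hp : p.Prime) :
     p * gp N p * (p:ℝ)^(α-1) ≤ 3/4 ∧ 0 ≤ p * gp N p * (p:ℝ)^(α-1) ∧ 4 * (|p * gp N p - 1| * (p:ℝ)^(α-1)) ≤ (if p ∣ N then 4*(p:ℝ)^(α-1) else 6 * (1/(p:ℝ)^((7:ℝ)/4))) := by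
  have hp0 : (0:ℝ) < p := by exact_mod_cast hp.pos
  have hp2 := hp.two_le
  rw [gp]
  split_ifs with h
  · simp only [mul_zero, zero_mul, zero_sub, abs_neg, abs_one, one_mul, le_refl, and_true]; norm_num
  · have hp3 : (3:ℝ) ≤ p := by
      have : p ≠ 2 := fun h2 => h (h2 ▸ hN.two_dvd)
      exact_mod_cast (show 3 ≤ p by omega)
    have hq : (0:ℝ) < p - 1 := by linarith
    have e2 : (p:ℝ) * (1/(p-1)) * (p:ℝ)^(α-1) = (p:ℝ)^α/(p-1) := by
      rw [Real.rpow_sub_one hp0.ne']; field_simp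
    have hb : (p:ℝ)^α ≤ 1 + (1/4)*(p-1) := by
      refine (Real.rpow_le_rpow_of_exponent_le (by linarith) h1).trans ?_
      have := rpow_one_add_le_one_add_mul_self (s := (p:ℝ)-1) (by linarith) (p := 1/4) (by norm_num) (by norm_num)
      rwa [add_sub_cancel] at this
    refine ⟨?_, by positivity, ?_⟩
    · rw [e2, div_le_iff₀ hq]; linarith
    · have e3 : (p:ℝ) * (1/(p-1)) - 1 = 1/(p-1) := by field_simp; ring
      have e4 : (p:ℝ)^((7:ℝ)/4) = p * (p:ℝ)^((3:ℝ)/4) := by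
        nth_rewrite 2 [← Real.rpow_one (p:ℝ)]; rw [← Real.rpow_add hp0]; norm_num
      rw [e3, abs_of_pos (by positivity), e4]
      have h5 : (p:ℝ)^(α-1) ≤ 1/(p:ℝ)^((3:ℝ)/4) := by
        rw [one_div, ← Real.rpow_neg hp0.le]; exact Real.rpow_le_rpow_of_exponent_le (by linarith) (by linarith)
      have h6 : 1/((p:ℝ)-1) ≤ (3/2)/p := by rw [div_le_div_iff₀ hq hp0]; linarith
      calc _ ≤ 4 * ((3/2)/p * (1/(p:ℝ)^((3:ℝ)/4))) := by gcongr
        _ = _ := by field_simp; norm_num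
lemma fa_loc {N : ℕ} (hN : Even N) {α : ℝ} (h0 : 0 ≤ α) (h1 : α ≤ 1/4) {p : ℕ} (hp : p.Prime) :
    Summable (fun e => fa N α (p^e)) ∧ ∑' e, fa N α (p^e) ≤ Real.exp ((if p ∣ N then (p:ℝ)^(α-1) else 0) + 6 * (1/(p:ℝ)^((7:ℝ)/4))) := by
  have hp0 : (0:ℝ) < p := by exact_mod_cast hp.pos
  have e1 : ∀ e, fa N α (p^(e+1)) = (|p * gp N p - 1| * (p:ℝ)^(α-1)) * (p * gp N p * (p:ℝ)^(α-1))^e := by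
    intro e
    have : ((p^(e+1):ℕ):ℝ)^(α-1) = ((p:ℝ)^(α-1))^(e+1) := by
      rw [Nat.cast_pow, ← Real.rpow_natCast_mul hp0.le, mul_comm, Real.rpow_mul_natCast hp0.le]
    rw [fa, kA_pow N hp, abs_mul, abs_pow, abs_of_nonneg (mul_nonneg hp0.le (gp_nn N p hp)), this, mul_pow, mul_pow, mul_pow, pow_succ]; ring
  have hp2 : 2 ≤ p := hp.two_le
  obtain ⟨r1, r2, r3⟩ := fa_hr hN h0 h1 hp
  have hs : HasSum (fun e => fa N α (p^(e+1))) ((|p * gp N p - 1| * (p:ℝ)^(α-1)) * (1 - p * gp N p * (p:ℝ)^(α-1))⁻¹) := by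
    simp_rw [e1]
    exact (hasSum_geometric_of_lt_one r2 (by linarith)).mul_left _
  have hs' := (summable_nat_add_iff (f := fun e => fa N α (p^e)) 1).1 hs.summable
  refine ⟨hs', ?_⟩
  rw [hs'.tsum_eq_zero_add, hs.tsum_eq, pow_zero, fa, (kA_mult N).1]
  simp only [abs_one, Nat.cast_one, Real.one_rpow, mul_one]
  refine le_trans ?_ (Real.add_one_le_exp _)
  rw [add_comm]
  refine add_le_add ?_ le_rfl
  have hb := Real.rpow_pos_of_pos hp0 (α-1)
  have h7 : 0 ≤ 6 * (1/(p:ℝ)^((7:ℝ)/4)) := by positivity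
  split_ifs at r3 ⊢ with h
  · simp [gp, h]; positivity
  · rw [zero_add]
    refine le_trans ?_ r3
    rw [mul_comm 4]
    refine mul_le_mul_of_nonneg_left ?_ (by positivity)
    rw [inv_le_comm₀ (by linarith) (by norm_num)]; linarith
lemma fa_zero (N : ℕ) (α : ℝ) : fa N α 0 = 0 := by simp [fa]
lemma fa_nn (N : ℕ) (α : ℝ) (n : ℕ) : 0 ≤ fa N α n := by rw [fa]; positivity
lemma fa_sum : ∃ Z : ℝ, 0 ≤ Z ∧ ∀ N : ℕ, N ≠ 0 → Even N → ∀ α : ℝ, 0 ≤ α → α ≤ 1/4 → Summable (fa N α) ∧ ∑' n, fa N α n ≤ Real.exp (Z + ∑ p ∈ N.primeFactors, (p:ℝ)^(α-1)) := by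
  have hZ : Summable fun n : ℕ => 6 * (1/(n:ℝ)^((7:ℝ)/4)) := (Real.summable_one_div_nat_rpow.2 (by norm_num)).mul_left 6
  refine ⟨∑' n : ℕ, 6 * (1/(n:ℝ)^((7:ℝ)/4)), tsum_nonneg fun n => by positivity, fun N hN0 hN α h0 h1 => ?_⟩
  have key : ∀ X, ∑ n ∈ Finset.range X, fa N α n ≤ Real.exp ((∑' n : ℕ, 6 * (1/(n:ℝ)^((7:ℝ)/4))) + ∑ p ∈ N.primeFactors, (p:ℝ)^(α-1)) := by
    intro X
    obtain ⟨s1, s2⟩ := EulerProduct.summable_and_hasSum_smoothNumbers_prod_primesBelow_tsum (f := fa N α) (by simp [fa, (kA_mult N).1])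
      (fun {m n} h => by rw [fa, fa, fa, (kA_mult N).2 h, abs_mul, Nat.cast_mul, Real.mul_rpow (by positivity) (by positivity)]; ring)
      (fun {p} hp => by simpa only [Real.norm_of_nonneg (fa_nn N α _)] using (fa_loc hN h0 h1 hp).1) X
    have s3 : Summable ((X.smoothNumbers).indicator (fa N α)) := summable_subtype_iff_indicator.1 s2.summable
    have s4 : ∑ n ∈ Finset.range X, fa N α n ≤ ∑' n, (X.smoothNumbers).indicator (fa N α) n := by
      refine le_trans (Finset.sum_le_sum fun n hn => ?_) (s3.sum_le_tsum (Finset.range X) fun n _ => Set.indicator_nonneg (fun n _ => fa_nn N α n) n)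
      rcases Nat.eq_zero_or_pos n with rfl | h
      · rw [fa_zero]; exact Set.indicator_nonneg (fun n _ => fa_nn N α n) 0
      · rw [Set.indicator_of_mem (Nat.mem_smoothNumbers_of_lt h (Finset.mem_range.1 hn))]
    rw [← tsum_subtype, s2.tsum_eq] at s4
    refine s4.trans ((Finset.prod_le_prod (fun p _ => tsum_nonneg fun _ => fa_nn N α _) fun p hp => (fa_loc hN h0 h1 (Nat.prime_of_mem_primesBelow hp)).2).trans ?_)
    rw [← Real.exp_sum, Real.exp_le_exp, Finset.sum_add_distrib, add_comm]
    refine add_le_add (hZ.sum_le_tsum _ fun _ _ => by positivity) ?_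
    rw [← Finset.sum_filter]
    refine Finset.sum_le_sum_of_subset_of_nonneg (fun p hp => ?_) fun _ _ _ => by positivity
    rw [Finset.mem_filter] at hp
    exact Nat.mem_primeFactors.2 ⟨Nat.prime_of_mem_primesBelow hp.1, hp.2, hN0⟩
  exact ⟨summable_of_sum_range_le (fa_nn N α) key, Real.tsum_le_of_sum_range_le (fa_nn N α) key⟩
lemma mult_sq : Multipliable (fun p : ℕ => if p.Prime ∧ 2 < p then (1 - 1/((p:ℝ)-1)^2) else 1) := by
  have : (fun p : ℕ => if p.Prime ∧ 2 < p then (1 - 1/((p:ℝ)-1)^2) else 1) = fun p : ℕ => 1 + (if p.Prime ∧ 2 < p then (- (1/((p:ℝ)-1)^2)) else 0) := by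
    ext p; split_ifs <;> ring
  rw [this]
  refine Real.multipliable_one_add_of_summable (Summable.of_norm_bounded (g := fun p : ℕ => 4 * (1/(p:ℝ)^2)) ((Real.summable_one_div_nat_pow.2 (by norm_num)).mul_left 4) fun p => ?_)
  split_ifs with h
  · have h3 : (3:ℝ) ≤ p := by exact_mod_cast h.2
    have : 0 < (p:ℝ)-1 := by linarith
    rw [norm_neg, Real.norm_of_nonneg (by positivity), ← mul_div_assoc, mul_one, div_le_div_iff₀ (by positivity) (by positivity)]
    nlinarith
  · simp
lemma Y_eq {N : ℕ} (hN0 : N ≠ 0) (hN : Even N) : (∑' n, kA N n / n) * (2 * CN N) = 1 := by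
  obtain ⟨_, _, hf⟩ := fa_sum
  have hs : Summable (fun n => ‖kA N n / n‖) := by
    convert (hf N hN0 hN 0 le_rfl (by norm_num)).1 using 2 with n
    rw [fa, zero_sub, Real.rpow_neg_one, norm_div, Real.norm_eq_abs, Real.norm_natCast, div_eq_mul_inv]
  have hE := EulerProduct.eulerProduct_hasProd_mulIndicator (f := fun n => kA N n / n) (by simp [(kA_mult N).1])
    (fun {m n} h => by rw [(kA_mult N).2 h, Nat.cast_mul, mul_div_mul_comm]) hs (by simp)
  have hl : ∀ p, p.Prime → ∑' e, kA N (p^e) / (p^e:ℕ) = if p ∣ N then 1 - 1/(p:ℝ) else 1/(1 - 1/((p:ℝ)-1)^2) := by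
    intro p hp
    have hp0 : (2:ℝ) ≤ p := by exact_mod_cast hp.two_le
    have hpp : (0:ℝ) < p := by linarith
    have e1 : ∀ e, kA N (p^(e+1)) / (p^(e+1):ℕ) = ((p * gp N p - 1)/p) * (gp N p)^e := by
      intro e; rw [kA_pow N hp]; push_cast; rw [mul_pow, pow_succ]; field_simp
    have hg : gp N p < 1 := by
      rw [gp]; split_ifs with h
      · norm_num
      · have hp3 : (3:ℝ) ≤ p := by
          have : p ≠ 2 := fun h2 => h (h2 ▸ hN.two_dvd)
          have := hp.two_le
          exact_mod_cast (show 3 ≤ p by omega)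
        rw [div_lt_one (by linarith)]; linarith
    have h2 : HasSum (fun e => kA N (p^(e+1)) / (p^(e+1):ℕ)) (((p * gp N p - 1)/p) * (1 - gp N p)⁻¹) := by
      simp_rw [e1]; exact (hasSum_geometric_of_lt_one (gp_nn N p hp) hg).mul_left _
    rw [((summable_nat_add_iff (f := fun e => kA N (p^e) / (p^e:ℕ)) 1).1 h2.summable).tsum_eq_zero_add, h2.tsum_eq, pow_zero, (kA_mult N).1]
    rw [gp] at hg ⊢
    split_ifs with h
    · field_simp; ring
    · rw [if_neg h] at hg
      have h1 : (0:ℝ) < p - 1 := by linarith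
      rw [div_lt_one h1] at hg
      have h3 : (p:ℝ) - 2 ≠ 0 := by intro h3; linarith
      have e2 : 1 - 1/((p:ℝ)-1)^2 = p*(p-2)/((p:ℝ)-1)^2 := by field_simp; ring
      have e3 : 1 - 1/((p:ℝ)-1) = (p-2)/((p:ℝ)-1) := by field_simp; ring
      rw [e2, e3]; field_simp; ring
  have hb : HasProd (fun p : ℕ => if p ∈ N.primeFactors.filter (fun p => 2 < p) then ((p:ℝ)-1)/(p-2) else 1)
      (∏ p ∈ N.primeFactors.filter (fun p => 2 < p), ((p:ℝ)-1)/((p:ℝ)-2)) := by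
    rw [← Finset.prod_congr rfl fun p (hp : p ∈ N.primeFactors.filter (fun p => 2 < p)) => (if_pos hp : (if p ∈ N.primeFactors.filter (fun p => 2 < p) then ((p:ℝ)-1)/(p-2) else 1) = _)]
    exact hasProd_prod_of_ne_finset_one fun p hp => if_neg hp
  have ha : ∏' p : {p : ℕ // p.Prime ∧ 2 < p}, (1 - 1/(((p:ℕ):ℝ)-1)^2) = ∏' p : ℕ, if p.Prime ∧ 2 < p then (1 - 1/((p:ℝ)-1)^2) else 1 := by
    refine (tprod_subtype {p : ℕ | p.Prime ∧ 2 < p} (fun p : ℕ => 1 - 1/((p:ℝ)-1)^2)).trans ?_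
    refine tprod_congr fun p => ?_
    simp [Set.mulIndicator_apply]
  have h1 := (hE.mul mult_sq.hasProd).mul hb
  have h2 : HasProd (fun p : ℕ => if p = 2 then (1/2:ℝ) else 1) (1/2) := hasProd_ite_eq 2 _
  have h3 := h1.unique (by
    refine (congrArg (HasProd · (1/2:ℝ)) (funext fun p => ?_)).mpr h2
    by_cases hp : p.Prime
    · rw [Set.mulIndicator_of_mem (by exact hp), hl p hp]
      simp only [Finset.mem_filter, Nat.mem_primeFactors, hp, true_and, ne_eq, hN0, not_false_eq_true, and_true]
      by_cases h2 : p = 2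
      · subst h2; simp [hN.two_dvd]; norm_num
      · have h5 := hp.two_le
        have h6 : 2 < p := by omega
        have h7 : (3:ℝ) ≤ p := by exact_mod_cast h6
        have h8 : (p:ℝ) - 2 ≠ 0 := by intro h; linarith
        have h9 : (p:ℝ) - 1 ≠ 0 := by intro h; linarith
        have hpp : (p:ℝ) ≠ 0 := by intro h; linarith
        have e2 : 1 - 1/((p:ℝ)-1)^2 = p*(p-2)/((p:ℝ)-1)^2 := by field_simp; ring
        simp only [h6, h2, and_true, if_true, if_false, e2]
        split_ifs <;> field_simp
    · have hp2 : p ≠ 2 := fun h => hp (h ▸ Nat.prime_two)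
      rw [Set.mulIndicator_of_notMem (by exact hp)]
      simp [hp, hp2])
  rw [CN, ha]
  linarith
end

section
open MeasureTheory Filter Topology
open scoped ArithmeticFunction.vonMangoldt ArithmeticFunction.Moebius ArithmeticFunction.zeta
lemma gN_div (N : ℕ) {n : ℕ} (hn : n ≠ 0) : gN N n = (∑ x ∈ n.divisorsAntidiagonal, kA N x.1) / n := by
  have h := congrArg (fun f : ArithmeticFunction ℝ => f n) (cA_eq N)
  simp only [ArithmeticFunction.mul_apply] at h
  have hn' : (n:ℝ) ≠ 0 := by exact_mod_cast hn
  rw [eq_div_iff hn', mul_comm]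
  change _ = (n:ℝ) * gN N n at h
  rw [← h]
  refine Finset.sum_congr rfl fun x hx => ?_
  have := Nat.mem_divisorsAntidiagonal.1 hx
  rw [ArithmeticFunction.natCoe_apply, ArithmeticFunction.zeta_apply_ne (by rintro h0; rw [h0] at this; simp at this; omega)]; simp
lemma sm_neg (f : ℕ → ℝ) (f0 : f 0 = 0) {t : ℝ} (ht : t ≤ 0) : sm hh f t = 0 := by
  rw [sm]
  refine (tsum_congr fun n => ?_).trans tsum_zero
  rcases Nat.eq_zero_or_pos n with rfl | h
  · rw [f0, zero_mul]
  · rw [hh_z1, mul_zero]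
    have := Real.log_natCast_nonneg n; linarith
lemma gconv (N : ℕ) (e : ℕ → ℝ) (he : ∀ a b, a ≠ 0 → b ≠ 0 → e (a*b) = e a * e b) (τ : ℝ) :
    sm hh (fun n => e n * gN N n) τ = ∑' a, e a * kA N a / a * sm hh (fun n => e n / n) (τ - Real.log a) := by
  obtain ⟨X, hX⟩ := exists_nat_ge (Real.exp τ)
  rw [sm_fin hh_z1 (by simp [gN_zero]) hX, tsum_eq_sum (s := Finset.Ioc 0 X)]
  · have e0 : ∀ a ∈ Finset.Ioc 0 X, e a * kA N a / a * sm hh (fun n => e n / n) (τ - Real.log a) =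
        ∑ b ∈ Finset.Ioc 0 X, e a * kA N a / a * (e b / b) * hh (Real.log a + Real.log b - τ) := by
      intro a ha
      have ha' := Finset.mem_Ioc.1 ha
      rw [sm_fin hh_z1 (by simp) (X := X) ((Real.exp_le_exp.2 (sub_le_self _ (Real.log_natCast_nonneg a))).trans hX), Finset.mul_sum]
      refine Finset.sum_congr rfl fun b _ => ?_
      rw [show Real.log b - (τ - Real.log a) = Real.log a + Real.log b - τ by ring]; ring
    rw [Finset.sum_congr rfl e0, ← Finset.sum_product']
    trans ∑ n ∈ Finset.Ioc 0 X, ∑ x ∈ Finset.Ioc 0 X ×ˢ Finset.Ioc 0 X with x.1 * x.2 = n,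
      e x.1 * kA N x.1 / x.1 * (e x.2 / x.2) * hh (Real.log x.1 + Real.log x.2 - τ)
    · refine Finset.sum_congr rfl fun n hn => ?_
      rw [Finset.mem_Ioc] at hn
      rw [gN_div N hn.1.ne', Nat.divisorsAntidiagonal_eq_prod_filter_of_le hn.1.ne' hn.2, Finset.sum_div, Finset.mul_sum, Finset.sum_mul]
      refine Finset.sum_congr rfl fun x hx => ?_
      simp only [Finset.mem_filter, Finset.mem_product, Finset.mem_Ioc] at hx
      have h1 : (x.1:ℝ) ≠ 0 := by exact_mod_cast hx.1.1.1.ne'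
      have h2 : (x.2:ℝ) ≠ 0 := by exact_mod_cast hx.1.2.1.ne'
      rw [← hx.2, Nat.cast_mul (α := ℝ), Real.log_mul h1 h2, he _ _ hx.1.1.1.ne' hx.1.2.1.ne']
      field_simp
    · simp_rw [Finset.sum_filter]
      rw [Finset.sum_comm]
      refine Finset.sum_congr rfl fun x hx => ?_
      simp only [Finset.mem_product, Finset.mem_Ioc] at hx
      rw [Finset.sum_ite_eq]
      split_ifs with h
      · rfl
      · have h3 : X ≤ x.1 * x.2 := by
          by_contra h4; exact h (Finset.mem_Ioc.2 ⟨Nat.mul_pos hx.1.1 hx.2.1, by omega⟩)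
        have := h_zero hh_z1 hX h3
        rw [Nat.cast_mul, Real.log_mul (by exact_mod_cast hx.1.1.ne') (by exact_mod_cast hx.2.1.ne')] at this
        rw [this, mul_zero]
  · intro a ha
    rcases Nat.eq_zero_or_pos a with rfl | h
    · simp
    · have h1 : X < a := by
        by_contra h2; exact ha (Finset.mem_Ioc.2 ⟨h, by omega⟩)
      have h2 : Real.exp τ ≤ a := hX.trans (by exact_mod_cast h1.le)
      rw [sm_neg _ (by simp) (by rw [sub_nonpos]; exact (Real.le_log_iff_exp_le (by exact_mod_cast h)).2 h2), mul_zero]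
lemma gconv_bd {N : ℕ} {e : ℕ → ℝ} (he : ∀ a b, a ≠ 0 → b ≠ 0 → e (a*b) = e a * e b) (he1 : ∀ a, |e a| ≤ 1) {ι C : ℝ} {m : ℕ} (hι : |ι| ≤ 1)
    (hR : ∀ t, |sm hh (fun n => e n / n) t| ≤ C) (hR2 : ∀ t, 0 < t → |sm hh (fun n => e n / n) t - ι| ≤ C/t^m)
    {α : ℝ} (hα : 0 ≤ α) (hf : Summable (fa N α)) {τ : ℝ} (hτ : 0 < τ) :
    |sm hh (fun n => e n * gN N n) τ - ι * ∑' a, e a * kA N a / a| ≤ (C*2^m/τ^m + (C+1)*Real.exp (-(α*τ/2))) * ∑' n, fa N α n := by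
  have hC : 0 ≤ C := (abs_nonneg _).trans (hR 0)
  have b0 : ∀ a, |e a * kA N a / a| ≤ fa N α a := by
    intro a
    rcases Nat.eq_zero_or_pos a with rfl | h
    · simp [fa]
    have ha : (1:ℝ) ≤ a := by exact_mod_cast h
    rw [abs_div, abs_mul, fa, div_eq_mul_inv]
    have : |(a:ℝ)|⁻¹ ≤ (a:ℝ)^(α-1) := by
      rw [abs_of_pos (by linarith), ← Real.rpow_neg_one]; exact Real.rpow_le_rpow_of_exponent_le ha (by linarith)
    exact mul_le_mul (mul_le_of_le_one_left (abs_nonneg _) (he1 a)) this (by positivity) (abs_nonneg _)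
  have s1 : Summable fun a => e a * kA N a / a := Summable.of_norm_bounded hf b0
  have s2 : Summable fun a : ℕ => e a * kA N a / a * sm hh (fun n => e n / n) (τ - Real.log a) :=
    Summable.of_norm_bounded (hf.mul_right C) fun a => by
      rw [norm_mul]; exact mul_le_mul (b0 a) (hR _) (norm_nonneg _) (fa_nn N α a)
  rw [gconv N e he, ← tsum_mul_left, ← (s2.tsum_sub (s1.mul_left ι)), ← tsum_mul_left]
  have s3 := hf.mul_left (C*2^m/τ^m + (C+1)*Real.exp (-(α*τ/2)))
  have b3 : ∀ a : ℕ, ‖e a * kA N a / a * sm hh (fun n => e n / n) (τ - Real.log a) - ι * (e a * kA N a / a)‖ ≤ (C*2^m/τ^m + (C+1)*Real.exp (-(α*τ/2))) * fa N α a := by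
    intro a
    rw [show e a * kA N a / a * sm hh (fun n => e n / n) (τ - Real.log a) - ι * (e a * kA N a / a) = e a * kA N a / a * (sm hh (fun n => e n / n) (τ - Real.log a) - ι) by ring, norm_mul, add_mul]
    rcases Nat.eq_zero_or_pos a with rfl | h
    · simp [fa]
    have ha : (0:ℝ) < a := by exact_mod_cast h
    rcases le_or_gt (Real.log a) (τ/2) with h | h
    · have h2 := hR2 (τ - Real.log a) (by linarith)
      have h3 : C/(τ - Real.log a)^m ≤ C*2^m/τ^m := by
        rw [mul_div_assoc, ← div_pow, div_eq_mul_inv, ← inv_pow, ← one_div]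
        refine mul_le_mul_of_nonneg_left (pow_le_pow_left₀ (by rw [one_div, inv_nonneg]; linarith) ?_ m) hC
        rw [div_le_div_iff₀ (by linarith) hτ]; linarith
      have := mul_le_mul (b0 a) (h2.trans h3) (abs_nonneg _) (fa_nn N α a)
      rw [Real.norm_eq_abs, Real.norm_eq_abs, mul_comm (C*2^m/τ^m)]
      refine this.trans (le_add_of_nonneg_right ?_)
      have := fa_nn N α a; positivity
    · have h2 : |sm hh (fun n => e n / n) (τ - Real.log a) - ι| ≤ C + 1 := (abs_sub _ _).trans (add_le_add (hR _) hι)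
      have b4 : |e a * kA N a / a| ≤ Real.exp (-(α*τ/2)) * fa N α a := by
        rw [abs_div, abs_mul, fa, div_eq_mul_inv, abs_of_pos ha]
        have : (a:ℝ)⁻¹ ≤ Real.exp (-(α*τ/2)) * (a:ℝ)^(α-1) := by
          rw [Real.rpow_sub_one ha.ne', Real.rpow_def_of_pos ha, ← mul_div_assoc, ← Real.exp_add, inv_eq_one_div]
          refine div_le_div_of_nonneg_right (Real.one_le_exp ?_) ha.le
          nlinarith
        calc _ ≤ |kA N a| * (Real.exp (-(α*τ/2)) * (a:ℝ)^(α-1)) := mul_le_mul (mul_le_of_le_one_left (abs_nonneg _) (he1 a)) this (by positivity) (abs_nonneg _)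
          _ = _ := by ring
      have := mul_le_mul b4 h2 (abs_nonneg _) (mul_nonneg (Real.exp_pos _).le (fa_nn N α a))
      have h6 := fa_nn N α a
      refine this.trans (le_add_of_nonneg_of_le (by positivity) (le_of_eq (by ring)))
  exact tsum_of_norm_bounded s3.hasSum b3
lemma hR_one (m : ℕ) : ∃ C : ℝ, 0 ≤ C ∧ (∀ t, |sm hh (fun n => 1 / n) t| ≤ C) ∧ ∀ t, 0 < t → |sm hh (fun n => 1 / n) t - 1| ≤ C/t^m := by
  obtain ⟨C, h0, h1, h2⟩ := riem (φ := fun v => (hh v : ℂ)) (Complex.ofRealCLM.contDiff.comp hh_cd) (cs_cast hh_cs) m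
  have e : ∀ t, (∑' n : ℕ, (1:ℂ)/n * (hh (Real.log n - t) : ℂ)) = ((sm hh (fun n => 1 / n) t : ℝ) : ℂ) := by
    intro t; rw [sm, Complex.ofReal_tsum]; push_cast; rfl
  refine ⟨C, h0, fun t => ?_, fun t ht => ?_⟩
  · have := h1 t; rwa [e, Complex.norm_real] at this
  · have := h2 t ht
    rwa [e, integral_complex_ofReal, hh_int, ← Complex.ofReal_sub, Complex.norm_real] at this
lemma hR_lam (m : ℕ) : ∃ C : ℝ, 0 ≤ C ∧ (∀ t, |sm hh (fun n => (ArithmeticFunction.liouville n:ℝ) / n) t| ≤ C) ∧ ∀ t, 0 < t → |sm hh (fun n => (ArithmeticFunction.liouville n:ℝ) / n) t - 0| ≤ C/t^m := by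
  have e : ∀ t, (∑' n : ℕ, (ArithmeticFunction.liouville n:ℂ)/n * (hh (Real.log n - t) : ℂ)) = ((sm hh (fun n => (ArithmeticFunction.liouville n:ℝ) / n) t : ℝ) : ℂ) := by
    intro t; rw [sm, Complex.ofReal_tsum]; push_cast; rfl
  have H := fun m => liou (φ := fun v => (hh v : ℂ)) (Complex.ofRealCLM.contDiff.comp hh_cd) (cs_cast hh_cs) m
  obtain ⟨C, h0, h1⟩ := H 0
  obtain ⟨C', h0', h1'⟩ := H m
  refine ⟨max C C', le_max_of_le_left h0, fun t => ?_, fun t ht => ?_⟩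
  · have := h1 t; rw [e, Complex.norm_real, pow_zero, mul_one] at this; exact this.trans (le_max_left _ _)
  · have := h1' t
    rw [e, Complex.norm_real, abs_of_pos ht] at this
    rw [sub_zero, le_div_iff₀ (by positivity)]; exact this.trans (le_max_right _ _)
noncomputable def YN (N : ℕ) : ℝ := ∑' a, kA N a / a
lemma pf_bd {κ : ℝ} (hκ : 0 < κ) : ∃ C : ℝ, 0 ≤ C ∧ ∀ N : ℕ, Real.exp 4 ≤ Real.log N →
    ∑ p ∈ N.primeFactors, (p:ℝ)^(1/Real.log (Real.log N) - 1) ≤ C + κ * Real.log (Real.log N) := by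
  obtain ⟨C, hC, H⟩ := prime_recip (κ := κ/6) (by linarith)
  refine ⟨6*C + κ + 12, by linarith, fun N hN => ?_⟩
  obtain ⟨l, hl⟩ : ∃ l, l = Real.log N := ⟨_, rfl⟩
  rw [← hl] at hN ⊢
  have h4 : (5:ℝ) ≤ Real.exp 4 := by have := Real.add_one_le_exp 4; linarith
  have hl0 : 0 < l := by linarith
  have hll : 4 ≤ Real.log l := (Real.le_log_iff_exp_le hl0).2 hN
  obtain ⟨α, hα⟩ : ∃ α, α = 1/Real.log l := ⟨_, rfl⟩
  have ha0 : 0 < α := by rw [hα]; positivity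
  have ha1 : α ≤ 1/4 := by rw [hα]; exact one_div_le_one_div_of_le (by norm_num) hll
  rw [← hα]
  have hN0 : N ≠ 0 := by rintro rfl; simp at hl; linarith
  obtain ⟨w, hw⟩ : ∃ w, w = ⌈l⌉₊ := ⟨_, rfl⟩
  have hw1 : l ≤ w := hw ▸ Nat.le_ceil l
  have hw2 : (w:ℝ) ≤ 2*l := by have := Nat.ceil_lt_add_one hl0.le; rw [← hw] at this; linarith
  have hw0 : (0:ℝ) < w := by linarith
  have hwl : Real.log w ≤ Real.log l + 1 := by
    have := Real.log_le_log hw0 hw2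
    rw [Real.log_mul (by norm_num) hl0.ne'] at this
    have := Real.log_two_lt_d9; linarith
  have hwa : (w:ℝ)^α ≤ 6 := by
    rw [Real.rpow_def_of_pos hw0]
    have h1 : Real.log w * α ≤ 1 + 1/4 := by
      have : Real.log l * α = 1 := by rw [hα]; field_simp
      nlinarith
    have h2 : Real.exp (1+1/4) ≤ 6 := by
      have h5 : Real.exp (1/4) ≤ 2 := by
        have h3 := Real.exp_one_lt_d9
        have h6 : Real.exp (1/4)^4 = Real.exp 1 := by rw [← Real.exp_nat_mul]; norm_num
        by_contra h7; push Not at h7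
        have := pow_lt_pow_left₀ h7 (by norm_num) (n := 4) (by norm_num)
        rw [h6] at this; linarith
      rw [Real.exp_add]; have := Real.exp_one_lt_d9; have := Real.exp_pos 1; nlinarith
    exact (Real.exp_le_exp.2 h1).trans h2
  have hcard : (N.primeFactors.card : ℝ) ≤ 2*l := by
    have h1 := log_pf hN0
    have h2 : ∑ p ∈ N.primeFactors, (1/2:ℝ) ≤ ∑ p ∈ N.primeFactors, Real.log p := Finset.sum_le_sum fun p hp => by
      have : (2:ℝ) ≤ p := by exact_mod_cast (Nat.prime_of_mem_primeFactors hp).two_le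
      have := Real.log_le_log (by norm_num) this
      have := Real.log_two_gt_d9; linarith
    rw [Finset.sum_const, nsmul_eq_mul] at h2
    rw [← hl] at h1; linarith
  rw [← Finset.sum_filter_add_sum_filter_not _ (fun p => p < w)]
  have t1 : ∑ p ∈ N.primeFactors with p < w, (p:ℝ)^(α-1) ≤ 6*C + κ * Real.log l + κ := by
    calc _ ≤ ∑ p ∈ N.primeFactors with p < w, 6 * (1/(p:ℝ)) := Finset.sum_le_sum fun p hp => by
          rw [Finset.mem_filter] at hp
          have hp0 : (0:ℝ) < p := by exact_mod_cast (Nat.prime_of_mem_primeFactors hp.1).pos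
          rw [Real.rpow_sub_one hp0.ne', mul_one_div]
          refine div_le_div_of_nonneg_right ((Real.rpow_le_rpow hp0.le ?_ ha0.le).trans hwa) hp0.le
          exact_mod_cast hp.2.le
      _ ≤ ∑ p ∈ Finset.range w with p.Prime, 6 * (1/(p:ℝ)) := by
          refine Finset.sum_le_sum_of_subset_of_nonneg (fun p hp => ?_) fun _ _ _ => by positivity
          rw [Finset.mem_filter] at hp ⊢
          exact ⟨Finset.mem_range.2 hp.2, Nat.prime_of_mem_primeFactors hp.1⟩
      _ ≤ _ := by
          rw [← Finset.mul_sum]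
          have := H w (by exact_mod_cast (show (1:ℝ) ≤ w by linarith))
          nlinarith
  have t2 : ∑ p ∈ N.primeFactors with ¬ p < w, (p:ℝ)^(α-1) ≤ 12 := by
    calc _ ≤ ∑ p ∈ N.primeFactors with ¬ p < w, (6 / (w:ℝ)) := Finset.sum_le_sum fun p hp => by
          rw [Finset.mem_filter] at hp
          refine (Real.rpow_le_rpow_of_nonpos hw0 (by exact_mod_cast (not_lt.1 hp.2)) (by linarith)).trans ?_
          rw [Real.rpow_sub_one hw0.ne']; exact div_le_div_of_nonneg_right hwa hw0.le
      _ ≤ (2*l) * (6/w) := by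
          rw [Finset.sum_const, nsmul_eq_mul]
          refine mul_le_mul_of_nonneg_right (le_trans ?_ hcard) (by positivity)
          exact_mod_cast Finset.card_filter_le _ _
      _ ≤ 12 := by rw [← mul_div_assoc, div_le_iff₀ hw0]; linarith
  linarith
lemma A3 {κ : ℝ} (hκ : 0 < κ) (m : ℕ) : ∃ C l0 : ℝ, 1 ≤ C ∧ 1 ≤ l0 ∧ ∀ N : ℕ, Even N → l0 ≤ Real.log N →
    YN N * (2 * CN N) = 1 ∧ YN N ≤ C*(Real.log N)^κ ∧ (∀ τ, sm hh (gN N) τ ≤ C*(Real.log N)^κ) ∧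
    ∀ τ, (Real.log N)^κ ≤ τ → |sm hh (gN N) τ - YN N| ≤ C*(Real.log N)^κ/τ^m ∧
      |sm hh (fun n => (ArithmeticFunction.liouville n:ℝ) * gN N n) τ| ≤ C*(Real.log N)^κ/τ^m := by
  obtain ⟨C1, hC1, H1⟩ := pf_bd hκ
  obtain ⟨Z, hZ, HZ⟩ := fa_sum
  obtain ⟨C2, hC2, R1, R2⟩ := hR_one m
  obtain ⟨C3, hC3, R3, R4⟩ := hR_lam m
  obtain ⟨C4, hC4, H4⟩ := exp_pow_bd (κ/4) (by linarith) (2*m)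
  obtain ⟨C0, hC0⟩ : ∃ C0, C0 = C2 + C3 := ⟨_, rfl⟩
  obtain ⟨E, hE⟩ : ∃ E, E = Real.exp (Z + C1) := ⟨_, rfl⟩
  have hE1 : 1 ≤ E := by rw [hE]; exact Real.one_le_exp (by positivity)
  refine ⟨(C0*2^m + (C0+1)*(C4+1) + 1) * E, Real.exp 4, ?_, Real.one_le_exp (by norm_num), fun N hN hl => ?_⟩
  · have : 0 ≤ C0*2^m + (C0+1)*(C4+1) := by rw [hC0]; positivity
    nlinarith
  obtain ⟨l, hl'⟩ : ∃ l, l = Real.log N := ⟨_, rfl⟩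
  have H1' := H1 N hl
  rw [← hl'] at hl H1' ⊢
  have h4 : (5:ℝ) ≤ Real.exp 4 := by have := Real.add_one_le_exp 4; linarith
  have hl0 : 0 < l := by linarith
  have hll : 4 ≤ Real.log l := (Real.le_log_iff_exp_le hl0).2 hl
  have hN0 : N ≠ 0 := by rintro rfl; simp at hl'; linarith
  obtain ⟨α, hα⟩ : ∃ α, α = 1/Real.log l := ⟨_, rfl⟩
  have ha0 : 0 < α := by rw [hα]; positivity
  have ha1 : α ≤ 1/4 := by rw [hα]; exact one_div_le_one_div_of_le (by norm_num) hll
  rw [← hα] at H1'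
  obtain ⟨hs, hsum⟩ := HZ N hN0 hN α ha0.le ha1
  have hF : ∑' n, fa N α n ≤ E * l^κ := by
    refine hsum.trans ?_
    rw [hE, Real.rpow_def_of_pos hl0, ← Real.exp_add, Real.exp_le_exp]; linarith
  have hF0 : 0 ≤ ∑' n, fa N α n := tsum_nonneg (fa_nn N α)
  have hk : 0 < l^κ := Real.rpow_pos_of_pos hl0 κ
  have hC00 : 0 ≤ C0 := by rw [hC0]; positivity
  have hbig : 0 ≤ C0*2^m + (C0+1)*(C4+1) := by positivity
  have b0 : ∀ a : ℕ, |kA N a / a| ≤ fa N α a := by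
    intro a
    rcases Nat.eq_zero_or_pos a with rfl | h
    · simp [fa]
    have ha : (1:ℝ) ≤ a := by exact_mod_cast h
    rw [abs_div, fa, div_eq_mul_inv, abs_of_pos (by linarith : (0:ℝ) < a), ← Real.rpow_neg_one]
    exact mul_le_mul_of_nonneg_left (Real.rpow_le_rpow_of_exponent_le ha (by linarith)) (abs_nonneg _)
  have gen : ∀ e : ℕ → ℝ, (∀ a b, a ≠ 0 → b ≠ 0 → e (a*b) = e a * e b) → (∀ a, |e a| ≤ 1) → ∀ ι, |ι| ≤ 1 →
    (∀ t, |sm hh (fun n => e n / n) t| ≤ C0) → (∀ t, 0 < t → |sm hh (fun n => e n / n) t - ι| ≤ C0/t^m) → ∀ τ, l^κ ≤ τ →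
     |sm hh (fun n => e n * gN N n) τ - ι * ∑' a, e a * kA N a / a| ≤ (C0*2^m + (C0+1)*(C4+1) + 1) * E * l^κ / τ^m := by
    intro e he he1 ι hι r1 r2 τ hτ
    have hτ0 : 0 < τ := hk.trans_le hτ
    refine (gconv_bd he he1 hι r1 r2 ha0.le hs hτ0).trans ?_
    have hx : Real.exp (-(α*τ/2)) ≤ C4/τ^m := by
      have h5 : Real.log l ≤ (2/κ) * Real.sqrt τ := by
        have h6 := Real.log_le_log hk hτ
        rw [Real.log_rpow hl0] at h6
        have h7 : Real.log τ ≤ 2 * Real.sqrt τ := by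
          have h8 := Real.log_sqrt hτ0.le
          have h9 := Real.log_le_sub_one_of_pos (Real.sqrt_pos.2 hτ0)
          linarith
        rw [div_mul_eq_mul_div, le_div_iff₀ hκ]; linarith
      have h6 := H4 (Real.sqrt τ) (Real.sqrt_pos.2 hτ0)
      rw [pow_mul, Real.sq_sqrt hτ0.le] at h6
      refine le_trans (Real.exp_le_exp.2 (neg_le_neg ?_)) h6
      rw [hα, show 1/Real.log l*τ/2 = τ/(2*Real.log l) by field_simp, le_div_iff₀ (by positivity)]
      have h10 : Real.sqrt τ * Real.sqrt τ = τ := Real.mul_self_sqrt hτ0.le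
      have h11 := mul_le_mul_of_nonneg_left h5 (show 0 ≤ κ/2 * Real.sqrt τ by positivity)
      have h12 : κ/2 * Real.sqrt τ * (2/κ * Real.sqrt τ) = τ := by field_simp; rw [Real.sq_sqrt hτ0.le]
      linarith
    calc _ ≤ (C0*2^m/τ^m + (C0+1)*(C4/τ^m)) * (E * l^κ) := by gcongr
      _ = (C0*2^m + (C0+1)*C4) * E * l^κ / τ^m := by ring
      _ ≤ _ := by gcongr ?_ * E * l^κ / τ^m; nlinarith
  have g1 : ∀ τ, |sm hh (gN N) τ| ≤ (C0*2^m + (C0+1)*(C4+1) + 1) * E * l^κ := by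
    intro τ
    have e1 := gconv N (fun _ => 1) (by simp) τ
    simp only [one_mul] at e1
    rw [e1, ← Real.norm_eq_abs]
    refine (tsum_of_norm_bounded (hs.mul_left C0).hasSum fun a => ?_).trans ?_
    · rw [norm_mul, mul_comm C0]
      exact mul_le_mul (b0 a) ((R1 _).trans (by linarith)) (abs_nonneg _) (fa_nn N α a)
    · rw [tsum_mul_left, mul_assoc]
      refine mul_le_mul ?_ hF hF0 (by positivity)
      have : (1:ℝ) ≤ 2^m := one_le_pow₀ (by norm_num)
      have : 0 ≤ (C0+1)*(C4+1) := by positivity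
      nlinarith
  refine ⟨Y_eq hN0 hN, ?_, fun τ => (le_abs_self _).trans (g1 τ), fun τ hτ => ⟨?_, ?_⟩⟩
  · refine (Real.le_norm_self _).trans ((tsum_of_norm_bounded hs.hasSum b0).trans (hF.trans ?_))
    have : 1 * (E*l^κ) ≤ (C0*2^m + (C0+1)*(C4+1) + 1) * (E * l^κ) := mul_le_mul_of_nonneg_right (by linarith) (by positivity)
    linarith
  · have := gen (fun _ => 1) (by simp) (by simp) 1 (by simp) (fun t => (R1 t).trans (by linarith)) (fun t ht => (R2 t ht).trans (by gcongr; linarith)) τ hτ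
    simpa only [one_mul, YN] using this
  · have := gen (fun n => (ArithmeticFunction.liouville n:ℝ)) (fun a b ha hb => by rw [ArithmeticFunction.liouville_apply_mul]; push_cast; rfl) (fun a => ?_) 0 (by simp) (fun t => (R3 t).trans (by linarith)) (fun t ht => (R4 t ht).trans (by gcongr; linarith)) τ hτ
    · simpa only [zero_mul, sub_zero] using this
    · rcases Nat.eq_zero_or_pos a with rfl | h
      · simp
      · rw [ArithmeticFunction.liouville_apply h.ne']; push_cast; simp
lemma sm_nn {f : ℕ → ℝ} (hf : ∀ n, 0 ≤ f n) (τ : ℝ) : 0 ≤ sm hh f τ := tsum_nonneg fun n => mul_nonneg (hf n) (hh_nn _)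
lemma Y_pos {N : ℕ} {a K : ℝ} {m : ℕ} (hm : m ≠ 0) (h : ∀ τ, a ≤ τ → |sm hh (gN N) τ - YN N| ≤ K/τ^m) (h1 : YN N * (2 * CN N) = 1) : 0 < YN N := by
  have h0 : 0 ≤ YN N := by
    have t : Tendsto (fun τ : ℝ => YN N + K/τ^m) atTop (𝓝 (YN N + 0)) := tendsto_const_nhds.add (tendsto_const_nhds.div_atTop (tendsto_pow_atTop hm))
    rw [add_zero] at t
    refine ge_of_tendsto t ?_
    filter_upwards [eventually_ge_atTop a] with τ hτ
    have := (abs_le.1 (h τ hτ)).2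
    have := sm_nn (gN_nn N) τ
    linarith
  refine h0.lt_of_ne fun h => ?_
  rw [← h, zero_mul] at h1; norm_num at h1
end

section
open MeasureTheory Filter Topology
open Classical in
noncomputable def sv (N : ℕ) : ℕ → Bool → ℝ → (ℕ → ℝ) → ℝ
  | 0, _, _, f => f 1
  | z+1, b, L, f => sv N z b L f - if z.Prime ∧ ¬ z ∣ N ∧ (b = false ∨ 3 * Real.log z + 2 < L) then sv N z (!b) (L - Real.log z) (fun d => f (z*d)) else 0
lemma sv_lin (N z : ℕ) (c : ℝ) : ∀ (b : Bool) (L : ℝ) (f g : ℕ → ℝ), sv N z b L (fun d => f d - c * g d) = sv N z b L f - c * sv N z b L g := by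
  induction z with
  | zero => intros; rfl
  | succ z ih =>
    intro b L f g
    rw [sv, sv, sv, ih, ih]
    split_ifs <;> ring
lemma sv_mul (N z : ℕ) (c : ℝ) (b : Bool) (L : ℝ) (g : ℕ → ℝ) : sv N z b L (fun d => c * g d) = c * sv N z b L g := by
  have h := sv_lin N z c b L (fun d => c * g d) g
  have h2 := sv_lin N z 1 b L (fun d => c * g d) (fun d => c * g d)
  have h3 := sv_lin N z 0 b L (fun d => c * g d - c * g d) (fun d => c * g d - c * g d)
  simp only [one_mul, sub_self, zero_mul] at h h2 h3
  linarith
open Classical in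
noncomputable def Wf (N z : ℕ) (L : ℝ) : Finset ℕ := (Finset.Icc 1 ⌊Real.exp L⌋₊).filter fun d => Squarefree d ∧ ∀ p, p.Prime → p ∣ d → p < z ∧ ¬ p ∣ N
def nodeC (b : Bool) (z : ℕ) (L : ℝ) : Prop := if b then Real.log z + 2 ≤ L else 2 * Real.log z + 2 ≤ L
lemma log_mono {a b : ℕ} (h : a ≤ b) : Real.log a ≤ Real.log b := by
  rcases Nat.eq_zero_or_pos a with rfl | h0
  · simpa using Real.log_natCast_nonneg b
  · exact Real.log_le_log (by exact_mod_cast h0) (by exact_mod_cast h)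
lemma nodeC_mono {b : Bool} {z w : ℕ} {L : ℝ} (h : z ≤ w) (hn : nodeC b w L) : nodeC b z L := by
  have := log_mono h
  cases b <;> simp only [nodeC, if_true, Bool.false_eq_true, if_false] at hn ⊢ <;> linarith
lemma nodeC_step {b : Bool} {z w : ℕ} {L : ℝ} (h : z ≤ w) (hn : nodeC b w L) (hc : b = false ∨ 3 * Real.log z + 2 < L) : nodeC (!b) z (L - Real.log z) := by
  have := log_mono h
  cases b <;> simp [nodeC] at hn hc ⊢ <;> linarith
lemma nodeC_pos {b : Bool} {z : ℕ} {L : ℝ} (hn : nodeC b z L) : 2 ≤ L := by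
  have := Real.log_natCast_nonneg z
  cases b <;> simp [nodeC] at hn <;> linarith
open Classical in
lemma sv_bd (N z : ℕ) : ∀ (b : Bool) (L : ℝ) (f : ℕ → ℝ), nodeC b z L → |sv N z b L f| ≤ ∑ d ∈ Wf N z L, |f d| := by
  induction z with
  | zero =>
    intro b L f h
    rw [sv]
    refine Finset.single_le_sum (f := fun d => |f d|) (fun _ _ => abs_nonneg _) ?_
    rw [Wf, Finset.mem_filter, Finset.mem_Icc]
    refine ⟨⟨le_rfl, Nat.le_floor (by simpa using (by linarith [nodeC_pos h] : (0:ℝ) ≤ L))⟩, squarefree_one, fun p hp h1 => absurd (Nat.dvd_one.1 h1) hp.ne_one⟩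
  | succ z ih =>
    intro b L f h
    rw [sv]
    have h1 := ih b L f (nodeC_mono (Nat.le_succ z) h)
    have hsub : Wf N z L ⊆ Wf N (z+1) L := by
      intro d hd
      rw [Wf, Finset.mem_filter] at hd ⊢
      exact ⟨hd.1, hd.2.1, fun p hp hpd => ⟨(hd.2.2 p hp hpd).1.trans (Nat.lt_succ_self z), (hd.2.2 p hp hpd).2⟩⟩
    split_ifs with hc
    · obtain ⟨hz, hzN, hc⟩ := hc
      have h2 := ih (!b) (L - Real.log z) (fun d => f (z*d)) (nodeC_step (Nat.le_succ z) h hc)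
      have hinj : Set.InjOn (fun d => z*d) (Wf N z (L - Real.log z) : Set ℕ) := fun a _ b _ hab => Nat.eq_of_mul_eq_mul_left hz.pos hab
      have e : ∑ d ∈ Wf N z (L - Real.log z), |f (z*d)| = ∑ d ∈ (Wf N z (L - Real.log z)).image (fun d => z*d), |f d| := (Finset.sum_image (f := fun d => |f d|) hinj).symm
      have hdis : Disjoint (Wf N z L) ((Wf N z (L - Real.log z)).image (fun d => z*d)) := by
        rw [Finset.disjoint_left]
        intro d hd hd2
        obtain ⟨c, _, rfl⟩ := Finset.mem_image.1 hd2
        rw [Wf, Finset.mem_filter] at hd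
        exact lt_irrefl _ (hd.2.2 z hz (Dvd.intro c rfl)).1
      have hsub2 : (Wf N z (L - Real.log z)).image (fun d => z*d) ⊆ Wf N (z+1) L := by
        intro d hd
        obtain ⟨c, hc, rfl⟩ := Finset.mem_image.1 hd
        rw [Wf, Finset.mem_filter, Finset.mem_Icc] at hc ⊢
        obtain ⟨⟨c1, c2⟩, c3, c4⟩ := hc
        have hz0 : (0:ℝ) < z := by exact_mod_cast hz.pos
        refine ⟨⟨Nat.mul_pos hz.pos c1, Nat.le_floor ?_⟩, ?_, fun p hp hpd => ?_⟩
        · have := (Nat.le_floor_iff (Real.exp_pos _).le).1 c2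
          rw [Real.exp_sub, Real.exp_log hz0, le_div_iff₀ hz0] at this
          push_cast; linarith
        · refine (Nat.squarefree_mul ((Nat.Prime.coprime_iff_not_dvd hz).2 fun h => lt_irrefl _ (c4 z hz h).1)).2 ⟨hz.squarefree, c3⟩
        · rcases (Nat.Prime.dvd_mul hp).1 hpd with h | h
          · rw [(Nat.prime_dvd_prime_iff_eq hp hz).1 h]; exact ⟨Nat.lt_succ_self z, hzN⟩
          · exact ⟨(c4 p hp h).1.trans (Nat.lt_succ_self z), (c4 p hp h).2⟩
      calc _ ≤ |sv N z b L f| + |sv N z (!b) (L - Real.log z) (fun d => f (z*d))| := abs_sub _ _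
        _ ≤ ∑ d ∈ Wf N z L, |f d| + ∑ d ∈ (Wf N z (L - Real.log z)).image (fun d => z*d), |f d| := by rw [← e]; exact add_le_add h1 h2
        _ = ∑ d ∈ Wf N z L ∪ (Wf N z (L - Real.log z)).image (fun d => z*d), |f d| := (Finset.sum_union hdis).symm
        _ ≤ _ := Finset.sum_le_sum_of_subset_of_nonneg (Finset.union_subset hsub hsub2) fun _ _ _ => abs_nonneg _
    · rw [sub_zero]
      exact h1.trans (Finset.sum_le_sum_of_subset_of_nonneg hsub fun _ _ _ => abs_nonneg _)
open Classical in
lemma sv_real {ι : Type*} (s : Finset ι) (v : ι → ℕ) (N z : ℕ) : ∀ (a : ι → ℝ) (f : ℕ → ℝ) (L : ℝ), (∀ i ∈ s, 0 ≤ a i) →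
    (∀ d, (∀ p, p.Prime → p ∣ d → p < z) → f d = ∑ i ∈ s, if d ∣ v i then a i else 0) →
    sv N z false L f ≤ ∑ i ∈ s, (if ∀ p, p.Prime → p < z → ¬ p ∣ N → ¬ p ∣ v i then a i else 0) ∧
    ∑ i ∈ s, (if ∀ p, p.Prime → p < z → ¬ p ∣ N → ¬ p ∣ v i then a i else 0) ≤ sv N z true L f := by
  induction z with
  | zero =>
    intro a f L ha hf
    have := hf 1 (fun p hp h => absurd (Nat.dvd_one.1 h) hp.ne_one)
    simp only [one_dvd, if_true] at this
    simp [sv, this]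
  | succ z ih =>
    intro a f L ha hf
    have hf1 : ∀ d, (∀ p, p.Prime → p ∣ d → p < z) → f d = ∑ i ∈ s, if d ∣ v i then a i else 0 := fun d hd => hf d fun p hp h => (hd p hp h).trans (Nat.lt_succ_self z)
    have i1 := ih a f L ha hf1
    by_cases hz : z.Prime ∧ ¬ z ∣ N
    · have i2 := ih (fun i => if z ∣ v i then a i else 0) (fun d => f (z*d)) (L - Real.log z) (fun i hi => by split_ifs; exacts [ha i hi, le_rfl]) (fun d hd => by
        rw [hf (z*d) (fun p hp h => by
          rcases (Nat.Prime.dvd_mul hp).1 h with h | h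
          · rw [(Nat.prime_dvd_prime_iff_eq hp hz.1).1 h]; exact Nat.lt_succ_self z
          · exact (hd p hp h).trans (Nat.lt_succ_self z))]
        refine Finset.sum_congr rfl fun i _ => ?_
        have hcop : z.Coprime d := (Nat.Prime.coprime_iff_not_dvd hz.1).2 fun h => lt_irrefl _ (hd z hz.1 h)
        rw [← ite_and]
        exact if_congr ⟨fun h => ⟨(Dvd.intro_left z rfl).trans h, (Dvd.intro d rfl).trans h⟩, fun h => hcop.mul_dvd_of_dvd_of_dvd h.2 h.1⟩ rfl rfl)
      have e : ∑ i ∈ s, (if ∀ p, p.Prime → p < z+1 → ¬ p ∣ N → ¬ p ∣ v i then a i else 0) = ∑ i ∈ s, (if ∀ p, p.Prime → p < z → ¬ p ∣ N → ¬ p ∣ v i then a i else 0)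
          - ∑ i ∈ s, (if ∀ p, p.Prime → p < z → ¬ p ∣ N → ¬ p ∣ v i then (if z ∣ v i then a i else 0) else 0) := by
        rw [← Finset.sum_sub_distrib]
        refine Finset.sum_congr rfl fun i _ => ?_
        by_cases h1 : ∀ p, p.Prime → p < z → ¬ p ∣ N → ¬ p ∣ v i
        · rw [if_pos h1, if_pos h1]
          by_cases h2 : z ∣ v i
          · rw [if_pos h2, if_neg (fun h => h z hz.1 (Nat.lt_succ_self z) hz.2 h2), sub_self]
          · rw [if_neg h2, if_pos, sub_zero]
            intro p hp hpz
            rcases Nat.lt_succ_iff_lt_or_eq.1 hpz with h | rfl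
            exacts [h1 p hp h, fun _ => h2]
        · rw [if_neg h1, if_neg h1, if_neg (fun h => h1 fun p hp hpz => h p hp (hpz.trans (Nat.lt_succ_self z))), sub_zero]
      have e0 : 0 ≤ ∑ i ∈ s, (if ∀ p, p.Prime → p < z → ¬ p ∣ N → ¬ p ∣ v i then (if z ∣ v i then a i else 0) else 0) :=
        Finset.sum_nonneg fun i hi => by have := ha i hi; split_ifs <;> simp [this]
      rw [e, sv, sv, if_pos ⟨hz.1, hz.2, Or.inl rfl⟩]
      refine ⟨sub_le_sub i1.1 i2.2, ?_⟩
      by_cases hc : z.Prime ∧ ¬ z ∣ N ∧ (true = false ∨ 3 * Real.log z + 2 < L)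
      · rw [if_pos hc]; exact sub_le_sub i1.2 i2.1
      · rw [if_neg hc]; linarith [i1.2]
    · have e : ∑ i ∈ s, (if ∀ p, p.Prime → p < z+1 → ¬ p ∣ N → ¬ p ∣ v i then a i else 0) = ∑ i ∈ s, (if ∀ p, p.Prime → p < z → ¬ p ∣ N → ¬ p ∣ v i then a i else 0) := by
        refine Finset.sum_congr rfl fun i _ => if_congr ⟨fun h p hp hpz => h p hp (hpz.trans (Nat.lt_succ_self z)), fun h p hp hpz hpN => ?_⟩ rfl rfl
        rcases Nat.lt_succ_iff_lt_or_eq.1 hpz with h' | rfl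
        exacts [h p hp h' hpN, absurd ⟨hp, hpN⟩ hz]
      rw [e, sv, sv, if_neg (fun h => hz ⟨h.1, h.2.1⟩), if_neg (fun h => hz ⟨h.1, h.2.1⟩), sub_zero, sub_zero]
      exact i1
end

section
open MeasureTheory Filter Topology
open Classical in
noncomputable def rg (N : ℕ) (w : ℕ → ℝ) (z n : ℕ) : ℝ := if ∀ p, p.Prime → p ∣ n → z ≤ p then w (ArithmeticFunction.cardFactors n) * gN N n else 0
noncomputable def Sw (N : ℕ) (w : ℕ → ℝ) (z : ℕ) (L : ℝ) : ℝ := sm hh (rg N w z) L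
lemma rg_zero (N : ℕ) (w : ℕ → ℝ) (z : ℕ) : rg N w z 0 = 0 := by rw [rg]; split_ifs <;> simp [gN_zero]
lemma rg_nn (N : ℕ) {w : ℕ → ℝ} (hw : ∀ k, 0 ≤ w k) (z n : ℕ) : 0 ≤ rg N w z n := by
  rw [rg]; split_ifs
  exacts [mul_nonneg (hw _) (gN_nn N n), le_rfl]
lemma Sw_nn (N : ℕ) {w : ℕ → ℝ} (hw : ∀ k, 0 ≤ w k) (z : ℕ) (L : ℝ) : 0 ≤ Sw N w z L := sm_nn (rg_nn N hw z) L
lemma sm_summable {f : ℕ → ℝ} (f0 : f 0 = 0) (L : ℝ) : Summable fun n : ℕ => f n * hh (Real.log n - L) := by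
  obtain ⟨X, hX⟩ := exists_nat_ge (Real.exp L)
  exact summable_of_ne_finset_zero (sm_term hh_z1 f0 hX)
lemma Sw_zero (N : ℕ) (w : ℕ → ℝ) {z : ℕ} (hz : z ≤ 2) (L : ℝ) : Sw N w z L = sm hh (fun n => w (ArithmeticFunction.cardFactors n) * gN N n) L := by
  rw [Sw]; congr 1; funext n; rw [rg, if_pos fun p hp _ => hz.trans hp.two_le]
open Classical in
lemma rg_succ (N : ℕ) (w : ℕ → ℝ) {z : ℕ} (hz : z.Prime) (n : ℕ) : rg N w z n = rg N w (z+1) n + if z ∣ n then rg N w z n else 0 := by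
  by_cases h : z ∣ n
  · rw [if_pos h, right_eq_add, rg, if_neg fun h' => absurd (h' z hz h) (by omega)]
  · rw [if_neg h, add_zero, rg, rg]
    refine if_congr ⟨fun h1 p hp hpn => ?_, fun h1 p hp hpn => (Nat.le_succ z).trans (h1 p hp hpn)⟩ rfl rfl
    exact Nat.lt_of_le_of_ne (h1 p hp hpn) (by rintro rfl; exact h hpn)
open Classical in
lemma rg_mul (N : ℕ) (w : ℕ → ℝ) {z : ℕ} (hz : z.Prime) (n : ℕ) : rg N w z (z*n) = gp N z * rg N (fun k => w (k+1)) z n := by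
  rcases Nat.eq_zero_or_pos n with rfl | h
  · simp [rg_zero]
  rw [rg, rg, gN_mul N hz.ne_zero h.ne', gN_prime N hz, ArithmeticFunction.cardFactors_mul hz.ne_zero h.ne', ArithmeticFunction.cardFactors_apply_prime hz, mul_ite, mul_zero, add_comm 1]
  refine if_congr ⟨fun h1 p hp hpn => h1 p hp (hpn.mul_left z), fun h1 p hp hpn => ?_⟩ (by ring) rfl
  rcases (Nat.Prime.dvd_mul hp).1 hpn with h | h
  exacts [((Nat.prime_dvd_prime_iff_eq hp hz).1 h).ge, h1 p hp h]
open Classical in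
lemma buch (N : ℕ) (w : ℕ → ℝ) (z : ℕ) (L : ℝ) :
    Sw N w z L = Sw N w (z+1) L + if z.Prime then gp N z * Sw N (fun k => w (k+1)) z (L - Real.log z) else 0 := by
  by_cases hz : z.Prime
  · rw [if_pos hz]
    have e1 : Sw N w z L = Sw N w (z+1) L + ∑' n : ℕ, (if z ∣ n then rg N w z n else 0) * hh (Real.log n - L) := by
      rw [Sw, Sw, sm, sm, ← (sm_summable (rg_zero N w (z+1)) L).tsum_add (sm_summable (by simp [rg_zero]) L)]
      refine tsum_congr fun n => ?_
      exact (congrArg (· * _) (rg_succ N w hz n)).trans (add_mul _ _ _)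
    rw [e1]
    congr 1
    rw [Sw, sm, ← tsum_mul_left]
    have hinj : Function.Injective (fun n : ℕ => z * n) := fun a b hab => Nat.eq_of_mul_eq_mul_left hz.pos hab
    rw [← hinj.tsum_eq]
    · refine tsum_congr fun n => ?_
      rw [if_pos (Dvd.intro n rfl), rg_mul N w hz]
      rcases Nat.eq_zero_or_pos n with rfl | h
      · simp [rg_zero]
      rw [Nat.cast_mul, Real.log_mul (by exact_mod_cast hz.ne_zero) (by exact_mod_cast h.ne'), show Real.log z + Real.log n - L = Real.log n - (L - Real.log z) by ring]
      ring
    · intro n hn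
      rw [Function.mem_support] at hn
      by_contra h
      refine hn ?_
      rw [if_neg, zero_mul]
      rintro ⟨c, rfl⟩; exact h ⟨c, rfl⟩
  · rw [if_neg hz, add_zero, Sw, Sw]
    congr 1; funext n; rw [rg, rg]
    refine if_congr ⟨fun h1 p hp hpn => ?_, fun h1 p hp hpn => (Nat.le_succ z).trans (h1 p hp hpn)⟩ rfl rfl
    exact Nat.lt_of_le_of_ne (h1 p hp hpn) (by rintro rfl; exact hz hp)
noncomputable def wm (k : ℕ) : ℝ := 1 + (-1)^k
noncomputable def wp (k : ℕ) : ℝ := 1 - (-1)^k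
lemma wm_nn (k : ℕ) : 0 ≤ wm k := by rw [wm]; rcases neg_one_pow_eq_or ℝ k with h | h <;> rw [h] <;> norm_num
lemma wp_nn (k : ℕ) : 0 ≤ wp k := by rw [wp]; rcases neg_one_pow_eq_or ℝ k with h | h <;> rw [h] <;> norm_num
lemma wm_s : (fun k => wm (k+1)) = wp := by funext k; rw [wm, wp, pow_succ]; ring
lemma wp_s : (fun k => wp (k+1)) = wm := by funext k; rw [wm, wp, pow_succ]; ring
noncomputable def Dm (N z : ℕ) (L : ℝ) : ℝ := Sw N wm z L - YN N * sv N z false L (gN N)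
noncomputable def Dp (N z : ℕ) (L : ℝ) : ℝ := YN N * sv N z true L (gN N) - Sw N wp z L
lemma gN_fun (N : ℕ) {z : ℕ} (hz : z.Prime) : (fun d => gN N (z*d)) = fun d => gp N z * gN N d := by
  funext d
  rcases Nat.eq_zero_or_pos d with rfl | h
  · simp [gN_zero]
  · rw [gN_mul N hz.ne_zero h.ne', gN_prime N hz]
open Classical in
lemma Dm_succ (N z : ℕ) (L : ℝ) : Dm N (z+1) L = Dm N z L + if z.Prime then gp N z * Dp N z (L - Real.log z) else 0 := by
  have h := buch N wm z L
  rw [wm_s] at h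
  rw [Dm, Dm, Dp, sv, h]
  by_cases hz : z.Prime
  · rw [if_pos hz, gN_fun N hz, sv_mul, if_pos hz]
    by_cases hN : z ∣ N
    · rw [if_neg fun h => h.2.1 hN, gp, if_pos hN]; ring
    · rw [if_pos ⟨hz, hN, Or.inl rfl⟩, Bool.not_false]; ring
  · rw [if_neg hz, if_neg hz, if_neg fun h => hz h.1]; ring
open Classical in
lemma Dp_succ (N z : ℕ) (L : ℝ) : Dp N (z+1) L = Dp N z L + if z.Prime then gp N z * (if 3 * Real.log z + 2 < L then Dm N z (L - Real.log z) else Sw N wm z (L - Real.log z)) else 0 := by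
  have h := buch N wp z L
  rw [wp_s] at h
  rw [Dp, Dp, Dm, sv, h]
  by_cases hz : z.Prime
  · rw [if_pos hz, gN_fun N hz, sv_mul, if_pos hz]
    by_cases hN : z ∣ N
    · rw [if_neg fun h => h.2.1 hN, gp, if_pos hN]; ring
    · by_cases hc : 3 * Real.log z + 2 < L
      · rw [if_pos ⟨hz, hN, Or.inr hc⟩, if_pos hc, Bool.not_true]; ring
      · rw [if_neg fun h => ?_, if_neg hc]; ring
        rcases h.2.2 with h | h
        exacts [by simp at h, hc h]
  · rw [if_neg hz, if_neg hz, if_neg fun h => hz h.1]; ring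
open Classical in
lemma tele {D F : ℕ → ℝ} (h : ∀ z, D (z+1) = D z + if z.Prime then F z else 0) {z0 z : ℕ} (hz : z0 ≤ z) : D z = D z0 + ∑ p ∈ Finset.Ico z0 z with p.Prime, F p := by
  induction z, hz using Nat.le_induction with
  | base => simp
  | succ n hn ih => rw [h, ih, Finset.sum_filter, Finset.sum_filter, Finset.sum_Ico_succ_top hn]; ring
end

section
open MeasureTheory Filter Topology
lemma wm_le (k : ℕ) : wm k ≤ 2 := by rw [wm]; rcases neg_one_pow_eq_or ℝ k with h | h <;> rw [h] <;> norm_num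
lemma wp_le (k : ℕ) : wp k ≤ 2 := by rw [wp]; rcases neg_one_pow_eq_or ℝ k with h | h <;> rw [h] <;> norm_num
lemma two_fac {p n : ℕ} (hp : 2 ≤ p) (h0 : n ≠ 0) (hr : ∀ q, q.Prime → q ∣ n → p ≤ q) (h1 : n ≠ 1) (hw : wm (ArithmeticFunction.cardFactors n) ≠ 0) (hn : n < p^3) :
    ∃ q r, q.Prime ∧ r.Prime ∧ p ≤ q ∧ p ≤ r ∧ n = q * r := by
  obtain ⟨m, hm⟩ := Nat.minFac_dvd n
  have hq := Nat.minFac_prime h1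
  have hq2 := hr _ hq (Nat.minFac_dvd n)
  have hm0 : m ≠ 0 := by rintro rfl; exact h0 (by rw [hm, mul_zero])
  have hm1 : m ≠ 1 := by
    rintro rfl
    rw [mul_one] at hm
    rw [hm, ArithmeticFunction.cardFactors_apply_prime hq, wm] at hw
    norm_num at hw
  obtain ⟨k, hk⟩ := Nat.minFac_dvd m
  have hs := Nat.minFac_prime hm1
  have hs2 := hr _ hs ((Nat.minFac_dvd m).trans (hm ▸ Dvd.intro_left _ rfl))
  have hk1 : k = 1 := by
    by_contra hk1
    have hk0 : k ≠ 0 := by rintro rfl; exact hm0 (by rw [hk, mul_zero])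
    have h3 := hr _ (Nat.minFac_prime hk1) ((Nat.minFac_dvd k).trans ((Dvd.intro_left _ hk.symm).trans (Dvd.intro_left _ hm.symm)))
    have h4 := h3.trans (Nat.minFac_le (Nat.pos_of_ne_zero hk0))
    have : p^3 ≤ n := by
      calc p^3 = p*(p*p) := by ring
        _ ≤ n.minFac * (m.minFac * k) := Nat.mul_le_mul hq2 (Nat.mul_le_mul hs2 h4)
        _ = n := by rw [← hk, ← hm]
    omega
  exact ⟨_, _, hq, hs, hq2, hs2, by rw [hk1, mul_one] at hk; rw [← hk]; exact hm⟩
lemma src : ∃ (C : ℝ) (z1 : ℕ), 0 ≤ C ∧ 1 ≤ z1 ∧ ∀ (N p : ℕ) (L : ℝ), z1 ≤ p → 2 ≤ L → L ≤ 2 * Real.log p + 2 → Sw N wm p L ≤ C/(Real.log p)^2 := by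
  obtain ⟨t1, ht1, hM⟩ := MU (η := 1) one_pos
  obtain ⟨B, hB, hB2⟩ := hh_bd
  obtain ⟨z1, hz1⟩ := exists_nat_ge (Real.exp (t1+2))
  refine ⟨2*B*64, z1, by positivity, ?_, fun N p L hp hL hL2 => ?_⟩
  · have := Real.exp_pos (t1+2)
    have h : (0:ℝ) < z1 := by linarith
    exact_mod_cast h
  have hp0 : Real.exp (t1+2) ≤ p := hz1.trans (by exact_mod_cast hp)
  have hpp : (0:ℝ) < p := (Real.exp_pos _).trans_le hp0
  have hlp : t1 + 2 ≤ Real.log p := (Real.le_log_iff_exp_le hpp).2 hp0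
  have hp1 : 1 ≤ p := by exact_mod_cast hpp
  have hp2 : 2 ≤ p := by
    by_contra h
    have : p = 1 := by omega
    rw [this] at hlp; simp at hlp; linarith
  obtain ⟨A, hA⟩ : ∃ A, A = (Finset.Ico p (8*p)).filter Nat.Prime := ⟨_, rfl⟩
  have hl8 : Real.log (8*p:ℕ) ≤ Real.log p + 3 := by
    push_cast
    rw [Real.log_mul (by norm_num) hpp.ne', show (8:ℝ) = 2^3 by norm_num, Real.log_pow]
    have := Real.log_two_lt_d9; push_cast; linarith
  have hA1 : ∑ q ∈ A, gp N q ≤ 8/Real.log p := by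
    have := LU (N := N) (z0 := p) (z := 8*p) (c := 1+1) hp1 (fun t ht => hM N t (by linarith)) (fun _ => 1) (fun _ => 1/Real.log p) continuousOn_const
      (fun _ _ => by have : 0 < Real.log p := by linarith
                     positivity) (fun q hq _ t _ _ => by
        rw [Finset.mem_Ico] at hq
        rw [mul_one_div, one_le_div (by linarith)]; exact log_mono hq.1) (by omega)
    simp only [mul_one, intervalIntegral.integral_const, smul_eq_mul] at this
    rw [hA]
    refine this.trans ?_
    have hl0 : 0 < Real.log p := by linarith
    rw [mul_one_div, ← mul_div_assoc]
    refine div_le_div_of_nonneg_right ?_ hl0.le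
    linarith
  have hA0 : 0 ≤ ∑ q ∈ A, gp N q := Finset.sum_nonneg fun q hq => gp_nn N q (by rw [hA, Finset.mem_filter] at hq; exact hq.2)
  classical
  rw [Sw, sm, tsum_eq_sum (s := (A ×ˢ A).image fun x => x.1 * x.2)]
  · calc _ ≤ ∑ n ∈ (A ×ˢ A).image (fun x => x.1 * x.2), 2*B*gN N n := by
          refine Finset.sum_le_sum fun n _ => ?_
          have h1 : rg N wm p n ≤ 2 * gN N n := by
            have := gN_nn N n
            rw [rg]; split_ifs
            · exact mul_le_mul_of_nonneg_right (wm_le _) this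
            · linarith
          calc _ ≤ (2 * gN N n) * B := mul_le_mul h1 (hB2 _) (hh_nn _) (by have := gN_nn N n; linarith)
            _ = _ := by ring
      _ ≤ ∑ x ∈ A ×ˢ A, 2*B*gN N (x.1*x.2) := Finset.sum_image_le_of_nonneg fun n _ => by have := gN_nn N n; positivity
      _ = 2*B*(∑ q ∈ A, gp N q)^2 := by
          rw [← Finset.mul_sum, sq, Finset.sum_mul_sum, ← Finset.sum_product']
          congr 1
          refine Finset.sum_congr rfl fun x hx => ?_
          simp only [hA, Finset.mem_product, Finset.mem_filter] at hx
          rw [gN_mul N hx.1.2.ne_zero hx.2.2.ne_zero, gN_prime N hx.1.2, gN_prime N hx.2.2]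
      _ ≤ 2*B*(8/Real.log p)^2 := by gcongr
      _ = _ := by rw [div_pow]; ring
  · intro n hn
    by_contra hne
    refine hn ?_
    have hr := left_ne_zero_of_mul hne
    obtain ⟨h1, h2⟩ := hh_sup (right_ne_zero_of_mul hne)
    rw [rg] at hr
    split_ifs at hr with hrr
    swap; · exact absurd rfl hr
    have hn0 : n ≠ 0 := by rintro rfl; simp [gN_zero] at hr
    have hn1 : n ≠ 1 := by rintro rfl; simp at h1; linarith
    have hnn : (0:ℝ) < n := by exact_mod_cast Nat.pos_of_ne_zero hn0
    have h3 : n < p^3 := by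
      have : Real.log n < Real.log ((p^3:ℕ):ℝ) := by push_cast; rw [Real.log_pow]; push_cast; linarith
      exact_mod_cast (Real.log_lt_log_iff hnn (by positivity)).1 this
    obtain ⟨q, r, hq, hr', hpq, hpr, rfl⟩ := two_fac hp2 hn0 hrr hn1 (left_ne_zero_of_mul hr) h3
    have h8 : q * r < 8*p*p := by
      have : Real.log ((q*r:ℕ):ℝ) < Real.log ((8*p*p:ℕ):ℝ) := by
        rw [show ((8*p*p:ℕ):ℝ) = 2^3*p*p by push_cast; norm_num, Real.log_mul (by positivity) hpp.ne', Real.log_mul (by norm_num) hpp.ne', Real.log_pow]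
        have := Real.log_two_gt_d9; push_cast at *; linarith
      exact_mod_cast (Real.log_lt_log_iff hnn (by positivity)).1 this
    refine Finset.mem_image.2 ⟨(q, r), ?_, rfl⟩
    simp only [hA, Finset.mem_product, Finset.mem_filter, Finset.mem_Ico]
    refine ⟨⟨⟨hpq, ?_⟩, hq⟩, ⟨hpr, ?_⟩, hr'⟩ <;> by_contra h <;> push Not at h
    · have := Nat.mul_le_mul h hpr; omega
    · have := Nat.mul_le_mul hpq h
      have e : p*(8*p) = 8*p*p := by ring
      omega
end

section
open MeasureTheory Filter Topology
lemma int1 {L b : ℝ} (hb : 0 ≤ b) (hL : b < L) : ∫ t in (0:ℝ)..b, t^2/(L-t)^4 = b^3/(3*L*(L-b)^3) := by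
  have hL0 : 0 < L := by linarith
  have := intervalIntegral.integral_eq_sub_of_hasDerivAt (a := 0) (b := b) (f := fun t => t^3/(3*L*(L-t)^3)) (f' := fun t => t^2/(L-t)^4) (fun t ht => ?_) ?_
  · rw [this]; simp
  · rw [Set.uIcc_of_le hb] at ht
    have h1 : L - t ≠ 0 := by have := ht.2; intro h; linarith
    have h2 : HasDerivAt (fun t : ℝ => L - t) (-1) t := by simpa using (hasDerivAt_id t).const_sub L
    have h3 := (hasDerivAt_pow 3 t).div ((h2.pow 3).const_mul (3*L)) (mul_ne_zero (by positivity) (pow_ne_zero 3 h1))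
    refine h3.congr_deriv ?_
    simp only [Pi.pow_apply]
    field_simp
    push_cast
    ring
  · refine ContinuousOn.intervalIntegrable ?_
    rw [Set.uIcc_of_le hb]
    refine ContinuousOn.div (by fun_prop) (by fun_prop) fun t ht => pow_ne_zero 4 ?_
    have := ht.2; intro h; linarith
lemma int_ext {χ : ℝ → ℝ} {α b : ℝ} (h0 : 0 ≤ α) (hα : α ≤ b) (hc : ContinuousOn χ (Set.Icc 0 b)) (hn : ∀ t ∈ Set.Icc 0 b, 0 ≤ χ t) : ∫ t in α..b, χ t ≤ ∫ t in (0:ℝ)..b, χ t := by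
  have i1 : IntervalIntegrable χ volume 0 α := by
    refine ContinuousOn.intervalIntegrable ?_
    rw [Set.uIcc_of_le h0]; exact hc.mono (Set.Icc_subset_Icc_right hα)
  have i2 : IntervalIntegrable χ volume α b := by
    refine ContinuousOn.intervalIntegrable ?_
    rw [Set.uIcc_of_le hα]; exact hc.mono (Set.Icc_subset_Icc_left h0)
  rw [← intervalIntegral.integral_add_adjacent_intervals i1 i2]
  have := intervalIntegral.integral_nonneg (μ := volume) h0 fun t ht => hn t ⟨ht.1, ht.2.trans hα⟩
  linarith
noncomputable def chi (L t : ℝ) : ℝ := (min t (L/4))^2/(L - min t (L/4))^4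
lemma chi_c {L : ℝ} (hL : 0 < L) : Continuous (chi L) := by
  refine Continuous.div (by fun_prop) (by fun_prop) fun t => pow_ne_zero 4 ?_
  have := min_le_right t (L/4); intro h; linarith
lemma chi_int {L α b : ℝ} (hL : 0 < L) (h0 : 0 ≤ α) (hα : α ≤ b) (hb : b ≤ L/2) : ∫ t in α..b, chi L t ≤ 0.84 * b^3/L^4 := by
  refine (int_ext h0 hα (chi_c hL).continuousOn fun t _ => by rw [chi]; positivity).trans ?_
  have hb0 : 0 ≤ b := h0.trans hα
  have k : ∀ c, 0 ≤ c → c ≤ L/4 → ∫ t in (0:ℝ)..c, chi L t = c^3/(3*L*(L-c)^3) := by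
    intro c c0 c1
    rw [← int1 c0 (by linarith)]
    refine intervalIntegral.integral_congr fun t ht => ?_
    rw [Set.uIcc_of_le c0] at ht
    simp only [chi]
    rw [min_eq_left (ht.2.trans c1)]
  rcases le_total b (L/4) with h | h
  · rw [k b hb0 h, div_le_div_iff₀ (by have : 0 < L - b := by linarith
                                       positivity) (by positivity)]
    have h1 : (3*L/4)^3 ≤ (L-b)^3 := pow_le_pow_left₀ (by linarith) (by linarith) 3
    have h2 : L^3 ≤ 0.84*3*(L-b)^3 := by
      have : (3*L/4)^3 = 27/64*L^3 := by ring
      have : 0 < L^3 := by positivity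
      linarith
    calc b^3*L^4 = b^3*L*L^3 := by ring
      _ ≤ b^3*L*(0.84*3*(L-b)^3) := mul_le_mul_of_nonneg_left h2 (by positivity)
      _ = _ := by ring
  · rw [← intervalIntegral.integral_add_adjacent_intervals ((chi_c hL).intervalIntegrable 0 (L/4)) ((chi_c hL).intervalIntegrable (L/4) b), k (L/4) (by linarith) le_rfl]
    have e : ∫ t in (L/4)..b, chi L t = (b - L/4) * (16/(81*L^2)) := by
      rw [intervalIntegral.integral_congr (g := fun _ => 16/(81*L^2)), intervalIntegral.integral_const, smul_eq_mul]
      intro t ht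
      rw [Set.uIcc_of_le h] at ht
      simp only [chi]
      rw [min_eq_right ht.1]; field_simp; norm_num
    obtain ⟨x, hx⟩ : ∃ x, x = b/L := ⟨_, rfl⟩
    have hbx : b = x*L := by rw [hx]; field_simp
    have hx1 : 1/4 ≤ x := by rw [hx, le_div_iff₀ hL]; linarith
    have hx2 : x ≤ 1/2 := by rw [hx, div_le_iff₀ hL]; linarith
    rw [e, hbx]
    have e2 : (L/4)^3/(3*L*(L-L/4)^3) + (x*L - L/4) * (16/(81*L^2)) = (16*x-3)/81/L := by field_simp; ring
    have e3 : 0.84*(x*L)^3/L^4 = 0.84*x^3/L := by field_simp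
    rw [e2, e3]
    refine div_le_div_of_nonneg_right ?_ hL.le
    nlinarith [mul_nonneg (by linarith : 0 ≤ x + 0.56) (sq_nonneg (x-0.28))]
lemma chi_mono {L s t : ℝ} (hL : 0 < L) (h0 : 0 ≤ s) (h : s ≤ t) : chi L s ≤ chi L t := by
  rw [chi, chi]
  have h1 : min s (L/4) ≤ min t (L/4) := min_le_min_right _ h
  have h2 : 0 ≤ min s (L/4) := le_min h0 (by linarith)
  have h3 := min_le_right t (L/4)
  have h4 : 0 < L - min t (L/4) := by linarith
  exact div_le_div₀ (by positivity) (pow_le_pow_left₀ h2 h1 2) (by positivity) (pow_le_pow_left₀ h4.le (by linarith) 4)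
lemma F_chi {L v : ℝ} (hv : 0 < v) (hL : 2*v ≤ L) : (min v ((L-v)/3))^3/(L-v)^4 ≤ v * chi L v := by
  have hLv : 0 < L - v := by linarith
  have hL0 : 0 < L := by linarith
  rw [chi]
  rcases le_total v (L/4) with h | h
  · rw [min_eq_left h, min_eq_left (by linarith), ← mul_div_assoc]; exact (by ring : v^3/(L-v)^4 = v*v^2/(L-v)^4).le
  · rw [min_eq_right h, min_eq_right (by linarith)]
    have e1 : ((L-v)/3)^3/(L-v)^4 = 1/(27*(L-v)) := by field_simp; norm_num
    have e2 : (L/4)^2/(L-L/4)^4 = 16/(81*L^2) := by field_simp; norm_num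
    rw [e1, e2, ← mul_div_assoc, div_le_div_iff₀ (by positivity) (by positivity)]
    nlinarith [mul_nonneg (by linarith : 0 ≤ v - L/4) (by linarith : 0 ≤ 3*L/4 - v)]
end

section
open MeasureTheory Filter Topology
lemma stepL {N z0 z : ℕ} {L Q : ℝ} (D : ℕ → ℝ) (hz0 : 1 ≤ z0) (hl : 10^6 ≤ Real.log z0) (hM : ∀ t, Real.log z0 ≤ t → MN N t ≤ 1.001)
    (hzz : z0 ≤ z) (hL : 2*Real.log z + 2 ≤ L) (hQ : 0 ≤ Q)
    (hD : ∀ p ∈ Finset.Ico z0 z, p.Prime → D p ≤ Q * ((min (Real.log p) ((L-Real.log p)/3))^3/(L-Real.log p)^4)) :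
    ∑ p ∈ Finset.Ico z0 z with p.Prime, gp N p * D p ≤ 0.8425 * Q * (Real.log z)^3/L^4 := by
  have hlz := log_mono hzz
  have hL0 : 0 < L := by linarith
  refine (LU hz0 hM D (fun t => Q * chi L t) (continuous_const.mul (chi_c hL0)).continuousOn (fun t _ => by rw [chi]; positivity) (fun p hp hpp t h1 h2 => ?_) hzz).trans ?_
  · have hp1 := Finset.mem_Ico.1 hp
    have h3 := log_mono hp1.1
    have h4 := log_mono hp1.2.le
    have h5 : 0 < Real.log p := by linarith
    refine (hD p hp hpp).trans ?_
    have := (F_chi h5 (by linarith : 2*Real.log p ≤ L)).trans (mul_le_mul_of_nonneg_left (chi_mono hL0 h5.le h1) h5.le)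
    nlinarith
  · rw [intervalIntegral.integral_const_mul]
    have h6 := chi_int (α := Real.log z0) (b := Real.log z + 1) hL0 (by linarith) (by linarith) (by linarith)
    have h7 : (Real.log z + 1)^3 ≤ 1.001*(Real.log z)^3 := by
      calc (Real.log z + 1)^3 ≤ (1.00001*Real.log z)^3 := pow_le_pow_left₀ (by linarith) (by linarith) 3
        _ = 1.00001^3*(Real.log z)^3 := by ring
        _ ≤ _ := mul_le_mul_of_nonneg_right (by norm_num) (by have : 0 < Real.log z := by linarith
                                                              positivity)
    have h8 : 0.84*(Real.log z + 1)^3/L^4 ≤ 0.84*(1.001*(Real.log z)^3)/L^4 := by gcongr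
    have h9 : 0 ≤ (Real.log z)^3/L^4 := by have : 0 < Real.log z := by linarith
                                           positivity
    calc _ ≤ 1.001*(Q*(0.84*(1.001*(Real.log z)^3)/L^4)) := by gcongr; exact h6.trans h8
      _ = (1.001*0.84*1.001)*(Q*((Real.log z)^3/L^4)) := by ring
      _ ≤ 0.8425*(Q*((Real.log z)^3/L^4)) := mul_le_mul_of_nonneg_right (by norm_num) (by positivity)
      _ = _ := by ring
lemma stepU {N z0 z : ℕ} {L Q : ℝ} (D : ℕ → ℝ) (hz0 : 1 ≤ z0) (hl : 10^6 ≤ Real.log z0) (hM : ∀ t, Real.log z0 ≤ t → MN N t ≤ 1.001)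
    (hzz : z0 ≤ z) (hL : Real.log z + 2 ≤ L) (hQ : 0 ≤ Q)
    (hD : ∀ p ∈ Finset.Ico z0 z, p.Prime → 3*Real.log p + 2 < L → D p ≤ Q * ((Real.log p)^3/(L-Real.log p)^4)) :
    ∑ p ∈ Finset.Ico z0 z with p.Prime, gp N p * (if 3*Real.log p + 2 < L then D p else 0) ≤ 1.129 * Q * (min (Real.log z) (L/3))^3/L^4 := by
  have hlz := log_mono hzz
  have hL0 : 0 < L := by linarith
  have hmu : 3*10^5 ≤ min (Real.log z) (L/3) := le_min (by linarith) (by linarith)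
  obtain ⟨μ, hμ⟩ : ∃ μ, μ = min (Real.log z) (L/3) := ⟨_, rfl⟩
  rw [← hμ] at hmu ⊢
  obtain ⟨z', hz'⟩ : ∃ z', z' = min z ⌈Real.exp ((L-2)/3)⌉₊ := ⟨_, rfl⟩
  have hR : 0 ≤ 1.129 * Q * μ^3/L^4 := by have : 0 ≤ μ := by linarith
                                          positivity
  have hz'z : z' ≤ z := hz' ▸ min_le_left _ _
  have hout : ∀ p ∈ Finset.Ico z0 z, p.Prime → z' ≤ p → ¬ (3*Real.log p + 2 < L) := by
    intro p hp hpp hz h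
    have hp1 := Finset.mem_Ico.1 hp
    have h1 : p < z' := by
      rw [hz', lt_min_iff, Nat.lt_ceil, ← Real.log_lt_iff_lt_exp (by exact_mod_cast hpp.pos)]
      exact ⟨hp1.2, by linarith⟩
    omega
  rcases le_total z' z0 with hle | hle
  · rw [Finset.sum_eq_zero]
    · exact hR
    · intro p hp
      rw [Finset.mem_filter] at hp
      rw [if_neg (hout p hp.1 hp.2 (hle.trans (Finset.mem_Ico.1 hp.1).1)), mul_zero]
  have e : ∑ p ∈ Finset.Ico z0 z with p.Prime, gp N p * (if 3*Real.log p + 2 < L then D p else 0) = ∑ p ∈ Finset.Ico z0 z' with p.Prime, gp N p * (if 3*Real.log p + 2 < L then D p else 0) := by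
    symm
    refine Finset.sum_subset (fun p hp => ?_) fun p hp hn => ?_
    · simp only [Finset.mem_filter, Finset.mem_Ico] at hp ⊢; exact ⟨⟨hp.1.1, hp.1.2.trans_le hz'z⟩, hp.2⟩
    · rw [Finset.mem_filter] at hp
      rw [if_neg (hout p hp.1 hp.2 ?_), mul_zero]
      simp only [Finset.mem_filter, Finset.mem_Ico, not_and] at hn
      by_contra h
      exact hn ⟨(Finset.mem_Ico.1 hp.1).1, by omega⟩ hp.2
  rw [e]
  have hlz' := log_mono hle
  have hb : Real.log z' + 1 ≤ μ + 2 := by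
    have h1 := log_mono hz'z
    have h2 : Real.log z' ≤ (L-2)/3 + 1 := by
      rw [Real.log_le_iff_le_exp (by exact_mod_cast (by omega : 0 < z'))]
      have h3 : (z':ℝ) ≤ Real.exp ((L-2)/3) + 1 := by
        have h4 : (z':ℝ) ≤ (⌈Real.exp ((L-2)/3)⌉₊:ℝ) := by rw [hz']; exact_mod_cast min_le_right _ _
        exact h4.trans (Nat.ceil_lt_add_one (Real.exp_pos _).le).le
      have h5 := Real.one_le_exp (x := (L-2)/3) (by linarith)
      have h6 := Real.add_one_le_exp (1:ℝ)
      rw [Real.exp_add]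
      nlinarith
    rcases min_choice (Real.log z) (L/3) with h | h <;> rw [hμ, h] <;> linarith
  have hb2 : μ ≤ L/3 := hμ ▸ min_le_right _ _
  obtain ⟨b, hbb⟩ : ∃ b, b = Real.log z' + 1 := ⟨_, rfl⟩
  rw [← hbb] at hb
  have hb0 : 0 ≤ b := by linarith
  have hbL : b < L := by linarith
  have hcont : ContinuousOn (fun t : ℝ => t^2/(L-t)^4) (Set.Icc 0 b) := by
    refine ContinuousOn.div (by fun_prop) (by fun_prop) fun t ht => pow_ne_zero 4 ?_
    have := ht.2; intro h; linarith
  refine (LU hz0 hM _ (fun t => Q * (t^2/(L-t)^4)) ?_ (fun t _ => by positivity) (fun p hp hpp t h1 h2 => ?_) hle).trans ?_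
  · rw [← hbb]
    exact continuousOn_const.mul (hcont.mono (Set.Icc_subset_Icc_left (by linarith)))
  · have hp1 := Finset.mem_Ico.1 hp
    have h3 := log_mono hp1.1
    have h4 := log_mono hp1.2.le
    have h5 : 0 < Real.log p := by linarith
    split_ifs with hc
    · refine (hD p (Finset.mem_Ico.2 ⟨hp1.1, hp1.2.trans_le hz'z⟩) hpp hc).trans ?_
      have h6 : (Real.log p)^2/(L-Real.log p)^4 ≤ t^2/(L-t)^4 := by
        have : 0 < L - t := by linarith
        exact div_le_div₀ (by positivity) (pow_le_pow_left₀ h5.le h1 2) (by positivity) (pow_le_pow_left₀ this.le (by linarith) 4)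
      calc Q * ((Real.log p)^3/(L-Real.log p)^4) = Real.log p * (Q*((Real.log p)^2/(L-Real.log p)^4)) := by ring
        _ ≤ _ := by gcongr
    · positivity
  · rw [← hbb, intervalIntegral.integral_const_mul]
    have h6 := int_ext (χ := fun t : ℝ => t^2/(L-t)^4) (α := Real.log z0) (b := b) (by linarith) (by linarith) hcont (fun t _ => by positivity)
    rw [int1 hb0 hbL] at h6
    have h7 : b^3 ≤ 1.0002*μ^3 := by
      calc b^3 ≤ (1.00001*μ)^3 := pow_le_pow_left₀ hb0 (by linarith) 3
        _ = 1.00001^3*μ^3 := by ring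
        _ ≤ _ := mul_le_mul_of_nonneg_right (by norm_num) (by have : 0 < μ := by linarith
                                                              positivity)
    have h8 : 0.2962*L^3 ≤ (L-b)^3 := by
      calc 0.2962*L^3 ≤ (0.66666*L)^3 := by
            rw [mul_pow]; exact mul_le_mul_of_nonneg_right (by norm_num) (by positivity)
        _ ≤ _ := pow_le_pow_left₀ (by linarith) (by linarith) 3
    have hm0 : 0 ≤ μ := by linarith
    have h9 : b^3/(3*L*(L-b)^3) ≤ (1.0002*μ^3)/(3*L*(0.2962*L^3)) :=
      div_le_div₀ (by positivity) h7 (by positivity) (by gcongr)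
    calc _ ≤ 1.001*(Q*((1.0002*μ^3)/(3*L*(0.2962*L^3)))) := by gcongr; exact h6.trans h9
      _ = (1.001*1.0002/(3*0.2962))*(Q*(μ^3/L^4)) := by field_simp
      _ ≤ 1.129*(Q*(μ^3/L^4)) := mul_le_mul_of_nonneg_right (by norm_num) (by positivity)
      _ = _ := by ring
lemma stepS {N z0 z : ℕ} {L Cs : ℝ} (D : ℕ → ℝ) (hz0 : 1 ≤ z0) (hl : 10^6 ≤ Real.log z0) (hM : ∀ t, Real.log z0 ≤ t → MN N t ≤ 1.001)
    (hzz : z0 ≤ z) (hL : Real.log z + 2 ≤ L) (hC : 0 ≤ Cs)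
    (hD : ∀ p ∈ Finset.Ico z0 z, p.Prime → ¬ 3*Real.log p + 2 < L → D p ≤ Cs/(Real.log p)^2) :
    ∑ p ∈ Finset.Ico z0 z with p.Prime, gp N p * (if 3*Real.log p + 2 < L then 0 else D p) ≤ 4200 * Cs * (min (Real.log z) (L/3))^3/L^5 := by
  have hlz := log_mono hzz
  have hL0 : 0 < L := by linarith
  have hmu : 0 ≤ min (Real.log z) (L/3) := le_min (by linarith) (by linarith)
  rcases lt_or_ge (3*Real.log z + 2) L with h | h
  · rw [Finset.sum_eq_zero]
    · positivity
    · intro p hp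
      rw [Finset.mem_filter] at hp
      have := log_mono (Finset.mem_Ico.1 hp.1).2.le
      rw [if_pos (by linarith), mul_zero]
  have hmu2 : L/4 ≤ min (Real.log z) (L/3) := le_min (by linarith) (by linarith)
  refine (LU hz0 hM _ (fun t => 64*Cs/L^3) continuousOn_const (fun t _ => by positivity) (fun p hp hpp t h1 h2 => ?_) hzz).trans ?_
  · have hp1 := Finset.mem_Ico.1 hp
    have h3 := log_mono hp1.1
    have h5 : 0 < Real.log p := by linarith
    split_ifs with hc
    · positivity
    · refine (hD p hp hpp hc).trans ?_
      have h6 : (L/4)^3 ≤ (Real.log p)^3 := pow_le_pow_left₀ (by linarith) (by linarith) 3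
      rw [← mul_div_assoc, div_le_div_iff₀ (by positivity) (by positivity)]
      nlinarith
  · rw [intervalIntegral.integral_const, smul_eq_mul]
    have h6 : (L/4)^3 ≤ (min (Real.log z) (L/3))^3 := pow_le_pow_left₀ (by linarith) hmu2 3
    calc _ ≤ 1.001*(L*(64*Cs/L^3)) := by gcongr; linarith
      _ = 64.064*64*Cs*(L/4)^3/L^5 := by field_simp; ring
      _ ≤ 4200*Cs*(L/4)^3/L^5 := by gcongr; norm_num
      _ ≤ _ := by gcongr
set_option maxHeartbeats 1000000 in
lemma Dmain {N z0 : ℕ} {K Λ Cs : ℝ} {E : ℝ → ℝ} (hK : 0 < K) (hz0 : 1 ≤ z0) (hl : 10^6 ≤ Real.log z0)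
    (hE0 : ∀ L, 0 < L → 0 < E L) (hE1 : ∀ L L', 0 < L → L/2 ≤ L' → E L' ≤ 1.001 * E L) (hE2 : ∀ L, 1 ≤ L → 1/L ≤ E L)
    (hM : ∀ t, Real.log z0 ≤ t → MN N t ≤ 1.001) (hC : 0 ≤ Cs) (hKC : 10^6*Cs ≤ K)
    (hs : ∀ (p : ℕ) (L : ℝ), z0 ≤ p → 2 ≤ L → L ≤ 2 * Real.log p + 2 → Sw N wm p L ≤ Cs/(Real.log p)^2)
    (b1 : ∀ (z : ℕ) (L : ℝ), L ≤ Λ → (nodeC false z L → Dm N z L ≤ 0.01*K*E L/L^4) ∧ (nodeC true z L → Dp N z L ≤ 0.01*K*E L/L^4))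
    (b2 : ∀ L, Λ ≤ L → Dm N z0 L ≤ 0.01*K*E L/L^4 ∧ Dp N z0 L ≤ 0.01*K*E L/L^4) :
    ∀ z, z0 ≤ z → ∀ L, (nodeC false z L → Dm N z L ≤ 0.86*K*(Real.log z)^3*E L/L^4) ∧ (nodeC true z L → Dp N z L ≤ K*(min (Real.log z) (L/3))^3*E L/L^4) := by
  intro z
  induction z using Nat.strong_induction_on with
  | _ z ih =>
  intro hzz L
  have hlz := log_mono hzz
  refine ⟨fun hn => ?_, fun hn => ?_⟩
  · have hL : 2*Real.log z + 2 ≤ L := by simpa [nodeC] using hn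
    have hL0 : 0 < L := by linarith
    have hE := hE0 L hL0
    have h1 : 1 ≤ (Real.log z)^3 := one_le_pow₀ (by linarith)
    have hsm : 0.01*K*E L/L^4 ≤ 0.01*K*(Real.log z)^3*E L/L^4 := by
      rw [show 0.01*K*E L/L^4 = 0.01*K*1*E L/L^4 by ring]; gcongr
    have hpos : 0 ≤ K*(Real.log z)^3*E L/L^4 := by positivity
    rcases le_total L Λ with h | h
    · refine ((b1 z L h).1 hn).trans (hsm.trans ?_)
      rw [show 0.01*K*(Real.log z)^3*E L/L^4 = 0.01*(K*(Real.log z)^3*E L/L^4) by ring, show 0.86*K*(Real.log z)^3*E L/L^4 = 0.86*(K*(Real.log z)^3*E L/L^4) by ring]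
      linarith
    · rw [tele (D := fun z => Dm N z L) (F := fun z => gp N z * Dp N z (L-Real.log z)) (fun z => Dm_succ N z L) hzz]
      have h2 := stepL (Q := 1.001*K*E L) (fun p => Dp N p (L-Real.log p)) hz0 hl hM hzz hL (by positivity) ?_
      · have h3 := (b2 L h).1.trans hsm
        rw [show 0.86*K*(Real.log z)^3*E L/L^4 = 0.86*(K*(Real.log z)^3*E L/L^4) by ring]
        rw [show 0.8425*(1.001*K*E L)*(Real.log z)^3/L^4 = 0.8425*1.001*(K*(Real.log z)^3*E L/L^4) by ring] at h2
        rw [show 0.01*K*(Real.log z)^3*E L/L^4 = 0.01*(K*(Real.log z)^3*E L/L^4) by ring] at h3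
        linarith
      · intro p hp hpp
        have hp1 := Finset.mem_Ico.1 hp
        have h3 := log_mono hp1.1
        have h4 := log_mono hp1.2.le
        have h5 := (ih p hp1.2 hp1.1 (L-Real.log p)).2 (by simp only [nodeC, if_true]; linarith)
        have h6 := hE1 L (L-Real.log p) hL0 (by linarith)
        have h7 : 0 ≤ min (Real.log p) ((L-Real.log p)/3) := le_min (by linarith) (by linarith)
        refine h5.trans ?_
        calc _ ≤ K*(min (Real.log p) ((L-Real.log p)/3))^3*(1.001*E L)/(L-Real.log p)^4 := by gcongr
          _ = _ := by ring
  · have hL : Real.log z + 2 ≤ L := by simpa [nodeC] using hn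
    have hL0 : 0 < L := by linarith
    have hE := hE0 L hL0
    obtain ⟨μ, hμ⟩ : ∃ μ, μ = min (Real.log z) (L/3) := ⟨_, rfl⟩
    have hm1 : 1 ≤ μ := hμ ▸ le_min (by linarith) (by linarith)
    have h1 : 1 ≤ μ^3 := one_le_pow₀ hm1
    rw [← hμ]
    have hpos : 0 ≤ K*μ^3*E L/L^4 := by positivity
    have hsm : 0.01*K*E L/L^4 ≤ 0.01*(K*μ^3*E L/L^4) := by
      rw [show 0.01*K*E L/L^4 = 0.01*(K*1*E L/L^4) by ring]; gcongr
    rcases le_total L Λ with h | h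
    · refine ((b1 z L h).2 hn).trans (hsm.trans ?_)
      linarith
    · rw [tele (D := fun z => Dp N z L) (fun z => Dp_succ N z L) hzz]
      have h2 := stepU (Q := 0.86*1.001*K*E L) (fun p => Dm N p (L-Real.log p)) hz0 hl hM hzz hL (by positivity) ?_
      · have h3 := (b2 L h).2.trans hsm
        have h4 := stepS (Cs := Cs) (fun p => Sw N wm p (L-Real.log p)) hz0 hl hM hzz hL hC ?_
        · have e : ∑ p ∈ Finset.Ico z0 z with p.Prime, gp N p * (if 3 * Real.log p + 2 < L then Dm N p (L - Real.log p) else Sw N wm p (L - Real.log p)) = ∑ p ∈ Finset.Ico z0 z with p.Prime, gp N p * (if 3*Real.log p + 2 < L then Dm N p (L - Real.log p) else 0) + ∑ p ∈ Finset.Ico z0 z with p.Prime, gp N p * (if 3*Real.log p + 2 < L then 0 else Sw N wm p (L - Real.log p)) := by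
            rw [← Finset.sum_add_distrib]
            refine Finset.sum_congr rfl fun p _ => ?_
            split_ifs <;> ring
          rw [e]
          rw [← hμ] at h2 h4
          rw [show 1.129*(0.86*1.001*K*E L)*μ^3/L^4 = 1.129*0.86*1.001*(K*μ^3*E L/L^4) by ring] at h2
          have h5 : 4200*Cs*μ^3/L^5 ≤ 0.0042*(K*μ^3*E L/L^4) := by
            calc 4200*Cs*μ^3/L^5 = 0.0042*((10^6*Cs)*μ^3*(1/L)/L^4) := by field_simp; ring
              _ ≤ _ := by gcongr; exact hE2 L (by linarith)
          linarith
        · intro p hp hpp hc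
          have hp1 := Finset.mem_Ico.1 hp
          have h4 := log_mono hp1.2.le
          exact hs p _ hp1.1 (by linarith) (by linarith)
      · intro p hp hpp hc
        have hp1 := Finset.mem_Ico.1 hp
        have h3 := log_mono hp1.1
        have h5 := (ih p hp1.2 hp1.1 (L-Real.log p)).1 (by simp only [nodeC, Bool.false_eq_true, if_false]; linarith)
        have h6 := hE1 L (L-Real.log p) hL0 (by linarith)
        have h7 : 0 ≤ Real.log p := by linarith
        refine h5.trans ?_
        calc _ ≤ 0.86*K*(Real.log p)^3*(1.001*E L)/(L-Real.log p)^4 := by gcongr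
          _ = _ := by ring
end

section
open MeasureTheory Filter Topology
lemma gN_tot (N d : ℕ) (hd : Squarefree d) (h : ∀ p, p.Prime → p ∣ d → ¬ p ∣ N) : gN N d = 1/(d.totient:ℝ) := by
  induction d using induction_on_primes with
  | zero => simp at hd
  | one => simp [gN_one]
  | prime_mul p a hp ih =>
    have ha : a ≠ 0 := by rintro rfl; simp at hd
    have hc : p.Coprime a := Nat.coprime_of_squarefree_mul hd
    rw [gN_mul N hp.ne_zero ha, gN_prime N hp, ih hd.of_mul_right fun q hq h1 => h q hq (h1.mul_left p), Nat.totient_mul hc, Nat.totient_prime hp, gp, if_neg (h p hp (dvd_mul_right p a))]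
    rw [Nat.cast_mul, Nat.cast_sub hp.one_le, div_mul_div_comm]; simp
open Classical in
lemma Wf_tot {N z : ℕ} {L : ℝ} {d : ℕ} (hd : d ∈ Wf N z L) : gN N d = 1/(d.totient:ℝ) := by
  rw [Wf, Finset.mem_filter] at hd
  exact gN_tot N d hd.2.1 fun p hp h => (hd.2.2 p hp h).2
open Classical in
lemma sv_triv {N z : ℕ} {b : Bool} {L : ℝ} (hn : nodeC b z L) : |sv N z b L (gN N)| ≤ 9*L^2 := by
  have hL := nodeC_pos hn
  refine (sv_bd N z b L _ hn).trans ?_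
  have h1 : ⌊Real.exp L⌋₊ ≤ 2^(⌈2*L⌉₊) := by
    refine Nat.floor_le_of_le ?_
    push_cast
    rw [← Real.rpow_natCast, Real.rpow_def_of_pos two_pos]
    refine Real.exp_le_exp.2 ?_
    have := Nat.le_ceil (2*L)
    have := Real.log_two_gt_d9
    nlinarith
  have h2 : ((⌈2*L⌉₊:ℕ):ℝ) ≤ 2*L + 1 := (Nat.ceil_lt_add_one (by linarith)).le
  calc ∑ d ∈ Wf N z L, |gN N d| ≤ ∑ d ∈ Finset.Ioc 0 ⌊Real.exp L⌋₊, (1:ℝ)/d.totient := by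
        rw [Finset.sum_congr rfl fun d hd => by rw [Wf_tot hd, abs_of_nonneg (by positivity)]]
        refine Finset.sum_le_sum_of_subset_of_nonneg (fun d hd => ?_) fun _ _ _ => by positivity
        rw [Wf, Finset.mem_filter, Finset.mem_Icc] at hd
        exact Finset.mem_Ioc.2 hd.1
    _ ≤ _ := tot_sum _ _ h1
    _ ≤ (3*L)^2 := pow_le_pow_left₀ (by positivity) (by linarith) 2
    _ = _ := by ring
lemma sm_le {f g : ℕ → ℝ} (f0 : f 0 = 0) (g0 : g 0 = 0) (h : ∀ n, f n ≤ g n) (τ : ℝ) : sm hh f τ ≤ sm hh g τ :=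
  (sm_summable f0 τ).tsum_le_tsum (fun n => mul_le_mul_of_nonneg_right (h n) (hh_nn _)) (sm_summable g0 τ)
lemma Sw_le (N : ℕ) {w : ℕ → ℝ} (hw : ∀ k, w k ≤ 2) (z : ℕ) (L : ℝ) : Sw N w z L ≤ 2 * sm hh (gN N) L := by
  have e : 2 * sm hh (gN N) L = sm hh (fun n => 2 * gN N n) L := by
    rw [sm, sm, ← tsum_mul_left]; simp only [mul_assoc]
  rw [e, Sw]
  refine sm_le (rg_zero _ _ _) (by simp [gN_zero]) (fun n => ?_) L
  have := gN_nn N n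
  rw [rg]; split_ifs
  · exact mul_le_mul_of_nonneg_right (hw _) this
  · positivity
lemma gp_le (N : ℕ) {p : ℕ} (hp : p.Prime) : gp N p ≤ 1 := by
  have : (2:ℝ) ≤ p := by exact_mod_cast hp.two_le
  rw [gp]; split_ifs
  · norm_num
  · rw [div_le_one (by linarith)]; linarith
lemma sm_wm (N : ℕ) (s L : ℝ) : sm hh (fun n => (1 + s * (-1)^(ArithmeticFunction.cardFactors n)) * gN N n) L = sm hh (gN N) L + s * sm hh (fun n => (ArithmeticFunction.liouville n:ℝ) * gN N n) L := by
  rw [sm, sm, sm, ← tsum_mul_left, ← (sm_summable (gN_zero N) L).tsum_add ((sm_summable (by simp [gN_zero]) L).mul_left s)]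
  congr 1; funext n
  rcases Nat.eq_zero_or_pos n with rfl | h
  · simp [gN_zero]
  rw [ArithmeticFunction.liouville_apply h.ne']
  push_cast
  ring
lemma Dsm {κ : ℝ} (hκ : 0 < κ) (z : ℕ) : ∃ B l0 : ℝ, 0 ≤ B ∧ 1 ≤ l0 ∧ ∀ N : ℕ, Even N → l0 ≤ Real.log N → ∀ L, (Real.log N)^κ + (z:ℝ)^2 ≤ L →
    |Dm N z L| ≤ B*(Real.log N)^κ/L^5 ∧ |Dp N z L| ≤ B*(Real.log N)^κ/L^5 := by
  induction z with
  | zero =>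
    obtain ⟨C, l0, hC, hl0, H⟩ := A3 hκ 5
    refine ⟨2*C, l0, by positivity, hl0, fun N hN hl L hL => ?_⟩
    obtain ⟨-, -, -, h4⟩ := H N hN hl
    obtain ⟨h5, h6⟩ := h4 L (by simpa using hL)
    have e1 : Sw N wm 0 L = _ := (Sw_zero N wm (by norm_num) L).trans ((congrArg (fun f => sm hh f L) (by funext n; rw [wm]; ring)).trans (sm_wm N 1 L))
    have e2 : Sw N wp 0 L = _ := (Sw_zero N wp (by norm_num) L).trans ((congrArg (fun f => sm hh f L) (by funext n; rw [wp]; ring)).trans (sm_wm N (-1) L))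
    rw [Dm, Dp, e1, e2, sv, sv, gN_one]
    rw [abs_le] at h5 h6
    have : 2*C*(Real.log N)^κ/L^5 = C*(Real.log N)^κ/L^5 + C*(Real.log N)^κ/L^5 := by ring
    rw [this]
    constructor <;> rw [abs_le] <;> constructor <;> linarith
  | succ z ih =>
    obtain ⟨B, l0, hB, hl0, H⟩ := ih
    refine ⟨33*B, l0, by positivity, hl0, fun N hN hl L hL => ?_⟩
    have hq : 0 < (Real.log N)^κ := Real.rpow_pos_of_pos (by linarith) κ
    push_cast at hL
    have hz0 : (0:ℝ) ≤ z := by positivity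
    obtain ⟨h1, h2⟩ := H N hN hl L (by nlinarith)
    have hL0 : 0 < L := by nlinarith
    obtain ⟨R, hR⟩ : ∃ R, R = B*(Real.log N)^κ/L^5 := ⟨_, rfl⟩
    have hRn : 0 ≤ R := by rw [hR]; positivity
    rw [show 33*B*(Real.log N)^κ/L^5 = R + 32*R by rw [hR]; ring]
    rw [← hR] at h1 h2
    rw [Dm_succ, Dp_succ]
    by_cases hp : z.Prime
    · rw [if_pos hp, if_pos hp]
      have hz2 : (2:ℝ) ≤ z := by exact_mod_cast hp.two_le
      have hlog := Real.log_le_sub_one_of_pos (by linarith : (0:ℝ) < z)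
      rw [if_pos (by nlinarith : 3*Real.log z + 2 < L)]
      obtain ⟨h3, h4⟩ := H N hN hl (L-Real.log z) (by nlinarith)
      have h5 : B*(Real.log N)^κ/(L-Real.log z)^5 ≤ 32*R := by
        have : (L/2)^5 ≤ (L-Real.log z)^5 := pow_le_pow_left₀ (by linarith) (by nlinarith) 5
        calc _ ≤ B*(Real.log N)^κ/(L/2)^5 := by gcongr
          _ = _ := by rw [hR]; field_simp; norm_num
      have h6 : ∀ x, |x| ≤ B*(Real.log N)^κ/(L-Real.log z)^5 → |gp N z * x| ≤ 32*R := fun x hx => by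
        rw [abs_mul, abs_of_nonneg (gp_nn N z hp)]
        exact (mul_le_of_le_one_left (abs_nonneg _) (gp_le N hp)).trans (hx.trans h5)
      exact ⟨(abs_add_le _ _).trans (add_le_add h1 (h6 _ h4)), (abs_add_le _ _).trans (add_le_add h2 (h6 _ h3))⟩
    · rw [if_neg hp, if_neg hp, add_zero, add_zero]
      constructor <;> linarith
set_option maxHeartbeats 1000000 in
lemma Dbound {κ : ℝ} (hκ : 0 < κ) : ∃ (C l0 : ℝ) (z0 : ℕ), 0 ≤ C ∧ 1 ≤ l0 ∧ ∀ N : ℕ, Even N → l0 ≤ Real.log N → ∀ z, z0 ≤ z → ∀ L, 2*Real.log z+2 ≤ L →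
    Dm N z L ≤ C*((Real.log N)^κ)^8*(Real.log z)^3*L^(-(1/1000):ℝ)/L^4 := by
  obtain ⟨t1, ht1, HM⟩ := MU (η := 0.001) (by norm_num)
  obtain ⟨Cs, z1, hCs, hz1, Hs⟩ := src
  obtain ⟨z0, hz0⟩ := exists_nat_ge (Real.exp (t1 + 10^6) + z1)
  have hez : Real.exp (t1 + 10^6) ≤ z0 := le_trans (le_add_of_nonneg_right (Nat.cast_nonneg _)) hz0
  have hz1z : z1 ≤ z0 := by exact_mod_cast le_trans (le_add_of_nonneg_left (Real.exp_pos _).le) hz0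
  have hlz : t1 + 10^6 ≤ Real.log z0 := by
    rw [Real.le_log_iff_exp_le ((Real.exp_pos _).trans_le hez)]; exact hez
  obtain ⟨B, l1, hB, hl1, HB⟩ := Dsm hκ z0
  obtain ⟨C, l2, hC, hl2, HC⟩ := A3 hκ 5
  obtain ⟨l3, hl3⟩ := ((tendsto_rpow_atTop hκ).eventually_ge_atTop ((z0:ℝ)^2 + 1)).exists_forall_of_atTop
  obtain ⟨K, hK⟩ : ∃ K, K = 10^6*Cs + 10^3*B + 10^6*C := ⟨_, rfl⟩
  have hK0 : 0 < K := by rw [hK]; positivity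
  refine ⟨K, l1 + l2 + |l3|, z0, hK0.le, by linarith [abs_nonneg l3], fun N hN hl z hz L hL => ?_⟩
  have al := abs_nonneg l3
  have hB1 := HB N hN (by linarith)
  obtain ⟨-, hY, hg, hgY⟩ := HC N hN (by linarith)
  have hq := hl3 (Real.log N) (by linarith [le_abs_self l3])
  obtain ⟨q, hqq⟩ : ∃ q, q = (Real.log N)^κ := ⟨_, rfl⟩
  rw [← hqq] at hB1 hY hg hgY hq ⊢
  have hq1 : 1 ≤ q := by nlinarith
  have hY0 : 0 < YN N := by
    refine Y_pos (N := N) (a := q) (K := C*q) (m := 5) (by norm_num) (fun τ h => (hgY τ h).1) ?_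
    exact (HC N hN (by linarith)).1
  have hq8 : q ≤ q^8 := le_self_pow₀ hq1 (by norm_num)
  have hq81 : 1 ≤ q^8 := one_le_pow₀ hq1
  have hKq : 0 < K*q^8 := by positivity
  have hE2 : ∀ L:ℝ, 1 ≤ L → 1/L ≤ L^(-(1/1000):ℝ) := fun L h => by
    rw [one_div, ← Real.rpow_neg_one]; exact Real.rpow_le_rpow_of_exponent_le h (by norm_num)
  have key : ∀ L x : ℝ, 1 ≤ L → x ≤ 0.01*(K*q^8)/L^5 → x ≤ 0.01*(K*q^8)*L^(-(1/1000):ℝ)/L^4 := by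
    intro L x h1 h2
    have : 0 < L := by linarith
    refine h2.trans ?_
    calc 0.01*(K*q^8)/L^5 = 0.01*(K*q^8)*(1/L)/L^4 := by field_simp
      _ ≤ _ := by gcongr; exact hE2 L h1
  have hs1 : ∀ L, 1 ≤ L → L ≤ 2*q → ∀ s S : ℝ, |s| ≤ 9*L^2 → 0 ≤ S → S ≤ 2*sm hh (gN N) L → S - YN N * s ≤ 0.01*(K*q^8)/L^5 ∧ YN N * s - S ≤ 0.01*(K*q^8)/L^5 := by
    intro L h1 h2 s S hs hS0 hS
    have h3 : |YN N * s| ≤ C*q*(9*L^2) := by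
      rw [abs_mul, abs_of_pos hY0]; exact mul_le_mul hY hs (abs_nonneg _) (by positivity)
    have h4 : S ≤ 2*(C*q) := hS.trans (by linarith [hg L])
    have h5 : 11*(C*q*L^2) ≤ 0.01*(K*q^8)/L^5 := by
      rw [le_div_iff₀ (by positivity)]
      have h6 : L^7 ≤ (2*q)^7 := pow_le_pow_left₀ (by linarith) h2 7
      have h7 : 10^6*C ≤ K := by rw [hK]; have : 0 ≤ 10^6*Cs + 10^3*B := by positivity
                                 linarith
      calc 11*(C*q*L^2)*L^5 = 11*C*q*L^7 := by ring
        _ ≤ 11*C*q*(2*q)^7 := by gcongr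
        _ = 1408*(C*q^8) := by ring
        _ ≤ 0.01*((10^6*C)*q^8) := by have : 0 ≤ C*q^8 := by positivity
                                      linarith
        _ ≤ _ := by gcongr
    have h8 : C*q ≤ C*q*L^2 := le_mul_of_one_le_right (by positivity) (one_le_pow₀ h1)
    have h9 := abs_le.1 h3
    constructor <;> linarith
  have H := Dmain (N := N) (z0 := z0) (K := K*q^8) (Λ := 2*q) (Cs := Cs) (E := fun L => L^(-(1/1000):ℝ)) hKq (hz1.trans hz1z) (by linarith) (fun L h => Real.rpow_pos_of_pos h _) ?_ hE2
    (fun t ht => (HM N t (by linarith)).trans (by norm_num)) hCs ?_ (fun p L h1 h2 h3 => Hs N p L (hz1z.trans h1) h2 h3) ?_ ?_ z hz L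
  · refine (H.1 (by simp only [nodeC, Bool.false_eq_true, if_false]; exact hL)).trans ?_
    have : 0 < L := by linarith [log_mono hz]
    have h0 : 0 ≤ Real.log z := by linarith [log_mono hz]
    have : 0 ≤ K*q^8*(Real.log z)^3*L^(-(1/1000):ℝ)/L^4 := by positivity
    calc _ = 0.86*(K*q^8*(Real.log z)^3*L^(-(1/1000):ℝ)/L^4) := by ring
      _ ≤ _ := by linarith
  · intro L L' h1 h2
    have h3 : L'^(-(1/1000):ℝ) ≤ (L/2)^(-(1/1000):ℝ) := Real.rpow_le_rpow_of_nonpos (by linarith) h2 (by norm_num)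
    have h4 : (2:ℝ)^(1/1000:ℝ) ≤ 1.001 := by
      have := rpow_one_add_le_one_add_mul_self (s := 1) (p := 1/1000) (by norm_num) (by norm_num) (by norm_num)
      norm_num at this ⊢; exact this
    refine h3.trans ?_
    rw [Real.div_rpow h1.le (by norm_num), Real.rpow_neg two_pos.le, div_inv_eq_mul, mul_comm]
    have := Real.rpow_pos_of_pos h1 (-(1/1000):ℝ)
    gcongr
  · have : 10^6*Cs ≤ K := by rw [hK]; have : 0 ≤ 10^3*B + 10^6*C := by positivity
                             linarith
    exact this.trans (le_mul_of_one_le_right hK0.le hq81)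
  · intro z L hL
    refine ⟨fun hn => ?_, fun hn => ?_⟩
    · have h1 : 1 ≤ L := by linarith [nodeC_pos hn]
      exact key L _ h1 (hs1 L h1 hL _ _ (sv_triv hn) (Sw_nn N wm_nn z L) (Sw_le N wm_le z L)).1
    · have h1 : 1 ≤ L := by linarith [nodeC_pos hn]
      exact key L _ h1 (hs1 L h1 hL _ _ (sv_triv hn) (Sw_nn N wp_nn z L) (Sw_le N wp_le z L)).2
  · intro L hL
    have h1 : 1 ≤ L := by linarith
    obtain ⟨h2, h3⟩ := hB1 L (by linarith)
    have h4 : B*q/L^5 ≤ 0.01*(K*q^8)/L^5 := by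
      refine div_le_div_of_nonneg_right ?_ (by positivity)
      have : 10^3*B ≤ K := by rw [hK]; have : 0 ≤ 10^6*Cs + 10^6*C := by positivity
                              linarith
      have := mul_le_mul this hq8 (by positivity) hK0.le
      have : 0 ≤ B*q := by positivity
      linarith
    exact ⟨key L _ h1 ((le_abs_self _).trans (h2.trans h4)), key L _ h1 ((le_abs_self _).trans (h3.trans h4))⟩
end

section
open MeasureTheory Filter Topology
noncomputable def GG : ℕ → ℝ → ℝ
  | 0, _ => 1
  | k+1, s => ∫ u in (1:ℝ)..(max 1 (s-1)), GG k u / max 1 u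
lemma GG_c (k : ℕ) : Continuous (GG k) := by
  induction k with
  | zero => exact continuous_const
  | succ k ih =>
    have h1 : Continuous fun u => GG k u / max 1 u := ih.div (by fun_prop) fun u => by positivity
    exact (intervalIntegral.continuous_primitive (fun a b => h1.intervalIntegrable a b) 1).comp (by fun_prop : Continuous fun s : ℝ => max 1 (s-1))
lemma GG_ic (k : ℕ) : Continuous fun u => GG k u / max 1 u := (GG_c k).div (by fun_prop) fun u => by positivity
lemma GG_nn (k : ℕ) : ∀ s, 0 ≤ GG k s := by
  induction k with
  | zero => exact fun _ => zero_le_one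
  | succ k ih => exact fun s => intervalIntegral.integral_nonneg (le_max_left _ _) fun u _ => div_nonneg (ih u) (by positivity)
lemma GGp_mono (k : ℕ) {x y : ℝ} (h : x ≤ y) : ∫ u in (1:ℝ)..x, GG k u / max 1 u ≤ ∫ u in (1:ℝ)..y, GG k u / max 1 u := by
  rw [← intervalIntegral.integral_add_adjacent_intervals ((GG_ic k).intervalIntegrable 1 x) ((GG_ic k).intervalIntegrable x y)]
  have := intervalIntegral.integral_nonneg (μ := volume) h fun u _ => div_nonneg (GG_nn k u) (by positivity : 0 ≤ max 1 u)
  linarith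
lemma GG_mono (k : ℕ) : Monotone (GG k) := by
  cases k with
  | zero => exact monotone_const
  | succ k => exact fun x y h => GGp_mono k (max_le_max_left _ (by linarith))
lemma GG_sub (k : ℕ) {a b τ B : ℝ} (ha : 0 < a) (hab : a ≤ b) (hB : 1 ≤ B) (hb : b = τ/(1+B)) :
    IntervalIntegrable (fun t => GG k ((τ-t)/(B*t))/(t*(τ-t))) volume a b ∧ ∫ t in a..b, GG k ((τ-t)/(B*t))/(t*(τ-t)) = (∫ u in (1:ℝ)..((τ-a)/(B*a)), GG k u / max 1 u)/τ := by
  have hτ : τ = b*(1+B) := by rw [hb]; field_simp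
  have hb0 : 0 < b := by linarith
  have hc : ContinuousOn (fun t => GG k ((τ-t)/(B*t))/(t*(τ-t))) (Set.uIcc a b) := by
    rw [Set.uIcc_of_le hab]
    have hne : ∀ t ∈ Set.Icc a b, t ≠ 0 := fun t ht => by linarith [ht.1]
    refine ContinuousOn.div ((GG_c k).comp_continuousOn (ContinuousOn.div (by fun_prop) (by fun_prop) fun t ht => mul_ne_zero (by linarith) (hne t ht))) (by fun_prop) fun t ht => mul_ne_zero (hne t ht) ?_
    have := ht.2
    nlinarith
  refine ⟨hc.intervalIntegrable, ?_⟩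
  have := intervalIntegral.integral_eq_sub_of_hasDerivAt (f := fun t => -(∫ u in (1:ℝ)..((τ-t)/(B*t)), GG k u / max 1 u)/τ) (f' := fun t => GG k ((τ-t)/(B*t))/(t*(τ-t))) (a := a) (b := b) (fun t ht => ?_) hc.intervalIntegrable
  · rw [this]
    have e : (τ-b)/(B*b) = 1 := by rw [hτ]; field_simp; ring
    rw [e, intervalIntegral.integral_same]; ring
  · rw [Set.uIcc_of_le hab] at ht
    have ht0 : 0 < t := by linarith [ht.1]
    have htt : B*t ≤ τ - t := by have := ht.2; nlinarith
    have hτt : 0 < τ - t := by nlinarith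
    have hτ0 : 0 < τ := by linarith
    have h1 : HasDerivAt (fun x => ∫ u in (1:ℝ)..x, GG k u / max 1 u) (GG k ((τ-t)/(B*t)) / max 1 ((τ-t)/(B*t))) ((τ-t)/(B*t)) :=
      intervalIntegral.integral_hasDerivAt_right ((GG_ic k).intervalIntegrable _ _) (GG_ic k).stronglyMeasurable.stronglyMeasurableAtFilter (GG_ic k).continuousAt
    have h2 : HasDerivAt (fun t => (τ-t)/(B*t)) (((-1)*(B*t) - (τ-t)*(B*1))/(B*t)^2) t :=
      ((hasDerivAt_id t).const_sub τ).div ((hasDerivAt_id t).const_mul B) (by positivity)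
    refine ((h1.comp t h2).neg.div_const τ).congr_deriv ?_
    rw [max_eq_right (by rw [le_div_iff₀ (by positivity)]; linarith)]
    field_simp
    ring
noncomputable def wk (k j : ℕ) : ℝ := if j = k then 1 else 0
lemma wk_nn (k j : ℕ) : 0 ≤ wk k j := by rw [wk]; positivity
open Classical in
lemma T_one {N z : ℕ} {τ m : ℝ} (hz : Real.log z + 1 ≤ τ) (hM : m ≤ MN N τ) : m/τ ≤ Sw N (wk 1) z τ := by
  have h0 : 0 < τ := by linarith [Real.log_natCast_nonneg z]
  rw [div_le_iff₀ h0, mul_comm]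
  refine hM.trans ?_
  rw [MN, Sw, sm, sm, ← tsum_mul_left]
  refine Summable.tsum_le_tsum (fun n => ?_) (sm_summable (by simp) τ) ((sm_summable (rg_zero _ _ _) τ).mul_left τ)
  by_cases hn : n.Prime
  · by_cases hz0 : hh (Real.log n - τ) = 0
    · rw [hz0]; simp
    obtain ⟨h1, h2⟩ := hh_sup hz0
    have hzn : z ≤ n := by
      by_contra h
      have := log_mono (by omega : n ≤ z)
      linarith
    rw [if_pos hn, rg, if_pos, ArithmeticFunction.cardFactors_apply_prime hn, wk, if_pos rfl, one_mul, gN_prime N hn, ← mul_assoc]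
    · have := gp_nn N n hn
      have := hh_nn (Real.log n - τ)
      gcongr; linarith
    · intro p hp h
      rw [(Nat.prime_dvd_prime_iff_eq hp hn).1 h]; exact hzn
  · rw [if_neg hn, zero_mul]
    exact mul_nonneg h0.le (mul_nonneg (rg_nn N (wk_nn 1) z n) (hh_nn _))
lemma T_low {N : ℕ} {ε ω : ℝ} (hε : 0 < ε) (hε1 : ε < 1) (hω : 1 ≤ ε*ω) (hM : ∀ t, ω ≤ t → 1-ε ≤ MN N t) (k : ℕ) :
    ∀ (z : ℕ) (τ : ℝ), ω ≤ Real.log z → (1+ε)^(k+1)*Real.log z ≤ τ → (1-ε)^(k+1)*GG k (τ/((1+ε)^(k+1)*Real.log z))/τ ≤ Sw N (wk (k+1)) z τ := by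
  have hω0 : 0 < ω := by by_contra h; nlinarith
  induction k with
  | zero =>
    intro z τ hz hτ
    simp only [zero_add, pow_one, GG, mul_one] at hτ ⊢
    have : ε*ω ≤ ε*Real.log z := by gcongr
    exact T_one (by linarith) (hM τ (by linarith))
  | succ k ih =>
    intro z τ hz hτ
    have hz0 : 0 < Real.log z := by linarith
    have hB1 : 1 ≤ (1+ε)^(k+1) := one_le_pow₀ (by linarith)
    obtain ⟨B, hB⟩ : ∃ B, B = (1+ε)^(k+1) := ⟨_, rfl⟩
    rw [pow_succ (1+ε) (k+1)] at hτ ⊢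
    simp only [← hB] at ih hτ hB1 ⊢
    have hτ0 : 0 < τ := lt_of_lt_of_le (by positivity) hτ
    have h1e : 0 < 1 - ε := by linarith
    rcases le_or_gt (τ/(B*(1+ε)*Real.log z)) 2 with hs | hs
    · rw [GG, max_eq_left (by linarith), intervalIntegral.integral_same]
      simpa using Sw_nn N (wk_nn _) z τ
    rw [lt_div_iff₀ (by positivity)] at hs
    obtain ⟨b, hb⟩ : ∃ b, b = τ/(1+B) := ⟨_, rfl⟩
    have hbτ : τ = b*(1+B) := by rw [hb]; field_simp
    have ha : Real.log z + 1 ≤ (1+ε)*Real.log z := by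
      have : ε*ω ≤ ε*Real.log z := by gcongr
      linarith
    have hab : Real.log z + 1 ≤ b := by
      refine ha.trans ?_
      rw [hb, le_div_iff₀ (by linarith)]
      have : 0 ≤ (1+ε)*Real.log z*(B-1) := mul_nonneg (by positivity) (by linarith)
      linarith
    obtain ⟨Z, hZ⟩ := exists_nat_ge (Real.exp τ + z)
    have hzZ : z ≤ Z := by exact_mod_cast le_trans (le_add_of_nonneg_left (Real.exp_pos _).le) hZ
    have heZ : Real.exp τ ≤ Z := le_trans (le_add_of_nonneg_right (Nat.cast_nonneg _)) hZ
    have hbZ : b ≤ Real.log Z := by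
      have : τ ≤ Real.log Z := (Real.le_log_iff_exp_le ((Real.exp_pos _).trans_le heZ)).2 heZ
      nlinarith
    have hz1 : 1 ≤ z := by
      rcases Nat.eq_zero_or_pos z with rfl | h
      · simp at hz0
      · exact h
    have e1 := tele (D := fun z => -Sw N (wk (k+1+1)) z τ) (F := fun p => gp N p * Sw N (wk (k+1)) p (τ-Real.log p)) (fun z => ?_) hzZ
    · obtain ⟨i1, i2⟩ := GG_sub k (τ := τ) (by linarith) hab hB1 hb
      have e2 := LLow (c := 1-ε) hz1 hab le_rfl hbZ (fun t ht _ => hM t (by linarith)) (fun p => Sw N (wk (k+1)) p (τ-Real.log p)) (fun t => (1-ε)^(k+1)*(GG k ((τ-t)/(B*t))/(t*(τ-t)))) (i1.const_mul _) ?_ (fun p _ _ => Sw_nn N (wk_nn _) _ _) ?_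
      · rw [intervalIntegral.integral_const_mul, i2] at e2
        have e3 := Sw_nn N (wk_nn (k+1+1)) Z τ
        have e4 : GG (k+1) (τ/(B*(1+ε)*Real.log z)) ≤ ∫ u in (1:ℝ)..((τ-(Real.log z+1))/(B*(Real.log z+1))), GG k u / max 1 u := by
          rw [GG]
          refine GGp_mono k (max_le ?_ ?_)
          · rw [le_div_iff₀ (by positivity)]; nlinarith
          · have h5 : τ/(B*(1+ε)*Real.log z) ≤ τ/(B*(Real.log z+1)) := by
              refine div_le_div_of_nonneg_left hτ0.le (by positivity) ?_
              rw [mul_assoc]; gcongr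
            have h6 : (τ-(Real.log z+1))/(B*(Real.log z+1)) = τ/(B*(Real.log z+1)) - 1/B := by field_simp
            have h7 : 1/B ≤ 1 := by rw [div_le_one (by linarith)]; exact hB1
            rw [h6]; linarith
        have e5 : (1-ε)^(k+1+1)*GG (k+1) (τ/(B*(1+ε)*Real.log z))/τ ≤ (1-ε)*((1-ε)^(k+1)*((∫ u in (1:ℝ)..((τ-(Real.log z+1))/(B*(Real.log z+1))), GG k u / max 1 u)/τ)) := by
          rw [pow_succ (1-ε) (k+1)]
          calc _ = (1-ε)*((1-ε)^(k+1)*(GG (k+1) (τ/(B*(1+ε)*Real.log z))/τ)) := by ring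
            _ ≤ _ := by gcongr
        linarith
      · intro t ht
        have : 0 < t := by linarith [ht.1]
        have : 0 ≤ τ - t := by have := ht.2; nlinarith
        exact mul_nonneg (by positivity) (div_nonneg (GG_nn _ _) (by positivity))
      · intro p hp hpp t ht h1 h2
        have hzp := log_mono (Finset.mem_Ico.1 hp).1
        have hp0 : 0 < Real.log p := by linarith
        have htb := ht.2
        have ht0 : 0 < t := by linarith
        have hBp : B*Real.log p ≤ τ - Real.log p := by nlinarith
        have h2t : 2*t ≤ τ := by nlinarith
        refine le_trans ?_ (ih p (τ-Real.log p) (by linarith) hBp)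
        have h3 : GG k ((τ-t)/(B*t)) ≤ GG k ((τ-Real.log p)/(B*Real.log p)) := by
          refine GG_mono k ?_
          rw [div_le_div_iff₀ (by positivity) (by positivity)]
          nlinarith [mul_nonneg (by linarith : 0 ≤ B) (mul_nonneg hτ0.le (by linarith : 0 ≤ t - Real.log p))]
        have h4 : Real.log p/(t*(τ-t)) ≤ 1/(τ-Real.log p) := by
          rw [div_le_div_iff₀ (mul_pos ht0 (by linarith)) (by linarith)]
          nlinarith [mul_nonneg (by linarith : 0 ≤ t-Real.log p) (by linarith : 0 ≤ τ-t-Real.log p)]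
        have h5 := GG_nn k ((τ-t)/(B*t))
        have h6 : 0 ≤ Real.log p/(t*(τ-t)) := div_nonneg hp0.le (mul_nonneg ht0.le (by linarith))
        calc Real.log p*((1-ε)^(k+1)*(GG k ((τ-t)/(B*t))/(t*(τ-t)))) = (1-ε)^(k+1)*(GG k ((τ-t)/(B*t))*(Real.log p/(t*(τ-t)))) := by ring
          _ ≤ (1-ε)^(k+1)*(GG k ((τ-Real.log p)/(B*Real.log p))*(1/(τ-Real.log p))) := by
            refine mul_le_mul_of_nonneg_left (mul_le_mul h3 h4 h6 (GG_nn _ _)) (by positivity)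
          _ = _ := by ring
    · rw [buch N (wk (k+1+1)) z τ]
      have : (fun j => wk (k+1+1) (j+1)) = wk (k+1) := by funext j; simp [wk]
      rw [this]; ring
lemma wm_T (N z : ℕ) (L : ℝ) : 2*(Sw N (wk 2) z L + Sw N (wk 4) z L) ≤ Sw N wm z L := by
  rw [Sw, Sw, Sw, sm, sm, sm, ← (sm_summable (rg_zero _ _ _) L).tsum_add (sm_summable (rg_zero _ _ _) L), ← tsum_mul_left]
  refine Summable.tsum_le_tsum (fun n => ?_) (((sm_summable (rg_zero _ _ _) L).add (sm_summable (rg_zero _ _ _) L)).mul_left 2) (sm_summable (rg_zero _ _ _) L)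
  rw [← add_mul, ← mul_assoc]
  refine mul_le_mul_of_nonneg_right ?_ (hh_nn _)
  rw [rg, rg, rg]
  split_ifs
  · rw [← add_mul, ← mul_assoc]
    refine mul_le_mul_of_nonneg_right ?_ (gN_nn N n)
    obtain ⟨k, hk⟩ : ∃ k, k = ArithmeticFunction.cardFactors n := ⟨_, rfl⟩
    rw [← hk, wk, wk]
    split_ifs with h1 h2 h2
    · omega
    · rw [h1, wm]; norm_num
    · rw [h2, wm]; norm_num
    · simpa using wm_nn k
  · simp
end

section
open MeasureTheory Filter Topology
lemma GG_s (k : ℕ) {s : ℝ} (h : s ≤ 2) : GG (k+1) s = 0 := by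
  rw [GG, max_eq_left (by linarith), intervalIntegral.integral_same]
lemma GG_one {s : ℝ} (h : 2 ≤ s) : GG 1 s = Real.log (s-1) := by
  rw [GG, max_eq_right (by linarith), intervalIntegral.integral_congr (g := fun u => 1/u), integral_one_div_of_pos one_pos (by linarith), div_one]
  intro u hu
  rw [Set.uIcc_of_le (by linarith)] at hu
  simp only [GG]
  rw [max_eq_right hu.1]
lemma GG_del {S : ℝ} (hS : 4 ≤ S) : GG 1 S + GG 3 S = Real.log (S-1) + ∫ s in (2:ℝ)..(S-2), Real.log (s-1)/s * Real.log ((S-1)/(s+1)) := by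
  rw [GG_one (by linarith)]
  congr 1
  obtain ⟨P, hP⟩ : ∃ P : ℝ → ℝ, P = fun x => ∫ u in (1:ℝ)..x, GG 1 u / max 1 u := ⟨_, rfl⟩
  have hd : ∀ x, HasDerivAt P (GG 1 x / max 1 x) x := fun x => by
    rw [hP]; exact intervalIntegral.integral_hasDerivAt_right ((GG_ic 1).intervalIntegrable _ _) (GG_ic 1).stronglyMeasurable.stronglyMeasurableAtFilter (GG_ic 1).continuousAt
  have h2 : ∀ x, 2 ≤ x → GG 2 x = P (x-1) := fun x hx => by rw [GG, max_eq_right (by linarith), hP]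
  have e1 : GG 3 S = ∫ x in (2:ℝ)..(S-1), P (x-1) * x⁻¹ := by
    rw [GG, max_eq_right (by linarith), ← intervalIntegral.integral_add_adjacent_intervals ((GG_ic 2).intervalIntegrable 1 2) ((GG_ic 2).intervalIntegrable 2 (S-1)), intervalIntegral.integral_congr (g := fun _ => 0) (a := 1)]
    · rw [intervalIntegral.integral_zero, zero_add]
      refine intervalIntegral.integral_congr fun x hx => ?_
      rw [Set.uIcc_of_le (by linarith)] at hx
      rw [h2 x hx.1, max_eq_right (by linarith [hx.1]), div_eq_mul_inv]
    · intro x hx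
      rw [Set.uIcc_of_le (by linarith)] at hx
      simp only
      rw [GG_s 1 hx.2, zero_div]
  have hne : ∀ x ∈ Set.uIcc (2:ℝ) (S-1), x ≠ 0 := fun x hx => by
    rw [Set.uIcc_of_le (by linarith)] at hx; linarith [hx.1]
  have c1 : Continuous fun x => GG 1 (x-1) / max 1 (x-1) := (GG_ic 1).comp (continuous_id.sub continuous_const)
  have e2 := intervalIntegral.integral_mul_deriv_eq_deriv_mul (u := fun x => P (x-1)) (v := Real.log) (u' := fun x => GG 1 (x-1) / max 1 (x-1)) (v' := fun x => x⁻¹) (a := 2) (b := S-1)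
    (fun x _ => ((hd (x-1)).comp x ((hasDerivAt_id x).sub_const 1)).congr_deriv (mul_one _)) (fun x hx => Real.hasDerivAt_log (hne x hx)) (c1.intervalIntegrable _ _)
    (ContinuousOn.intervalIntegrable (continuousOn_inv₀.mono fun x hx => hne x hx))
  have e3 := intervalIntegral.integral_comp_sub_right (fun v => GG 1 v / max 1 v * Real.log (v+1)) 1 (a := 2) (b := S-1)
  simp only [sub_add_cancel] at e3
  rw [e1, e2, e3, show (2:ℝ)-1 = 1 by norm_num, show S-1-1 = S-2 by ring]
  have e4 : P 1 = 0 := by rw [hP]; simp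
  have c2 : ContinuousOn (fun v : ℝ => GG 1 v / max 1 v * Real.log (v+1)) (Set.Icc 1 (S-2)) :=
    (GG_ic 1).continuousOn.mul (ContinuousOn.log (by fun_prop) fun x hx => by linarith [hx.1])
  have c3 : ContinuousOn (fun v : ℝ => GG 1 v / max 1 v * Real.log ((S-1)/(v+1))) (Set.Icc 1 (S-2)) :=
    (GG_ic 1).continuousOn.mul (ContinuousOn.log (ContinuousOn.div (by fun_prop) (by fun_prop) fun x hx => by linarith [hx.1]) fun x hx => (div_pos (by linarith) (by linarith [hx.1])).ne')
  rw [e4, zero_mul, sub_zero]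
  have e5 : P (S-2) * Real.log (S-1) = ∫ v in (1:ℝ)..(S-2), GG 1 v / max 1 v * Real.log (S-1) := by
    rw [intervalIntegral.integral_mul_const, hP]
  rw [e5, ← intervalIntegral.integral_sub (((GG_ic 1).intervalIntegrable _ _).mul_const _) (ContinuousOn.intervalIntegrable (by rw [Set.uIcc_of_le (by linarith)]; exact c2))]
  rw [intervalIntegral.integral_congr (g := fun v => GG 1 v / max 1 v * Real.log ((S-1)/(v+1)))]
  · rw [← intervalIntegral.integral_add_adjacent_intervals (b := 2) (ContinuousOn.intervalIntegrable (by rw [Set.uIcc_of_le (by linarith)]; exact c3.mono (Set.Icc_subset_Icc_right (by linarith)))) (ContinuousOn.intervalIntegrable (by rw [Set.uIcc_of_le (by linarith)]; exact c3.mono (Set.Icc_subset_Icc_left (by linarith)))), intervalIntegral.integral_congr (g := fun _ => 0) (a := 1)]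
    · rw [intervalIntegral.integral_zero, zero_add]
      refine intervalIntegral.integral_congr fun x hx => ?_
      rw [Set.uIcc_of_le (by linarith)] at hx
      rw [GG_one hx.1, max_eq_right (by linarith [hx.1])]
    · intro x hx
      rw [Set.uIcc_of_le (by linarith)] at hx
      simp only
      rw [GG_s 0 hx.2]; simp
  · intro v hv
    rw [Set.uIcc_of_le (by linarith)] at hv
    simp only
    rw [Real.log_div (by linarith) (by linarith [hv.1])]; ring
lemma Δ_eq : GG 1 (5.995*0.838) + GG 3 (5.995*0.838) = Δ₁ := by
  rw [GG_del (by norm_num), Δ₁]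
end

section
open MeasureTheory Filter Topology
open scoped ArithmeticFunction.vonMangoldt
lemma tst {η : ℝ} (hη : 0 < η) : ∃ (h : ℝ → ℝ) (A : ℝ), ContDiff ℝ (⊤:ℕ∞) h ∧ HasCompactSupport h ∧ (∀ v, 0 ≤ h v) ∧ (∀ v, h v ≤ Real.exp v) ∧ (∀ v, h v ≤ 1) ∧
    (∀ v, 0 ≤ v → h v = 0) ∧ (∀ v, v ≤ -A → h v = 0) ∧ 1 - η ≤ ∫ v, h v := by
  obtain ⟨r, hr0, hr⟩ : ∃ r > 0, 1 - η/2 ≤ Real.exp (-r) := by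
    refine ⟨η/2, by positivity, ?_⟩
    linarith [Real.add_one_le_exp (-(η/2))]
  obtain ⟨R, hR1, hR⟩ : ∃ R, r < R ∧ Real.exp (r-2*R) ≤ η/2 := by
    have h1 : Tendsto (fun R : ℝ => Real.exp (r-2*R)) atTop (𝓝 0) := by
      refine Real.tendsto_exp_atBot.comp ?_
      exact tendsto_atBot_add_const_left _ r (tendsto_neg_atTop_atBot.comp (tendsto_id.const_mul_atTop two_pos)) |>.congr fun x => by simp [sub_eq_add_neg]
    exact ((eventually_gt_atTop r).and (h1.eventually_le_const (by positivity))).exists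
  let g : ContDiffBump (-R) := ⟨R-r, R, by linarith, by linarith⟩
  have hz : ∀ v, (v ≤ -(2*R) ∨ 0 ≤ v) → g v = 0 := fun v hv => g.zero_of_le_dist (by
    rw [Real.dist_eq]
    show R ≤ _
    rcases hv with h | h
    · rw [abs_of_nonpos (by linarith)]; linarith
    · rw [abs_of_nonneg (by linarith)]; linarith)
  have hle : ∀ v, Real.exp v * g v ≤ Real.exp v := fun v => mul_le_of_le_one_right (Real.exp_pos _).le g.le_one
  have hcd : ContDiff ℝ (⊤:ℕ∞) fun v => Real.exp v * g v := Real.contDiff_exp.mul g.contDiff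
  have hcs : HasCompactSupport fun v => Real.exp v * g v := g.hasCompactSupport.mul_left
  refine ⟨fun v => Real.exp v * g v, 2*R, hcd, hcs, fun v => mul_nonneg (Real.exp_pos _).le g.nonneg, hle, fun v => ?_, fun v hv => by beta_reduce; rw [hz v (Or.inr hv), mul_zero], fun v hv => by beta_reduce; rw [hz v (Or.inl hv), mul_zero], ?_⟩
  · rcases le_total 0 v with h | h
    · beta_reduce; rw [hz v (Or.inr h)]; simp
    · exact (hle v).trans (Real.exp_le_one_iff.2 h)
  · have h1 : ∫ v in (r-2*R)..(-r), Real.exp v ≤ ∫ v, Real.exp v * g v := by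
      rw [intervalIntegral.integral_of_le (by linarith), setIntegral_congr_fun measurableSet_Ioc (g := fun v => Real.exp v * g v)]
      · exact setIntegral_le_integral (hcd.continuous.integrable_of_hasCompactSupport hcs) (Eventually.of_forall fun v => mul_nonneg (Real.exp_pos _).le g.nonneg)
      · intro v hv
        have : g v = 1 := g.one_of_mem_closedBall (by
          rw [Metric.mem_closedBall, Real.dist_eq, abs_le]
          show -(R-r) ≤ _ ∧ _ ≤ R - r
          constructor <;> linarith [hv.1, hv.2])
        simp [this]
    rw [integral_exp] at h1
    linarith
lemma itecmp (P Q : Prop) [Decidable P] [Decidable Q] [Decidable (Q ∧ P)] {x : ℝ} (hx : 0 ≤ x) : (if P then x else 0) - (if Q ∧ P then x else 0) ≤ x - if Q then x else 0 := by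
  by_cases h1 : P <;> by_cases h2 : Q <;> simp [h1, h2, hx]
open Classical in
set_option maxHeartbeats 1000000 in
lemma real_side {h : ℝ → ℝ} {A ε : ℝ} (hd : ContDiff ℝ (⊤:ℕ∞) h) (hc : HasCompactSupport h) (h0 : ∀ v, 0 ≤ h v) (he : ∀ v, h v ≤ Real.exp v) (h1 : ∀ v, h v ≤ 1)
    (hs : ∀ v, 0 ≤ v → h v = 0) (hA : ∀ v, v ≤ -A → h v = 0) (hε : 0 < ε) (hε1 : ε ≤ 1/2) :
    ∃ C T₀ : ℝ, 0 ≤ C ∧ 1 ≤ T₀ ∧ ∀ (N : ℕ) (T L : ℝ), T₀ ≤ T → T = 0.838*Real.log N → L = (1/2-ε)*T → nodeC false ⌈(N:ℝ)^(1/11.99:ℝ)⌉₊ L →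
      sm h (fun n => Λ n / n) T * sv N ⌈(N:ℝ)^(1/11.99:ℝ)⌉₊ false L (gN N) - C/T^3 - 1*Real.exp (A-T)*(2*Real.exp (T/2)*T + Real.log N) ≤ S1 N * (T/Real.exp T) := by
  obtain ⟨C, T₀, hC, hT₀, H⟩ := BV (φ := fun v => (h v : ℂ)) (Complex.ofRealCLM.contDiff.comp hd) (cs_cast hc) hε hε1 3
  refine ⟨C, T₀, hC, hT₀, fun N T L hT hTN hL hn => ?_⟩
  have hl0 : 0 < Real.log N := by linarith
  have hN0 : N ≠ 0 := by rintro rfl; simp at hl0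
  have hNp : (0:ℝ) < N := by positivity
  have heT : Real.exp T = (N:ℝ)^(0.838:ℝ) := by rw [Real.rpow_def_of_pos hNp, hTN, mul_comm]
  have heN : Real.exp T ≤ N := by
    rw [← Real.le_log_iff_exp_le hNp]; linarith
  obtain ⟨z, hz⟩ : ∃ z, z = ⌈(N:ℝ)^(1/11.99:ℝ)⌉₊ := ⟨_, rfl⟩
  rw [← hz] at hn ⊢
  obtain ⟨X, hX⟩ : ∃ X, X = ⌈Real.exp T⌉₊ := ⟨_, rfl⟩
  have hXT : Real.exp T ≤ X := hX ▸ Nat.le_ceil _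
  have hlt : ∀ i ∈ Finset.range X, (i:ℝ) < Real.exp T := fun i hi => by
    rw [Finset.mem_range, hX, Nat.lt_ceil] at hi; exact hi
  have hiN : ∀ i ∈ Finset.range X, i ≤ N := fun i hi => by exact_mod_cast (hlt i hi).le.trans heN
  obtain ⟨a, ha⟩ : ∃ a : ℕ → ℝ, a = fun n => Λ n / n * h (Real.log n - T) := ⟨_, rfl⟩
  have ha0 : ∀ i, 0 ≤ a i := fun i => by
    rw [ha]; exact mul_nonneg (div_nonneg ArithmeticFunction.vonMangoldt_nonneg (Nat.cast_nonneg _)) (h0 _)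
  obtain ⟨f, hf⟩ : ∃ f : ℕ → ℝ, f = fun d => ∑ i ∈ Finset.range X, if d ∣ N - i then a i else 0 := ⟨_, rfl⟩
  have hout : ∀ n, n ∉ Finset.range X → a n = 0 := fun n hn => by
    rw [ha]; simp only
    rw [h_zero hs hXT (by simpa using hn), mul_zero]
  have hS : sm h (fun n => Λ n / n) T = ∑ i ∈ Finset.range X, a i := by
    rw [sm, tsum_eq_sum (s := Finset.range X) fun n hn => by have := hout n hn; rw [ha] at this; exact this, ha]
  have hwt : ∀ n, wt (fun v => (h v : ℂ)) T n = (a n : ℂ) := fun n => by rw [wt, ha]; push_cast; rfl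
  have hR : ∀ d, RD (fun v => (h v : ℂ)) T N d = ((f d - sm h (fun n => Λ n / n) T * (1/(d.totient:ℝ)) : ℝ) : ℂ) := by
    intro d
    rw [RD, tsum_eq_sum (s := Finset.range X), tsum_eq_sum (s := Finset.range X), hS, hf]
    · push_cast
      simp only [hwt]
      rw [mul_one_div]
      congr 1
      refine Finset.sum_congr rfl fun i hi => ?_
      have : ((i : ZMod d) = N) ↔ d ∣ N - i := by
        rw [ZMod.natCast_eq_natCast_iff, Nat.modEq_iff_dvd' (hiN i hi)]
      by_cases h : d ∣ N - i
      · rw [if_pos h, if_pos (this.2 h)]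
      · rw [if_neg h, if_neg fun h' => h (this.1 h')]; simp
    · intro n hn; rw [hwt, hout n hn]; simp
    · intro n hn; rw [hwt, hout n hn]; simp
  have hrem : |sv N z false L (fun d => f d - sm h (fun n => Λ n / n) T * gN N d)| ≤ C/T^3 := by
    refine (sv_bd N z false L _ hn).trans (le_trans ?_ (H T hT ⌊Real.exp L⌋₊ N ?_))
    · rw [Finset.sum_congr rfl fun d hd => by rw [Wf_tot hd, ← Real.norm_eq_abs, ← Complex.norm_real, ← hR]]
      refine Finset.sum_le_sum_of_subset_of_nonneg (fun d hd => ?_) fun _ _ _ => norm_nonneg _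
      rw [Wf, Finset.mem_filter, Finset.mem_Icc] at hd
      refine Finset.mem_filter.2 ⟨Finset.mem_Ioc.2 hd.1, Nat.Coprime.symm (Nat.coprime_of_dvd fun p hp h1 h2 => (hd.2.2 p hp h2).2 h1)⟩
    · rw [← hL]; exact Nat.floor_le (Real.exp_pos _).le
  have hsv := (sv_real (Finset.range X) (fun i => N - i) N z a f L (fun i _ => ha0 i) (fun d _ => by rw [hf])).1
  rw [sv_lin] at hrem
  have hld := lamdiff h0 h1 hs hA hN0 (by linarith : 0 ≤ T)
  rw [hS] at hld hrem ⊢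
  have hpr : sm h (fun n => if n.Prime ∧ ¬ n ∣ N then Real.log n / n else 0) T = ∑ i ∈ Finset.range X, if i.Prime ∧ ¬ i ∣ N then a i else 0 := by
    rw [sm, tsum_eq_sum (s := Finset.range X)]
    · refine Finset.sum_congr rfl fun i hi => ?_
      by_cases hi2 : i.Prime ∧ ¬ i ∣ N
      · rw [if_pos hi2, if_pos hi2, ha]; simp only; rw [ArithmeticFunction.vonMangoldt_apply_prime hi2.1]
      · rw [if_neg hi2, if_neg hi2, zero_mul]
    · intro n hn
      rw [h_zero hs hXT (by simpa using hn), mul_zero]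
  rw [hpr] at hld
  have hcmp : (∑ i ∈ Finset.range X, if ∀ p, p.Prime → p < z → ¬ p ∣ N → ¬ p ∣ N - i then a i else 0) - (∑ i ∈ Finset.range X, if (i.Prime ∧ ¬ i ∣ N) ∧ ∀ p, p.Prime → p < z → ¬ p ∣ N → ¬ p ∣ N - i then a i else 0)
      ≤ (∑ i ∈ Finset.range X, a i) - ∑ i ∈ Finset.range X, if i.Prime ∧ ¬ i ∣ N then a i else 0 := by
    rw [← Finset.sum_sub_distrib, ← Finset.sum_sub_distrib]
    refine Finset.sum_le_sum fun i _ => ?_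
    exact itecmp _ _ (ha0 i)
  have hcnt : (∑ i ∈ Finset.range X, if (i.Prime ∧ ¬ i ∣ N) ∧ ∀ p, p.Prime → p < z → ¬ p ∣ N → ¬ p ∣ N - i then a i else 0) ≤ S1 N * (T/Real.exp T) := by
    rw [← Finset.sum_filter]
    have k1 : ∀ i ∈ (Finset.range X).filter (fun i => (i.Prime ∧ ¬ i ∣ N) ∧ ∀ p, p.Prime → p < z → ¬ p ∣ N → ¬ p ∣ N - i), a i ≤ T/Real.exp T := by
      intro i hi
      rw [Finset.mem_filter] at hi
      have hip : (0:ℝ) < i := by exact_mod_cast hi.2.1.1.pos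
      have hil : Real.log i ≤ T := by rw [Real.log_le_iff_le_exp hip]; exact (hlt i hi.1).le
      rw [ha]; simp only
      rw [ArithmeticFunction.vonMangoldt_apply_prime hi.2.1.1]
      have hi1 : 0 ≤ Real.log i := Real.log_natCast_nonneg i
      calc Real.log i / i * h (Real.log i - T) ≤ Real.log i / i * Real.exp (Real.log i - T) := by gcongr; exact he _
        _ = Real.log i / Real.exp T := by rw [Real.exp_sub, Real.exp_log hip]; field_simp
        _ ≤ _ := by gcongr
    refine (Finset.sum_le_card_nsmul _ _ _ k1).trans ?_
    rw [nsmul_eq_mul]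
    refine mul_le_mul_of_nonneg_right ?_ (div_nonneg (by linarith) (Real.exp_pos _).le)
    rw [S1, Nat.cast_le, ← Set.ncard_coe_finset]
    refine Set.ncard_le_ncard (fun i hi => ?_) ?_
    · simp only [Finset.coe_filter, Set.mem_ofPred_eq] at hi
      refine ⟨hi.2.1.1, ?_, hi.2.1.2, fun q hq hqz hqN => hi.2.2 q hq ?_ hqN⟩
      · rw [← heT]; exact (hlt i hi.1).le
      · rw [hz, Nat.lt_ceil]; exact hqz
    · refine (Finset.finite_toSet (Finset.range (⌊(N:ℝ)^(0.838:ℝ)⌋₊+1))).subset fun i hi => ?_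
      rw [Finset.coe_range, Set.mem_Iio, Nat.lt_succ_iff]
      exact Nat.le_floor hi.2.1
  have := (abs_le.1 hrem).1
  linarith
end

section
open MeasureTheory Filter Topology
open scoped ArithmeticFunction.vonMangoldt
lemma model {N : ℕ} {ε s L : ℝ} {z : ℕ} (hε : 0 < ε) (hε1 : ε < 1) (hω : 1 ≤ ε*Real.log z) (hM : ∀ t, Real.log z ≤ t → 1-ε ≤ MN N t)
    (hs : 1 ≤ s) (hL : s*((1+ε)^4*Real.log z) ≤ L) : 2*((1-ε)^4*(GG 1 s + GG 3 s))/L ≤ Sw N wm z L := by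
  have hz : 0 < Real.log z := by by_contra h; nlinarith
  have h4 : (1+ε)^2 ≤ (1+ε)^4 := pow_le_pow_right₀ (by linarith) (by norm_num)
  have h4' : (1-ε)^4 ≤ (1-ε)^2 := pow_le_pow_of_le_one (by linarith) (by linarith) (by norm_num)
  have hp : 0 < (1+ε)^4*Real.log z := by positivity
  have h5 : (1+ε)^4*Real.log z ≤ L := (le_mul_of_one_le_left hp.le hs).trans hL
  have hL0 : 0 < L := hp.trans_le h5
  have h6 : (1+ε)^2*Real.log z ≤ (1+ε)^4*Real.log z := by gcongr
  have a1 := T_low hε hε1 hω hM 1 z L le_rfl (h6.trans h5)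
  have a3 := T_low hε hε1 hω hM 3 z L le_rfl h5
  have b3 : GG 3 s ≤ GG 3 (L/((1+ε)^(3+1)*Real.log z)) := GG_mono 3 (by rw [le_div_iff₀ hp]; exact hL)
  have b1 : GG 1 s ≤ GG 1 (L/((1+ε)^(1+1)*Real.log z)) := GG_mono 1 (by
    rw [le_div_iff₀ (by positivity)]; exact le_trans (by gcongr) hL)
  have c1 : (1-ε)^4*GG 1 s/L ≤ Sw N (wk 2) z L := by
    refine le_trans ?_ a1
    have := GG_nn 1 s
    gcongr
  have c3 : (1-ε)^4*GG 3 s/L ≤ Sw N (wk 4) z L := by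
    refine le_trans ?_ a3
    have := GG_nn 3 s
    have : 0 ≤ 1 - ε := by linarith
    gcongr
  have := wm_T N z L
  calc _ = 2*((1-ε)^4*GG 1 s/L + (1-ε)^4*GG 3 s/L) := by ring
    _ ≤ 2*(Sw N (wk 2) z L + Sw N (wk 4) z L) := by gcongr
    _ ≤ _ := this
lemma Δ_pos : 0 < Δ₁ := by
  rw [← Δ_eq, GG_one (by norm_num)]
  exact add_pos_of_pos_of_nonneg (Real.log_pos (by norm_num)) (GG_nn _ _)
lemma epsl {δ : ℝ} (hδ : 0 < δ) : ∃ ε s : ℝ, 0 < ε ∧ ε < 1/10 ∧ 5/2 < s ∧ s = 5.995*0.838*(1-2*ε)/(1+ε)^5 ∧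
    (1-δ/2)*Δ₁ ≤ (1-2*ε)*((1-ε)^4*(GG 1 s + GG 3 s)) := by
  have hs : ContinuousAt (fun ε : ℝ => 5.995*0.838*(1-2*ε)/(1+ε)^5) 0 := ContinuousAt.div (by fun_prop) (by fun_prop) (by norm_num)
  have h1 : ContinuousAt (fun ε : ℝ => (1-2*ε)*((1-ε)^4*(GG 1 (5.995*0.838*(1-2*ε)/(1+ε)^5) + GG 3 (5.995*0.838*(1-2*ε)/(1+ε)^5)))) 0 := by
    refine ContinuousAt.mul (by fun_prop) (ContinuousAt.mul (by fun_prop) (ContinuousAt.add ?_ ?_))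
    · exact (GG_c 1).continuousAt.comp hs
    · exact (GG_c 3).continuousAt.comp hs
  have e2 := h1.tendsto.eventually_const_lt (u := (1-δ/2)*Δ₁) (by
    have := Δ_pos
    norm_num
    norm_num at *
    have h := Δ_eq
    norm_num at h
    rw [h]; nlinarith)
  have e3 := hs.tendsto.eventually_const_lt (u := 5/2) (by norm_num)
  have e4 : ∀ᶠ ε in 𝓝[>] (0:ℝ), ε < 1/10 := nhdsWithin_le_nhds (gt_mem_nhds (by norm_num))
  obtain ⟨ε, ⟨⟨h2, h3⟩, h4⟩, h5⟩ := ((((e2.filter_mono (nhdsWithin_le_nhds (s := Set.Ioi 0))).and (e3.filter_mono nhdsWithin_le_nhds)).and e4).and eventually_mem_nhdsWithin).exists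
  exact ⟨ε, _, h5, h4, h3, rfl, h2.le⟩
lemma evl (Cd K ε ω η : ℝ) (hε : 0 < ε) (hη : 0 < η) : ∃ l1 : ℝ, ∀ l, l1 ≤ l → 1 ≤ l ∧ ω ≤ l ∧ 13 ≤ ε*l ∧ 2*Real.log l ≤ l/11.99 ∧
    K/l ≤ η ∧ Cd*((l^(1/16000:ℝ))^8*(0.3*l)^(-(1/1000):ℝ)) ≤ η := by
  have t1 : Tendsto (fun l : ℝ => K/l) atTop (𝓝 0) := tendsto_const_nhds.div_atTop tendsto_id
  have t2 : ∀ᶠ l : ℝ in atTop, 2*Real.log l ≤ l/11.99 := by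
    have := Real.isLittleO_log_id_atTop.bound (c := 1/24) (by norm_num)
    filter_upwards [this, eventually_ge_atTop 1] with l h h1
    rw [Real.norm_eq_abs, abs_of_nonneg (Real.log_nonneg h1), Real.norm_eq_abs, id, abs_of_pos (by linarith)] at h
    rw [le_div_iff₀ (by norm_num)]
    nlinarith
  have t3 : Tendsto (fun l : ℝ => Cd*((l^(1/16000:ℝ))^8*(0.3*l)^(-(1/1000):ℝ))) atTop (𝓝 0) := by
    have h := (tendsto_rpow_neg_atTop (y := 1/2000) (by norm_num)).const_mul (Cd*(0.3:ℝ)^(-(1/1000):ℝ))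
    rw [mul_zero] at h
    refine h.congr' ?_
    filter_upwards [eventually_gt_atTop 0] with l hl
    rw [← Real.rpow_natCast, ← Real.rpow_mul hl.le, Real.mul_rpow (by norm_num) hl.le]
    have e : l^(-(1/2000):ℝ) = l^((1/16000:ℝ)*((8:ℕ):ℝ)) * l^(-(1/1000):ℝ) := by
      rw [← Real.rpow_add hl]; norm_num
    rw [e]; ring
  obtain ⟨l1, h1⟩ := (((((eventually_ge_atTop (1:ℝ)).and (eventually_ge_atTop ω)).and (eventually_ge_atTop (13/ε))).and t2).and ((t1.eventually_le_const hη).and (t3.eventually_le_const hη))).exists_forall_of_atTop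
  refine ⟨l1, fun l hl => ?_⟩
  obtain ⟨⟨⟨⟨a, b⟩, c⟩, d⟩, e, f⟩ := h1 l hl
  exact ⟨a, b, by rw [div_le_iff₀ hε] at c; linarith, d, e, f⟩
set_option maxHeartbeats 2000000 in
theorem S1_lower_bound :
    ∀ δ : ℝ, 0 < δ → ∃ N₀ : ℕ, ∀ N : ℕ, N₀ ≤ N → Even N →
      (1 - δ) * (8 * Δ₁ * CN N * (N : ℝ) ^ (0.838 : ℝ)) /
          ((0.838 : ℝ) ^ 2 * (Real.log N) ^ 2) ≤ (S1 N : ℝ) := by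
  intro δ hδ
  have hΔ := Δ_pos
  obtain ⟨ε, s, hε, hε1, hs2, hs⟩ := epsl hδ
  obtain ⟨h, A, hd, hc, h0, he, h1, hz, hA, hI⟩ := tst hε
  obtain ⟨C, T₀, hC, hT₀, HR⟩ := real_side hd hc h0 he h1 hz hA hε (by linarith)
  obtain ⟨t1, ht1, HX⟩ := lam_lim hd hc hε
  obtain ⟨t2, ht2, HM⟩ := ML hε
  obtain ⟨C2, l2, hC2, hl2, HA⟩ := A3 (κ := 1/16000) (by norm_num) 5
  obtain ⟨Cd, l3, z0, hCd, hl3, HD⟩ := Dbound (κ := 1/16000) (by norm_num)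
  obtain ⟨c5, hc5, H5⟩ := exp_pow_bd (1/2) (by norm_num) 4
  obtain ⟨Xc, hXc⟩ : ∃ Xc, Xc = (∫ v, h v) + ε := ⟨_, rfl⟩
  obtain ⟨η, hη⟩ : ∃ η, η = δ*Δ₁/2 := ⟨_, rfl⟩
  have hη0 : 0 < η := by rw [hη]; positivity
  have hXc0 : 0 ≤ Xc := by rw [hXc]; linarith
  obtain ⟨l1, H1⟩ := evl (Xc*3*Cd) (2*(C2*(C+4*Real.exp A*c5))) ε (2*T₀+2*t1+12*t2+l2+l3+12*Real.log z0+100) η hε hη0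
  obtain ⟨N₀, hN₀⟩ := exists_nat_ge (Real.exp l1)
  refine ⟨N₀+1, fun N hN hev => ?_⟩
  have hNp : (0:ℝ) < N := by exact_mod_cast (by omega : 0 < N)
  have hlN : l1 ≤ Real.log N := by
    rw [Real.le_log_iff_exp_le hNp]; exact hN₀.trans (by exact_mod_cast (by omega : N₀ ≤ N))
  obtain ⟨k1, k2, k3, k4, k5⟩ := H1 _ hlN
  obtain ⟨l, hl⟩ : ∃ l, l = Real.log N := ⟨_, rfl⟩
  obtain ⟨T, hT⟩ : ∃ T, T = 0.838*Real.log N := ⟨_, rfl⟩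
  obtain ⟨L, hL⟩ : ∃ L, L = (1/2-ε)*T := ⟨_, rfl⟩
  have hlz0 : 0 ≤ Real.log z0 := Real.log_natCast_nonneg z0
  have heT : Real.exp T = (N:ℝ)^(0.838:ℝ) := by rw [Real.rpow_def_of_pos hNp, hT, mul_comm]
  have HR' := HR N T L
  have HA' := HA N hev (by linarith)
  have HD' := HD N hev (by linarith)
  have HM' := fun t => HM N t (by exact_mod_cast hNp)
  rw [← hl] at k1 k2 k3 k4 k5 HR' HA' HD' HM' hT
  have hl100 : 100 ≤ l := by linarith
  have hTl : T ≤ l := by linarith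
  have hlT : l ≤ 1.2*T := by linarith
  have hT1 : T₀ ≤ T := by linarith
  have hT0 : 0 < T := by linarith
  have hLT : 0.4*T ≤ L := by rw [hL]; gcongr; linarith
  have hL0 : 0 < L := by linarith
  obtain ⟨z, hzz⟩ : ∃ z, z = ⌈(N:ℝ)^(1/11.99:ℝ)⌉₊ := ⟨_, rfl⟩
  rw [← hzz] at HR'
  have hNe : (N:ℝ)^(1/11.99:ℝ) = Real.exp (l/11.99) := by rw [Real.rpow_def_of_pos hNp, ← hl]; congr 1; ring
  have hz1 : Real.exp (l/11.99) ≤ z := by rw [hzz, hNe]; exact Nat.le_ceil _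
  have hzp : (0:ℝ) < z := (Real.exp_pos _).trans_le hz1
  have hzl : l/11.99 ≤ Real.log z := (Real.le_log_iff_exp_le hzp).2 hz1
  have hzu : Real.log z ≤ l/11.99 + 1 := by
    rw [Real.log_le_iff_le_exp hzp, Real.exp_add]
    have h3 : (z:ℝ) ≤ Real.exp (l/11.99) + 1 := by rw [hzz, hNe]; exact (Nat.ceil_lt_add_one (Real.exp_pos _).le).le
    have h5 := Real.one_le_exp (x := l/11.99) (by positivity)
    have h6 := mul_le_mul_of_nonneg_left (Real.add_one_le_exp (1:ℝ)) (Real.exp_pos (l/11.99)).le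
    linarith
  have hl12 : l/12 ≤ l/11.99 := by gcongr; norm_num
  have hzu2 : 11.99*Real.log z ≤ (1+ε)*l := by
    have : 11.99*Real.log z ≤ l + 11.99 := by
      have := mul_le_mul_of_nonneg_left hzu (by norm_num : (0:ℝ) ≤ 11.99)
      have e : 11.99*(l/11.99+1) = l + 11.99 := by field_simp
      linarith
    linarith
  have hzz0 : z0 ≤ z := by
    by_contra hcon
    have := log_mono (by omega : z ≤ z0)
    linarith
  have hsL : True ∧ s*((1+ε)^4*Real.log z) ≤ L := by
    refine ⟨trivial, ?_⟩
    have e : s*(1+ε)^5 = 5.995*0.838*(1-2*ε) := by rw [hs.1]; field_simp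
    have hs0 : 0 < s := by linarith
    have h3 : 11.99*(s*((1+ε)^4*Real.log z)) ≤ 11.99*L := by
      calc 11.99*(s*((1+ε)^4*Real.log z)) = s*(1+ε)^4*(11.99*Real.log z) := by ring
        _ ≤ s*(1+ε)^4*((1+ε)*l) := by gcongr
        _ = (s*(1+ε)^5)*l := by ring
        _ = 11.99*L := by rw [e, hL, hT]; ring
    linarith only [h3]
  have hz0' : 0 ≤ Real.log z := Real.log_natCast_nonneg z
  have hLz : 5/2*Real.log z ≤ L := by
    refine le_trans ?_ hsL.2
    have : 1 ≤ (1+ε)^4 := one_le_pow₀ (by linarith)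
    exact mul_le_mul hs2.le (le_mul_of_one_le_left hz0' this) hz0' (by linarith)
  have hnL : 2*Real.log z + 2 ≤ L := by linarith
  have hzl' : l ≤ 11.99*Real.log z := by rwa [div_le_iff₀' (by norm_num)] at hzl
  have hmod := And.intro trivial <| model (N := N) (z := z) hε (by linarith) (by linarith [mul_le_mul_of_nonneg_left hzl' hε.le]) (fun t ht => HM' t (by linarith) (by linarith)) (by linarith) hsL.2
  have hreal := And.intro trivial <| HR' hT1 hT hL (by simp only [nodeC, Bool.false_eq_true, if_false]; exact hnL)
  have hDm := And.intro trivial <| HD' z hzz0 L hnL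
  obtain ⟨hY1, hY2, -, hY3⟩ := HA'
  have hY0 := Y_pos (N := N) (by norm_num) (fun τ h => (hY3 τ h).1) hY1
  have hX := abs_le.1 (HX T (by linarith))
  clear k4 hz1 hzu hzu2 hl12 hN hlN hN₀ hA hd hc h0 he h1 hz hlz0 hzl hzl' hT1 k2 hT₀ hl2 hl3 ht1 ht2 hzz hNe hzp
  obtain ⟨X, hXX⟩ : ∃ X, X = sm h (fun n => Λ n / n) T := ⟨_, rfl⟩
  rw [← hXX] at hreal hX
  have hX1 : 1 - 2*ε ≤ X := by linarith [hX.1]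
  have hX2 : X ≤ Xc := by rw [hXc]; linarith [hX.2]
  have herr : C/T^3 + 1*Real.exp (A-T)*(2*Real.exp (T/2)*T + l) ≤ (C+4*Real.exp A*c5)/T^3 := by
    have h3 := H5 T hT0
    have h4 : Real.exp (A-T)*(2*Real.exp (T/2)*T + l) ≤ 4*Real.exp A*c5/T^3 := by
      have e1 : Real.exp (A-T) = Real.exp A*Real.exp (-(1/2*T))*Real.exp (-(1/2*T)) := by rw [← Real.exp_add, ← Real.exp_add]; congr 1; ring
      have e2 : Real.exp (-(1/2*T))*Real.exp (T/2) = 1 := by rw [← Real.exp_add]; ring_nf; simp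
      have e3 : Real.exp (-(1/2*T)) ≤ 1 := Real.exp_le_one_iff.2 (by linarith)
      calc Real.exp (A-T)*(2*Real.exp (T/2)*T + l) = Real.exp A*Real.exp (-(1/2*T))*(2*(Real.exp (-(1/2*T))*Real.exp (T/2))*T + Real.exp (-(1/2*T))*l) := by rw [e1]; ring
        _ ≤ Real.exp A*Real.exp (-(1/2*T))*(4*T) := by
            rw [e2]; gcongr
            have : Real.exp (-(1/2*T))*l ≤ 1*l := by gcongr
            linarith
        _ ≤ Real.exp A*(c5/T^4)*(4*T) := by gcongr
        _ = _ := by field_simp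
    rw [add_div, one_mul]; linarith
  have hE2 : YN N*T*(C/T^3 + 1*Real.exp (A-T)*(2*Real.exp (T/2)*T + l)) ≤ η := by
    have hlk : l^(1/16000:ℝ) ≤ l := by
      conv_rhs => rw [← Real.rpow_one l]
      exact Real.rpow_le_rpow_of_exponent_le k1 (by norm_num)
    refine le_trans ?_ k5.1
    calc _ ≤ (C2*(1.2*T))*T*((C+4*Real.exp A*c5)/T^3) := by
          gcongr
          exact hY2.trans (by gcongr; exact hlk.trans hlT)
      _ = 1.2*(C2*(C+4*Real.exp A*c5))/T := by field_simp
      _ ≤ 1.2*(C2*(C+4*Real.exp A*c5))/(l/1.2) := by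
          gcongr; rw [div_le_iff₀ (by norm_num)]; linarith
      _ = 1.44*(C2*(C+4*Real.exp A*c5))/l := by field_simp; ring
      _ ≤ _ := by gcongr; norm_num
  have hE1 : T*X*Dm N z L ≤ η := by
    have hX0 : 0 ≤ X := by linarith
    have hq : 0 ≤ l^(1/16000:ℝ) := by positivity
    have hLl : 0.3*l ≤ L := by linarith
    have hr : L^(-(1/1000):ℝ) ≤ (0.3*l)^(-(1/1000):ℝ) := Real.rpow_le_rpow_of_nonpos (by positivity) hLl (by norm_num)
    have hr0 : 0 ≤ L^(-(1/1000):ℝ) := by positivity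
    refine le_trans ?_ k5.2
    calc T*X*Dm N z L ≤ T*X*(Cd*(l^(1/16000:ℝ))^8*(Real.log z)^3*L^(-(1/1000):ℝ)/L^4) := by gcongr; exact hDm.2
      _ ≤ (3*L)*Xc*(Cd*(l^(1/16000:ℝ))^8*L^3*L^(-(1/1000):ℝ)/L^4) := by
          gcongr
          · linarith
          · linarith
      _ = Xc*3*Cd*((l^(1/16000:ℝ))^8*L^(-(1/1000):ℝ)) := by field_simp
      _ ≤ _ := by gcongr
  have hE3 : 4*((1-δ/2)*Δ₁) ≤ T*X*Sw N wm z L := by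
    have hG := add_nonneg (GG_nn 1 s) (GG_nn 3 s)
    have hTL : 2 ≤ T/L := by rw [le_div_iff₀ hL0, hL]; linarith [mul_pos hε hT0]
    have h1e : 0 ≤ 1 - 2*ε := by linarith
    have hg0 : 0 ≤ (1-ε)^4*(GG 1 s + GG 3 s) := mul_nonneg (by positivity) hG
    calc 4*((1-δ/2)*Δ₁) ≤ 4*((1-2*ε)*((1-ε)^4*(GG 1 s + GG 3 s))) := by linarith only [hs.2]
      _ = 2*(1-2*ε)*(2*((1-ε)^4*(GG 1 s + GG 3 s))) := by ring
      _ ≤ (T/L)*X*(2*((1-ε)^4*(GG 1 s + GG 3 s))) := by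
          refine mul_le_mul_of_nonneg_right (mul_le_mul hTL hX1 h1e (by positivity)) (by positivity)
      _ = T*X*(2*((1-ε)^4*(GG 1 s + GG 3 s))/L) := by ring
      _ ≤ _ := mul_le_mul_of_nonneg_left hmod.2 (mul_nonneg hT0.le (by linarith))
  have hDd : Dm N z L = Sw N wm z L - YN N * sv N z false L (gN N) := rfl
  have hfin : 4*((1-δ)*Δ₁) ≤ YN N*T*(S1 N*(T/Real.exp T)) := by
    have h3 := mul_le_mul_of_nonneg_left hreal.2 (mul_nonneg hY0.le hT0.le)
    have h4 : YN N*T*(X*sv N z false L (gN N)) = T*X*Sw N wm z L - T*X*Dm N z L := by rw [hDd]; ring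
    have h5 : 4*((1-δ)*Δ₁) = 4*((1-δ/2)*Δ₁) - 4*η := by rw [hη]; ring
    have h6 : YN N*T*(X*sv N z false L (gN N) - C/T^3 - 1*Real.exp (A-T)*(2*Real.exp (T/2)*T + l)) = YN N*T*(X*sv N z false L (gN N)) - YN N*T*(C/T^3 + 1*Real.exp (A-T)*(2*Real.exp (T/2)*T + l)) := by ring
    rw [h6, h4] at h3
    linarith
  have hCN : 0 < CN N := by
    by_contra hcon
    have : YN N*(2*CN N) ≤ 0 := mul_nonpos_of_nonneg_of_nonpos hY0.le (by linarith)
    linarith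
  rw [← hl, ← heT, ← mul_pow, ← hT, div_le_iff₀ (by positivity)]
  have h3 := mul_le_mul_of_nonneg_left hfin (by positivity : 0 ≤ 2*CN N*Real.exp T)
  have e : 2*CN N*Real.exp T*(YN N*T*(S1 N*(T/Real.exp T))) = (YN N*(2*CN N))*(S1 N*T^2) := by field_simp
  rw [e, hY1] at h3
  linarith
end
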